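/- (Magnus' conjecture in the case A = B.) The recurrence coefficients of the orthonormal polynomials for the weight w(x) = A(1−x)^α(1+x)^β|x−x₁|^{2λ} on (−1,1) satisfy a_n = 1/2 − (λ/(2n))√(1−x₁²)·cos(2n·arccos x₁ − Φ̂) + O(1/n²) and b_n = −(λ/n)√(1−x₁²)·cos((2n+1)·arccos x₁ − Φ̂) + O(1/n²) as n → ∞, where Φ̂ = (α+λ)π − (α+β+2λ)·arccos x₁. -/

import Mathlib

section
open Filter Topology Asymptotics

namespace Magnus

/-- `f n = O(n^{-k})` -/
def Ok {E : Type*} [NormedAddCommGroup E] (k : ℕ) (f : ℕ → E) : Prop :=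
  ∃ C : ℝ, 0 ≤ C ∧ ∃ N : ℕ, 1 ≤ N ∧ ∀ n : ℕ, N ≤ n → ‖f n‖ ≤ C / (n : ℝ) ^ k

namespace Ok
section
variable {E : Type*} [NormedAddCommGroup E] {k l : ℕ} {f g : ℕ → E}

theorem of_ev (hf : Ok k f) (N : ℕ) (h : ∀ n, N ≤ n → f n = g n) : Ok k g := by
  obtain ⟨C, hC, M, hM, H⟩ := hf
  refine ⟨C, hC, max M N, le_max_of_le_left hM, fun n hn => ?_⟩
  rw [← h n (le_of_max_le_right hn)]; exact H n (le_of_max_le_left hn)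

theorem add (hf : Ok k f) (hg : Ok k g) : Ok k (fun n => f n + g n) := by
  obtain ⟨C, hC, M, hM, H⟩ := hf
  obtain ⟨C', hC', M', hM', H'⟩ := hg
  refine ⟨C + C', by positivity, max M M', le_max_of_le_left hM, fun n hn => ?_⟩
  rw [add_div]
  exact (norm_add_le _ _).trans (add_le_add (H n (le_of_max_le_left hn)) (H' n (le_of_max_le_right hn)))

theorem neg (hf : Ok k f) : Ok k (fun n => - f n) := by
  obtain ⟨C, hC, M, hM, H⟩ := hf
  exact ⟨C, hC, M, hM, fun n hn => by rw [norm_neg]; exact H n hn⟩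

theorem sub (hf : Ok k f) (hg : Ok k g) : Ok k (fun n => f n - g n) :=
  (hf.add hg.neg).of_ev 0 (fun n _ => by simp [sub_eq_add_neg])

theorem const (c : E) : Ok 0 (fun _ : ℕ => c) :=
  ⟨‖c‖, norm_nonneg _, 1, le_rfl, fun n _ => by simp⟩

theorem mono (hf : Ok k f) (h : l ≤ k) : Ok l f := by
  obtain ⟨C, hC, M, hM, H⟩ := hf
  refine ⟨C, hC, M, hM, fun n hn => (H n hn).trans ?_⟩
  have : (1 : ℝ) ≤ n := by exact_mod_cast hM.trans hn
  gcongr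

theorem shift (hf : Ok k f) : Ok k (fun n => f (n + 1)) := by
  obtain ⟨C, hC, M, hM, H⟩ := hf
  refine ⟨C, hC, M, hM, fun n hn => (H (n+1) (by omega)).trans ?_⟩
  have : (1 : ℝ) ≤ n := by exact_mod_cast hM.trans hn
  push_cast
  gcongr
  linarith

theorem unshift (hf : Ok k (fun n => f (n + 1))) : Ok k f := by
  obtain ⟨C, hC, M, hM, H⟩ := hf
  refine ⟨C * 2 ^ k, by positivity, M + 1, by omega, fun n hn => ?_⟩
  obtain ⟨m, rfl⟩ : ∃ m, n = m + 1 := ⟨n - 1, by omega⟩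
  refine (H m (by omega)).trans ?_
  have : (1 : ℝ) ≤ m := by exact_mod_cast hM.trans (by omega : M ≤ m)
  rw [div_le_div_iff₀ (by positivity) (by positivity), mul_assoc]
  gcongr
  rw [← mul_pow]
  gcongr
  push_cast; linarith

theorem norm_le (hf : Ok k f) {E' : Type*} [NormedAddCommGroup E'] {h : ℕ → E'}
    (N : ℕ) (H : ∀ n, N ≤ n → ‖h n‖ ≤ ‖f n‖) : Ok k h := by
  obtain ⟨C, hC, M, hM, HH⟩ := hf
  refine ⟨C, hC, max M N, le_max_of_le_left hM, fun n hn => ?_⟩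
  exact (H n (le_of_max_le_right hn)).trans (HH n (le_of_max_le_left hn))

theorem norm (hf : Ok k f) : Ok k (fun n => ‖f n‖) := hf.norm_le 0 (fun n _ => by simp)

end

section
variable {𝕜 : Type*} [NormedField 𝕜] {k l : ℕ} {f g : ℕ → 𝕜}

theorem mul (hf : Ok k f) (hg : Ok l g) : Ok (k + l) (fun n => f n * g n) := by
  obtain ⟨C, hC, M, hM, H⟩ := hf
  obtain ⟨C', hC', M', hM', H'⟩ := hg
  refine ⟨C * C', by positivity, max M M', le_max_of_le_left hM, fun n hn => ?_⟩
  rw [norm_mul, pow_add, mul_div_mul_comm]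
  exact mul_le_mul (H n (le_of_max_le_left hn)) (H' n (le_of_max_le_right hn)) (norm_nonneg _)
    (by positivity)

theorem mul0 (hf : Ok k f) (hg : Ok 0 g) : Ok k (fun n => f n * g n) := hf.mul hg

theorem cmul (hf : Ok k f) (c : 𝕜) : Ok k (fun n => c * f n) :=
  (hf.mul (const c)).of_ev 0 (fun n _ => mul_comm _ _)
end

theorem ofReal {k : ℕ} {f : ℕ → ℝ} (hf : Ok k f) : Ok k (fun n => (f n : ℂ)) :=
  hf.norm_le 0 (fun n _ => by simp)

/-- `1/(n+c)` -/
theorem inv_add (c : ℝ) : Ok 1 (fun n : ℕ => ((n : ℝ) + c)⁻¹) := by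
  refine ⟨2, by norm_num, ⌈2 * |c|⌉₊ + 1, by omega, fun n hn => ?_⟩
  have h1 : 2 * |c| + 1 ≤ n := by
    have := Nat.le_ceil (2 * |c|)
    have h : ((⌈2 * |c|⌉₊ + 1 : ℕ) : ℝ) ≤ n := by exact_mod_cast hn
    push_cast at h; linarith
  have h2 := neg_abs_le c
  have h3 := abs_nonneg c
  have : (n : ℝ) / 2 ≤ n + c := by linarith
  rw [Real.norm_eq_abs, abs_of_nonneg (by rw [inv_nonneg]; linarith), pow_one,
    inv_le_comm₀ (by linarith) (by apply div_pos <;> linarith)]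
  rw [inv_div]; exact this

theorem inv_n : Ok 1 (fun n : ℕ => ((n : ℝ))⁻¹) := (inv_add 0).of_ev 0 (by simp)

theorem tendsto {E : Type*} [NormedAddCommGroup E] {f : ℕ → E} {k : ℕ} (hk : 1 ≤ k) (hf : Ok k f) : Tendsto f atTop (𝓝 0) := by
  obtain ⟨C, hC, M, hM, H⟩ := hf.mono hk
  have : Tendsto (fun n : ℕ => C / (n : ℝ) ^ 1) atTop (𝓝 0) := by
    simpa using tendsto_const_div_atTop_nhds_zero_nat C
  exact squeeze_zero_norm' (Filter.eventually_atTop.2 ⟨M, H⟩) this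

theorem of_tendsto {E : Type*} [NormedAddCommGroup E] {f : ℕ → E} {l : E} (hf : Tendsto f atTop (𝓝 l)) : Ok 0 f := by
  have := hf.norm.eventually (gt_mem_nhds (lt_add_one ‖l‖))
  obtain ⟨N, hN⟩ := Filter.eventually_atTop.1 this
  exact ⟨‖l‖ + 1, by positivity, N + 1, by omega, fun n hn => by
    simpa using (hN n (by omega)).le⟩

end Ok

/-- telescoping -/
theorem tele {E : Type*} [NormedAddCommGroup E] [CompleteSpace E] {Y : ℕ → E}
    (h : Ok 2 (fun n => Y (n + 1) - Y n)) : ∃ l, Ok 1 (fun n => Y n - l) := by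
  obtain ⟨C, hC, M, hM, H⟩ := h
  have key : ∀ n, M ≤ n → ∀ j, ‖Y (n + j) - Y n‖ ≤ 2 * C * (1 / n - 1 / ((n + j : ℕ) : ℝ)) := by
    intro n hn j
    have hn1 : (1 : ℝ) ≤ n := by exact_mod_cast hM.trans hn
    induction j with
    | zero => simp
    | succ j ih =>
      have h1 := H (n + j) (by omega)
      have h2 : ‖Y (n + (j + 1)) - Y n‖ ≤ ‖Y (n + j + 1) - Y (n + j)‖ + ‖Y (n + j) - Y n‖ := by
        rw [← add_assoc]
        calc _ = ‖(Y (n + j + 1) - Y (n + j)) + (Y (n + j) - Y n)‖ := by congr 1; abel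
          _ ≤ _ := norm_add_le _ _
      have hx : (1 : ℝ) ≤ ((n + j : ℕ) : ℝ) := by push_cast; have : (0 : ℝ) ≤ j := by positivity
                                                  linarith
      have h3 : ((n + (j + 1) : ℕ) : ℝ) = ((n + j : ℕ) : ℝ) + 1 := by push_cast; ring
      rw [h3]
      set x := ((n + j : ℕ) : ℝ)
      have h4 : C / x ^ 2 ≤ 2 * C * (1 / x - 1 / (x + 1)) := by
        have : 1 / x - 1 / (x + 1) = 1 / (x * (x + 1)) := by field_simp; ring
        rw [this, mul_one_div, div_le_div_iff₀ (by positivity) (by positivity)]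
        have : x * (x + 1) ≤ 2 * x ^ 2 := by nlinarith
        nlinarith
      nlinarith
  have key2 : ∀ n, M ≤ n → ∀ j, ‖Y (n + j) - Y n‖ ≤ 2 * C / n := by
    intro n hn j
    refine (key n hn j).trans ?_
    have : (0:ℝ) ≤ 1 / ((n + j : ℕ) : ℝ) := by positivity
    rw [mul_sub, mul_one_div]
    have : 0 ≤ 2 * C * (1 / ((n + j : ℕ) : ℝ)) := by positivity
    linarith
  have hlim : Tendsto (fun n : ℕ => 2 * (2 * C) / (n : ℝ)) atTop (𝓝 0) :=
    tendsto_const_div_atTop_nhds_zero_nat _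
  have hc : CauchySeq Y := by
    rw [Metric.cauchySeq_iff']
    intro ε hε
    obtain ⟨N, hN⟩ := Filter.eventually_atTop.1 (hlim.eventually (gt_mem_nhds hε))
    refine ⟨max N M, fun n hn => ?_⟩
    obtain ⟨j, rfl⟩ := Nat.exists_eq_add_of_le hn
    rw [dist_eq_norm]
    have h1 := key2 (max N M) (le_max_right _ _) j
    have h2 := hN (max N M) (le_max_left _ _)
    have h3 : 2 * C / ((max N M : ℕ) : ℝ) ≤ 2 * (2 * C) / ((max N M : ℕ) : ℝ) := by
      gcongr; linarith
    linarith
  obtain ⟨l, hl⟩ := cauchySeq_tendsto_of_complete hc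
  refine ⟨l, 2 * C, by positivity, M, hM, fun n hn => ?_⟩
  have h1 : Tendsto (fun j => ‖Y (n + j) - Y n‖) atTop (𝓝 ‖l - Y n‖) := by
    have : Tendsto (fun j => Y (n + j)) atTop (𝓝 l) := by
      simpa [add_comm] using (tendsto_add_atTop_iff_nat n).2 hl
    exact (this.sub_const _).norm
  rw [norm_sub_rev, pow_one]
  exact le_of_tendsto' h1 (key2 n hn)

theorem mul_bdd {Y : ℕ → ℂ} {C : ℝ} (hC : 0 ≤ C) (N : ℕ) (hN : 1 ≤ N)
    (h : ∀ n, N ≤ n → ‖Y (n + 1) - Y n‖ ≤ C / (n : ℝ) ^ 2 * ‖Y n‖) : Ok 0 Y := by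
  -- `u n = ‖Y n‖ * exp (2 C / n)` is decreasing
  have step : ∀ n, N ≤ n → ‖Y (n + 1)‖ * Real.exp (2 * C / ((n + 1 : ℕ) : ℝ)) ≤ ‖Y n‖ * Real.exp (2 * C / n) := by
    intro n hn
    have hx : (1 : ℝ) ≤ n := by exact_mod_cast hN.trans hn
    have h1 : ‖Y (n + 1)‖ ≤ (C / (n : ℝ) ^ 2 + 1) * ‖Y n‖ := by
      have := norm_add_le (Y (n + 1) - Y n) (Y n)
      rw [sub_add_cancel] at this
      linarith [h n hn]
    have h2 : C / (n : ℝ) ^ 2 + 1 ≤ Real.exp (2 * C / n - 2 * C / ((n + 1 : ℕ) : ℝ)) := by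
      refine le_trans ?_ (Real.add_one_le_exp _)
      push_cast
      have : 2 * C / (n:ℝ) - 2 * C / (n + 1) = 2 * C / (n * (n + 1)) := by field_simp; ring
      rw [this]
      gcongr ?_ + 1
      rw [div_le_div_iff₀ (by positivity) (by positivity)]
      have : (n:ℝ) * (n + 1) ≤ 2 * n ^ 2 := by nlinarith
      nlinarith
    calc _ ≤ (C / (n : ℝ) ^ 2 + 1) * ‖Y n‖ * Real.exp (2 * C / ((n + 1 : ℕ) : ℝ)) := by gcongr
      _ ≤ Real.exp (2 * C / n - 2 * C / ((n + 1 : ℕ) : ℝ)) * ‖Y n‖ * Real.exp (2 * C / ((n + 1 : ℕ) : ℝ)) := by gcongr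
      _ = _ := by
        rw [show (2 * C / (n:ℝ)) = (2 * C / n - 2 * C / ((n + 1 : ℕ) : ℝ)) + 2 * C / ((n + 1 : ℕ) : ℝ) by ring,
          Real.exp_add]; ring_nf
  refine ⟨‖Y N‖ * Real.exp (2 * C / N), by positivity, N, hN, fun n hn => ?_⟩
  have : ‖Y n‖ * Real.exp (2 * C / n) ≤ ‖Y N‖ * Real.exp (2 * C / N) := by
    induction n, hn using Nat.le_induction with
    | base => exact le_rfl
    | succ n hn ih => exact (step n hn).trans ih
  rw [pow_zero, div_one]
  refine le_trans ?_ this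
  exact le_mul_of_one_le_right (norm_nonneg _) (Real.one_le_exp (by positivity))

theorem mtele {Y r : ℕ → ℂ} (N : ℕ) (h0 : ∀ n, N ≤ n → Y n ≠ 0)
    (h : ∀ n, N ≤ n → Y (n + 1) = Y n * (1 + r n)) (hr : Ok 2 r) :
    ∃ l, l ≠ 0 ∧ Ok 1 (fun n => Y n - l) := by
  have hr0 := hr
  obtain ⟨C, hC, M, hM, H⟩ := hr
  have b1 : Ok 0 Y := by
    refine mul_bdd hC (max M N) (le_max_of_le_left hM) (fun n hn => ?_)
    rw [h n (le_of_max_le_right hn), mul_add, mul_one, add_sub_cancel_left, norm_mul, mul_comm]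
    gcongr
    exact H n (le_of_max_le_left hn)
  have c1 : Ok 2 (fun n => Y (n + 1) - Y n) :=
    (hr0.mul b1).of_ev N (fun n hn => by rw [h n hn]; ring)
  obtain ⟨l, hl⟩ := tele c1
  refine ⟨l, ?_, hl⟩
  -- inverse is bounded
  have b2 : Ok 0 (fun n => (Y n)⁻¹) := by
    obtain ⟨K, hK⟩ := exists_nat_gt (2 * C)
    refine mul_bdd (C := 2 * C) (by positivity) (max (max M N) K) (le_max_of_le_left (le_max_of_le_left hM)) (fun n hn => ?_)
    have hnN : N ≤ n := le_of_max_le_right (le_of_max_le_left hn)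
    have hnM : M ≤ n := le_of_max_le_left (le_of_max_le_left hn)
    have hnK : K ≤ n := le_of_max_le_right hn
    have hx : (1 : ℝ) ≤ n := by exact_mod_cast hM.trans hnM
    have hxK : (K : ℝ) ≤ n := by exact_mod_cast hnK
    have hr := H n hnM
    have hr2 : ‖r n‖ ≤ 1 / 2 := by
      refine hr.trans ?_
      rw [div_le_div_iff₀ (by positivity) (by positivity)]
      nlinarith
    have hr3 : 1 / 2 ≤ ‖1 + r n‖ := by
      have := norm_sub_norm_le (1 : ℂ) (-r n)
      rw [norm_one, norm_neg, sub_neg_eq_add] at this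
      linarith
    have hne : 1 + r n ≠ 0 := by
      intro h; rw [h, norm_zero] at hr3; linarith
    have : (Y (n + 1))⁻¹ - (Y n)⁻¹ = - r n / (1 + r n) * (Y n)⁻¹ := by
      rw [h n hnN]
      have := h0 n hnN
      field_simp; ring
    rw [this, norm_mul, norm_div, norm_neg]
    refine mul_le_mul_of_nonneg_right ?_ (norm_nonneg _)
    rw [div_le_iff₀ (by linarith)]
    have h5 : 0 ≤ 2 * C / (n : ℝ) ^ 2 := by positivity
    have h6 : 2 * C / (n : ℝ) ^ 2 = 2 * (C / (n : ℝ) ^ 2) := by ring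
    nlinarith
  rintro rfl
  have t := (b2.mul hl).tendsto (k := 0 + 1) le_rfl
  have : Tendsto (fun n => (Y n)⁻¹ * (Y n - 0)) atTop (𝓝 1) := by
    refine tendsto_const_nhds.congr' ?_
    filter_upwards [Filter.eventually_ge_atTop N] with n hn
    rw [sub_zero, inv_mul_cancel₀ (h0 n hn)]
  exact zero_ne_one (tendsto_nhds_unique t this)

end Magnus
end

section
open Polynomial

namespace Magnus

/-- `(1 - x^2)(x - x₁)` -/
noncomputable def PhiP (x₁ : ℝ) : ℝ[X] := -X ^ 3 + C x₁ * X ^ 2 + X - C x₁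

noncomputable def NP (σ N1 N0 : ℝ) : ℝ[X] := -C σ * X ^ 2 + C N1 * X + C N0

structure OPSys (x₁ σ N1 N0 : ℝ) (L : ℝ[X] →ₗ[ℝ] ℝ) (p : ℕ → ℝ[X]) (a b : ℕ → ℝ) : Prop where
  a0 : a 0 = 0
  apos : ∀ n, 0 < a (n + 1)
  deg : ∀ n, (p n).natDegree = n
  ne : ∀ n, p n ≠ 0
  orth : ∀ m n, L (p m * p n) = if m = n then 1 else 0
  recur : ∀ n, X * p n = C (a (n + 1)) * p (n + 1) + C (b n) * p n + C (a n) * p (n - 1)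
  orthdeg : ∀ (q : ℝ[X]) (m : ℕ), q.natDegree < m → L (q * p m) = 0
  expand : ∀ (q : ℝ[X]) (m : ℕ), q.natDegree < m →
    q = ∑ k ∈ Finset.range m, C (L (q * p k)) * p k
  pearson : ∀ q : ℝ[X],
    L (PhiP x₁ * derivative q + (derivative (PhiP x₁) + NP σ N1 N0) * q) = 0

namespace OPSys

variable {x₁ σ N1 N0 : ℝ} {L : ℝ[X] →ₗ[ℝ] ℝ} {p : ℕ → ℝ[X]} {a b : ℕ → ℝ}

lemma LC (L : ℝ[X] →ₗ[ℝ] ℝ) (r : ℝ) (q : ℝ[X]) : L (C r * q) = r * L q := by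
  rw [← smul_eq_C_mul, map_smul, smul_eq_mul]

theorem ruleX (S : OPSys x₁ σ N1 N0 L p a b) (q : ℝ[X]) (m : ℕ) :
    L (X * q * p m) = a (m + 1) * L (q * p (m + 1)) + b m * L (q * p m)
      + a m * L (q * p (m - 1)) := by
  have : X * q * p m = C (a (m + 1)) * (q * p (m + 1)) + C (b m) * (q * p m)
      + C (a m) * (q * p (m - 1)) := by
    have := S.recur m
    linear_combination q * this
  rw [this, map_add, map_add, LC, LC, LC]

theorem x1_0 (S : OPSys x₁ σ N1 N0 L p a b) (n : ℕ) : L (X * p n * p n) = b n := by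
  rw [S.ruleX, S.orth, S.orth, S.orth]
  rcases n with _ | n
  · simp [S.a0]
  · simp

theorem x1_1 (S : OPSys x₁ σ N1 N0 L p a b) (n : ℕ) : L (X * p n * p (n + 1)) = a (n + 1) := by
  rw [S.ruleX, S.orth, S.orth, S.orth]; simp
  intro h; omega

theorem x1_m1 (S : OPSys x₁ σ N1 N0 L p a b) (n : ℕ) : L (X * p (n + 1) * p n) = a (n + 1) := by
  rw [← S.x1_1 n]; congr 1; ring

theorem natDegree_X_pow_mul (S : OPSys x₁ σ N1 N0 L p a b) (k n : ℕ) :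
    (X ^ k * p n).natDegree = k + n := by
  rw [natDegree_mul (pow_ne_zero _ X_ne_zero) (S.ne n), natDegree_X_pow, S.deg]

theorem xk_big (S : OPSys x₁ σ N1 N0 L p a b) (k n m : ℕ) (h : k + n < m) :
    L (X ^ k * p n * p m) = 0 := S.orthdeg _ _ (by rw [S.natDegree_X_pow_mul]; exact h)

theorem x2_2 (S : OPSys x₁ σ N1 N0 L p a b) (n : ℕ) :
    L (X ^ 2 * p n * p (n + 2)) = a (n + 1) * a (n + 2) := by
  have := S.ruleX (X ^ 1 * p n) (n + 2)
  have e : X * (X ^ 1 * p n) * p (n + 2) = X ^ 2 * p n * p (n + 2) := by ring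
  rw [e, S.xk_big 1 n (n + 2 + 1) (by omega), S.xk_big 1 n (n + 2) (by omega)] at this
  rw [this]; simp [S.x1_1]; ring

theorem x2_1 (S : OPSys x₁ σ N1 N0 L p a b) (n : ℕ) :
    L (X ^ 2 * p n * p (n + 1)) = a (n + 1) * (b n + b (n + 1)) := by
  have := S.ruleX (X ^ 1 * p n) (n + 1)
  have e : X * (X ^ 1 * p n) * p (n + 1) = X ^ 2 * p n * p (n + 1) := by ring
  rw [e, S.xk_big 1 n (n + 1 + 1) (by omega)] at this
  rw [this]; simp [S.x1_1, S.x1_0]; ring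

theorem x2_0 (S : OPSys x₁ σ N1 N0 L p a b) (n : ℕ) :
    L (X ^ 2 * p n * p n) = a n ^ 2 + b n ^ 2 + a (n + 1) ^ 2 := by
  have := S.ruleX (X ^ 1 * p n) n
  have e : X * (X ^ 1 * p n) * p n = X ^ 2 * p n * p n := by ring
  rw [e] at this
  rw [this]
  rcases n with _ | n
  · simp [S.x1_1, S.x1_0, S.a0]; ring
  · simp [S.x1_1, S.x1_0, S.x1_m1]; ring

theorem x3_3 (S : OPSys x₁ σ N1 N0 L p a b) (n : ℕ) :
    L (X ^ 3 * p n * p (n + 3)) = a (n + 1) * a (n + 2) * a (n + 3) := by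
  have := S.ruleX (X ^ 2 * p n) (n + 3)
  have e : X * (X ^ 2 * p n) * p (n + 3) = X ^ 3 * p n * p (n + 3) := by ring
  rw [e, S.xk_big 2 n (n + 3 + 1) (by omega), S.xk_big 2 n (n + 3) (by omega)] at this
  rw [this]; simp [S.x2_2]; ring

theorem x3_2 (S : OPSys x₁ σ N1 N0 L p a b) (n : ℕ) :
    L (X ^ 3 * p n * p (n + 2)) = a (n + 1) * a (n + 2) * (b n + b (n + 1) + b (n + 2)) := by
  have := S.ruleX (X ^ 2 * p n) (n + 2)
  have e : X * (X ^ 2 * p n) * p (n + 2) = X ^ 3 * p n * p (n + 2) := by ring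
  rw [e, S.xk_big 2 n (n + 2 + 1) (by omega)] at this
  rw [this]; simp [S.x2_2, S.x2_1]; ring

theorem x3_1 (S : OPSys x₁ σ N1 N0 L p a b) (n : ℕ) :
    L (X ^ 3 * p n * p (n + 1)) = a (n + 1) * (b n ^ 2 + b n * b (n + 1) + b (n + 1) ^ 2
      + a n ^ 2 + a (n + 1) ^ 2 + a (n + 2) ^ 2) := by
  have := S.ruleX (X ^ 2 * p n) (n + 1)
  have e : X * (X ^ 2 * p n) * p (n + 1) = X ^ 3 * p n * p (n + 1) := by ring
  rw [e] at this
  rw [this]; simp [S.x2_2, S.x2_1, S.x2_0]; ring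

theorem LPhi (L : ℝ[X] →ₗ[ℝ] ℝ) (q r : ℝ[X]) : L (PhiP x₁ * q * r) = -L (X ^ 3 * q * r) + x₁ * L (X ^ 2 * q * r)
    + L (X * q * r) - x₁ * L (q * r) := by
  have : PhiP x₁ * q * r = -(X ^ 3 * q * r) + C x₁ * (X ^ 2 * q * r) + (X * q * r) - C x₁ * (q * r) := by
    unfold PhiP; ring
  rw [this, map_sub, map_add, map_add, map_neg, LC, LC]

theorem derPhi : derivative (PhiP x₁) = -C 3 * X ^ 2 + C (2 * x₁) * X + C 1 := by
  unfold PhiP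
  simp only [derivative_sub, derivative_add, derivative_neg, derivative_X_pow, derivative_mul,
    derivative_C, derivative_X]
  have h3 : (C (3:ℝ)) = 3 := map_ofNat C 3
  have h2 : (C (2:ℝ)) = 2 := map_ofNat C 2
  simp only [C_mul, map_one]
  push_cast
  rw [h3, h2]
  ring

theorem LN (L : ℝ[X] →ₗ[ℝ] ℝ) (q r : ℝ[X]) : L ((derivative (PhiP x₁) + NP σ N1 N0) * (q * r)) =
    -(3 + σ) * L (X ^ 2 * q * r) + (2 * x₁ + N1) * L (X * q * r) + (1 + N0) * L (q * r) := by
  have : (derivative (PhiP x₁) + NP σ N1 N0) * (q * r) = C (-(3 + σ)) * (X ^ 2 * q * r)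
      + C (2 * x₁ + N1) * (X * q * r) + C (1 + N0) * (q * r) := by
    rw [derPhi, NP]
    simp only [C_mul, C_add, C_neg]; ring
  rw [this, map_add, map_add, LC, LC, LC]

/-- matrix of `Φ d/dx`. -/
noncomputable def cc (x₁ : ℝ) (L : ℝ[X] →ₗ[ℝ] ℝ) (p : ℕ → ℝ[X]) (n m : ℕ) : ℝ :=
  L (PhiP x₁ * derivative (p n) * p m)

theorem PhiP_natDegree_le : (PhiP x₁).natDegree ≤ 3 := by
  unfold PhiP; compute_degree

theorem p0_der (S : OPSys x₁ σ N1 N0 L p a b) : derivative (p 0) = 0 := by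
  have := S.deg 0
  rw [natDegree_eq_zero] at this
  obtain ⟨c, hc⟩ := this
  rw [← hc, derivative_C]

theorem phid_deg (S : OPSys x₁ σ N1 N0 L p a b) (n : ℕ) :
    (PhiP x₁ * derivative (p n)).natDegree ≤ n + 2 := by
  rcases n with _ | n
  · rw [S.p0_der]; simp
  · refine natDegree_mul_le.trans ?_
    have h1 := PhiP_natDegree_le (x₁ := x₁)
    have h2 := natDegree_derivative_le (p (n + 1))
    rw [S.deg] at h2
    omega

theorem cc_big (S : OPSys x₁ σ N1 N0 L p a b) (n m : ℕ) (h : n + 2 < m) : cc x₁ L p n m = 0 :=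
  S.orthdeg _ _ (lt_of_le_of_lt (S.phid_deg n) h)

theorem cc_zero (S : OPSys x₁ σ N1 N0 L p a b) (m : ℕ) : cc x₁ L p 0 m = 0 := by
  simp [cc, S.p0_der]

theorem cc_rec (S : OPSys x₁ σ N1 N0 L p a b) (n m : ℕ) :
    L (PhiP x₁ * p n * p m) + (a (m + 1) * cc x₁ L p n (m + 1) + b m * cc x₁ L p n m
      + a m * cc x₁ L p n (m - 1)) = a (n + 1) * cc x₁ L p (n + 1) m + b n * cc x₁ L p n m
      + a n * cc x₁ L p (n - 1) m := by
  have h := congrArg derivative (S.recur n)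
  simp only [derivative_mul, derivative_add, derivative_X, derivative_C, zero_mul, zero_add,
    one_mul] at h
  have h2 := S.ruleX (PhiP x₁ * derivative (p n)) m
  unfold cc
  rw [← h2, ← map_add]
  have : PhiP x₁ * p n * p m + X * (PhiP x₁ * derivative (p n)) * p m
      = C (a (n + 1)) * (PhiP x₁ * derivative (p (n + 1)) * p m)
      + C (b n) * (PhiP x₁ * derivative (p n) * p m)
      + C (a n) * (PhiP x₁ * derivative (p (n - 1)) * p m) := by
    linear_combination (PhiP x₁ * p m) * h
  rw [this, map_add, map_add, LC, LC, LC]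

theorem cc_sym (S : OPSys x₁ σ N1 N0 L p a b) (n m : ℕ) :
    cc x₁ L p n m + cc x₁ L p m n = (3 + σ) * L (X ^ 2 * p n * p m)
      - (2 * x₁ + N1) * L (X * p n * p m) - (1 + N0) * L (p n * p m) := by
  have h := S.pearson (p n * p m)
  rw [map_add, LN] at h
  unfold cc
  rw [← map_add]
  have : PhiP x₁ * derivative (p n) * p m + PhiP x₁ * derivative (p m) * p n
    = PhiP x₁ * derivative (p n * p m) := by rw [derivative_mul]; ring
  rw [this]; linarith

theorem cc_2 (S : OPSys x₁ σ N1 N0 L p a b) (n : ℕ) :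
    cc x₁ L p n (n + 2) = -n * a (n + 1) * a (n + 2) := by
  induction n with
  | zero => rw [S.cc_zero]; simp
  | succ n ih =>
    have h := S.cc_rec n (n + 3)
    rw [LPhi, S.x3_3, S.xk_big 2 n (n + 3) (by omega)] at h
    have e1 := S.xk_big 1 n (n + 3) (by omega)
    rw [pow_one] at e1
    have e0 := S.orth n (n + 3)
    rw [if_neg (by omega)] at e0
    have e3 : cc x₁ L p (n - 1) (n + 3) = 0 := S.cc_big _ _ (by omega)
    rw [e1, e0, S.cc_big n (n + 3) (by omega), S.cc_big n (n + 3 + 1) (by omega), e3,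
      show n + 3 - 1 = n + 2 by omega, ih] at h
    have ha := S.apos n
    rw [show n + 1 + 2 = n + 3 by omega, show n + 1 + 1 = n + 2 by omega]
    push_cast
    apply mul_left_cancel₀ ha.ne'
    linear_combination -h

/-- partial sums of `b` -/
noncomputable def BB (b : ℕ → ℝ) (n : ℕ) : ℝ := ∑ k ∈ Finset.range n, b k

theorem BB_succ (n : ℕ) : BB b (n + 1) = BB b n + b n := Finset.sum_range_succ _ _

theorem cc_1 (S : OPSys x₁ σ N1 N0 L p a b) (n : ℕ) :
    cc x₁ L p n (n + 1) = a (n + 1) * (x₁ * n - BB b n - n * (b n + b (n + 1))) := by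
  induction n with
  | zero => rw [S.cc_zero]; simp [BB]
  | succ n ih =>
    have h := S.cc_rec n (n + 2)
    have e1 := S.xk_big 1 n (n + 2) (by omega)
    rw [pow_one] at e1
    have e0 := S.orth n (n + 2)
    rw [if_neg (by omega)] at e0
    have e3 : a n * cc x₁ L p (n - 1) (n + 2) = 0 := by
      rcases n with _ | n
      · simp [S.a0]
      · rw [S.cc_big _ _ (by omega)]; simp
    rw [LPhi, S.x3_2, S.x2_2, e1, e0, S.cc_2, S.cc_big n (n + 2 + 1) (by omega), e3,
      show n + 2 - 1 = n + 1 by omega, ih] at h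
    have ha := S.apos n
    rw [show n + 1 + 1 = n + 2 by omega, BB_succ]
    push_cast
    apply mul_left_cancel₀ ha.ne'
    linear_combination -h

theorem cc_0 (S : OPSys x₁ σ N1 N0 L p a b) (n : ℕ) :
    2 * cc x₁ L p n n = (3 + σ) * (a n ^ 2 + b n ^ 2 + a (n + 1) ^ 2)
      - (2 * x₁ + N1) * b n - (1 + N0) := by
  have := S.cc_sym n n
  rw [S.x2_0, S.x1_0, S.orth, if_pos rfl] at this
  linarith

theorem cc_m1 (S : OPSys x₁ σ N1 N0 L p a b) (n : ℕ) :
    cc x₁ L p (n + 1) n = a (n + 1) * ((3 + σ) * (b n + b (n + 1)) - (2 * x₁ + N1)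
      - (x₁ * n - BB b n - n * (b n + b (n + 1)))) := by
  have := S.cc_sym n (n + 1)
  rw [S.x2_1, S.x1_1, S.orth, if_neg (by omega), S.cc_1] at this
  linarith

theorem cc_m2 (S : OPSys x₁ σ N1 N0 L p a b) (n : ℕ) :
    cc x₁ L p (n + 2) n = a (n + 1) * a (n + 2) * (3 + σ + n) := by
  have e1 := S.xk_big 1 n (n + 2) (by omega)
  rw [pow_one] at e1
  have := S.cc_sym n (n + 2)
  rw [S.x2_2, e1, S.orth, if_neg (by omega), S.cc_2] at this
  linarith

theorem cc_m3 (S : OPSys x₁ σ N1 N0 L p a b) (n m : ℕ) (h : n + 2 < m) :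
    cc x₁ L p m n = 0 := by
  have e1 := S.xk_big 1 n m (by omega)
  rw [pow_one] at e1
  have := S.cc_sym n m
  rw [S.xk_big 2 n m (by omega), e1, S.orth, if_neg (by omega), S.cc_big _ _ h] at this
  linarith

theorem cc_diff (S : OPSys x₁ σ N1 N0 L p a b) (n : ℕ) :
    cc x₁ L p (n + 2) (n + 2) - cc x₁ L p (n + 1) (n + 1) =
     -(b (n + 1) ^ 2 + b (n + 1) * b (n + 2) + b (n + 2) ^ 2
      + a (n + 1) ^ 2 + a (n + 2) ^ 2 + a (n + 3) ^ 2) + x₁ * (b (n + 1) + b (n + 2)) + 1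
      - (n + 1) * a (n + 3) ^ 2 + (b (n + 2) - b (n + 1)) * (x₁ * (n + 1) - BB b (n + 1)
         - (n + 1) * (b (n + 1) + b (n + 2))) + n * a (n + 1) ^ 2 := by
  have h := S.cc_rec (n + 1) (n + 2)
  have e1 := S.x1_1 (n + 1)
  have e0 := S.orth (n + 1) (n + 2)
  rw [if_neg (by omega)] at e0
  have e2 := S.x2_1 (n + 1)
  have e3 := S.x3_1 (n + 1)
  have c2 := S.cc_2 (n + 1)
  have c1 := S.cc_1 (n + 1)
  have cm := S.cc_2 n
  simp only [show n + 1 + 1 = n + 2 by omega, show n + 1 + 2 = n + 3 by omega,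
    show n + 2 + 1 = n + 3 by omega, show n + 2 - 1 = n + 1 by omega,
    show n + 1 - 1 = n by omega] at *
  rw [LPhi, e0, e1, e2, e3, c2, c1, cm] at h
  push_cast at h
  have ha := S.apos (n + 1)
  simp only [show n + 1 + 1 = n + 2 by omega] at ha
  apply mul_left_cancel₀ ha.ne'
  linear_combination -h

/-- coefficients of the ladder relation -/
noncomputable def e0 (x₁ σ : ℝ) (L : ℝ[X] →ₗ[ℝ] ℝ) (p : ℕ → ℝ[X]) (a b : ℕ → ℝ) (n : ℕ) : ℝ :=
  cc x₁ L p n n + n * a (n + 1) ^ 2 - (n + 1 + σ) * a n ^ 2 - b n * (x₁ * n - BB b n) + n * b n ^ 2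

noncomputable def th0 (x₁ σ N1 : ℝ) (b : ℕ → ℝ) (n : ℕ) : ℝ :=
  (2 * n + 1) * x₁ + N1 - 2 * BB b n - (2 * n + 2 + σ) * b n

theorem expand5 (S : OPSys x₁ σ N1 N0 L p a b) (n : ℕ) :
    PhiP x₁ * derivative (p (n + 2)) = C (cc x₁ L p (n + 2) n) * p n
      + C (cc x₁ L p (n + 2) (n + 1)) * p (n + 1) + C (cc x₁ L p (n + 2) (n + 2)) * p (n + 2)
      + C (cc x₁ L p (n + 2) (n + 3)) * p (n + 3) + C (cc x₁ L p (n + 2) (n + 4)) * p (n + 4) := by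
  have h := S.expand (PhiP x₁ * derivative (p (n + 2))) (n + 5)
    (lt_of_le_of_lt (S.phid_deg _) (by omega))
  rw [Finset.sum_range_succ, Finset.sum_range_succ, Finset.sum_range_succ, Finset.sum_range_succ,
    Finset.sum_range_succ, Finset.sum_eq_zero, zero_add] at h
  · exact h
  · intro k hk
    have := S.cc_m3 k (n + 2) (by have := Finset.mem_range.1 hk; omega)
    unfold cc at this
    rw [this]; simp

theorem ladder1 (S : OPSys x₁ σ N1 N0 L p a b) (n : ℕ) :
    PhiP x₁ * derivative (p (n + 2)) =
      (-C ((n : ℝ) + 2) * X ^ 2 + C (x₁ * (n + 2) - BB b (n + 2)) * X + C (e0 x₁ σ L p a b (n + 2)))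
        * p (n + 2)
      - C (a (n + 2)) * (-C (2 * ((n : ℝ) + 2) + 1 + σ) * X + C (th0 x₁ σ N1 b (n + 2))) * p (n + 1) := by
  have h := S.expand5 n
  have r1 := S.recur (n + 1)
  have r2 := S.recur (n + 2)
  have r3 := S.recur (n + 3)
  have c1 := S.cc_1 (n + 2)
  have c2 := S.cc_2 (n + 2)
  have cm1 := S.cc_m1 (n + 1)
  have cm2 := S.cc_m2 n
  simp only [show n + 1 + 1 = n + 2 by omega, show n + 2 + 1 = n + 3 by omega,
    show n + 3 + 1 = n + 4 by omega, show n + 1 - 1 = n by omega, show n + 2 - 1 = n + 1 by omega,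
    show n + 3 - 1 = n + 2 by omega, show n + 2 + 2 = n + 4 by omega] at *
  rw [c1, c2, cm1, cm2] at h
  rw [h, e0, th0]
  have hB : BB b (n + 2) = BB b (n + 1) + b (n + 1) := BB_succ _
  rw [hB]
  push_cast
  simp only [C_add, C_mul, C_sub, C_neg, C_pow, map_one, map_ofNat] at *
  linear_combination (-(C (a (n+2)) * (3 + C σ + C (n:ℝ)))) * r1
    + (-(C x₁ * (C (n:ℝ) + 2) - (C (BB b (n+1)) + C (b (n+1))) - (C (n:ℝ) + 2) * (C (b (n+2)) + C (b (n+3))))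
      + (C (n:ℝ) + 2) * (X - C (b (n+3)))) * r2
    + ((C (n:ℝ) + 2) * C (a (n+3))) * r3

theorem e0_rel (S : OPSys x₁ σ N1 N0 L p a b) (n : ℕ) :
    e0 x₁ σ L p a b (n + 2) + e0 x₁ σ L p a b (n + 1) + N0 = -b (n + 1) * th0 x₁ σ N1 b (n + 1) := by
  have h1 := S.cc_diff n
  have h2 := S.cc_0 (n + 1)
  simp only [e0, th0, show n + 1 + 1 = n + 2 by omega, show n + 2 + 1 = n + 3 by omega] at *
  have hB : BB b (n + 2) = BB b (n + 1) + b (n + 1) := BB_succ _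
  rw [hB]
  push_cast
  linear_combination h1 + h2

theorem ladder2 (S : OPSys x₁ σ N1 N0 L p a b) (n : ℕ) :
    PhiP x₁ * derivative (p (n + 2)) =
      C (a (n + 3)) * (-C (2 * ((n : ℝ) + 2) + 1 + σ) * X + C (th0 x₁ σ N1 b (n + 2))) * p (n + 3)
      + (-(-C ((n : ℝ) + 3) * X ^ 2 + C (x₁ * (n + 3) - BB b (n + 3)) * X + C (e0 x₁ σ L p a b (n + 3)))
        - NP σ N1 N0) * p (n + 2) := by
  rw [S.ladder1 n]
  have r2 := S.recur (n + 2)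
  have e := S.e0_rel (n + 1)
  simp only [show n + 1 + 1 = n + 2 by omega, show n + 1 + 2 = n + 3 by omega,
     show n + 2 + 1 = n + 3 by omega, show n + 2 - 1 = n + 1 by omega] at *
  have hB : BB b (n + 3) = BB b (n + 2) + b (n + 2) := BB_succ _
  have e' : e0 x₁ σ L p a b (n + 3) = -b (n + 2) * th0 x₁ σ N1 b (n + 2) - N0 - e0 x₁ σ L p a b (n + 2) := by
    linarith
  rw [hB, e', NP, th0]
  push_cast
  simp only [C_add, C_mul, C_sub, C_neg, C_pow, map_one, map_ofNat] at *
  linear_combination ((-(2 * (C (n:ℝ) + 2) + 1 + C σ) * X + ((2 * (C (n:ℝ) + 2) + 1) * C x₁ + C N1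
    - 2 * C (BB b (n+2)) - (2 * (C (n:ℝ) + 2) + 2 + C σ) * C (b (n+2))))) * r2

end OPSys
end Magnus
end

section
open Polynomial

namespace Magnus

/-- scalar data extracted from the orthogonal polynomial system -/
structure Dyn (x₁ α β lam : ℝ) (p : ℕ → ℝ[X]) (a b g ω ξ : ℕ → ℝ) : Prop where
  apos : ∀ n, 0 < a (n + 1)
  recur : ∀ n x, x * (p (n + 1)).eval x = a (n + 2) * (p (n + 2)).eval x
    + b (n + 1) * (p (n + 1)).eval x + a (n + 1) * (p n).eval x
  ne : ∀ n x, (p n).eval x ≠ 0 ∨ (p (n + 1)).eval x ≠ 0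
  gdef : ∀ n, g n = (β - α) / 2 - lam * x₁ - ∑ k ∈ Finset.range n, b k
  bx : ∀ n : ℕ, (2 * (n : ℝ) + 1 + (α + β + 2 * lam)) * b n = g n + g (n + 1) - ξ n
  oo : ∀ n, ω (n + 2) + ω (n + 1) = (x₁ - b (n + 1)) * ξ (n + 1)
  L1 : ∀ (n : ℕ) (x : ℝ), (1 - x ^ 2) * (x - x₁) * (derivative (p (n + 2))).eval x =
    ((x - x₁) * (-((n : ℝ) + 2 + (α + β + 2 * lam) / 2) * x + g (n + 2)) + ω (n + 2)
      - (-α * (1 + x) * (x - x₁) + β * (1 - x) * (x - x₁) + 2 * lam * (1 - x ^ 2)) / 2)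
        * (p (n + 2)).eval x
    - a (n + 2) * (-(2 * ((n : ℝ) + 2) + 1 + (α + β + 2 * lam)) * (x - x₁) + ξ (n + 2))
      * (p (n + 1)).eval x
  L2 : ∀ (n : ℕ) (x : ℝ), (1 - x ^ 2) * (x - x₁) * (derivative (p (n + 2))).eval x =
    a (n + 3) * (-(2 * ((n : ℝ) + 2) + 1 + (α + β + 2 * lam)) * (x - x₁) + ξ (n + 2))
      * (p (n + 3)).eval x -
    ((x - x₁) * (-((n : ℝ) + 3 + (α + β + 2 * lam) / 2) * x + g (n + 3)) + ω (n + 3)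
      + (-α * (1 + x) * (x - x₁) + β * (1 - x) * (x - x₁) + 2 * lam * (1 - x ^ 2)) / 2)
        * (p (n + 2)).eval x

theorem OPSys.toDyn {x₁ α β lam : ℝ} {L : ℝ[X] →ₗ[ℝ] ℝ} {p : ℕ → ℝ[X]} {a b : ℕ → ℝ}
    (S : OPSys x₁ (α + β + 2 * lam) (-α * (1 - x₁) + β * (1 + x₁)) (α * x₁ - β * x₁ + 2 * lam) L p a b) :
    ∃ g ω ξ, Dyn x₁ α β lam p a b g ω ξ := by
  set σ := α + β + 2 * lam with hσ
  set N1 := -α * (1 - x₁) + β * (1 + x₁) with hN1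
  set N0 := α * x₁ - β * x₁ + 2 * lam with hN0
  let g : ℕ → ℝ := fun n => (β - α) / 2 - lam * x₁ - OPSys.BB b n
  let ω : ℕ → ℝ := fun n => OPSys.e0 x₁ σ L p a b n + N0 / 2 + x₁ * g n
  let ξ : ℕ → ℝ := fun n => OPSys.th0 x₁ σ N1 b n - (2 * n + 1 + σ) * x₁
  have recur : ∀ n x, x * (p (n + 1)).eval x = a (n + 2) * (p (n + 2)).eval x
    + b (n + 1) * (p (n + 1)).eval x + a (n + 1) * (p n).eval x := by
    intro n x
    have := congrArg (eval x) (S.recur (n + 1))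
    simpa using this
  refine ⟨g, ω, ξ, S.apos, recur, ?_, fun n => rfl, ?_, ?_, ?_, ?_⟩
  · intro n x
    induction n with
    | zero =>
      left
      have h := S.deg 0
      obtain ⟨c, hc⟩ := natDegree_eq_zero.1 h
      have h2 := S.ne 0
      rw [← hc] at h2 ⊢
      rw [eval_C]
      intro h; rw [h] at h2; simp at h2
    | succ n ih =>
      by_contra hh
      push Not at hh
      have := recur n x
      rw [hh.1, hh.2] at this
      have h3 := S.apos n
      have h4 : (p n).eval x = 0 := by
        rcases mul_eq_zero.1 (show a (n + 1) * (p n).eval x = 0 by linarith) with h | h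
        · exact absurd h h3.ne'
        · exact h
      rcases ih with ih | ih
      · exact ih h4
      · exact ih hh.1
  · intro n
    simp only [g, ξ, OPSys.th0, OPSys.BB_succ, hN1]
    rw [hσ]; ring
  · intro n
    have h := S.e0_rel n
    have h2 : OPSys.BB b (n + 2) = OPSys.BB b (n + 1) + b (n + 1) := OPSys.BB_succ _
    have h1 : OPSys.th0 x₁ σ N1 b (n + 1) =
      (2 * ((n + 1 : ℕ) : ℝ) + 1) * x₁ + N1 - 2 * OPSys.BB b (n + 1) - (2 * ((n + 1 : ℕ) : ℝ) + 2 + σ) * b (n + 1) := rfl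
    simp only [g, ω, ξ, h2]
    generalize OPSys.th0 x₁ σ N1 b (n + 1) = T at *
    push_cast at h1 ⊢
    rw [hN1] at h1
    rw [hσ] at h1 ⊢
    linear_combination h - x₁ * h1
  · intro n x
    have h := congrArg (eval x) (S.ladder1 n)
    simp only [eval_mul, eval_add, eval_sub, eval_neg, eval_C, eval_pow, eval_X, PhiP] at h
    simp only [ω, g, ξ, hN0, hN1] at h ⊢
    push_cast
    rw [hσ] at h ⊢
    linear_combination h
  · intro n x
    have h := congrArg (eval x) (S.ladder2 n)
    simp only [eval_mul, eval_add, eval_sub, eval_neg, eval_C, eval_pow, eval_X, PhiP, NP] at h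
    simp only [ω, g, ξ, hN0, hN1] at h ⊢
    push_cast
    rw [hσ] at h ⊢
    linear_combination h

namespace Dyn
variable {x₁ α β lam : ℝ} {p : ℕ → ℝ[X]} {a b g ω ξ : ℕ → ℝ}

theorem gs (D : Dyn x₁ α β lam p a b g ω ξ) (n : ℕ) : g (n + 1) = g n - b n := by
  rw [D.gdef, D.gdef, Finset.sum_range_succ]; ring

theorem det {u v w z P Q : ℝ} (h : P ≠ 0 ∨ Q ≠ 0) (h1 : u * Q = w * P) (h2 : v * P = z * Q) :
    u * v = w * z := by
  rcases h with h | h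
  · apply mul_right_cancel₀ h
    linear_combination u * h2 + z * h1
  · apply mul_right_cancel₀ h
    linear_combination v * h1 + w * h2

theorem Prel1 (D : Dyn x₁ α β lam p a b g ω ξ) (n : ℕ) :
    (ω (n + 3) - lam * (1 - x₁ ^ 2)) * (p (n + 3)).eval x₁
      = a (n + 3) * ξ (n + 3) * (p (n + 2)).eval x₁ := by
  have := D.L1 (n + 1) x₁
  simp only [show n + 1 + 2 = n + 3 by omega, show n + 1 + 1 = n + 2 by omega] at this
  linear_combination -this

theorem Prel2 (D : Dyn x₁ α β lam p a b g ω ξ) (n : ℕ) :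
    (ω (n + 3) + lam * (1 - x₁ ^ 2)) * (p (n + 2)).eval x₁
      = a (n + 3) * ξ (n + 2) * (p (n + 3)).eval x₁ := by
  have := D.L2 n x₁
  linear_combination this

theorem F3 (D : Dyn x₁ α β lam p a b g ω ξ) (n : ℕ) :
    ω (n + 3) ^ 2 - a (n + 3) ^ 2 * ξ (n + 3) * ξ (n + 2) = (lam * (1 - x₁ ^ 2)) ^ 2 := by
  have := det (D.ne (n + 2) x₁) (D.Prel1 n) (D.Prel2 n)
  linear_combination this

theorem det1 (D : Dyn x₁ α β lam p a b g ω ξ) (n : ℕ) :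
    ((1 - x₁) * (g (n + 3) - ((n : ℝ) + 3 + (α + β + 2 * lam) / 2)) + ω (n + 3)) ^ 2
     - a (n + 3) ^ 2 * ((2 * ((n : ℝ) + 3) + 1 + (α + β + 2 * lam)) * (1 - x₁) - ξ (n + 3))
      * ((2 * ((n : ℝ) + 3) - 1 + (α + β + 2 * lam)) * (1 - x₁) - ξ (n + 2)) = (α * (1 - x₁)) ^ 2 := by
  have h1 := D.L1 (n + 1) 1
  have h2 := D.L2 n 1
  simp only [show n + 1 + 2 = n + 3 by omega, show n + 1 + 1 = n + 2 by omega] at h1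
  push_cast at h1
  have := det (D.ne (n + 2) 1) (u := ((1 - x₁) * (g (n + 3) - ((n : ℝ) + 3 + (α + β + 2 * lam) / 2)) + ω (n + 3)) + α * (1 - x₁))
     (w := a (n + 3) * (-(2 * ((n : ℝ) + 3) + 1 + (α + β + 2 * lam)) * (1 - x₁) + ξ (n + 3)))
     (v := ((1 - x₁) * (g (n + 3) - ((n : ℝ) + 3 + (α + β + 2 * lam) / 2)) + ω (n + 3)) - α * (1 - x₁))
     (z := a (n + 3) * (-(2 * ((n : ℝ) + 2) + 1 + (α + β + 2 * lam)) * (1 - x₁) + ξ (n + 2)))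
     (by linear_combination -h1) (by linear_combination h2)
  linear_combination this

theorem det2 (D : Dyn x₁ α β lam p a b g ω ξ) (n : ℕ) :
    (-(1 + x₁) * (g (n + 3) + ((n : ℝ) + 3 + (α + β + 2 * lam) / 2)) + ω (n + 3)) ^ 2
     - a (n + 3) ^ 2 * ((2 * ((n : ℝ) + 3) + 1 + (α + β + 2 * lam)) * (1 + x₁) + ξ (n + 3))
      * ((2 * ((n : ℝ) + 3) - 1 + (α + β + 2 * lam)) * (1 + x₁) + ξ (n + 2)) = (β * (1 + x₁)) ^ 2 := by
  have h1 := D.L1 (n + 1) (-1)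
  have h2 := D.L2 n (-1)
  simp only [show n + 1 + 2 = n + 3 by omega, show n + 1 + 1 = n + 2 by omega] at h1
  push_cast at h1
  have := det (D.ne (n + 2) (-1)) (u := (-(1 + x₁) * (g (n + 3) + ((n : ℝ) + 3 + (α + β + 2 * lam) / 2)) + ω (n + 3)) + β * (1 + x₁))
     (w := a (n + 3) * ((2 * ((n : ℝ) + 3) + 1 + (α + β + 2 * lam)) * (1 + x₁) + ξ (n + 3)))
     (v := (-(1 + x₁) * (g (n + 3) + ((n : ℝ) + 3 + (α + β + 2 * lam) / 2)) + ω (n + 3)) - β * (1 + x₁))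
     (z := a (n + 3) * ((2 * ((n : ℝ) + 2) + 1 + (α + β + 2 * lam)) * (1 + x₁) + ξ (n + 2)))
     (by linear_combination -h1) (by linear_combination h2)
  linear_combination this

theorem F12 (D : Dyn x₁ α β lam p a b g ω ξ) (hx : -1 < x₁ ∧ x₁ < 1) : ∃ c₁ c₄ : ℝ, ∀ n : ℕ,
   a (n + 3) ^ 2 * (4 * ((n : ℝ) + 3 + (α + β + 2 * lam) / 2) ^ 2 - 1) =
     ((n : ℝ) + 3 + (α + β + 2 * lam) / 2) ^ 2 + g (n + 3) ^ 2
      - 2 * ((n : ℝ) + 3 + (α + β + 2 * lam) / 2) * ω (n + 3)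
      + 2 * ((n : ℝ) + 3 + (α + β + 2 * lam) / 2) * x₁ * g (n + 3) + c₄ ∧
   a (n + 3) ^ 2 * ((2 * ((n : ℝ) + 3 + (α + β + 2 * lam) / 2) + 1) * ξ (n + 2)
       + (2 * ((n : ℝ) + 3 + (α + β + 2 * lam) / 2) - 1) * ξ (n + 3)) =
     2 * ((n : ℝ) + 3 + (α + β + 2 * lam) / 2) * (x₁ * ω (n + 3) + (1 - x₁ ^ 2) * g (n + 3))
      - 2 * g (n + 3) * ω (n + 3) + c₁ := by
  have hu : (1 - x₁) ≠ 0 := by linarith [hx.2]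
  have hv : (1 + x₁) ≠ 0 := by linarith [hx.1]
  set κ := lam * (1 - x₁ ^ 2) with hκ
  set c₁ : ℝ := (1 - x₁ ^ 2) / 2 * (κ ^ 2 * (1 / (1 + x₁) ^ 2 - 1 / (1 - x₁) ^ 2) - β ^ 2 + α ^ 2) with hc1
  refine ⟨c₁, (κ ^ 2 / (1 - x₁) ^ 2 - α ^ 2) + c₁ / (1 - x₁), fun n => ?_⟩
  have d1 := D.det1 n
  have d2 := D.det2 n
  have d3 := D.F3 n
  rw [← hκ] at d3
  set ν := (n : ℝ) + 3 + (α + β + 2 * lam) / 2 with hν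
  rw [show 2 * ((n : ℝ) + 3) + 1 + (α + β + 2 * lam) = 2 * ν + 1 by rw [hν]; ring,
    show 2 * ((n : ℝ) + 3) - 1 + (α + β + 2 * lam) = 2 * ν - 1 by rw [hν]; ring] at d1 d2
  have e1 : (g (n + 3) - ν) ^ 2 + 2 * ω (n + 3) * (g (n + 3) - ν) / (1 - x₁) + κ ^ 2 / (1 - x₁) ^ 2
    - a (n + 3) ^ 2 * (4 * ν ^ 2 - 1) + a (n + 3) ^ 2 * ((2 * ν + 1) * ξ (n + 2)
       + (2 * ν - 1) * ξ (n + 3)) / (1 - x₁) = α ^ 2 := by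
    field_simp
    linear_combination d1 - d3
  have e2 : (g (n + 3) + ν) ^ 2 - 2 * ω (n + 3) * (g (n + 3) + ν) / (1 + x₁) + κ ^ 2 / (1 + x₁) ^ 2
    - a (n + 3) ^ 2 * (4 * ν ^ 2 - 1) - a (n + 3) ^ 2 * ((2 * ν + 1) * ξ (n + 2)
       + (2 * ν - 1) * ξ (n + 3)) / (1 + x₁) = β ^ 2 := by
    field_simp
    linear_combination d2 - d3
  have key : a (n + 3) ^ 2 * ((2 * ν + 1) * ξ (n + 2)
       + (2 * ν - 1) * ξ (n + 3)) =
     2 * ν * (x₁ * ω (n + 3) + (1 - x₁ ^ 2) * g (n + 3))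
      - 2 * g (n + 3) * ω (n + 3) + c₁ := by
    rw [hc1]
    set Z := a (n + 3) ^ 2 * ((2 * ν + 1) * ξ (n + 2) + (2 * ν - 1) * ξ (n + 3))
    have : Z = (1 - x₁ ^ 2) / 2 * (Z / (1 - x₁) + Z / (1 + x₁)) := by field_simp; ring
    have h2 : 2 * ν * (x₁ * ω (n + 3) + (1 - x₁ ^ 2) * g (n + 3)) - 2 * g (n + 3) * ω (n + 3)
      = (1 - x₁ ^ 2) / 2 * (4 * g (n + 3) * ν - 2 * ω (n + 3) * (g (n + 3) + ν) / (1 + x₁)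
         - 2 * ω (n + 3) * (g (n + 3) - ν) / (1 - x₁)) := by field_simp; ring
    rw [h2, this]
    linear_combination ((1 - x₁ ^ 2) / 2) * e1 - ((1 - x₁ ^ 2) / 2) * e2
  refine ⟨?_, key⟩
  rw [key] at e1
  have h3 : (2 * ν * (x₁ * ω (n + 3) + (1 - x₁ ^ 2) * g (n + 3))
      - 2 * g (n + 3) * ω (n + 3) + c₁) / (1 - x₁) = c₁ / (1 - x₁) + 2 * ν * (1 + x₁) * g (n + 3) +
       (2 * ν * x₁ * ω (n + 3) - 2 * g (n + 3) * ω (n + 3)) / (1 - x₁) := by field_simp; ring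
  have h4 : 2 * ω (n + 3) * (g (n + 3) - ν) / (1 - x₁) = - 2 * ν * ω (n + 3) - (2 * ν * x₁ * ω (n + 3) - 2 * g (n + 3) * ω (n + 3)) / (1 - x₁) := by
    field_simp; ring
  rw [h3, h4] at e1
  linear_combination -e1

end Dyn
end Magnus
end

section
open Polynomial Filter Topology

namespace Magnus
namespace Dyn
variable {x₁ α β lam : ℝ} {p : ℕ → ℝ[X]} {a b g ω ξ : ℕ → ℝ}

theorem inv_sub (c : ℝ) : Ok 2 (fun n : ℕ => ((n : ℝ) + c)⁻¹ - ((n : ℝ))⁻¹) := by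
  have h := ((Ok.inv_add c).mul Ok.inv_n).mul (Ok.const (-c))
  obtain ⟨K, hK⟩ := exists_nat_gt |c|
  refine h.of_ev (K + 1) (fun n hn => ?_)
  have h1 : (K : ℝ) + 1 ≤ n := by exact_mod_cast hn
  have h2 : (n : ℝ) ≠ 0 := by have := abs_nonneg c; intro h; linarith
  have h3 : (n : ℝ) + c ≠ 0 := by have := neg_abs_le c; have := abs_nonneg c; intro h; linarith
  field_simp; ring

theorem ev_ne (c : ℝ) : ∃ N : ℕ, ∀ n : ℕ, N ≤ n → (n : ℝ) + c ≠ 0 := by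
  obtain ⟨K, hK⟩ := exists_nat_gt |c|
  refine ⟨K, fun n hn => ?_⟩
  have h1 : (K : ℝ) ≤ n := by exact_mod_cast hn
  have := neg_abs_le c
  intro h; linarith

set_option maxHeartbeats 2000000 in
/-- Boundedness of `ω` and `ξ`. -/
theorem bdd (D : Dyn x₁ α β lam p a b g ω ξ) (hx : -1 < x₁ ∧ x₁ < 1)
    (ha : Tendsto a atTop (𝓝 (1 / 2))) (hg : Tendsto g atTop (𝓝 0)) : Ok 0 ω ∧ Ok 0 ξ := by
  obtain ⟨c₁, c₄, hF⟩ := D.F12 hx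
  set σ := α + β + 2 * lam
  have hb : Tendsto b atTop (𝓝 0) := by
    have h1 : Tendsto (fun n => g (n + 1)) atTop (𝓝 0) := (tendsto_add_atTop_iff_nat 1).2 hg
    have := hg.sub h1
    rw [sub_zero] at this
    exact this.congr (fun n => by rw [D.gs]; ring)
  let r : ℕ → ℝ := fun n => ((n : ℝ) + (3 + σ / 2))⁻¹
  have hr : Tendsto r atTop (𝓝 0) := (Ok.inv_add _).tendsto le_rfl
  obtain ⟨N0, hN0⟩ := ev_ne (3 + σ / 2)
  have hr1 : ∀ n, N0 ≤ n → ((n : ℝ) + 3 + σ / 2) * r n = 1 := fun n hn => by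
    have := hN0 n hn
    simp only [r]; rw [add_assoc]; exact mul_inv_cancel₀ this
  have ha3 : Tendsto (fun n => a (n + 3)) atTop (𝓝 (1 / 2)) := (tendsto_add_atTop_iff_nat 3).2 ha
  have hg3 : Tendsto (fun n => g (n + 3)) atTop (𝓝 0) := (tendsto_add_atTop_iff_nat 3).2 hg
  have hg2 : Tendsto (fun n => g (n + 2)) atTop (𝓝 0) := (tendsto_add_atTop_iff_nat 2).2 hg
  have hg4 : Tendsto (fun n => g (n + 4)) atTop (𝓝 0) := (tendsto_add_atTop_iff_nat 4).2 hg
  have hb3 : Tendsto (fun n => b (n + 3)) atTop (𝓝 0) := (tendsto_add_atTop_iff_nat 3).2 hb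
  have hb2 : Tendsto (fun n => b (n + 2)) atTop (𝓝 0) := (tendsto_add_atTop_iff_nat 2).2 hb
  have hW : Tendsto (fun n => ω (n + 3) * r n) atTop (𝓝 0) := by
    have : Tendsto (fun n => (1 / 2 : ℝ) * ((1 - 4 * a (n + 3) ^ 2) + (a (n + 3) ^ 2 + g (n + 3) ^ 2 + c₄) * r n ^ 2
       + 2 * x₁ * g (n + 3) * r n)) atTop
       (𝓝 ((1 / 2 : ℝ) * ((1 - 4 * (1 / 2) ^ 2) + ((1 / 2) ^ 2 + 0 ^ 2 + c₄) * 0 ^ 2 + 2 * x₁ * 0 * 0))) :=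
      (((((ha3.pow 2).const_mul 4).const_sub 1).add
        ((((ha3.pow 2).add (hg3.pow 2)).add_const c₄).mul (hr.pow 2))).add
          ((hg3.const_mul (2 * x₁)).mul hr)).const_mul _
    norm_num at this
    refine this.congr' ?_
    filter_upwards [eventually_ge_atTop N0] with n hn
    have h1 := hr1 n hn
    have h2 := (hF n).1
    set ν := (n : ℝ) + 3 + σ / 2
    linear_combination (-(1 / 2) * r n ^ 2) * h2
       + (1 / 2 * (1 - 4 * a (n+3) ^ 2) * (-1 - ν * r n) - (-ω (n+3) * r n + x₁ * g (n+3) * r n) ) * h1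
  have hX3 : Tendsto (fun n => ξ (n + 3) * r n) atTop (𝓝 0) := by
    have : Tendsto (fun n => (g (n + 3) + g (n + 4)) * r n - b (n + 3) * (2 + r n)) atTop
      (𝓝 ((0 + 0) * 0 - 0 * (2 + 0))) := ((hg3.add hg4).mul hr).sub (hb3.mul (hr.const_add 2))
    norm_num at this
    refine this.congr' ?_
    filter_upwards [eventually_ge_atTop N0] with n hn
    have h1 := hr1 n hn
    have h2 := D.bx (n + 3)
    push_cast at h2
    linear_combination (- r n) * h2 + 2 * b (n + 3) * h1
  have hX2 : Tendsto (fun n => ξ (n + 2) * r n) atTop (𝓝 0) := by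
    have : Tendsto (fun n => (g (n + 2) + g (n + 3)) * r n - b (n + 2) * (2 - r n)) atTop
      (𝓝 ((0 + 0) * 0 - 0 * (2 - 0))) := ((hg2.add hg3).mul hr).sub (hb2.mul (hr.const_sub 2))
    norm_num at this
    refine this.congr' ?_
    filter_upwards [eventually_ge_atTop N0] with n hn
    have h1 := hr1 n hn
    have h2 := D.bx (n + 2)
    push_cast at h2
    simp only [show n + 2 + 1 = n + 3 by omega] at h2
    linear_combination (- r n) * h2 + 2 * b (n + 2) * h1
  have hE : Tendsto (fun n => a (n + 3) ^ 2 * (ξ (n + 2) + ξ (n + 3)) - x₁ * ω (n + 3)) atTop (𝓝 0) := by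
    have : Tendsto (fun n => (1 - x₁ ^ 2) * g (n + 3) - g (n + 3) * (ω (n + 3) * r n) + c₁ / 2 * r n
       - a (n + 3) ^ 2 * (1 / 2 * (ξ (n + 2) * r n - ξ (n + 3) * r n))) atTop
       (𝓝 ((1 - x₁ ^ 2) * 0 - 0 * 0 + c₁ / 2 * 0 - (1 / 2) ^ 2 * (1 / 2 * (0 - 0)))) :=
      (((hg3.const_mul _).sub (hg3.mul hW)).add (hr.const_mul _)).sub
        ((ha3.pow 2).mul ((hX2.sub hX3).const_mul _))
    norm_num at this
    refine this.congr' ?_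
    filter_upwards [eventually_ge_atTop N0] with n hn
    have h1 := hr1 n hn
    have h2 := (hF n).2
    set ν := (n : ℝ) + 3 + σ / 2
    linear_combination (-(1 / 2) * r n) * h2
      + (a (n + 3) ^ 2 * (ξ (n + 2) + ξ (n + 3)) - x₁ * ω (n + 3) - (1 - x₁ ^ 2) * g (n+3)) * h1
  set κ := lam * (1 - x₁ ^ 2)
  have hx2 : x₁ ^ 2 < 1 := by nlinarith [hx.1, hx.2]
  have hev : ∀ᶠ n in atTop, |a (n + 3) ^ 2 * (ξ (n + 2) + ξ (n + 3)) - x₁ * ω (n + 3)| < 1 ∧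
      (1 + x₁ ^ 2) / 2 < 4 * a (n + 3) ^ 2 ∧ a (n + 3) < 1 := by
    have e1 := hE.abs.eventually (gt_mem_nhds (show |(0 : ℝ)| < 1 by norm_num))
    have e2 := ((ha3.pow 2).const_mul 4).eventually (lt_mem_nhds (show (1 + x₁ ^ 2) / 2 < 4 * (1 / 2 : ℝ) ^ 2 by linarith))
    have e3 := ha3.eventually (gt_mem_nhds (show (1 / 2 : ℝ) < 1 by norm_num))
    filter_upwards [e1, e2, e3] with n h1 h2 h3 using ⟨h1, h2, h3⟩
  obtain ⟨N, hN⟩ := eventually_atTop.1 hev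
  set δ := (1 - x₁ ^ 2) / 2 with hδ
  have hδ0 : 0 < δ := by rw [hδ]; linarith
  set M := (4 * κ ^ 2 + 3) / δ + 1 with hM
  have hMδ : δ * M = 4 * κ ^ 2 + 3 + δ := by rw [hM]; field_simp
  have hM1 : 1 ≤ M := by rw [hM]; have : 0 ≤ (4 * κ ^ 2 + 3) / δ := by positivity
                         linarith
  have bW : ∀ n, N ≤ n → |ω (n + 3)| ≤ M := by
    intro n hn
    obtain ⟨h1, h2, h3⟩ := hN n hn
    have h4 := D.F3 n
    have ap := D.apos (n + 2)
    simp only [show n + 2 + 1 = n + 3 by omega] at ap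
    set e := a (n + 3) ^ 2 * (ξ (n + 2) + ξ (n + 3)) - x₁ * ω (n + 3) with he
    have ha1 : a (n + 3) ^ 2 ≤ 1 := by nlinarith
    have h5 : 4 * a (n + 3) ^ 2 * ω (n + 3) ^ 2 ≤ 4 * a (n + 3) ^ 2 * κ ^ 2 + (x₁ * ω (n + 3) + e) ^ 2 := by
      have : x₁ * ω (n + 3) + e = a (n + 3) ^ 2 * (ξ (n + 2) + ξ (n + 3)) := by rw [he]; ring
      rw [this]
      have : 0 ≤ (a (n + 3) ^ 2) ^ 2 * (ξ (n + 2) - ξ (n + 3)) ^ 2 := by positivity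
      linear_combination 4 * a (n + 3) ^ 2 * h4 + this
    set W := ω (n + 3)
    have h6 : x₁ * W * e ≤ |W| := by
      calc x₁ * W * e ≤ |x₁ * W * e| := le_abs_self _
        _ = |x₁| * |W| * |e| := by rw [abs_mul, abs_mul]
        _ ≤ 1 * |W| * 1 := by
          have : |x₁| ≤ 1 := abs_le.2 ⟨hx.1.le, hx.2.le⟩
          gcongr
        _ = |W| := by ring
    have h7 : e ^ 2 ≤ 1 := by rw [← sq_abs]; nlinarith [abs_nonneg e]
    have h8 : δ * W ^ 2 ≤ 4 * κ ^ 2 + 2 * |W| + 1 := by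
      have : (1 + x₁ ^ 2) / 2 * W ^ 2 ≤ 4 * a (n + 3) ^ 2 * W ^ 2 := by gcongr
      have h9 : 4 * a (n + 3) ^ 2 * κ ^ 2 ≤ 4 * κ ^ 2 := by nlinarith [sq_nonneg κ]
      rw [hδ]
      nlinarith
    by_contra hc
    push Not at hc
    have h10 : W ^ 2 = |W| ^ 2 := (sq_abs _).symm
    rw [h10] at h8
    have h11 : M * |W| ≤ |W| ^ 2 := by nlinarith
    have h12 : δ * (M * |W|) ≤ δ * |W| ^ 2 := by gcongr
    have h13 : 1 < |W| := lt_of_le_of_lt hM1 hc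
    rw [← mul_assoc, hMδ] at h12
    nlinarith [sq_nonneg κ]
  have OW : Ok 0 (fun n => ω (n + 3)) := ⟨M, by linarith, N + 1, by omega, fun n hn => by
    simpa using bW n (by omega)⟩
  refine ⟨OW.unshift.unshift.unshift, ?_⟩
  have OX : Ok 0 (fun n => ξ (n + 3)) := by
    refine ⟨8 * (M + 1) + 8 * (M ^ 2 + κ ^ 2) + 1, by positivity, N + 1, by omega, fun n hn => ?_⟩
    obtain ⟨h1, h2, h3⟩ := hN n (by omega)
    have h4 := D.F3 n
    have h5 := bW n (by omega)
    have h6 : |a (n + 3) ^ 2 * (ξ (n + 2) + ξ (n + 3))| ≤ M + 1 := by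
      have e1 : a (n + 3) ^ 2 * (ξ (n + 2) + ξ (n + 3)) = (a (n + 3) ^ 2 * (ξ (n + 2) + ξ (n + 3)) - x₁ * ω (n + 3)) + x₁ * ω (n + 3) := by ring
      rw [e1]
      refine (abs_add_le _ _).trans ?_
      have : |x₁ * ω (n + 3)| ≤ 1 * M := by
        rw [abs_mul]
        have : |x₁| ≤ 1 := abs_le.2 ⟨hx.1.le, hx.2.le⟩
        gcongr
      linarith
    have ha8 : 1 / 8 < a (n + 3) ^ 2 := by nlinarith [sq_nonneg x₁]
    set X := ξ (n + 3)
    set X' := ξ (n + 2)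
    set A2 := a (n + 3) ^ 2
    have hA1 : A2 ≤ 1 := by
      have ap := D.apos (n + 2)
      simp only [show n + 2 + 1 = n + 3 by omega] at ap
      simp only [A2]; nlinarith
    have h7 : ω (n + 3) ^ 2 ≤ M ^ 2 := by rw [← sq_abs]; gcongr
    have h8 : A2 * X ^ 2 ≤ |X| * (M + 1) + (M ^ 2 + κ ^ 2) := by
      have : A2 * X ^ 2 = X * (A2 * (X' + X)) - A2 * X * X' := by ring
      rw [this]
      have : X * (A2 * (X' + X)) ≤ |X| * (M + 1) := by
        refine (le_abs_self _).trans ?_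
        rw [abs_mul]; gcongr
      nlinarith [sq_nonneg κ, sq_nonneg (ω (n+3))]
    rw [pow_zero, div_one, Real.norm_eq_abs]
    by_contra hc
    push Not at hc
    rw [← sq_abs] at h8
    have h9 : 1 / 8 * |X| ^ 2 ≤ |X| * (M + 1) + (M ^ 2 + κ ^ 2) := by
      refine le_trans ?_ h8; gcongr
    set Q := M ^ 2 + κ ^ 2 with hQ
    have hQ0 : 0 ≤ Q := by positivity
    have h10 : 1 ≤ |X| := by linarith
    have h11 : |X| * (8 * (M + 1) + 8 * Q + 1) ≤ |X| * |X| := by gcongr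
    have h12 : Q * 1 ≤ Q * |X| := by gcongr
    nlinarith
  exact OX.unshift.unshift.unshift

end Dyn
end Magnus
end

section
open Polynomial Filter Topology

namespace Magnus
namespace Dyn
variable {x₁ α β lam : ℝ} {p : ℕ → ℝ[X]} {a b g ω ξ : ℕ → ℝ}

set_option maxHeartbeats 2000000 in
theorem asym1 (D : Dyn x₁ α β lam p a b g ω ξ) (hx : -1 < x₁ ∧ x₁ < 1)
    (ha : Tendsto a atTop (𝓝 (1 / 2))) (hg : Tendsto g atTop (𝓝 0)) :
    Ok 1 g ∧ Ok 1 (fun n => a n - 1 / 2) ∧ Ok 1 b ∧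
    Ok 2 (fun n => a n - 1 / 2 + ω n * (n : ℝ)⁻¹ / 2) ∧ Ok 2 (fun n => b n + ξ n * (n : ℝ)⁻¹ / 2) ∧
    Ok 1 (fun n => ω (n + 1) + ω n - x₁ * ξ n) ∧
    Ok 1 (fun n => ξ n + ξ (n + 1) - 4 * x₁ * ω (n + 1)) := by
  obtain ⟨Oω, Oξ⟩ := D.bdd hx ha hg
  obtain ⟨c₁, c₄, hF0⟩ := D.F12 hx
  set σ := α + β + 2 * lam with hσ
  have hx2 : 0 < 1 - x₁ ^ 2 := by nlinarith [hx.1, hx.2]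
  have Og : Ok 0 g := Ok.of_tendsto hg
  have Oa : Ok 0 a := Ok.of_tendsto ha
  let r : ℕ → ℝ := fun n => ((n : ℝ) + (1 + σ / 2))⁻¹
  have Or : Ok 1 r := Ok.inv_add _
  obtain ⟨N0, hN0⟩ := ev_ne (1 + σ / 2)
  have hr1 : ∀ n, N0 ≤ n → ((n : ℝ) + 1 + σ / 2) * r n = 1 := fun n hn => by
    have := hN0 n hn
    simp only [r]; rw [add_assoc]; exact mul_inv_cancel₀ this
  have hF : ∀ n : ℕ, 2 ≤ n → a (n + 1) ^ 2 * (4 * ((n : ℝ) + 1 + σ / 2) ^ 2 - 1) =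
     ((n : ℝ) + 1 + σ / 2) ^ 2 + g (n + 1) ^ 2
      - 2 * ((n : ℝ) + 1 + σ / 2) * ω (n + 1)
      + 2 * ((n : ℝ) + 1 + σ / 2) * x₁ * g (n + 1) + c₄ ∧
   a (n + 1) ^ 2 * ((2 * ((n : ℝ) + 1 + σ / 2) + 1) * ξ n
       + (2 * ((n : ℝ) + 1 + σ / 2) - 1) * ξ (n + 1)) =
     2 * ((n : ℝ) + 1 + σ / 2) * (x₁ * ω (n + 1) + (1 - x₁ ^ 2) * g (n + 1))
      - 2 * g (n + 1) * ω (n + 1) + c₁ := by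
    intro n hn
    obtain ⟨m, rfl⟩ := Nat.exists_eq_add_of_le' hn
    have := hF0 m
    push_cast
    rw [show (m : ℝ) + 2 + 1 = m + 3 by ring]
    exact this
  have Ob : Ok 1 b := by
    refine (Or.mul0 (Og.sub (Oξ.cmul (1 / 2)))).of_ev N0 (fun n hn => ?_)
    have h1 := hr1 n hn
    have h2 := D.bx n
    rw [D.gs] at h2
    rw [← hσ] at h2
    linear_combination (-r n / 2) * h2 + b n * h1
  have hbex : ∀ n, N0 ≤ n → b n = (g n - ξ n / 2) * r n := by
    intro n hn
    have h1 := hr1 n hn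
    have h2 := D.bx n
    rw [D.gs] at h2
    rw [← hσ] at h2
    linear_combination (r n / 2) * h2 - b n * h1
  have E2 : Ok 1 (fun n => ω (n + 1) + ω n - x₁ * ξ n) := by
    refine (Ob.mul0 Oξ).neg.of_ev 1 (fun n hn => ?_)
    obtain ⟨m, rfl⟩ := Nat.exists_eq_add_of_le' hn
    have := D.oo m
    simp only [show m + 1 + 1 = m + 2 by omega]
    linear_combination -this
  have Oa1 := Oa.shift
  have Og1 := Og.shift
  have Oω1 := Oω.shift
  have Oξ1 := Oξ.shift
  -- a^2 - 1/4
  have hA2 : ∀ n, max N0 2 ≤ n → a (n + 1) ^ 2 - 1 / 4 =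
      (a (n + 1) * a (n + 1) + g (n + 1) * g (n + 1) + c₄) * (r n * r n) / 4
       - ω (n + 1) * r n / 2 + x₁ * g (n + 1) * r n / 2 := by
    intro n hn
    have h1 := hr1 n (le_of_max_le_left hn)
    have h2 := (hF n (le_of_max_le_right hn)).1
    set ν := (n : ℝ) + 1 + σ / 2
    linear_combination (r n ^ 2 / 4) * h2 + (-(a (n+1) ^ 2 - 1 / 4) * (1 + ν * r n) - ω (n+1) * r n / 2 + x₁ * g (n+1) * r n / 2 ) * h1
  have A4 : Ok 2 (fun n => (a (n + 1) * a (n + 1) + g (n + 1) * g (n + 1) + c₄) * (r n * r n) / 4) :=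
    ((Or.mul Or).mul0 ((((Oa1.mul Oa1).add (Og1.mul Og1)).add (Ok.const c₄)).mul (Ok.const (1 / 4)))).of_ev 0
      (fun n _ => by ring)
  have A5 : Ok 1 (fun n => a (n + 1) ^ 2 - 1 / 4) := by
    have h1 : Ok 1 (fun n => (a (n + 1) * a (n + 1) + g (n + 1) * g (n + 1) + c₄) * (r n * r n) / 4
       - ω (n + 1) * r n / 2 + x₁ * g (n + 1) * r n / 2) :=
      ((A4.mono (by norm_num)).sub (((Or.mul0 Oω1).cmul (1 / 2)).of_ev (g := fun n => ω (n + 1) * r n / 2) 0 (fun n _ => by ring))).add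
       (((Or.mul0 Og1).cmul (x₁ / 2)).of_ev 0 (fun n _ => by ring))
    exact h1.of_ev (max N0 2) (fun n hn => (hA2 n hn).symm)
  have A6 : Ok 1 (fun n => a (n + 1) - 1 / 2) := by
    refine (A5.cmul 2).norm_le 0 (fun n _ => ?_)
    have := D.apos n
    have e : 2 * (a (n + 1) ^ 2 - 1 / 4) = (a (n + 1) - 1 / 2) * (2 * a (n + 1) + 1) := by ring
    rw [e, norm_mul]
    refine le_mul_of_one_le_right (norm_nonneg _) ?_
    rw [Real.norm_eq_abs]
    exact le_trans (by linarith) (le_abs_self _)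
  have E4 : Ok 1 (fun n => a (n + 1) ^ 2 * (ξ n + ξ (n + 1)) - x₁ * ω (n + 1) - (1 - x₁ ^ 2) * g (n + 1)) := by
    have : Ok 1 (fun n => r n * ((1 / 2) * (-2 * (g (n + 1) * ω (n + 1)) + c₁ - a (n + 1) * a (n + 1) * (ξ n - ξ (n + 1))))) :=
      Or.mul0 (((((Og1.mul Oω1).cmul (-2)).add (Ok.const c₁)).sub ((Oa1.mul Oa1).mul0 (Oξ.sub Oξ1))).cmul _)
    refine this.of_ev (max N0 2) (fun n hn => ?_)
    have h1 := hr1 n (le_of_max_le_left hn)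
    have h2 := (hF n (le_of_max_le_right hn)).2
    set ν := (n : ℝ) + 1 + σ / 2
    linear_combination (-r n / 2) * h2 + (a (n + 1) ^ 2 * (ξ n + ξ (n + 1)) - x₁ * ω (n + 1) - (1 - x₁ ^ 2) * g (n + 1)) * h1
  have E5 : Ok 1 (fun n => (1 / 4) * (ξ n + ξ (n + 1)) - x₁ * ω (n + 1) - (1 - x₁ ^ 2) * g (n + 1)) := by
    refine (E4.sub (A5.mul0 (Oξ.add Oξ1))).of_ev 0 (fun n _ => by ring)
  -- g = O(1/n)
  let V : ℕ → ℝ := fun n => (1 / 2) * (x₁ * ω (n + 1) - (1 / 2) * ξ n)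
  have OV : Ok 0 V := ((Oω1.cmul _).sub (Oξ.cmul _)).cmul _
  have V1 : Ok 1 (fun n => V (n + 1) - V n - (1 - x₁ ^ 2) * (g (n + 1) - ξ (n + 1) / 2)) := by
    refine (E5.add (E2.shift.cmul (x₁ / 2))).of_ev 0 (fun n _ => ?_)
    simp only [V]; ring
  have V2 : Ok 2 (fun n => (1 - x₁ ^ 2) * b (n + 1) - (V (n + 1) - V n) * r (n + 1)) := by
    refine (V1.mul Or.shift).neg.of_ev N0 (fun n hn => ?_)
    rw [hbex (n + 1) (by omega)]; ring
  have hrr : Ok 2 (fun n => r (n + 1) - r n) := by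
    have h1 := inv_sub (1 + σ / 2)
    have h2 := inv_sub (2 + σ / 2)
    refine (h2.sub h1).of_ev 0 (fun n _ => ?_)
    simp only [r]; push_cast; ring_nf
  let Y : ℕ → ℝ := fun n => (1 - x₁ ^ 2) * g (n + 1) + V n * r (n + 1)
  have hY : Ok 2 (fun n => Y (n + 1) - Y n) := by
    refine (V2.neg.add (hrr.shift.mul0 OV.shift)).of_ev 0 (fun n _ => ?_)
    simp only [Y, D.gs (n + 1)]; ring
  obtain ⟨l, hl⟩ := tele hY
  have hVr : Ok 1 (fun n => V n * r (n + 1)) := (Or.shift.mul0 OV).of_ev 0 (fun n _ => mul_comm _ _)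
  have hl0 : l = 0 := by
    have t1 : Tendsto Y atTop (𝓝 ((1 - x₁ ^ 2) * 0 + 0)) :=
      (((tendsto_add_atTop_iff_nat 1).2 hg).const_mul _).add (hVr.tendsto le_rfl)
    have t2 := t1.sub_const l
    have := tendsto_nhds_unique (hl.tendsto le_rfl) t2
    linarith
  have OG1 : Ok 1 (fun n => g (n + 1)) := by
    refine ((hl.sub hVr).cmul (1 - x₁ ^ 2)⁻¹).of_ev 0 (fun n _ => ?_)
    simp only [Y, hl0]; field_simp; ring
  have OG := OG1.unshift
  have hinv1 : Ok 2 (fun n : ℕ => r n - ((n : ℝ) + 1)⁻¹) :=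
    ((inv_sub (1 + σ / 2)).sub (inv_sub 1)).of_ev 0 (fun n _ => by simp only [r]; ring)
  refine ⟨OG, A6.unshift, Ob, ?_, ?_, E2, ?_⟩
  · apply Ok.unshift
    have h1 : Ok 2 (fun n => a (n + 1) ^ 2 - 1 / 4 + ω (n + 1) * r n / 2) := by
      refine (A4.add ((Or.mul OG1).cmul (x₁ / 2))).of_ev (max N0 2) (fun n hn => ?_)
      rw [hA2 n hn]; ring
    refine ((h1.sub (A6.mul A6)).sub ((hinv1.mul0 Oω1).cmul (1 / 2))).of_ev 0 (fun n _ => ?_)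
    push_cast; ring
  · refine ((Or.mul OG).sub (((inv_sub (1 + σ / 2)).mul0 Oξ).cmul (1 / 2))).of_ev N0 (fun n hn => ?_)
    rw [hbex n hn]; simp only [r]; ring
  · refine ((E5.add (OG1.cmul (1 - x₁ ^ 2))).cmul 4).of_ev 0 (fun n _ => by ring)

end Dyn
end Magnus
end

section
open Polynomial Filter Topology

namespace Magnus
namespace Dyn
variable {x₁ α β lam : ℝ} {p : ℕ → ℝ[X]} {a b g ω ξ : ℕ → ℝ}

/-- complexified value at `x₁` -/
noncomputable def Zc (x₁ s : ℝ) (p : ℕ → ℝ[X]) (n : ℕ) : ℂ :=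
  ⟨(p (n + 1)).eval x₁, ((p n).eval x₁ - x₁ * (p (n + 1)).eval x₁) / s⟩

theorem Zc_ne (D : Dyn x₁ α β lam p a b g ω ξ) {s : ℝ} (hs : 0 < s) (n : ℕ) : Zc x₁ s p n ≠ 0 := by
  intro h
  have h1 := congrArg Complex.re h
  have h2 := congrArg Complex.im h
  simp only [Zc, Complex.zero_re, Complex.zero_im] at h1 h2
  rw [h1] at h2
  rcases D.ne n x₁ with h | h
  · apply h
    rw [div_eq_zero_iff] at h2
    rcases h2 with h2 | h2
    · linarith
    · exact absurd h2 hs.ne'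
  · exact h h1

set_option maxHeartbeats 2000000 in
theorem asym2 (D : Dyn x₁ α β lam p a b g ω ξ) (hx : -1 < x₁ ∧ x₁ < 1) {s : ℝ} (hs : 0 < s)
    (hs2 : s ^ 2 = 1 - x₁ ^ 2)
    (ha : Tendsto a atTop (𝓝 (1 / 2))) (hg : Tendsto g atTop (𝓝 0)) :
    ∃ cx cy d : ℕ → ℝ, (∀ n, cx n ^ 2 + cy n ^ 2 = 1) ∧
      (∀ n, Zc x₁ s p n = ‖Zc x₁ s p n‖ * (⟨cx n, cy n⟩ : ℂ)) ∧
      (∀ n, Zc x₁ s p (n + 1) = (⟨x₁, s⟩ : ℂ) * (Zc x₁ s p n - (Complex.I / s) * (d n * ‖Zc x₁ s p n‖))) ∧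
      Ok 1 (fun n => ω (n + 1) - lam * (cx n ^ 2 - (s * cy n + x₁ * cx n) ^ 2)) ∧
      Ok 1 (fun n => ξ (n + 1) + 4 * lam * s * cx n * cy n) ∧
      Ok 2 (fun n => d n + 2 * lam * s * cy n * ((1 + 3 * x₁ ^ 2) * cx n ^ 2 + s ^ 2 * cy n ^ 2) * (n : ℝ)⁻¹) := by
  obtain ⟨OG, OA, OB, A2, B2, E2, E5⟩ := D.asym1 hx ha hg
  obtain ⟨Oω, Oξ⟩ := D.bdd hx ha hg
  have Oa : Ok 0 a := Ok.of_tendsto ha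
  let P : ℕ → ℝ := fun n => (p n).eval x₁
  let R : ℕ → ℝ := fun n => ‖Zc x₁ s p n‖
  have hR : ∀ n, 0 < R n := fun n => norm_pos_iff.2 (D.Zc_ne hs n)
  have hR2 : ∀ n, R n ^ 2 = P (n + 1) ^ 2 + ((P n - x₁ * P (n + 1)) / s) ^ 2 := by
    intro n
    simp only [R]
    rw [← Complex.normSq_eq_norm_sq, Complex.normSq_apply]
    simp only [Zc, P]; ring
  let cx : ℕ → ℝ := fun n => P (n + 1) / R n
  let cy : ℕ → ℝ := fun n => (P n - x₁ * P (n + 1)) / s / R n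
  let c0 : ℕ → ℝ := fun n => P n / R n
  let d : ℕ → ℝ := fun n => (P (n + 2) - 2 * x₁ * P (n + 1) + P n) / R n
  have h0 : ∀ n, c0 n = s * cy n + x₁ * cx n := by
    intro n
    have := (hR n).ne'
    simp only [c0, cx, cy]; field_simp; ring
  have h1 : ∀ n, cx n ^ 2 + cy n ^ 2 = 1 := by
    intro n
    have := (hR n).ne'
    simp only [cx, cy]
    rw [div_pow, div_pow _ (R n), ← add_div, ← hR2, div_self (pow_ne_zero _ this)]
  have hc : ∀ n, cx n ^ 2 + c0 n ^ 2 - 2 * x₁ * cx n * c0 n = s ^ 2 := by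
    intro n
    rw [h0]
    linear_combination (s ^ 2) * h1 n + (-cx n ^ 2) * hs2
  have Ocx : Ok 0 cx := ⟨1, by norm_num, 1, le_rfl, fun n _ => by
    rw [pow_zero, div_one, Real.norm_eq_abs, abs_le_one_iff_mul_self_le_one]
    nlinarith [h1 n, sq_nonneg (cy n)]⟩
  have Ocy : Ok 0 cy := ⟨1, by norm_num, 1, le_rfl, fun n _ => by
    rw [pow_zero, div_one, Real.norm_eq_abs, abs_le_one_iff_mul_self_le_one]
    nlinarith [h1 n, sq_nonneg (cx n)]⟩
  have Oc0 : Ok 0 c0 := ((Ocy.cmul s).add (Ocx.cmul x₁)).of_ev 0 (fun n _ => (h0 n).symm)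
  have r1 : ∀ n, 2 ≤ n → (ω (n + 1) - lam * s ^ 2) * cx n = a (n + 1) * ξ (n + 1) * c0 n := by
    intro n hn
    obtain ⟨m, rfl⟩ := Nat.exists_eq_add_of_le' hn
    have := D.Prel1 m
    rw [hs2]
    have h := (hR (m + 2)).ne'
    simp only [cx, c0, P]
    field_simp
    linear_combination this
  have r2 : ∀ n, 2 ≤ n → (ω (n + 1) + lam * s ^ 2) * c0 n = a (n + 1) * ξ n * cx n := by
    intro n hn
    obtain ⟨m, rfl⟩ := Nat.exists_eq_add_of_le' hn
    have := D.Prel2 m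
    rw [hs2]
    have h := (hR (m + 2)).ne'
    simp only [cx, c0, P]
    field_simp
    linear_combination this
  have OA1 := OA.shift
  have Oω1 := Oω.shift
  have Oξ1 := Oξ.shift
  have Oa1 := Oa.shift
  have C1 : Ok 1 (fun n => ω (n + 1) - lam * (cx n ^ 2 - c0 n ^ 2)) := by
    have e : Ok 1 (fun n => a (n + 1) * (ξ n + ξ (n + 1)) - 2 * x₁ * ω (n + 1)) :=
      ((OA1.mul0 (Oξ.add Oξ1)).add (E5.cmul (1 / 2))).of_ev 0 (fun n _ => by ring)
    refine ((e.mul0 (Ocx.mul0 Oc0)).cmul (s ^ 2)⁻¹).of_ev 2 (fun n hn => ?_)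
    have q1 := r1 n hn
    have q2 := r2 n hn
    have q3 := hc n
    have : s ^ 2 ≠ 0 := by positivity
    rw [inv_mul_eq_iff_eq_mul₀ this]
    linear_combination (-cx n) * q1 - c0 n * q2 + ω (n + 1) * q3
  have C2 : Ok 1 (fun n => ξ (n + 1) + 4 * lam * s * cx n * cy n) := by
    -- remainder terms
    have e1 : Ok 1 (fun n => (ξ n + ξ (n + 1) - 4 * x₁ * ω (n + 1)) * (a (n + 1) * ((cx n - x₁ * c0 n) * cx n))) :=
      E5.mul0 (Oa1.mul0 ((Ocx.sub (Oc0.cmul x₁)).mul0 Ocx))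
    have e2 : Ok 1 (fun n => (a (n + 1) - 1 / 2) * (4 * x₁ * (ω (n + 1) * ((cx n - x₁ * c0 n) * cx n)))) :=
      OA1.mul0 ((Oω1.mul0 ((Ocx.sub (Oc0.cmul x₁)).mul0 Ocx)).cmul _)
    have e3 : Ok 1 (fun n => (a (n + 1) - 1 / 2) * (s ^ 2 * ξ (n + 1))) :=
      OA1.mul0 (Oξ1.cmul _)
    have e4 := C1.cmul (x₁ * s ^ 2)
    refine ((((e1.add e2).sub e3).add e4).cmul (2 * (s ^ 2)⁻¹)).of_ev 2 (fun n hn => ?_)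
    have q1 := r1 n hn
    have q2 := r2 n hn
    have q3 := hc n
    have q0 := h0 n
    have : s ^ 2 ≠ 0 := by positivity
    rw [mul_assoc, ← mul_inv_cancel_left₀ (show (2 : ℝ) ≠ 0 by norm_num) (ξ (n + 1) + 4 * lam * s * cx n * cy n)]
    congr 1
    rw [inv_mul_eq_iff_eq_mul₀ this]
    have q4 : s * cy n = c0 n - x₁ * cx n := by linarith
    generalize cx n = X at *
    generalize c0 n = Y at *
    generalize cy n = Z at *
    linear_combination (Y - x₁ * X) * q1 - (X - x₁ * Y) * q2
      + (a (n+1) * ξ (n+1) - ω (n+1) * x₁) * q3 - 2 * s ^ 2 * lam * X * q4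
  have C1' : Ok 1 (fun n => ω (n + 1) - lam * (cx n ^ 2 - (s * cy n + x₁ * cx n) ^ 2)) :=
    C1.of_ev 0 (fun n _ => by rw [h0])
  refine ⟨cx, cy, d, h1, ?_, ?_, C1', C2, ?_⟩
  · intro n
    have := (hR n).ne'
    change Zc x₁ s p n = ((R n : ℝ) : ℂ) * _
    apply Complex.ext
    · simp only [Complex.re_ofReal_mul, cx, Zc, P]; field_simp
    · simp only [Complex.im_ofReal_mul, cy, Zc, P]; field_simp
  · intro n
    have := (hR n).ne'
    have hd : (d n : ℂ) * (‖Zc x₁ s p n‖ : ℂ) = ((P (n + 2) - 2 * x₁ * P (n + 1) + P n : ℝ) : ℂ) := by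
      rw [← Complex.ofReal_mul]
      congr 1
      exact div_mul_cancel₀ _ this
    have hI : Complex.I / (s : ℂ) = ⟨0, s⁻¹⟩ := by
      rw [div_eq_inv_mul, ← Complex.ofReal_inv]
      apply Complex.ext <;> simp
    rw [hd, hI]
    apply Complex.ext
    · simp only [Zc, P, Complex.mul_re, Complex.sub_re, Complex.sub_im, Complex.mul_im, Complex.ofReal_re, Complex.ofReal_im,
       show n + 1 + 1 = n + 2 by omega]
      field_simp
      ring
    · simp only [Zc, P, Complex.mul_re, Complex.sub_re, Complex.sub_im, Complex.mul_im, Complex.ofReal_re, Complex.ofReal_im,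
       show n + 1 + 1 = n + 2 by omega]
      field_simp
      linear_combination (- (p (n + 1)).eval x₁) * hs2
  · -- the increment
    let c2 : ℕ → ℝ := fun n => P (n + 2) / R n
    have hrec : ∀ n, x₁ * cx n = a (n + 2) * c2 n + b (n + 1) * cx n + a (n + 1) * c0 n := by
      intro n
      have := D.recur n x₁
      have h := (hR n).ne'
      simp only [cx, c2, c0, P]
      field_simp
      linear_combination this
    have OB1 := OB.shift
    have Oc2 : Ok 0 c2 := by
      have hai : Ok 0 (fun n => (a (n + 2))⁻¹) := by
        have : Tendsto (fun n => a (n + 2)) atTop (𝓝 (1 / 2)) := (tendsto_add_atTop_iff_nat 2).2 ha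
        exact Ok.of_tendsto (this.inv₀ (by norm_num))
      refine (hai.mul0 (((Ocx.cmul x₁).sub ((OB1.mono (Nat.zero_le 1)).mul0 Ocx)).sub (Oa1.mul0 Oc0))).of_ev 0 (fun n _ => ?_)
      have h2 := D.apos (n + 1)
      simp only [show n + 1 + 1 = n + 2 by omega] at h2
      rw [inv_mul_eq_iff_eq_mul₀ h2.ne']
      linarith [hrec n]
    have hd : ∀ n, d n = c2 n - 2 * x₁ * cx n + c0 n := by
      intro n
      have h := (hR n).ne'
      simp only [d, c2, cx, c0]; field_simp
    have hd2 : ∀ n, d n = -2 * (a (n + 2) - 1 / 2) * c2 n - 2 * b (n + 1) * cx n - 2 * (a (n + 1) - 1 / 2) * c0 n := by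
      intro n
      rw [hd]; linarith [hrec n]
    have OA2 : Ok 1 (fun n => a (n + 2) - 1 / 2) := OA.shift.shift
    have d1 : Ok 1 d := by
      refine ((((OA2.mul0 Oc2).cmul (-2)).sub ((OB1.mul0 Ocx).cmul 2)).sub ((OA1.mul0 Oc0).cmul 2)).of_ev 0
        (fun n _ => ?_)
      rw [hd2]; ring
    have k1 : Ok 2 (fun n : ℕ => ((n : ℝ) + 1)⁻¹ - (n : ℝ)⁻¹) := inv_sub 1
    have k2 : Ok 2 (fun n : ℕ => ((n : ℝ) + 2)⁻¹ - (n : ℝ)⁻¹) := inv_sub 2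
    have Oω2 : Ok 0 (fun n => ω (n + 2)) := Oω.shift.shift
    have a2 : Ok 2 (fun n => a (n + 2) - 1 / 2 + ω (n + 2) * (n : ℝ)⁻¹ / 2) := by
      refine (A2.shift.shift.sub ((k2.mul0 Oω2).cmul (1 / 2))).of_ev 0 (fun n _ => ?_)
      simp only [show n + 1 + 1 = n + 2 by omega]; push_cast; ring
    have a1 : Ok 2 (fun n => a (n + 1) - 1 / 2 + ω (n + 1) * (n : ℝ)⁻¹ / 2) := by
      refine (A2.shift.sub ((k1.mul0 Oω1).cmul (1 / 2))).of_ev 0 (fun n _ => ?_)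
      push_cast; ring
    have b1 : Ok 2 (fun n => b (n + 1) + ξ (n + 1) * (n : ℝ)⁻¹ / 2) := by
      refine (B2.shift.sub ((k1.mul0 Oξ1).cmul (1 / 2))).of_ev 0 (fun n _ => ?_)
      push_cast; ring
    have w2 : Ok 1 (fun n => ω (n + 2) - (x₁ * ξ (n + 1) - ω (n + 1))) :=
      E2.shift.of_ev 0 (fun n _ => by simp only [show n + 1 + 1 = n + 2 by omega]; ring)
    -- main
    have m1 : Ok 2 (fun n => d n - (ω (n + 2) * (2 * x₁ * cx n - c0 n) + ξ (n + 1) * cx n + ω (n + 1) * c0 n) * (n : ℝ)⁻¹) := by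
      refine (((((a2.mul0 Oc2).cmul (-2)).sub ((b1.mul0 Ocx).cmul 2)).sub ((a1.mul0 Oc0).cmul 2)).add
        ((Ok.inv_n.mul0 Oω2).mul d1)).of_ev 0 (fun n _ => ?_)
      have e1 : c2 n = d n + 2 * x₁ * cx n - c0 n := by rw [hd]; ring
      have e2 := hd2 n
      rw [e1] at e2 ⊢
      linear_combination -e2
    have m2 : Ok 2 (fun n => (n : ℝ)⁻¹ * ((ω (n + 2) - (x₁ * ξ (n + 1) - ω (n + 1))) * (2 * x₁ * cx n - c0 n)
       + (ξ (n + 1) + 4 * lam * s * cx n * cy n) * (x₁ * (2 * x₁ * cx n - c0 n) + cx n)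
       + (ω (n + 1) - lam * (cx n ^ 2 - c0 n ^ 2)) * (c0 n - (2 * x₁ * cx n - c0 n)))) := by
      have t := (Ocx.cmul (2 * x₁)).sub Oc0
      exact Ok.inv_n.mul (((w2.mul0 t).add (C2.mul0 ((t.cmul x₁).add Ocx))).add (C1.mul0 (Oc0.sub t)))
    refine (m1.add m2).of_ev 0 (fun n _ => ?_)
    have q0 := h0 n
    rw [q0]
    generalize cx n = X
    generalize cy n = Z
    generalize d n = W
    ring
end Dyn
end Magnus
end

section
open Polynomial Filter Topology ComplexConjugate

namespace Magnus

theorem Ok.rpow_ratio (c : ℝ) : Ok 2 (fun n : ℕ => ((n : ℝ) + 1) ^ c * ((n : ℝ) ^ c)⁻¹ - 1 - c * (n : ℝ)⁻¹) := by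
  have hl : Ok 2 (fun n : ℕ => Real.log (1 + (n : ℝ)⁻¹) - (n : ℝ)⁻¹) := by
    refine ⟨1, by norm_num, 1, le_rfl, fun n hn => ?_⟩
    have hn' : (0 : ℝ) < n := by exact_mod_cast hn
    have hi : (0 : ℝ) < (n : ℝ)⁻¹ := inv_pos.2 hn'
    have h1 := Real.log_le_sub_one_of_pos (show 0 < 1 + (n : ℝ)⁻¹ by linarith)
    have h2 := Real.one_sub_inv_le_log_of_pos (show 0 < 1 + (n : ℝ)⁻¹ by linarith)
    have h3 : (n : ℝ)⁻¹ - ((n : ℝ)⁻¹) ^ 2 ≤ 1 - (1 + (n : ℝ)⁻¹)⁻¹ := by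
      generalize (n : ℝ)⁻¹ = x at hi
      have : 1 - (1 + x)⁻¹ - (x - x ^ 2) = x ^ 3 / (1 + x) := by field_simp; ring
      have h5 : 0 ≤ x ^ 3 / (1 + x) := by positivity
      linarith
    rw [one_div, ← inv_pow, Real.norm_eq_abs, abs_le]
    constructor
    · linarith
    · nlinarith [sq_nonneg ((n : ℝ)⁻¹)]
  have hc : Ok 2 (fun n : ℕ => c * Real.log (1 + (n : ℝ)⁻¹) - c * (n : ℝ)⁻¹) :=
    (hl.cmul c).of_ev 0 (fun n _ => by ring)
  have hy : Ok 1 (fun n : ℕ => c * Real.log (1 + (n : ℝ)⁻¹)) :=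
    ((hc.mono (by norm_num : 1 ≤ 2)).add (Ok.inv_n.cmul c)).of_ev 0 (fun n _ => by ring)
  have h0 := hy.tendsto le_rfl
  have he : ∀ᶠ n : ℕ in atTop, |c * Real.log (1 + (n : ℝ)⁻¹)| ≤ 1 := by
    have := (tendsto_order.1 h0.norm).2 1 (by simp)
    filter_upwards [this] with n hn using le_of_lt hn
  obtain ⟨N, hN⟩ := eventually_atTop.1 he
  have hx : Ok 2 (fun n : ℕ => Real.exp (c * Real.log (1 + (n : ℝ)⁻¹)) - 1 - c * Real.log (1 + (n : ℝ)⁻¹)) := by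
    refine (hy.mul hy).norm_le N (fun n hn => ?_)
    have := Real.abs_exp_sub_one_sub_id_le (hN n hn)
    rw [Real.norm_eq_abs, Real.norm_eq_abs]
    refine this.trans ?_
    rw [← sq, abs_of_nonneg (sq_nonneg _)]
  refine (hx.add hc).of_ev 1 (fun n hn => ?_)
  have hn' : (0 : ℝ) < n := by exact_mod_cast hn
  have : ((n : ℝ) + 1) ^ c * ((n : ℝ) ^ c)⁻¹ = Real.exp (c * Real.log (1 + (n : ℝ)⁻¹)) := by
    rw [← div_eq_mul_inv, ← Real.div_rpow (by positivity) (by positivity), mul_comm c,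
      ← Real.rpow_def_of_pos (by positivity)]
    congr 1
    field_simp
  rw [this]; ring

theorem Ok.conj {k : ℕ} {f : ℕ → ℂ} (hf : Ok k f) : Ok k (fun n => conj (f n)) :=
  hf.norm_le 0 (fun n _ => by simp)
theorem Ok.re {k : ℕ} {f : ℕ → ℂ} (hf : Ok k f) : Ok k (fun n => (f n).re) :=
  hf.norm_le 0 (fun _ _ => Complex.abs_re_le_norm _)
theorem Ok.im {k : ℕ} {f : ℕ → ℂ} (hf : Ok k f) : Ok k (fun n => (f n).im) :=
  hf.norm_le 0 (fun _ _ => Complex.abs_im_le_norm _)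
theorem Ok.of_norm_one {f : ℕ → ℂ} (hf : ∀ n, ‖f n‖ = 1) : Ok 0 f :=
  ⟨1, by norm_num, 1, le_rfl, fun n _ => by simp [hf n]⟩

namespace Dyn
variable {x₁ α β lam : ℝ} {p : ℕ → ℝ[X]} {a b g ω ξ : ℕ → ℝ}

set_option maxHeartbeats 2000000 in
theorem asym3 (D : Dyn x₁ α β lam p a b g ω ξ) (hx : -1 < x₁ ∧ x₁ < 1) {s : ℝ} (hs : 0 < s)
    (hs2 : s ^ 2 = 1 - x₁ ^ 2)
    (ha : Tendsto a atTop (𝓝 (1 / 2))) (hg : Tendsto g atTop (𝓝 0)) :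
    ∃ (l : ℂ) (w : ℕ → ℂ), l ≠ 0 ∧ (∀ n, ‖w n‖ = 1) ∧
      (∀ n, Zc x₁ s p n = ‖Zc x₁ s p n‖ * w n) ∧
      Ok 1 (fun n => Zc x₁ s p n * (⟨x₁, -s⟩ : ℂ) ^ n * (((n : ℝ) ^ (-lam) : ℝ) : ℂ) - l) ∧
      Ok 1 (fun n => w n * (⟨x₁, -s⟩ : ℂ) ^ n - l / ‖l‖) ∧
      Ok 1 (fun n => ω (n + 1) + lam * s * (w n ^ 2 * (⟨x₁, -s⟩ : ℂ)).im) ∧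
      Ok 1 (fun n => ξ (n + 1) + 2 * lam * s * (w n ^ 2).im) := by
  obtain ⟨cx, cy, d, h1, hZ, hrec, C1, C2, C3⟩ := D.asym2 hx hs hs2 ha hg
  obtain ⟨e, he⟩ : ∃ e : ℂ, e = ⟨x₁, s⟩ := ⟨_, rfl⟩
  obtain ⟨e', he'⟩ : ∃ e' : ℂ, e' = ⟨x₁, -s⟩ := ⟨_, rfl⟩
  obtain ⟨w, hw⟩ : ∃ w : ℕ → ℂ, w = fun n => ⟨cx n, cy n⟩ := ⟨_, rfl⟩
  rw [← he']
  rw [← he] at hrec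
  have hee : e * e' = 1 := by
    rw [he, he']; apply Complex.ext
    · simp; linarith
    · simp; ring
  have heq : e = x₁ + s * Complex.I := by rw [he]; apply Complex.ext <;> simp
  have heq' : e' = x₁ - s * Complex.I := by rw [he']; apply Complex.ext <;> simp
  have hce : conj e = e' := by rw [he, he']; rfl
  have hne : ‖e‖ = 1 := by
    have : ‖e‖ * ‖e‖ = 1 := by
      have := congrArg norm hee
      rwa [norm_mul, ← hce, Complex.norm_conj, norm_one] at this
    nlinarith [norm_nonneg e]
  have hne' : ‖e'‖ = 1 := by rw [← hce, Complex.norm_conj, hne]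
  have hwn : ∀ n, ‖w n‖ = 1 := by
    intro n
    have : ‖w n‖ ^ 2 = 1 := by
      rw [← Complex.normSq_eq_norm_sq, hw, Complex.normSq_mk, ← h1 n]; ring
    nlinarith [norm_nonneg (w n)]
  have hww : ∀ n, w n * conj (w n) = 1 := by
    intro n; rw [Complex.mul_conj, Complex.normSq_eq_norm_sq, hwn]; norm_num
  have hZw : ∀ n, Zc x₁ s p n = ‖Zc x₁ s p n‖ * w n := by
    intro n; rw [hw]; exact hZ n
  obtain ⟨Z, hZd⟩ : ∃ Z : ℕ → ℂ, Z = Zc x₁ s p := ⟨_, rfl⟩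
  have hZ0 : ∀ n, Z n ≠ 0 := fun n => hZd ▸ D.Zc_ne hs n
  rw [← hZd] at hZw hrec ⊢
  obtain ⟨m, hm⟩ : ∃ m : ℕ → ℂ, m = fun n => -(Complex.I / s) * d n * conj (w n) := ⟨_, rfl⟩
  have hmrec : ∀ n, Z (n + 1) = e * Z n * (1 + m n) := by
    intro n
    rw [hrec n]
    have h2 : Z n * conj (w n) = ‖Z n‖ := by
      conv_lhs => rw [hZw n]
      rw [mul_assoc, hww, mul_one]
    rw [hm]
    linear_combination (-(e * (Complex.I / s) * d n)) * (-h2)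
  have Ow : Ok 0 w := Ok.of_norm_one hwn
  have Ow' := Ow.conj
  obtain ⟨F, hF⟩ : ∃ F : ℂ → ℂ, F = fun q : ℂ => -(conj q) + (x₁ : ℂ) ^ 2 * q - (x₁ : ℂ) ^ 2 * (conj q) ^ 2 := ⟨_, rfl⟩
  obtain ⟨H, hH⟩ : ∃ H : ℂ → ℂ, H = fun q : ℂ => Complex.I * lam / (2 * s) *
    (e * conj q + (x₁ : ℂ) ^ 2 * e' * q + x₁ / 2 * e ^ 2 * (conj q) ^ 2) := ⟨_, rfl⟩
  have hsC : (s : ℂ) ≠ 0 := by exact_mod_cast hs.ne'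
  have hFH : ∀ q, H (e ^ 2 * q) - H q = - lam * F q := by
    intro q
    rw [hH, hF]
    simp only [map_mul, map_pow, hce]
    have t1 : e * e' ^ 2 = e' := by linear_combination e' * hee
    have t2 : e' * e ^ 2 = e := by linear_combination e * hee
    have t3 : e ^ 2 * e' ^ 4 = e' ^ 2 := by linear_combination e' ^ 2 * (e * e' + 1) * hee
    have : Complex.I * lam / (2 * s) * (e * (e' ^ 2 * conj q) + x₁ ^ 2 * e' * (e ^ 2 * q) + x₁ / 2 * e ^ 2 * (e' ^ 2 * conj q) ^ 2)
      - Complex.I * lam / (2 * s) * (e * conj q + x₁ ^ 2 * e' * q + x₁ / 2 * e ^ 2 * (conj q) ^ 2)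
      = Complex.I * lam / (2 * s) * ((e' - e) * conj q + x₁ ^ 2 * (e - e') * q + x₁ / 2 * (e' ^ 2 - e ^ 2) * (conj q) ^ 2) := by
      linear_combination (Complex.I * lam / (2 * s)) * ((conj q) * t1 + x₁ ^ 2 * q * t2 + x₁ / 2 * (conj q) ^ 2 * t3)
    rw [this, heq, heq']
    have k : Complex.I * lam / (2 * s) * (s * Complex.I) = - lam / 2 := by
      field_simp
      linear_combination lam * Complex.I_sq
    linear_combination (-(2 * conj q - 2 * (x₁ : ℂ) ^ 2 * q + 2 * x₁ ^ 2 * (conj q) ^ 2)) * k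
  -- m expansion
  have Om : Ok 2 (fun n => m n - lam * (1 + F (w n ^ 2)) * (n : ℂ)⁻¹) := by
    refine ((C3.ofReal.mul0 Ow').cmul (-(Complex.I / s))).of_ev 0 (fun n _ => ?_)
    have e1 : (cx n : ℂ) = (w n + conj (w n)) / 2 := by
      rw [hw]; apply Complex.ext <;> simp
    have e2 : (s : ℂ) * (cy n : ℂ) = - Complex.I * s * (w n - conj (w n)) / 2 := by
      rw [hw]; apply Complex.ext <;> simp <;> ring
    have e2' : (cy n : ℂ) = - Complex.I * (w n - conj (w n)) / 2 := by
      rw [hw]; apply Complex.ext <;> simp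
    rw [hm, hF]
    push_cast
    have hs2C : (s : ℂ) ^ 2 = 1 - (x₁ : ℂ) ^ 2 := by exact_mod_cast hs2
    rw [hs2C, e1, e2']
    have hw1 := hww n
    simp only [map_pow]
    generalize conj (w n) = w' at hw1 ⊢
    generalize w n = u at hw1 ⊢
    have B : (1 + 3 * (x₁ : ℂ) ^ 2) * ((u + w') / 2) ^ 2 + (1 - (x₁ : ℂ) ^ 2) * (-Complex.I * (u - w') / 2) ^ 2
      = x₁ ^ 2 * (u ^ 2 + w' ^ 2) + (1 + x₁ ^ 2) := by
      linear_combination ((1 - (x₁ : ℂ) ^ 2) * (u - w') ^ 2 / 4) * Complex.I_sq + (1 + (x₁ : ℂ) ^ 2) * hw1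
    have I2 : Complex.I / s * (2 * lam * s * (-Complex.I * (u - w') / 2)) = lam * (u - w') := by
      field_simp
      linear_combination lam * (- u + w') * Complex.I_sq
    rw [B]
    linear_combination (-(x₁ ^ 2 * (u ^ 2 + w' ^ 2) + (1 + x₁ ^ 2)) * (n : ℂ)⁻¹ * w') * I2
      - lam * (n : ℂ)⁻¹ * (x₁ ^ 2 * u ^ 2 + x₁ ^ 2 * w' ^ 2 + 1 + x₁ ^ 2 - x₁ ^ 2 * (u * w' + 1)) * hw1
  have Oq : Ok 0 (fun n => w n ^ 2) := (Ow.mul0 Ow).of_ev 0 (fun n _ => by ring)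
  have Oq' := Oq.conj
  have OF : Ok 0 (fun n => F (w n ^ 2)) := by
    rw [hF]
    exact ((Oq'.neg.add (Oq.cmul _)).sub (((Oq'.mul0 Oq').of_ev 0 (fun n _ => by ring) : Ok 0 (fun n => (conj (w n ^ 2)) ^ 2)).cmul _))
  have OH : Ok 0 (fun n => H (w n ^ 2)) := by
    rw [hH]
    exact (((Oq'.cmul _).add (Oq.cmul _)).add (((Oq'.mul0 Oq').of_ev 0 (fun n _ => by ring) : Ok 0 (fun n => (conj (w n ^ 2)) ^ 2)).cmul _)).cmul _
  have OnC : Ok 1 (fun n : ℕ => (n : ℂ)⁻¹) := Ok.inv_n.ofReal.of_ev 0 (fun n _ => by push_cast; rfl)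
  have Om1 : Ok 1 m := ((Om.mono (by norm_num : 1 ≤ 2)).add (OnC.mul0 (((Ok.const 1).add OF).cmul (lam : ℂ)))).of_ev 0
    (fun n _ => by ring)
  have hnrec : ∀ n, ‖Z (n + 1)‖ = ‖Z n‖ * ‖1 + m n‖ := by
    intro n; rw [hmrec, norm_mul, norm_mul, hne, one_mul]
  have Ow1 : Ok 1 (fun n => w (n + 1) - e * w n) := by
    refine (Om1.norm.cmul 2).norm_le 0 (fun n _ => ?_)
    have h3 : w (n + 1) * ‖1 + m n‖ = e * w n * (1 + m n) := by
      have h4 : (‖Z n‖ : ℂ) ≠ 0 := by exact_mod_cast norm_ne_zero_iff.2 (hZ0 n)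
      apply mul_left_cancel₀ h4
      have h5 := hZw (n + 1)
      rw [hnrec, hmrec, hZw n] at h5
      rw [norm_mul, hwn] at h5
      simp only [Complex.norm_real, norm_norm, mul_one] at h5
      push_cast at h5
      linear_combination -h5
    have h6 : w (n + 1) - e * w n = w (n + 1) * (1 - ‖1 + m n‖) + e * w n * m n := by
      linear_combination h3
    rw [h6]
    refine (norm_add_le _ _).trans ?_
    rw [norm_mul, norm_mul, norm_mul, hwn, hwn, hne, norm_mul, norm_norm]
    have h7 : ‖(1 : ℂ) - (‖1 + m n‖ : ℂ)‖ ≤ ‖m n‖ := by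
      have : ((1 : ℂ) - (‖1 + m n‖ : ℂ)) = ((‖(1:ℂ)‖ - ‖1 + m n‖ : ℝ) : ℂ) := by push_cast; simp
      rw [this, Complex.norm_real, Real.norm_eq_abs]
      refine (abs_norm_sub_norm_le _ _).trans ?_
      simp
    rw [Real.norm_eq_abs, abs_of_nonneg (by norm_num : (0:ℝ) ≤ 2)]
    linarith
  have Oq1 : Ok 1 (fun n => w (n + 1) ^ 2 - e ^ 2 * w n ^ 2) :=
    (Ow1.mul0 (Ow.shift.add (Ow.cmul e))).of_ev 0 (fun n _ => by ring)
  have OH1 : Ok 1 (fun n => H (w (n + 1) ^ 2) - (H (w n ^ 2) - lam * F (w n ^ 2))) := by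
    have t := Oq1.conj
    have u := (t.mul0 (Oq'.shift.add (Oq'.cmul (conj (e ^ 2)))))
    refine ((((t.cmul e).add (Oq1.cmul ((x₁ : ℂ) ^ 2 * e'))).add (u.cmul (x₁ / 2 * e ^ 2))).cmul
      (Complex.I * lam / (2 * s))).of_ev 0 (fun n _ => ?_)
    have := hFH (w n ^ 2)
    have h8 : H (w n ^ 2) - lam * F (w n ^ 2) = H (e ^ 2 * w n ^ 2) := by linear_combination -this
    rw [h8, hH]
    simp only [map_sub, map_mul]
    ring
  -- the corrected product
  obtain ⟨X, hX⟩ : ∃ X : ℕ → ℂ, X = fun n => Z n * e' ^ n * (((n : ℝ) ^ (-lam) : ℝ) : ℂ) := ⟨_, rfl⟩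
  obtain ⟨h, hh⟩ : ∃ h : ℕ → ℂ, h = fun n => H (w n ^ 2) * (n : ℂ)⁻¹ := ⟨_, rfl⟩
  have Oh : Ok 1 h := hh ▸ (OnC.mul0 OH).of_ev 0 (fun n _ => by ring)
  have hlim : Tendsto (fun n => 1 + h n) atTop (𝓝 1) := by
    simpa using (Oh.tendsto le_rfl).const_add 1
  obtain ⟨N, hN⟩ := eventually_atTop.1 (hlim.eventually_ne one_ne_zero)
  have Oi : Ok 0 (fun n => (1 + h n)⁻¹) := Ok.of_tendsto (hlim.inv₀ one_ne_zero)
  have X0 : ∀ n, 1 ≤ n → X n ≠ 0 := by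
    intro n hn
    have hn' : (0 : ℝ) < n := by exact_mod_cast hn
    rw [hX]
    refine mul_ne_zero (mul_ne_zero (hZ0 n) (pow_ne_zero _ (right_ne_zero_of_mul_eq_one hee))) ?_
    exact_mod_cast (Real.rpow_pos_of_pos hn' _).ne'
  have hXrec : ∀ n, 1 ≤ n → X (n + 1) = X n * (1 + m n) * (((n : ℝ) + 1) ^ (-lam) * ((n : ℝ) ^ (-lam))⁻¹ : ℝ) := by
    intro n hn
    have hn' : (0 : ℝ) < n := by exact_mod_cast hn
    have h9 : (((n : ℝ) ^ (-lam) : ℝ) : ℂ) ≠ 0 := by exact_mod_cast (Real.rpow_pos_of_pos hn' _).ne'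
    rw [hX]
    simp only []
    rw [hmrec]
    push_cast
    rw [pow_succ]
    field_simp
    linear_combination (Z n * (1 + m n) * e' ^ n * (((n : ℝ) + 1) ^ (-lam) : ℝ)) * hee
  obtain ⟨ρ, hρ⟩ : ∃ ρ : ℕ → ℂ, ρ = fun n : ℕ => ((((n : ℝ) + 1) ^ (-lam) * ((n : ℝ) ^ (-lam))⁻¹ : ℝ) : ℂ) := ⟨_, rfl⟩
  have Oρ : Ok 2 (fun n => ρ n - (1 - lam * (n : ℂ)⁻¹)) := by
    refine (Ok.rpow_ratio (-lam)).ofReal.of_ev 0 (fun n _ => ?_)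
    rw [hρ]; push_cast; ring
  have Oρ1 : Ok 1 (fun n => ρ n - 1) := ((Oρ.mono (by norm_num : 1 ≤ 2)).sub (OnC.cmul (lam : ℂ))).of_ev 0
    (fun n _ => by ring)
  have Oh1 : Ok 2 (fun n => h (n + 1) - (H (w n ^ 2) - lam * F (w n ^ 2)) * (n : ℂ)⁻¹) := by
    have k1 : Ok 2 (fun n : ℕ => ((n : ℂ) + 1)⁻¹ - (n : ℂ)⁻¹) :=
      (inv_sub 1).ofReal.of_ev 0 (fun n _ => by push_cast; ring)
    refine ((k1.mul0 OH.shift).add (OH1.mul OnC)).of_ev 0 (fun n _ => ?_)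
    rw [hh]; push_cast; ring
  obtain ⟨r, hr⟩ : ∃ r : ℕ → ℂ, r = fun n => ((1 + m n) * ρ n * (1 + h (n + 1)) - (1 + h n)) * (1 + h n)⁻¹ := ⟨_, rfl⟩
  have Or : Ok 2 r := by
    rw [hr]
    refine Ok.mul0 ?_ Oi
    have A1 : Ok 2 (fun n => m n * (ρ n - 1)) := Om1.mul Oρ1
    have A2 : Ok 2 (fun n => m n * h (n + 1)) := Om1.mul Oh.shift
    have A3 : Ok 2 (fun n => (ρ n - 1) * h (n + 1)) := Oρ1.mul Oh.shift
    have A4 : Ok 2 (fun n => m n * (ρ n - 1) * h (n + 1)) := A1.mul0 (Oh.shift.mono (by norm_num))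
    refine ((((((A1.add A2).add A3).add A4).add Om).add Oρ).add Oh1).of_ev 0 (fun n _ => ?_)
    have : h n = H (w n ^ 2) * (n : ℂ)⁻¹ := by rw [hh]
    rw [this]
    ring
  obtain ⟨l, hl, Ol⟩ := mtele (Y := fun n => X n * (1 + h n)) (max N 1)
    (fun n hn => mul_ne_zero (X0 n (le_of_max_le_right hn)) (hN n (le_of_max_le_left hn)))
    (fun n hn => by
      have h10 := hN n (le_of_max_le_left hn)
      have h11 := hXrec n (le_of_max_le_right hn)
      have h12 : ρ n = ((((n : ℝ) + 1) ^ (-lam) * ((n : ℝ) ^ (-lam))⁻¹ : ℝ) : ℂ) := by rw [hρ]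
      rw [← h12] at h11
      simp only [hr]
      rw [h11]
      field_simp
      ring) Or
  have OX0 : Ok 0 X := by
    refine (((Ol.mono (Nat.zero_le 1)).add (Ok.const l)).mul0 Oi).of_ev N (fun n hn => ?_)
    have := hN n hn
    field_simp
    ring
  have OX : Ok 1 (fun n => X n - l) := (Ol.sub (Oh.mul0 OX0)).of_ev 0 (fun n _ => by ring)
  have hlC : (‖l‖ : ℂ) ≠ 0 := by exact_mod_cast norm_ne_zero_iff.2 hl
  have OXn : Ok 1 (fun n => (‖l‖ : ℂ) - ‖X n‖) := by
    refine OX.norm_le 0 (fun n _ => ?_)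
    rw [← Complex.ofReal_sub, Complex.norm_real, Real.norm_eq_abs, norm_sub_rev]
    exact abs_norm_sub_norm_le _ _
  have Owe : Ok 1 (fun n => w n * e' ^ n - l / ‖l‖) := by
    have Ot : Ok 0 (fun n => w n * e' ^ n) := Ok.of_norm_one (fun n => by rw [norm_mul, norm_pow, hwn, hne']; simp)
    refine ((OX.add (OXn.mul0 Ot)).cmul (‖l‖ : ℂ)⁻¹).of_ev 1 (fun n hn => ?_)
    have hn' : (0 : ℝ) < n := by exact_mod_cast hn
    have : X n = ‖X n‖ * (w n * e' ^ n) := by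
      rw [hX]
      simp only [norm_mul, norm_pow, hne', one_pow, mul_one, Complex.norm_real]
      rw [Real.norm_of_nonneg (Real.rpow_pos_of_pos hn' _).le]
      conv_lhs => rw [hZw n]
      push_cast
      ring
    field_simp
    linear_combination this
  refine ⟨l, w, hl, hwn, hZw, ?_, Owe, ?_, ?_⟩
  · rw [hX] at OX; exact OX
  · refine C1.of_ev 0 (fun n _ => ?_)
    have : (w n ^ 2 * e').im = x₁ * (2 * cx n * cy n) - s * (cx n ^ 2 - cy n ^ 2) := by
      rw [hw, he']; simp [sq]; ring
    rw [this]
    linear_combination (lam * cx n ^ 2) * hs2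
  · refine C2.of_ev 0 (fun n _ => ?_)
    have : (w n ^ 2).im = 2 * cx n * cy n := by
      rw [hw]; simp [sq]; ring
    rw [this]; ring
end Dyn
end Magnus
end

section
open Polynomial Filter Topology ComplexConjugate

namespace Magnus
namespace Dyn
variable {x₁ α β lam : ℝ} {p : ℕ → ℝ[X]} {a b g ω ξ : ℕ → ℝ}

theorem Lrate (D : Dyn x₁ α β lam p a b g ω ξ) (hx : -1 < x₁ ∧ x₁ < 1) {s : ℝ} (hs : 0 < s)
    (hs2 : s ^ 2 = 1 - x₁ ^ 2)
    (ha : Tendsto a atTop (𝓝 (1 / 2))) (hg : Tendsto g atTop (𝓝 0))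
    (L : ℕ → ℝ) (hL : ∀ n, L (n + 1) * (2 * a (n + 1)) = L n) (hL1 : Tendsto L atTop (𝓝 1)) :
    Ok 1 (fun n => L n - 1) := by
  obtain ⟨l, w, hl, hwn, hZw, _, Owe, C1, _⟩ := D.asym3 hx hs hs2 ha hg
  obtain ⟨OG, OA, OB, A2, B2, E2, E5⟩ := D.asym1 hx ha hg
  obtain ⟨Oω, Oξ⟩ := D.bdd hx ha hg
  obtain ⟨e, he⟩ : ∃ e : ℂ, e = ⟨x₁, s⟩ := ⟨_, rfl⟩
  obtain ⟨e', he'⟩ : ∃ e' : ℂ, e' = ⟨x₁, -s⟩ := ⟨_, rfl⟩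
  rw [← he'] at Owe C1
  have hee : e * e' = 1 := by
    rw [he, he']; apply Complex.ext
    · simp; linarith
    · simp; ring
  have hce : conj e = e' := by rw [he, he']; rfl
  have hne : ‖e‖ = 1 := by
    have : ‖e‖ * ‖e‖ = 1 := by
      have := congrArg norm hee
      rwa [norm_mul, ← hce, Complex.norm_conj, norm_one] at this
    nlinarith [norm_nonneg e]
  have he1 : e ^ 2 - 1 ≠ 0 := by
    intro h
    have h3 : e ^ 2 = e * e' := by rw [hee]; linear_combination h
    have h4 : e = e' := by
      have : e ≠ 0 := left_ne_zero_of_mul_eq_one hee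
      apply mul_left_cancel₀ this
      rw [← h3]; ring
    rw [he, he'] at h4
    have := congrArg Complex.im h4
    simp at this
    linarith
  obtain ⟨v, hv⟩ : ∃ v : ℂ, v = l / ‖l‖ := ⟨_, rfl⟩
  rw [← hv] at Owe
  have Oe : ∀ k : ℕ, Ok 0 (fun n => e ^ (k * n)) := fun k => Ok.of_norm_one (fun n => by rw [norm_pow, hne, one_pow])
  have Ow : Ok 1 (fun n => w n - v * e ^ n) := by
    refine (Owe.mul0 (Oe 1)).of_ev 0 (fun n _ => ?_)
    have : e' ^ n * e ^ n = 1 := by rw [← mul_pow, mul_comm, hee, one_pow]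
    rw [one_mul]
    linear_combination w n * this
  have Owb : Ok 0 w := Ok.of_norm_one hwn
  have Ovb : Ok 0 (fun n => v * e ^ n) := ((Oe 1).cmul v).of_ev 0 (fun n _ => by rw [one_mul])
  have Ow2 : Ok 1 (fun n => w n ^ 2 * e' - v ^ 2 * e ^ (2 * n) * e') := by
    refine ((Ow.mul0 (Owb.add Ovb)).cmul e').of_ev 0 (fun n _ => ?_)
    rw [mul_comm 2 n, pow_mul]; ring
  let U : ℕ → ℂ := fun n => v ^ 2 * e ^ (2 * n) * e' / (e ^ 2 - 1)
  let u : ℕ → ℝ := fun n => - lam * s * (U n).im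
  have hU : ∀ n, U (n + 1) - U n = v ^ 2 * e ^ (2 * n) * e' := by
    intro n
    simp only [U]
    field_simp
    ring
  have OU : Ok 0 U := ((Oe 2).cmul (v ^ 2 * e' / (e ^ 2 - 1))).of_ev 0 (fun n _ => by simp only [U]; ring)
  have Ou : Ok 0 u := OU.im.cmul _
  have Oω' : Ok 1 (fun n => ω (n + 1) - (u (n + 1) - u n)) := by
    refine (C1.sub (Ow2.im.cmul (lam * s))).of_ev 0 (fun n _ => ?_)
    have := congrArg Complex.im (hU n)
    rw [Complex.sub_im] at this
    simp only [u]
    rw [Complex.sub_im]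
    linear_combination (-lam * s) * this
  have OLb : Ok 0 L := Ok.of_tendsto hL1
  have OA1 := OA.shift
  have Onn := Ok.inv_n
  have OLd : Ok 1 (fun n => L (n + 1) - L n) := by
    refine ((OA1.mul0 OLb.shift).cmul (-2)).of_ev 0 (fun n _ => ?_)
    linear_combination -hL n
  have k1 : Ok 2 (fun n : ℕ => ((n : ℝ) + 1)⁻¹ - (n : ℝ)⁻¹) := inv_sub 1
  -- 2 a (n+1) - 1 = - ω(n+1)/n + Ok 2
  have a1 : Ok 2 (fun n => a (n + 1) - 1 / 2 + ω (n + 1) * (n : ℝ)⁻¹ / 2) := by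
    refine (A2.shift.sub ((k1.mul0 Oω.shift).cmul (1 / 2))).of_ev 0 (fun n _ => ?_)
    push_cast; ring
  have a2 : Ok 2 (fun n => (a (n + 1) - 1 / 2) + (u (n + 1) - u n) * (n : ℝ)⁻¹ / 2) := by
    refine (a1.sub ((Oω'.mul Onn).cmul (1 / 2))).of_ev 0 (fun n _ => ?_)
    ring
  have OY : Ok 2 (fun n => (L (n + 1) - L (n + 1) * u (n + 1) * ((n + 1 : ℕ) : ℝ)⁻¹) - (L n - L n * u n * (n : ℝ)⁻¹)) := by
    refine ((((a2.mul0 OLb.shift).cmul (-2)).sub (k1.mul0 (OLb.shift.mul0 Ou.shift))).sub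
      ((OLd.mul Onn).mul0 Ou)).of_ev 0 (fun n _ => ?_)
    push_cast
    linear_combination -hL n
  obtain ⟨l', hl'⟩ := tele (Y := fun n => L n - L n * u n * (n : ℝ)⁻¹) OY
  have O2 : Ok 1 (fun n => L n - l') := by
    refine (hl'.add (Onn.mul0 (OLb.mul0 Ou))).of_ev 0 (fun n _ => ?_)
    ring
  have : l' = 1 := by
    have h1 := (O2.tendsto le_rfl)
    have h2 := (hL1.sub_const l')
    have := tendsto_nhds_unique h1 h2
    linarith
  rw [← this]; exact O2
end Dyn
end Magnus
end

section
open Polynomial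

namespace Magnus

section
variable {L : ℝ[X] →ₗ[ℝ] ℝ} {p : ℕ → ℝ[X]}

theorem exp_aux (hdeg : ∀ n : ℕ, (p n).natDegree = n) (hne : ∀ n, p n ≠ 0) (m : ℕ) : ∀ q : ℝ[X], q.degree < m →
    ∃ c : ℕ → ℝ, q = ∑ k ∈ Finset.range m, C (c k) * p k := by
  induction m with
  | zero =>
    intro q hq
    refine ⟨fun _ => 0, ?_⟩
    simpa using hq
  | succ m ih =>
    intro q hq
    have hlc : (p m).coeff m ≠ 0 := by
      have := leadingCoeff_ne_zero.2 (hne m)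
      rwa [leadingCoeff, hdeg] at this
    rw [degree_lt_iff_coeff_zero] at hq
    obtain ⟨c, hc⟩ := ih (q - C (q.coeff m / (p m).coeff m) * p m) (by
      rw [degree_lt_iff_coeff_zero]
      intro j hj
      rw [coeff_sub, coeff_C_mul]
      rcases Nat.eq_or_lt_of_le hj with e | e
      · rw [← e]; field_simp; simp
      · rw [hq j e, coeff_eq_zero_of_natDegree_lt (p := p m) (n := j) (by rw [hdeg]; exact e)]; simp)
    refine ⟨fun k => if k = m then q.coeff m / (p m).coeff m else c k, ?_⟩
    simp only
    rw [Finset.sum_range_succ, if_pos rfl]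
    have : ∑ k ∈ Finset.range m, C (if k = m then q.coeff m / (p m).coeff m else c k) * p k =
        ∑ k ∈ Finset.range m, C (c k) * p k := by
      refine Finset.sum_congr rfl fun k hk => ?_
      rw [if_neg (by have := Finset.mem_range.1 hk; omega)]
    rw [this, ← hc]; ring

theorem mkOPSys (x₁ σ N1 N0 : ℝ) {a b : ℕ → ℝ} (hdeg : ∀ n : ℕ, (p n).degree = n) (hlead : ∀ n : ℕ, 0 < (p n).leadingCoeff)
    (orth : ∀ m n, L (p m * p n) = if m = n then 1 else 0) (a0 : a 0 = 0)
    (ha : ∀ n, a (n + 1) = L (X * p (n + 1) * p n)) (hb : ∀ n, b n = L (X * p n * p n))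
    (pearson : ∀ q : ℝ[X], L (PhiP x₁ * derivative q + (derivative (PhiP x₁) + NP σ N1 N0) * q) = 0) :
    OPSys x₁ σ N1 N0 L p a b := by
  have deg : ∀ n, (p n).natDegree = n := fun n => natDegree_eq_of_degree_eq_some (hdeg n)
  have ne : ∀ n, p n ≠ 0 := fun n h => by have := hlead n; rw [h] at this; simp at this
  have exp1 : ∀ (q : ℝ[X]) (m : ℕ), q.natDegree < m → q = ∑ k ∈ Finset.range m, C (L (q * p k)) * p k := by
    intro q m hq
    obtain ⟨c, hc⟩ := exp_aux deg ne m q (lt_of_le_of_lt degree_le_natDegree (by exact_mod_cast hq))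
    have : ∀ k ∈ Finset.range m, L (q * p k) = c k := by
      intro k hk
      conv_lhs => rw [hc]
      rw [Finset.sum_mul, map_sum, Finset.sum_eq_single k]
      · rw [mul_assoc, OPSys.LC, orth, if_pos rfl, mul_one]
      · intro j _ hjk
        rw [mul_assoc, OPSys.LC, orth, if_neg hjk, mul_zero]
      · intro h; exact absurd hk h
    conv_lhs => rw [hc]
    exact Finset.sum_congr rfl fun k hk => by rw [this k hk]
  have orthdeg : ∀ (q : ℝ[X]) (m : ℕ), q.natDegree < m → L (q * p m) = 0 := by
    intro q m hq
    conv_lhs => rw [exp1 q m hq]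
    rw [Finset.sum_mul, map_sum]
    refine Finset.sum_eq_zero fun k hk => ?_
    rw [mul_assoc, OPSys.LC, orth, if_neg (by have := Finset.mem_range.1 hk; omega), mul_zero]
  have hXd : ∀ n, (X * p n).natDegree = n + 1 := by
    intro n; rw [natDegree_X_mul (ne n), deg]
  have recur : ∀ n, X * p n = C (a (n + 1)) * p (n + 1) + C (b n) * p n + C (a n) * p (n - 1) := by
    intro n
    conv_lhs => rw [exp1 (X * p n) (n + 2) (by rw [hXd]; omega)]
    rw [Finset.sum_range_succ, Finset.sum_range_succ, ← hb]
    have e1 : L (X * p n * p (n + 1)) = a (n + 1) := by rw [ha]; congr 1; ring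
    rw [e1]
    have e2 : ∑ k ∈ Finset.range n, C (L (X * p n * p k)) * p k = C (a n) * p (n - 1) := by
      rcases n with _ | n
      · simp [a0]
      · rw [Finset.sum_range_succ, ← ha, Nat.add_sub_cancel, Finset.sum_eq_zero, zero_add]
        intro k hk
        have : X * p (n + 1) * p k = (X * p k) * p (n + 1) := by ring
        rw [this, orthdeg _ _ (by rw [hXd]; have := Finset.mem_range.1 hk; omega)]; simp
    rw [e2]; ring
  refine ⟨a0, ?_, deg, ne, orth, recur, orthdeg, exp1, pearson⟩
  intro n
  have h := congrArg (fun q => coeff q (n + 1)) (recur n)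
  simp only [coeff_X_mul, coeff_add, coeff_C_mul] at h
  rw [coeff_eq_zero_of_natDegree_lt (n := n + 1) (p := p n) (by rw [deg]; omega),
    coeff_eq_zero_of_natDegree_lt (n := n + 1) (p := p (n - 1)) (by rw [deg]; omega)] at h
  have l1 := hlead n
  have l2 := hlead (n + 1)
  rw [leadingCoeff, deg] at l1 l2
  rw [h] at l1
  simp at l1
  exact pos_of_mul_pos_left l1 l2.le

end
end Magnus
end

section
open Filter Topology ComplexConjugate MeasureTheory Set

namespace Magnus
namespace Sz

/-- elementary factor -/
noncomputable def fac (u : ℂ) (c : ℝ) (z : ℂ) : ℂ := (1 - z * u) ^ (c : ℂ)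

theorem re_pos {v : ℂ} (h : ‖v‖ ≤ 1) (h1 : v ≠ 1) : 0 < (1 - v).re := by
  have h2 : v.re ≤ ‖v‖ := Complex.re_le_norm v
  rw [Complex.sub_re, Complex.one_re]
  by_contra hc
  have h3 : v.re = 1 := by linarith
  have h4 : v.im = 0 := by
    have := Complex.sq_norm v
    rw [Complex.normSq_apply] at this
    nlinarith [norm_nonneg v, mul_self_nonneg v.im]
  exact h1 (Complex.ext (by simp [h3]) (by simp [h4]))

theorem mem_slit {v : ℂ} (h : ‖v‖ ≤ 1) (h1 : v ≠ 1) : 1 - v ∈ Complex.slitPlane :=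
  Or.inl (re_pos h h1)

theorem lt_slit {u z : ℂ} (hu : ‖u‖ = 1) (hz : ‖z‖ < 1) : 1 - z * u ∈ Complex.slitPlane := by
  have : ‖z * u‖ < 1 := by rw [norm_mul, hu, mul_one]; exact hz
  refine mem_slit this.le ?_
  intro h; rw [h] at this; simp at this

theorem fac_diff {u : ℂ} (c : ℝ) (hu : ‖u‖ = 1) : DifferentiableOn ℂ (fac u c) (Metric.ball 0 1) := by
  intro z hz
  have hz' : ‖z‖ < 1 := by simpa using hz
  refine DifferentiableAt.differentiableWithinAt ?_
  unfold fac
  exact DifferentiableAt.cpow_const (by fun_prop) (lt_slit hu hz')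

theorem fac_ne {u : ℂ} (c : ℝ) {z : ℂ} (h : z * u ≠ 1) : fac u c z ≠ 0 := by
  unfold fac
  rw [Complex.cpow_ne_zero_iff]
  left
  exact sub_ne_zero.2 (Ne.symm h)

theorem fac_zero (u : ℂ) (c : ℝ) : fac u c 0 = 1 := by simp [fac]

theorem fac_conj (u : ℂ) (c : ℝ) {z : ℂ} (h : ‖z * u‖ ≤ 1) (h1 : z * u ≠ 1) :
    fac (conj u) c (conj z) = conj (fac u c z) := by
  unfold fac
  have e : 1 - conj z * conj u = conj (1 - z * u) := by simp
  rw [e, Complex.conj_cpow, Complex.conj_ofReal]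
  · have := re_pos h h1
    intro h2
    rw [Complex.arg_eq_pi_iff] at h2
    linarith [h2.1]

theorem norm_fac (u : ℂ) (c : ℝ) (z : ℂ) : ‖fac u c z‖ = ‖1 - z * u‖ ^ c := Complex.norm_cpow_real _ _

theorem fac_cont {u z : ℂ} (c : ℝ) (hu : ‖z * u‖ = 1) (h1 : z * u ≠ 1) :
    Tendsto (fun r : ℝ => fac u c (r * z)) (𝓝[<] 1) (𝓝 (fac u c z)) := by
  have h : ContinuousAt (fun r : ℝ => fac u c (r * z)) 1 := by
    unfold fac
    refine ContinuousAt.cpow (by fun_prop) (by fun_prop) ?_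
    simpa using mem_slit hu.le h1
  have := h.tendsto
  simp only [Complex.ofReal_one, one_mul] at this
  exact this.mono_left nhdsWithin_le_nhds

theorem half_le {v : ℂ} (hv : ‖v‖ = 1) {r : ℝ} (h0 : 0 ≤ r) (h1 : r ≤ 1) : ‖1 - v‖ ≤ 2 * ‖1 - r * v‖ := by
  have h2 : ‖1 - v‖ ≤ ‖1 - r * v‖ + (1 - r) := by
    have : 1 - v = (1 - r * v) + -((1 - r : ℝ) * v) := by push_cast; ring
    rw [this]
    refine (norm_add_le _ _).trans ?_
    rw [norm_neg, norm_mul, hv, Complex.norm_real, Real.norm_of_nonneg (by linarith), mul_one]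
  have h3 : 1 - r ≤ ‖1 - r * v‖ := by
    have := norm_sub_norm_le (1 : ℂ) (r * v)
    rw [norm_mul, hv, Complex.norm_real, Real.norm_of_nonneg h0, mul_one, norm_one] at this
    exact this
  linarith

theorem le_two {v : ℂ} (hv : ‖v‖ = 1) {r : ℝ} (h0 : 0 ≤ r) (h1 : r ≤ 1) : ‖1 - r * v‖ ≤ 2 := by
  refine (norm_sub_le _ _).trans ?_
  rw [norm_mul, hv, Complex.norm_real, Real.norm_of_nonneg h0, mul_one, norm_one]
  linarith

theorem fac_bd {u z : ℂ} (c : ℝ) (hu : ‖z * u‖ = 1) (h1 : z * u ≠ 1) {r : ℝ} (h0 : 0 ≤ r) (hr : r ≤ 1) :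
    ‖fac u c (r * z)‖ ≤ 2 ^ |c| * ‖1 - z * u‖ ^ (min c 0) := by
  rw [norm_fac]
  have hp : 0 < ‖1 - z * u‖ := norm_pos_iff.2 (sub_ne_zero.2 (Ne.symm h1))
  have h2 := half_le hu h0 hr
  have h3 := le_two hu h0 hr
  rw [mul_assoc]
  rcases le_total 0 c with hc | hc
  · rw [min_eq_right hc, Real.rpow_zero, mul_one, abs_of_nonneg hc]
    exact Real.rpow_le_rpow (norm_nonneg _) h3 hc
  · rw [min_eq_left hc, abs_of_nonpos hc]
    have h4 : ‖1 - z * u‖ / 2 ≤ ‖1 - r * (z * u)‖ := by linarith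
    refine (Real.rpow_le_rpow_of_nonpos (by positivity) h4 hc).trans_eq ?_
    rw [Real.div_rpow hp.le (by norm_num), Real.rpow_neg (by norm_num), div_eq_inv_mul]

theorem fac_ratio {u z : ℂ} (c : ℝ) (hu : ‖z * u‖ = 1) (h1 : z * u ≠ 1) {r : ℝ} (h0 : 0 ≤ r) (hr : r < 1) :
    ‖fac u c z / fac u c (r * z)‖ ≤ 2 ^ |c| * ‖1 - z * u‖ ^ (min c 0) := by
  rw [norm_div, norm_fac, norm_fac]
  have hp : 0 < ‖1 - z * u‖ := norm_pos_iff.2 (sub_ne_zero.2 (Ne.symm h1))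
  have h2 := half_le hu h0 hr.le
  have h3 := le_two hu h0 hr.le
  rw [mul_assoc]
  have hq : 0 < ‖1 - r * (z * u)‖ := by linarith
  rw [← Real.div_rpow hp.le hq.le]
  rcases le_total 0 c with hc | hc
  · rw [min_eq_right hc, Real.rpow_zero, mul_one, abs_of_nonneg hc]
    refine Real.rpow_le_rpow (by positivity) ?_ hc
    rwa [div_le_iff₀ hq]
  · rw [min_eq_left hc, abs_of_nonpos hc]
    have h4 : ‖1 - z * u‖ / 2 ≤ ‖1 - z * u‖ / ‖1 - r * (z * u)‖ := by gcongr
    refine (Real.rpow_le_rpow_of_nonpos (by positivity) h4 hc).trans_eq ?_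
    rw [Real.div_rpow hp.le (by norm_num), Real.rpow_neg (by norm_num), div_eq_inv_mul]

/-- boundary value -/
theorem fac_bdry (c φ : ℝ) (h0 : 0 < φ) (h2 : φ < 2 * Real.pi) :
    (1 - Complex.exp (φ * Complex.I)) ^ (c : ℂ) =
      ((‖1 - Complex.exp (φ * Complex.I)‖ ^ c : ℝ) : ℂ) * Complex.exp ((c * (φ - Real.pi) / 2 : ℝ) * Complex.I) := by
  have hs : 0 < Real.sin (φ / 2) := Real.sin_pos_of_pos_of_lt_pi (by linarith) (by linarith)
  have h : 1 - Complex.exp (φ * Complex.I) =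
      ((2 * Real.sin (φ / 2) : ℝ) : ℂ) * Complex.exp (((φ - Real.pi) / 2 : ℝ) * Complex.I) := by
    have e1 : (((φ - Real.pi) / 2 : ℝ) : ℂ) * Complex.I = ((φ / 2 : ℝ) : ℂ) * Complex.I - Real.pi / 2 * Complex.I := by
      push_cast; ring
    rw [e1, Complex.exp_sub, Complex.exp_pi_div_two_mul_I]
    have e2 : (φ : ℂ) * Complex.I = ((φ / 2 : ℝ) : ℂ) * Complex.I + ((φ / 2 : ℝ) : ℂ) * Complex.I := by
      push_cast; ring
    rw [e2, Complex.exp_add, Complex.exp_mul_I, ← Complex.ofReal_cos, ← Complex.ofReal_sin, Complex.div_I]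
    push_cast
    have := Complex.sin_sq_add_cos_sq ((φ : ℂ) / 2)
    linear_combination -this + (Complex.sin ((φ : ℂ) / 2)) ^ 2 * Complex.I_sq
  have hn : ‖1 - Complex.exp (φ * Complex.I)‖ = 2 * Real.sin (φ / 2) := by
    rw [h, norm_mul, Complex.norm_exp_ofReal_mul_I, mul_one, Complex.norm_real, Real.norm_of_nonneg (by positivity)]
  rw [hn]
  conv_lhs => rw [h]
  have hR : 0 < 2 * Real.sin (φ / 2) := by positivity
  generalize 2 * Real.sin (φ / 2) = R at hR
  have hRC : (R : ℂ) ≠ 0 := by exact_mod_cast hR.ne'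
  have hl : Complex.log (Complex.exp (((φ - Real.pi) / 2 : ℝ) * Complex.I)) = ((φ - Real.pi) / 2 : ℝ) * Complex.I := by
    apply Complex.log_exp
    · simp; linarith [Real.pi_pos]
    · simp; linarith [Real.pi_pos]
  rw [Complex.cpow_def_of_ne_zero (mul_ne_zero hRC (Complex.exp_ne_zero _)),
    Complex.log_ofReal_mul hR (Complex.exp_ne_zero _), hl, add_mul, Complex.exp_add, Complex.ofReal_cpow hR.le,
    Complex.cpow_def_of_ne_zero hRC, Complex.ofReal_log hR.le]
  congr 2
  push_cast; ring
end Sz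
end Magnus
end

section
open Filter Topology ComplexConjugate MeasureTheory Set

namespace Magnus
namespace Sz

/-- reference measure on `(0,π)` -/
noncomputable abbrev mu : Measure ℝ := volume.restrict (Ioo 0 Real.pi)

theorem ii_abs_rpow {p : ℝ} (hp : -1 < p) {a b : ℝ} (ha : a ≤ 0) (hb : 0 ≤ b) :
    IntervalIntegrable (fun x : ℝ => |x| ^ p) volume a b := by
  have h : ∀ c : ℝ, 0 ≤ c → IntervalIntegrable (fun x : ℝ => |x| ^ p) volume 0 c := by
    intro c hc
    refine (intervalIntegral.intervalIntegrable_rpow' hp (a := 0) (b := c)).congr ?_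
    intro x hx
    rw [uIoc_of_le hc] at hx
    simp only
    rw [abs_of_pos hx.1]
  have h2 := (h (-a) (by linarith)).comp_mul_left (c := -1)
  simp at h2
  exact (h2.symm).trans (h b hb)

theorem int_abs_rpow {p : ℝ} (hp : -1 < p) {t : ℝ} (ht : 0 ≤ t) (ht2 : t ≤ Real.pi) :
    Integrable (fun x : ℝ => |x - t| ^ p) mu := by
  have h := (ii_abs_rpow hp (a := 0 - t) (b := Real.pi - t) (by linarith) (by linarith)).comp_sub_right t
  simp only [sub_add_cancel] at h
  rw [intervalIntegrable_iff_integrableOn_Ioo_of_le Real.pi_pos.le] at h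
  exact h

theorem prod3_le {a b c d p q r : ℝ} (ha : 0 < a) (hb : 0 < b) (hc : 0 < c) (hd : 0 < d) (hd2 : d ≤ 2)
    (hab : d ≤ a + b) (hac : d ≤ a + c) (hbc : d ≤ b + c) (hp : p ≤ 0) (hq : q ≤ 0) (hr : r ≤ 0) :
    a ^ p * b ^ q * c ^ r ≤ (d / 2) ^ (p + q + r) * (a ^ p + b ^ q + c ^ r) := by
  have key : ∀ a b c p q r : ℝ, 0 < a → 0 < b → 0 < c → d / 2 ≤ b → d / 2 ≤ c → p ≤ 0 → q ≤ 0 → r ≤ 0 →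
      a ^ p * b ^ q * c ^ r ≤ (d / 2) ^ (p + q + r) * a ^ p := by
    intro a b c p q r ha hb hc h1 h2 hp hq hr
    have hd0 : 0 < d / 2 := by positivity
    have e1 := Real.rpow_le_rpow_of_nonpos hd0 h1 hq
    have e2 := Real.rpow_le_rpow_of_nonpos hd0 h2 hr
    have e3 : 1 ≤ (d / 2) ^ p := Real.one_le_rpow_of_pos_of_le_one_of_nonpos hd0 (by linarith) hp
    rw [Real.rpow_add hd0, Real.rpow_add hd0]
    have p1 := Real.rpow_pos_of_pos ha p
    have p2 := Real.rpow_pos_of_pos hb q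
    have p3 := Real.rpow_pos_of_pos hc r
    have e4 : b ^ q * c ^ r ≤ (d / 2) ^ q * (d / 2) ^ r := by gcongr
    have e5 : 0 < (d / 2) ^ q * (d / 2) ^ r := by positivity
    calc a ^ p * b ^ q * c ^ r = 1 * (b ^ q * c ^ r) * a ^ p := by ring
      _ ≤ (d / 2) ^ p * ((d / 2) ^ q * (d / 2) ^ r) * a ^ p := by gcongr
      _ = _ := by ring
  have p1 := Real.rpow_pos_of_pos ha p
  have p2 := Real.rpow_pos_of_pos hb q
  have p3 := Real.rpow_pos_of_pos hc r
  have pd : 0 < (d / 2) ^ (p + q + r) := Real.rpow_pos_of_pos (by positivity) _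
  have up : ∀ x y, 0 ≤ y → x ≤ (d / 2) ^ (p + q + r) * y → y ≤ a ^ p + b ^ q + c ^ r →
      x ≤ (d / 2) ^ (p + q + r) * (a ^ p + b ^ q + c ^ r) := by
    intro x y _ h1 h2
    exact h1.trans (by gcongr)
  by_cases h1 : d / 2 ≤ b
  · by_cases h2 : d / 2 ≤ c
    · exact up _ _ p1.le (key a b c p q r ha hb hc h1 h2 hp hq hr) (by linarith)
    · refine up _ _ p3.le ?_ (by linarith : c ^ r ≤ _)
      have := key c b a r q p hc hb ha h1 (by linarith) hr hq hp
      rw [show r + q + p = p + q + r by ring] at this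
      refine le_trans (le_of_eq ?_) this; ring
  · refine up _ _ p2.le ?_ (by linarith : b ^ q ≤ _)
    have := key b a c q p r hb ha hc (by linarith) (by linarith) hq hp hr
    rw [show q + p + r = p + q + r by ring] at this
    refine le_trans (le_of_eq ?_) this; ring

/-- integrability of the product of singular factors -/
theorem int_prod3 {t k0 k1 k2 : ℝ} (ht : 0 < t) (ht2 : t < Real.pi) (h0 : k0 ≤ 0) (h1 : k1 ≤ 0) (h2 : k2 ≤ 0)
    (h0' : -1 < k0) (h1' : -1 < k1) (h2' : -1 < k2) :
    Integrable (fun x : ℝ => |x - 0| ^ k0 * |x - Real.pi| ^ k1 * |x - t| ^ k2) mu := by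
  have hpi := Real.pi_pos
  set d := min 2 (min t (Real.pi - t)) with hd
  have hd0 : 0 < d := lt_min (by norm_num) (lt_min ht (by linarith))
  have hd2 : d ≤ 2 := min_le_left _ _
  have hdt : d ≤ t := (min_le_right _ _).trans (min_le_left _ _)
  have hdt' : d ≤ Real.pi - t := (min_le_right _ _).trans (min_le_right _ _)
  have hI := (((int_abs_rpow h0' le_rfl hpi.le).add (int_abs_rpow h1' hpi.le le_rfl)).add
    (int_abs_rpow h2' ht.le ht2.le)).const_mul ((d / 2) ^ (k0 + k1 + k2))
  refine hI.mono' ?_ ?_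
  · exact Measurable.aestronglyMeasurable (by measurability)
  · have hne : ∀ᵐ x : ℝ ∂mu, x ≠ t := by
      refine ae_restrict_of_ae ?_
      simp [ae_iff]
    filter_upwards [ae_restrict_mem measurableSet_Ioo, hne] with x hx hxt
    have a1 : 0 < |x - 0| := abs_pos.2 (by simpa using hx.1.ne')
    have a2 : 0 < |x - Real.pi| := abs_pos.2 (sub_ne_zero.2 hx.2.ne)
    have a3 : 0 < |x - t| := abs_pos.2 (sub_ne_zero.2 hxt)
    rw [Real.norm_of_nonneg (by positivity)]
    refine prod3_le a1 a2 a3 hd0 hd2 ?_ ?_ ?_ h0 h1 h2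
    · rw [abs_of_pos (by simpa using hx.1), abs_of_neg (by linarith [hx.2])]; linarith
    · have := neg_abs_le (x - t)
      rw [abs_of_pos (by simpa using hx.1)]; linarith
    · have := le_abs_self (x - t)
      rw [abs_of_neg (by linarith [hx.2] : x - Real.pi < 0)]; linarith

theorem norm_one_sub_exp {φ : ℝ} (h : |φ| ≤ Real.pi) : 2 / Real.pi * |φ| ≤ ‖1 - Complex.exp (φ * Complex.I)‖ := by
  rw [norm_sub_rev, mul_comm (φ : ℂ), Complex.norm_exp_I_mul_ofReal_sub_one, norm_mul, Real.norm_eq_abs, Real.norm_eq_abs]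
  have h2 : |φ / 2| = |φ| / 2 := by rw [abs_div, abs_two]
  have := Real.mul_abs_le_abs_sin (x := φ / 2) (by rw [h2]; linarith)
  rw [h2] at this
  rw [abs_two]; linarith

/-- the Szegő function -/
noncomputable def Df (c0 c1 l t : ℝ) (z : ℂ) : ℂ :=
  fac 1 c0 z * fac (-1) c1 z * fac (Complex.exp (t * Complex.I)) l z * fac (Complex.exp ((-t : ℝ) * Complex.I)) l z

/-- dominating function -/
noncomputable def Gd (c0 c1 l t C : ℝ) (x : ℝ) : ℝ :=
  C * (|x - 0| ^ (min c0 0) * |x - Real.pi| ^ (min c1 0) * |x - t| ^ (min l 0))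

theorem Gd_sq_int {c0 c1 l t : ℝ} (C : ℝ) (ht : 0 < t) (ht2 : t < Real.pi) (h0 : -1 < 2 * c0) (h1 : -1 < 2 * c1)
    (h2 : -1 < 2 * l) : Integrable (fun x => Gd c0 c1 l t C x ^ 2) mu := by
  have a0 : -1 < 2 * min c0 0 := by rcases min_choice c0 0 with h | h <;> rw [h] <;> linarith
  have a1 : -1 < 2 * min c1 0 := by rcases min_choice c1 0 with h | h <;> rw [h] <;> linarith
  have a2 : -1 < 2 * min l 0 := by rcases min_choice l 0 with h | h <;> rw [h] <;> linarith
  have := (int_prod3 ht ht2 (by linarith [min_le_right c0 0] : 2 * min c0 0 ≤ 0)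
    (by linarith [min_le_right c1 0] : 2 * min c1 0 ≤ 0) (by linarith [min_le_right l 0] : 2 * min l 0 ≤ 0) a0 a1 a2).const_mul (C ^ 2)
  refine this.congr (Filter.Eventually.of_forall fun x => ?_)
  simp only [Gd]
  rw [mul_comm 2 (min c0 0), mul_comm 2 (min c1 0), mul_comm 2 (min l 0), Real.rpow_mul (abs_nonneg _),
    Real.rpow_mul (abs_nonneg _), Real.rpow_mul (abs_nonneg _)]
  simp only [Real.rpow_two]
  ring

theorem Gd_meas (c0 c1 l t C : ℝ) : Measurable (Gd c0 c1 l t C) := by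
  unfold Gd; measurability

end Sz
end Magnus
end

section
open Filter Topology ComplexConjugate MeasureTheory Set

namespace Magnus
namespace Sz

/-- unit circle point -/
noncomputable def ee (θ : ℝ) : ℂ := Complex.exp (θ * Complex.I)

theorem ee_norm (θ : ℝ) : ‖ee θ‖ = 1 := Complex.norm_exp_ofReal_mul_I θ

theorem ee_add (θ φ : ℝ) : ee (θ + φ) = ee θ * ee φ := by
  unfold ee; rw [← Complex.exp_add]; push_cast; ring_nf

theorem ee_zero : ee 0 = 1 := by simp [ee]

theorem ee_pi : ee Real.pi = -1 := by simp [ee]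

theorem ee_neg_pi : ee (-Real.pi) = -1 := by
  unfold ee; push_cast; rw [neg_mul, Complex.exp_neg, Complex.exp_pi_mul_I]; norm_num

theorem ee_two_pi : ee (-(2 * Real.pi)) = 1 := by
  unfold ee; push_cast; rw [neg_mul, Complex.exp_neg, Complex.exp_two_pi_mul_I]; norm_num

theorem ee_conj (θ : ℝ) : conj (ee θ) = ee (-θ) := by
  unfold ee
  rw [← Complex.exp_conj]; simp

theorem ee_re (θ : ℝ) : (ee θ).re = Real.cos θ := Complex.exp_ofReal_mul_I_re θ
theorem ee_im (θ : ℝ) : (ee θ).im = Real.sin θ := Complex.exp_ofReal_mul_I_im θ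

theorem ee_pow (θ : ℝ) (n : ℕ) : ee θ ^ n = ee (n * θ) := by
  unfold ee; rw [← Complex.exp_nat_mul]; push_cast; ring_nf

theorem ee_cont : Continuous ee := by unfold ee; fun_prop

theorem near_pos {φ : ℝ} (h : |φ| ≤ Real.pi) (h0 : φ ≠ 0) : 0 < ‖1 - ee φ‖ :=
  lt_of_lt_of_le (mul_pos (div_pos two_pos Real.pi_pos) (abs_pos.2 h0)) (norm_one_sub_exp h)

theorem near_ne {φ : ℝ} (h : |φ| ≤ Real.pi) (h0 : φ ≠ 0) : ee φ ≠ 1 := by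
  intro h1
  have := near_pos h h0
  rw [h1] at this; simp at this

theorem near_le {φ k : ℝ} (h : |φ| ≤ Real.pi) (h0 : φ ≠ 0) (hk : k ≤ 0) :
    ‖1 - ee φ‖ ^ k ≤ (2 / Real.pi) ^ k * |φ| ^ k := by
  have hp : 0 < 2 / Real.pi := div_pos two_pos Real.pi_pos
  rw [← Real.mul_rpow hp.le (abs_nonneg _)]
  exact Real.rpow_le_rpow_of_nonpos (mul_pos hp (abs_pos.2 h0)) (norm_one_sub_exp h) hk

theorem far_le {θ t : ℝ} (ht : 0 < t) (ht2 : t < Real.pi) (h : 0 < θ) (h2 : θ < Real.pi) :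
    2 / Real.pi * min t (Real.pi - t) ≤ ‖1 - ee (θ + t)‖ := by
  have hp : 0 < 2 / Real.pi := div_pos two_pos Real.pi_pos
  by_cases hc : θ + t ≤ Real.pi
  · refine le_trans ?_ (norm_one_sub_exp (φ := θ + t) (by rw [abs_of_pos (by linarith)]; exact hc))
    rw [abs_of_pos (by linarith)]
    gcongr
    exact (min_le_left _ _).trans (by linarith)
  · have e : ee (θ + t) = ee (θ + t - 2 * Real.pi) := by
      rw [sub_eq_add_neg, ee_add (θ + t), ee_two_pi, mul_one]
    rw [e]
    have hn : θ + t - 2 * Real.pi < 0 := by linarith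
    refine le_trans ?_ (norm_one_sub_exp (φ := θ + t - 2 * Real.pi) (by rw [abs_of_neg hn]; linarith))
    rw [abs_of_neg hn]
    gcongr
    exact (min_le_right _ _).trans (by linarith)

theorem far_ne {θ t : ℝ} (ht : 0 < t) (ht2 : t < Real.pi) (h : 0 < θ) (h2 : θ < Real.pi) : ee (θ + t) ≠ 1 := by
  intro h1
  have := far_le ht ht2 h h2
  rw [h1] at this
  have h3 : 0 < 2 / Real.pi * min t (Real.pi - t) :=
    mul_pos (div_pos two_pos Real.pi_pos) (lt_min ht (by linarith))
  simp only [sub_self, norm_zero] at this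
  linarith

/-- facts on the four factors at a boundary point -/
structure Pt (t θ : ℝ) : Prop where
  t0 : 0 < t
  t1 : t < Real.pi
  h0 : 0 < θ
  h1 : θ < Real.pi
  ht : θ ≠ t

theorem Pt.e0 {t θ : ℝ} : ee θ * 1 = ee θ := mul_one _
theorem Pt.e1 {t θ : ℝ} : ee θ * (-1) = ee (θ - Real.pi) := by
  rw [sub_eq_add_neg, ee_add, ee_neg_pi]
theorem Pt.e2 {t θ : ℝ} : ee θ * Complex.exp (t * Complex.I) = ee (θ + t) := by rw [ee_add]; rfl
theorem Pt.e3 {t θ : ℝ} : ee θ * Complex.exp ((-t : ℝ) * Complex.I) = ee (θ - t) := by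
  rw [sub_eq_add_neg, ee_add]; rfl

theorem Pt.n0 {t θ : ℝ} (h : Pt t θ) : ee θ * 1 ≠ 1 := by
  rw [mul_one]
  exact near_ne (by rw [abs_of_pos h.h0]; exact h.h1.le) h.h0.ne'
theorem Pt.n1 {t θ : ℝ} (h : Pt t θ) : ee θ * (-1) ≠ 1 := by
  rw [Pt.e1 (t := t)]
  have := h.h0; have := h.h1
  exact near_ne (by rw [abs_of_neg (by linarith)]; linarith) (by linarith)
theorem Pt.n2 {t θ : ℝ} (h : Pt t θ) : ee θ * Complex.exp (t * Complex.I) ≠ 1 := by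
  rw [Pt.e2]; exact far_ne h.t0 h.t1 h.h0 h.h1
theorem Pt.ab {t θ : ℝ} (h : Pt t θ) : |θ - t| ≤ Real.pi := by
  have := h.h0; have := h.h1; have := h.t0; have := h.t1
  rw [abs_le]; constructor <;> linarith
theorem Pt.n3 {t θ : ℝ} (h : Pt t θ) : ee θ * Complex.exp ((-t : ℝ) * Complex.I) ≠ 1 := by
  rw [Pt.e3]
  exact near_ne h.ab (sub_ne_zero.2 h.ht)

theorem nrm (θ t : ℝ) : ‖ee θ * Complex.exp (t * Complex.I)‖ = 1 := by
  rw [norm_mul, ee_norm]; simp [Complex.norm_exp_ofReal_mul_I]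

/-- constant of domination -/
noncomputable def CG (c0 c1 l t : ℝ) : ℝ := 2 ^ |c0| * 2 ^ |c1| * 2 ^ |l| * 2 ^ |l| *
  ((2 / Real.pi) ^ (min c0 0) * (2 / Real.pi) ^ (min c1 0) * (2 / Real.pi) ^ (min l 0) *
    (2 / Real.pi * min t (Real.pi - t)) ^ (min l 0))

theorem Pt.bd {c0 c1 l t θ : ℝ} (h : Pt t θ) {A B C D : ℝ}
    (hA : A ≤ 2 ^ |c0| * ‖1 - ee θ * 1‖ ^ (min c0 0)) (hB : B ≤ 2 ^ |c1| * ‖1 - ee θ * (-1)‖ ^ (min c1 0))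
    (hC : C ≤ 2 ^ |l| * ‖1 - ee θ * Complex.exp (t * Complex.I)‖ ^ (min l 0))
    (hD : D ≤ 2 ^ |l| * ‖1 - ee θ * Complex.exp ((-t : ℝ) * Complex.I)‖ ^ (min l 0))
    (hB0 : 0 ≤ B) (hC0 : 0 ≤ C) (hD0 : 0 ≤ D) :
    A * B * C * D ≤ Gd c0 c1 l t (CG c0 c1 l t) θ := by
  have u0 := h.h0; have u1 := h.h1; have u2 := h.t0; have u3 := h.t1
  rw [mul_one] at hA
  rw [Pt.e1 (t := t)] at hB
  rw [Pt.e2] at hC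
  rw [Pt.e3] at hD
  have p2 : ∀ x : ℝ, (0 : ℝ) < 2 ^ x := fun x => Real.rpow_pos_of_pos two_pos _
  have k0 := min_le_right c0 0
  have k1 := min_le_right c1 0
  have k2 := min_le_right l 0
  have a0 := near_le (φ := θ) (by rw [abs_of_pos u0]; exact u1.le) u0.ne' k0
  have a1 := near_le (φ := θ - Real.pi) (by rw [abs_of_neg (by linarith)]; linarith) (by linarith) k1
  have a3 := near_le h.ab (sub_ne_zero.2 h.ht) k2
  have a2 := Real.rpow_le_rpow_of_nonpos (mul_pos (div_pos two_pos Real.pi_pos) (lt_min u2 (by linarith)))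
    (far_le u2 u3 u0 u1) k2
  have hA' := hA.trans (mul_le_mul_of_nonneg_left a0 (p2 _).le)
  have hB' := hB.trans (mul_le_mul_of_nonneg_left a1 (p2 _).le)
  have hC' := hC.trans (mul_le_mul_of_nonneg_left a2 (p2 _).le)
  have hD' := hD.trans (mul_le_mul_of_nonneg_left a3 (p2 _).le)
  calc A * B * C * D ≤ _ := by
        have hpi := Real.pi_pos
        have : 0 < min t (Real.pi - t) := lt_min u2 (by linarith)
        refine mul_le_mul (mul_le_mul (mul_le_mul hA' hB' hB0 (by positivity)) hC' hC0 (by positivity)) hD' hD0 (by positivity)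
    _ = _ := by
        unfold Gd CG
        rw [sub_zero]
        ring

theorem Df_bd (c0 c1 l : ℝ) {t θ : ℝ} (h : Pt t θ) {r : ℝ} (h0 : 0 ≤ r) (hr : r ≤ 1) :
    ‖Df c0 c1 l t (r * ee θ)‖ ≤ Gd c0 c1 l t (CG c0 c1 l t) θ := by
  unfold Df
  rw [norm_mul, norm_mul, norm_mul]
  exact h.bd (fac_bd _ (by simp [ee_norm]) h.n0 h0 hr) (fac_bd _ (by simp [ee_norm]) h.n1 h0 hr)
    (fac_bd _ (nrm _ _) h.n2 h0 hr) (fac_bd _ (nrm _ _) h.n3 h0 hr) (norm_nonneg _) (norm_nonneg _) (norm_nonneg _)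

theorem Df_ratio (c0 c1 l : ℝ) {t θ : ℝ} (h : Pt t θ) {r : ℝ} (h0 : 0 ≤ r) (hr : r < 1) :
    ‖Df c0 c1 l t (ee θ) / Df c0 c1 l t (r * ee θ)‖ ≤ Gd c0 c1 l t (CG c0 c1 l t) θ := by
  unfold Df
  rw [mul_div_mul_comm, mul_div_mul_comm, mul_div_mul_comm, norm_mul, norm_mul, norm_mul]
  exact h.bd (fac_ratio _ (by simp [ee_norm]) h.n0 h0 hr) (fac_ratio _ (by simp [ee_norm]) h.n1 h0 hr)
    (fac_ratio _ (nrm _ _) h.n2 h0 hr) (fac_ratio _ (nrm _ _) h.n3 h0 hr) (norm_nonneg _) (norm_nonneg _) (norm_nonneg _)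

theorem Df_lim (c0 c1 l : ℝ) {t θ : ℝ} (h : Pt t θ) :
    Tendsto (fun r : ℝ => Df c0 c1 l t (r * ee θ)) (𝓝[<] 1) (𝓝 (Df c0 c1 l t (ee θ))) := by
  unfold Df
  exact (((fac_cont _ (by simp [ee_norm]) h.n0).mul (fac_cont _ (by simp [ee_norm]) h.n1)).mul
    (fac_cont _ (nrm _ _) h.n2)).mul (fac_cont _ (nrm _ _) h.n3)

theorem Df_bne (c0 c1 l : ℝ) {t θ : ℝ} (h : Pt t θ) : Df c0 c1 l t (ee θ) ≠ 0 := by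
  unfold Df
  exact mul_ne_zero (mul_ne_zero (mul_ne_zero (fac_ne _ h.n0) (fac_ne _ h.n1)) (fac_ne _ h.n2)) (fac_ne _ h.n3)

theorem Df_diff (c0 c1 l t : ℝ) : DifferentiableOn ℂ (Df c0 c1 l t) (Metric.ball 0 1) := by
  unfold Df
  exact (((fac_diff _ (by simp)).mul (fac_diff _ (by simp))).mul
    (fac_diff _ (Complex.norm_exp_ofReal_mul_I _))).mul (fac_diff _ (Complex.norm_exp_ofReal_mul_I _))

theorem lt_ne {u z : ℂ} (hu : ‖u‖ = 1) (hz : ‖z‖ < 1) : z * u ≠ 1 := by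
  intro h
  have : ‖z * u‖ < 1 := by rw [norm_mul, hu, mul_one]; exact hz
  rw [h] at this; simp at this

theorem Df_ne (c0 c1 l t : ℝ) {z : ℂ} (hz : ‖z‖ < 1) : Df c0 c1 l t z ≠ 0 := by
  unfold Df
  exact mul_ne_zero (mul_ne_zero (mul_ne_zero (fac_ne _ (lt_ne (by simp) hz)) (fac_ne _ (lt_ne (by simp) hz)))
    (fac_ne _ (lt_ne (Complex.norm_exp_ofReal_mul_I _) hz))) (fac_ne _ (lt_ne (Complex.norm_exp_ofReal_mul_I _) hz))

theorem Df_zero (c0 c1 l t : ℝ) : Df c0 c1 l t 0 = 1 := by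
  unfold Df; simp only [fac_zero]; norm_num

theorem conj_ex (t : ℝ) : conj (Complex.exp (t * Complex.I)) = Complex.exp ((-t : ℝ) * Complex.I) := ee_conj t

theorem Df_conj (c0 c1 l t : ℝ) {z : ℂ} (hz : ‖z‖ < 1) : Df c0 c1 l t (conj z) = conj (Df c0 c1 l t z) := by
  unfold Df
  have k : ∀ u : ℂ, ‖u‖ = 1 → ∀ c, fac (conj u) c (conj z) = conj (fac u c z) := by
    intro u hu c
    exact fac_conj u c (by rw [norm_mul, hu, mul_one]; exact hz.le) (lt_ne hu hz)
  have k0 := k 1 (by simp) c0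
  have k1 := k (-1) (by simp) c1
  have k2 := k _ (Complex.norm_exp_ofReal_mul_I t) l
  have k3 := k _ (Complex.norm_exp_ofReal_mul_I (-t)) l
  rw [conj_ex] at k2 k3
  rw [neg_neg] at k3
  rw [map_one] at k0
  rw [map_neg, map_one] at k1
  simp only [map_mul]
  rw [k0, k1, k2, k3]
  ring

theorem fac_deriv (u : ℂ) (c : ℝ) : HasDerivAt (fac u c) (-(c * u)) 0 := by
  unfold fac
  have h : HasDerivAt (fun z : ℂ => 1 - z * u) (-u) 0 := by
    simpa using ((hasDerivAt_id (0 : ℂ)).mul_const u).const_sub 1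
  have := h.cpow_const (c := (c : ℂ)) (by simp)
  simpa using this

theorem Df_deriv (c0 c1 l t : ℝ) : HasDerivAt (Df c0 c1 l t) ((c1 - c0 - 2 * l * Real.cos t : ℝ) : ℂ) 0 := by
  unfold Df
  have := (((fac_deriv 1 c0).mul (fac_deriv (-1) c1)).mul (fac_deriv (Complex.exp (t * Complex.I)) l)).mul
    (fac_deriv (Complex.exp ((-t : ℝ) * Complex.I)) l)
  refine this.congr_deriv ?_
  simp only [fac_zero, Pi.mul_apply]
  push_cast
  rw [Complex.cos]
  ring

end Sz
end Magnus
end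

section
open Filter Topology ComplexConjugate MeasureTheory Set

namespace Magnus
namespace Sz

/-- boundary phase -/
noncomputable def gam (c0 c1 l t θ : ℝ) : ℝ :=
  (c0 + c1 + 2 * l) / 2 * θ - c0 * Real.pi / 2 - if t < θ then l * Real.pi else 0

theorem fac_b {u : ℂ} (c : ℝ) {θ φ : ℝ} (h : ee θ * u = ee φ) (h0 : 0 < φ) (h2 : φ < 2 * Real.pi) :
    fac u c (ee θ) = (‖fac u c (ee θ)‖ : ℂ) * ee (c * (φ - Real.pi) / 2) := by
  rw [norm_fac]
  unfold fac
  rw [h]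
  exact fac_bdry c φ h0 h2

theorem Df_bdry (c0 c1 l : ℝ) {t θ : ℝ} (h : Pt t θ) :
    Df c0 c1 l t (ee θ) = (‖Df c0 c1 l t (ee θ)‖ : ℂ) * ee (gam c0 c1 l t θ) := by
  have u0 := h.h0; have u1 := h.h1; have u2 := h.t0; have u3 := h.t1
  have b0 := fac_b (u := 1) c0 (θ := θ) (φ := θ) (mul_one _) u0 (by linarith)
  have b1 := fac_b (u := -1) c1 (θ := θ) (φ := θ + Real.pi) (by rw [ee_add, ee_pi]) (by linarith) (by linarith)
  have b2 := fac_b (u := Complex.exp (t * Complex.I)) l (θ := θ) (φ := θ + t) Pt.e2 (by linarith) (by linarith)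
  have b3 : fac (Complex.exp ((-t : ℝ) * Complex.I)) l (ee θ) =
      (‖fac (Complex.exp ((-t : ℝ) * Complex.I)) l (ee θ)‖ : ℂ) *
      ee (l * (θ - t + Real.pi) / 2 - if t < θ then l * Real.pi else 0) := by
    by_cases hc : t < θ
    · rw [if_pos hc]
      have := fac_b (u := Complex.exp ((-t : ℝ) * Complex.I)) l (θ := θ) (φ := θ - t) Pt.e3 (by linarith) (by linarith)
      convert this using 3
      ring
    · rw [if_neg hc]
      have := fac_b (u := Complex.exp ((-t : ℝ) * Complex.I)) l (θ := θ) (φ := θ - t - -(2 * Real.pi))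
        (by rw [Pt.e3]; rw [← mul_one (ee (θ - t - _)), ← ee_two_pi, ← ee_add]; ring_nf) (by linarith)
        (by have := lt_of_le_of_ne (not_lt.1 hc) h.ht; linarith)
      convert this using 3
      ring
  have e : ee (gam c0 c1 l t θ) = ee (c0 * (θ - Real.pi) / 2) * ee (c1 * (θ + Real.pi - Real.pi) / 2) *
      ee (l * (θ + t - Real.pi) / 2) * ee (l * (θ - t + Real.pi) / 2 - if t < θ then l * Real.pi else 0) := by
    rw [← ee_add, ← ee_add, ← ee_add]
    congr 1
    unfold gam
    ring
  rw [e]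
  unfold Df
  simp only [norm_mul, Complex.ofReal_mul]
  calc _ = ((‖fac 1 c0 (ee θ)‖ : ℂ) * ee (c0 * (θ - Real.pi) / 2)) * ((‖fac (-1) c1 (ee θ)‖ : ℂ) * ee (c1 * (θ + Real.pi - Real.pi) / 2))
        * ((‖fac (Complex.exp (t * Complex.I)) l (ee θ)‖ : ℂ) * ee (l * (θ + t - Real.pi) / 2)) *
        ((‖fac (Complex.exp ((-t : ℝ) * Complex.I)) l (ee θ)‖ : ℂ) * ee (l * (θ - t + Real.pi) / 2 - if t < θ then l * Real.pi else 0)) := by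
        rw [← b0, ← b1, ← b2, ← b3]
    _ = _ := by ring

theorem nsq (φ : ℝ) : ‖1 - ee φ‖ = 2 * |Real.sin (φ / 2)| := by
  unfold ee
  rw [norm_sub_rev, mul_comm (φ : ℂ), Complex.norm_exp_I_mul_ofReal_sub_one, norm_mul, Real.norm_eq_abs, Real.norm_eq_abs, abs_two]

theorem Df_norm (c0 c1 l : ℝ) {t θ : ℝ} (h : Pt t θ) :
    ‖Df c0 c1 l t (ee θ)‖ ^ 2 = 2 ^ (c0 + c1 + 2 * l) * (1 - Real.cos θ) ^ c0 * (1 + Real.cos θ) ^ c1 *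
      |Real.cos θ - Real.cos t| ^ (2 * l) := by
  have u0 := h.h0; have u1 := h.h1; have u2 := h.t0; have u3 := h.t1
  have hs : 0 < Real.sin (θ / 2) := Real.sin_pos_of_pos_of_lt_pi (by linarith) (by linarith)
  have hc : 0 < Real.cos (θ / 2) := Real.cos_pos_of_mem_Ioo ⟨by linarith, by linarith⟩
  have n0 : ‖1 - ee θ * 1‖ ^ 2 = 2 * (1 - Real.cos θ) := by
    rw [mul_one, nsq, mul_pow, sq_abs, Real.sin_sq_eq_half_sub]; ring_nf
  have n1 : ‖1 - ee θ * (-1)‖ ^ 2 = 2 * (1 + Real.cos θ) := by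
    rw [Pt.e1 (t := t), nsq, mul_pow, sq_abs, Real.sin_sq_eq_half_sub, mul_div_cancel₀ _ two_ne_zero, Real.cos_sub_pi]; ring
  have n2 : ‖1 - ee θ * Complex.exp (t * Complex.I)‖ * ‖1 - ee θ * Complex.exp ((-t : ℝ) * Complex.I)‖ =
      2 * |Real.cos θ - Real.cos t| := by
    rw [Pt.e2, Pt.e3, nsq, nsq, Real.cos_sub_cos, abs_mul, abs_mul, abs_neg, abs_two]; ring
  have q : ∀ x c : ℝ, 0 ≤ x → (x ^ c) ^ 2 = (x ^ 2) ^ c := by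
    intro x c hx
    rw [← Real.rpow_two, ← Real.rpow_two, ← Real.rpow_mul hx, ← Real.rpow_mul hx, mul_comm]
  have c1' := Real.cos_le_one θ
  have c2' := Real.neg_one_le_cos θ
  unfold Df
  simp only [norm_mul, norm_fac]
  rw [mul_assoc, ← Real.mul_rpow (norm_nonneg _) (norm_nonneg _), n2, mul_pow, mul_pow, q _ _ (norm_nonneg _),
    q _ _ (norm_nonneg _), n0, n1, Real.mul_rpow two_pos.le (by linarith), Real.mul_rpow two_pos.le (by linarith),
    Real.mul_rpow two_pos.le (abs_nonneg _), mul_pow, Real.rpow_add two_pos, Real.rpow_add two_pos]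
  have e3 : ∀ x : ℝ, 0 ≤ x → (x ^ l) ^ 2 = x ^ (2 * l) := by
    intro x hx
    rw [mul_comm, Real.rpow_mul hx, Real.rpow_two]
  rw [e3 _ two_pos.le, e3 _ (abs_nonneg _)]
  ring

/-- the weight in terms of the Szegő function -/
theorem W_eq (A α β l : ℝ) {t θ : ℝ} (h : Pt t θ) :
    A * (1 - Real.cos θ) ^ α * (1 + Real.cos θ) ^ β * |Real.cos θ - Real.cos t| ^ (2 * l) * Real.sin θ =
      A * (2 : ℝ) ^ (-(α + β + 2 * l + 1)) * ‖Df (α + 1 / 2) (β + 1 / 2) l t (ee θ)‖ ^ 2 := by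
  have u0 := h.h0; have u1 := h.h1
  rw [Df_norm _ _ _ h]
  have hs : 0 < Real.sin θ := Real.sin_pos_of_pos_of_lt_pi u0 u1
  have hm : 0 < (1 - Real.cos θ) * (1 + Real.cos θ) := by
    have := Real.sin_sq_add_cos_sq θ
    nlinarith [sq_pos_of_pos hs]
  have h1 : 0 < 1 - Real.cos θ := by
    have c1' := Real.cos_le_one θ
    rcases eq_or_lt_of_le c1' with e | e
    · rw [e] at hm; simp at hm
    · linarith
  have h2 : 0 < 1 + Real.cos θ := by
    by_contra hc
    push Not at hc
    nlinarith
  have es : Real.sin θ = (1 - Real.cos θ) ^ (1 / 2 : ℝ) * (1 + Real.cos θ) ^ (1 / 2 : ℝ) := by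
    rw [← Real.mul_rpow h1.le h2.le, ← Real.sqrt_eq_rpow]
    rw [eq_comm, Real.sqrt_eq_iff_mul_self_eq hm.le hs.le]
    nlinarith [Real.sin_sq_add_cos_sq θ]
  rw [es, Real.rpow_add h1, Real.rpow_add h2]
  have e2 : (2 : ℝ) ^ (-(α + β + 2 * l + 1)) * 2 ^ (α + 1 / 2 + (β + 1 / 2) + 2 * l) = 1 := by
    rw [← Real.rpow_add two_pos]
    rw [show -(α + β + 2 * l + 1) + (α + 1 / 2 + (β + 1 / 2) + 2 * l) = 0 by ring, Real.rpow_zero]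
  linear_combination (-(A * ((1 - Real.cos θ) ^ α * (1 - Real.cos θ) ^ (1 / 2 : ℝ)) * ((1 + Real.cos θ) ^ β * (1 + Real.cos θ) ^ (1 / 2 : ℝ)) * |Real.cos θ - Real.cos t| ^ (2 * l))) * e2

end Sz
end Magnus
end

section
open Filter Topology ComplexConjugate MeasureTheory Set

namespace Magnus
namespace Sz

theorem half_mean {f : ℂ → ℂ} (hd : DifferentiableOn ℂ f (Metric.ball 0 1))
    (hc : ∀ z : ℂ, ‖z‖ < 1 → f (conj z) = conj (f z)) {r : ℝ} (h0 : 0 < r) (h1 : r < 1) :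
    ∫ θ, (f (r * ee θ)).re ∂mu = Real.pi * (f 0).re := by
  have hsub : Metric.closedBall (0 : ℂ) r ⊆ Metric.ball 0 1 := Metric.closedBall_subset_ball h1
  have hav : Real.circleAverage f 0 r = f 0 := by
    apply DiffContOnCl.circleAverage
    rw [abs_of_pos h0]
    exact (hd.mono (Metric.closure_ball_subset_closedBall.trans hsub)).diffContOnCl
  have hcont : Continuous (fun θ : ℝ => f (r * ee θ)) := by
    refine hd.continuousOn.comp_continuous (by have := ee_cont; fun_prop) ?_
    intro θ
    simp [ee_norm, abs_of_pos h0, h1]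
  have hcm : ∀ θ : ℝ, circleMap 0 r θ = r * ee θ := by intro θ; simp [circleMap, ee]
  rw [Real.circleAverage_def] at hav
  simp only [hcm] at hav
  have hpi := Real.pi_pos
  have hii : ∀ a b, IntervalIntegrable (fun θ : ℝ => f (r * ee θ)) volume a b := fun a b => hcont.intervalIntegrable _ _
  have e1 : ∫ θ in Real.pi..(2 * Real.pi), f (r * ee θ) = ∫ θ in (0:ℝ)..Real.pi, conj (f (r * ee θ)) := by
    have := intervalIntegral.integral_comp_sub_left (fun θ => f (r * ee θ)) (a := 0) (b := Real.pi) (2 * Real.pi)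
    rw [sub_zero, show 2 * Real.pi - Real.pi = Real.pi by ring] at this
    rw [← this]
    refine intervalIntegral.integral_congr ?_
    intro θ _
    simp only
    rw [← hc _ (by simp [ee_norm, abs_of_pos h0, h1]), map_mul, Complex.conj_ofReal, ee_conj]
    congr 2
    rw [← mul_one (ee (2 * Real.pi - θ)), ← ee_two_pi, ← ee_add]; congr 1; ring
  have hjj : IntervalIntegrable (fun θ : ℝ => conj (f (r * ee θ))) volume 0 Real.pi :=
    (Complex.continuous_conj.comp hcont).intervalIntegrable _ _
  have e2 : ∫ θ in (0:ℝ)..(2 * Real.pi), f (r * ee θ) = ((2 * ∫ θ in (0:ℝ)..Real.pi, (f (r * ee θ)).re : ℝ) : ℂ) := by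
    rw [← intervalIntegral.integral_add_adjacent_intervals (hii 0 Real.pi) (hii Real.pi _), e1,
      ← intervalIntegral.integral_add (hii _ _) hjj]
    rw [← intervalIntegral.integral_const_mul, ← intervalIntegral.integral_ofReal]
    refine intervalIntegral.integral_congr ?_
    intro θ _
    simp only
    rw [Complex.add_conj]
  rw [e2] at hav
  have hav2 := congrArg Complex.re hav
  rw [Complex.real_smul, Complex.re_ofReal_mul, Complex.ofReal_re] at hav2
  rw [intervalIntegral.integral_of_le hpi.le, integral_Ioc_eq_integral_Ioo] at hav2
  rw [← hav2]
  field_simp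

theorem ae_pt {t : ℝ} (ht : 0 < t) (ht2 : t < Real.pi) : ∀ᵐ θ ∂mu, Pt t θ := by
  have hne : ∀ᵐ x : ℝ ∂mu, x ≠ t := by
    refine ae_restrict_of_ae ?_
    simp [ae_iff]
  filter_upwards [ae_restrict_mem measurableSet_Ioo, hne] with x hx hxt
  exact ⟨ht, ht2, hx.1, hx.2, hxt⟩

theorem half_mean_lim {f : ℂ → ℂ} (hd : DifferentiableOn ℂ f (Metric.ball 0 1))
    (hc : ∀ z : ℂ, ‖z‖ < 1 → f (conj z) = conj (f z)) {F : ℝ → ℂ} {G : ℝ → ℝ} (hG : Integrable G mu)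
    (hb : ∀ᵐ θ ∂mu, ∀ r : ℝ, 1 / 2 ≤ r → r < 1 → ‖f (r * ee θ)‖ ≤ G θ)
    (hl : ∀ᵐ θ ∂mu, Tendsto (fun r : ℝ => f (r * ee θ)) (𝓝[<] 1) (𝓝 (F θ))) :
    ∫ θ, (F θ).re ∂mu = Real.pi * (f 0).re := by
  have hev : ∀ᶠ r : ℝ in 𝓝[<] 1, 1 / 2 ≤ r ∧ r < 1 := by
    filter_upwards [Ico_mem_nhdsLT (by norm_num : (1 / 2 : ℝ) < 1)] with r hr using hr
  have h1 : Tendsto (fun r : ℝ => ∫ θ, (f (r * ee θ)).re ∂mu) (𝓝[<] 1) (𝓝 (∫ θ, (F θ).re ∂mu)) := by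
    refine tendsto_integral_filter_of_dominated_convergence G ?_ ?_ hG ?_
    · filter_upwards [hev] with r hr
      have hcont : Continuous (fun θ : ℝ => f (r * ee θ)) := by
        refine hd.continuousOn.comp_continuous (by have := ee_cont; fun_prop) ?_
        intro θ
        simp only [Metric.mem_ball, dist_zero_right, norm_mul, ee_norm, mul_one, Complex.norm_real, Real.norm_eq_abs]
        rw [abs_of_nonneg (by linarith [hr.1])]; exact hr.2
      exact (Complex.continuous_re.comp hcont).aestronglyMeasurable
    · filter_upwards [hev] with r hr
      filter_upwards [hb] with θ h
      exact (Complex.abs_re_le_norm _).trans (h r hr.1 hr.2)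
    · filter_upwards [hl] with θ h
      exact (Complex.continuous_re.tendsto _).comp h
  have h2 : Tendsto (fun r : ℝ => ∫ θ, (f (r * ee θ)).re ∂mu) (𝓝[<] 1) (𝓝 (Real.pi * (f 0).re)) := by
    refine tendsto_const_nhds.congr' ?_
    filter_upwards [hev] with r hr
    exact (half_mean hd hc (by linarith [hr.1]) hr.2).symm
  exact tendsto_nhds_unique h1 h2

theorem int_of_sq {G : ℝ → ℝ} (hm : Measurable G) (h : Integrable (fun x => G x ^ 2) mu) : Integrable G mu := by
  have h2 : Integrable (fun x => G x ^ 2 + 1) mu := h.add (integrable_const _)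
  refine h2.mono' hm.aestronglyMeasurable (Eventually.of_forall fun x => ?_)
  rw [Real.norm_eq_abs]
  nlinarith [sq_nonneg (|G x| - 1), sq_abs (G x)]

variable {c0 c1 l t : ℝ}

theorem D1_nonneg (ht : 0 < t) (ht2 : t < Real.pi) (h0 : -1 < 2 * c0) (h1 : -1 < 2 * c1)
    (h2 : -1 < 2 * l) (k : ℕ) :
    ∫ θ, (ee (k * θ) * Df c0 c1 l t (ee θ)).re ∂mu = if k = 0 then Real.pi else 0 := by
  have hG := int_of_sq (Gd_meas c0 c1 l t (CG c0 c1 l t)) (Gd_sq_int _ ht ht2 h0 h1 h2)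
  have := half_mean_lim (f := fun z => z ^ k * Df c0 c1 l t z) (F := fun θ => ee (k * θ) * Df c0 c1 l t (ee θ))
    (by exact DifferentiableOn.mul (by fun_prop) (Df_diff _ _ _ _))
    (by intro z hz; rw [map_mul, map_pow, Df_conj _ _ _ _ hz]) hG ?_ ?_
  · rw [this]
    by_cases hk : k = 0
    · simp [hk, Df_zero]
    · simp [hk]
  · filter_upwards [ae_pt ht ht2] with θ h r hr hr1
    rw [norm_mul, norm_pow]
    have : ‖(r : ℂ) * ee θ‖ ≤ 1 := by
      rw [norm_mul, ee_norm, mul_one, Complex.norm_real, Real.norm_eq_abs, abs_of_nonneg (by linarith)]; exact hr1.le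
    calc _ ≤ 1 * ‖Df c0 c1 l t (r * ee θ)‖ := by gcongr; exact pow_le_one₀ (norm_nonneg _) this
      _ ≤ _ := by rw [one_mul]; exact Df_bd _ _ _ h (by linarith) hr1.le
  · filter_upwards [ae_pt ht ht2] with θ h
    refine Tendsto.mul ?_ (Df_lim _ _ _ h)
    rw [← ee_pow]
    have hc : Continuous (fun r : ℝ => ((r : ℂ) * ee θ) ^ k) := by fun_prop
    have := (hc.tendsto 1).mono_left (nhdsWithin_le_nhds (s := Iio 1))
    simpa using this

theorem Df_mble (c0 c1 l t : ℝ) : Measurable (fun θ : ℝ => Df c0 c1 l t (ee θ)) := by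
  have h : ∀ (u : ℂ) (c : ℝ), Measurable (fun θ : ℝ => fac u c (ee θ)) := by
    intro u c
    unfold fac
    have := ee_cont.measurable
    fun_prop
  unfold Df
  exact (((h _ _).mul (h _ _)).mul (h _ _)).mul (h _ _)

theorem Df_int (ht : 0 < t) (ht2 : t < Real.pi) (h0 : -1 < 2 * c0) (h1 : -1 < 2 * c1)
    (h2 : -1 < 2 * l) : Integrable (fun θ : ℝ => Df c0 c1 l t (ee θ)) mu := by
  have hG := int_of_sq (Gd_meas c0 c1 l t (CG c0 c1 l t)) (Gd_sq_int _ ht ht2 h0 h1 h2)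
  refine hG.mono' (Df_mble _ _ _ _).aestronglyMeasurable ?_
  filter_upwards [ae_pt ht ht2] with θ h
  simpa using Df_bd c0 c1 l h zero_le_one le_rfl

theorem ee_mul_int {f : ℝ → ℂ} (hf : Integrable f mu) (k : ℝ) : Integrable (fun θ => ee (k * θ) * f θ) mu := by
  refine hf.bdd_mul (c := 1) ?_ (Eventually.of_forall fun x => (ee_norm _).le)
  have := ee_cont
  exact Continuous.aestronglyMeasurable (by fun_prop)

theorem int_cos : ∫ θ, Real.cos θ ∂mu = 0 := by
  rw [← integral_Ioc_eq_integral_Ioo, ← intervalIntegral.integral_of_le Real.pi_pos.le]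
  simp

theorem D1_neg (ht : 0 < t) (ht2 : t < Real.pi) (h0 : -1 < 2 * c0) (h1 : -1 < 2 * c1)
    (h2 : -1 < 2 * l) :
    ∫ θ, (ee (-θ) * Df c0 c1 l t (ee θ)).re ∂mu = Real.pi * (c1 - c0 - 2 * l * Real.cos t) := by
  have hG := int_of_sq (Gd_meas c0 c1 l t (CG c0 c1 l t)) (Gd_sq_int _ ht ht2 h0 h1 h2)
  have hG2 : Integrable (fun θ => 2 * (Gd c0 c1 l t (CG c0 c1 l t) θ + 1)) mu := (hG.add (integrable_const _)).const_mul 2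
  have hds : ∀ z : ℂ, z ≠ 0 → dslope (Df c0 c1 l t) 0 z = z⁻¹ * (Df c0 c1 l t z - 1) := by
    intro z hz
    rw [dslope_of_ne _ hz, slope_def_module, Df_zero]; simp
  have := half_mean_lim (f := dslope (Df c0 c1 l t) 0) (F := fun θ => ee (-θ) * (Df c0 c1 l t (ee θ) - 1))
    ((Complex.differentiableOn_dslope (Metric.ball_mem_nhds 0 one_pos)).2 (Df_diff _ _ _ _))
    ?_ hG2 ?_ ?_
  · rw [dslope_same, (Df_deriv _ _ _ _).deriv, Complex.ofReal_re] at this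
    rw [← this]
    have e : ∀ θ, (ee (-θ) * (Df c0 c1 l t (ee θ) - 1)).re = (ee (-θ) * Df c0 c1 l t (ee θ)).re - Real.cos θ := by
      intro θ
      rw [mul_sub, Complex.sub_re, mul_one, ee_re, Real.cos_neg]
    simp only [e]
    rw [integral_sub, int_cos, sub_zero]
    · have := (ee_mul_int (Df_int ht ht2 h0 h1 h2) (-1)).re
      simpa using this
    · exact (Real.continuous_cos.integrableOn_Icc).mono_set Ioo_subset_Icc_self
  · intro z hz
    by_cases hz0 : z = 0
    · rw [hz0, map_zero, dslope_same, (Df_deriv _ _ _ _).deriv, Complex.conj_ofReal]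
    · rw [hds z hz0, hds _ (by simpa using hz0), Df_conj _ _ _ _ hz]
      simp
  · filter_upwards [ae_pt ht ht2] with θ h r hr hr1
    have hr0 : (r : ℂ) ≠ 0 := by norm_cast; linarith
    have he : ee θ ≠ 0 := by intro h; have := ee_norm θ; rw [h] at this; simp at this
    rw [hds _ (mul_ne_zero hr0 he), norm_mul, norm_inv, norm_mul, ee_norm, mul_one, Complex.norm_real, Real.norm_eq_abs,
      abs_of_pos (by linarith)]
    have a1 : r⁻¹ ≤ 2 := by rw [inv_le_comm₀ (by linarith) two_pos]; linarith
    have a2 : ‖Df c0 c1 l t (r * ee θ) - 1‖ ≤ Gd c0 c1 l t (CG c0 c1 l t) θ + 1 := by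
      refine (norm_sub_le _ _).trans ?_
      rw [norm_one]
      linarith [Df_bd c0 c1 l h (by linarith) hr1.le]
    gcongr
  · filter_upwards [ae_pt ht ht2] with θ h
    have hc : Tendsto (fun r : ℝ => ((r : ℂ) * ee θ)⁻¹) (𝓝[<] 1) (𝓝 (ee (-θ))) := by
      have he : ee θ ≠ 0 := by intro h; have := ee_norm θ; rw [h] at this; simp at this
      have e1 : ee (-θ) = (((1:ℝ) : ℂ) * ee θ)⁻¹ := by
        rw [Complex.ofReal_one, one_mul]
        apply eq_inv_of_mul_eq_one_left
        rw [← ee_add]; simp [ee_zero]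
      rw [e1]
      refine Tendsto.inv₀ ?_ (by simpa using he)
      have hc : Continuous (fun r : ℝ => ((r : ℂ) * ee θ)) := by fun_prop
      exact (hc.tendsto 1).mono_left nhdsWithin_le_nhds
    refine (hc.mul ((Df_lim c0 c1 l h).sub_const 1)).congr' ?_
    filter_upwards [Ico_mem_nhdsLT (by norm_num : (1 / 2 : ℝ) < 1)] with r hr
    have hr0 : (r : ℂ) ≠ 0 := by norm_cast; linarith [hr.1]
    have he : ee θ ≠ 0 := by intro h; have := ee_norm θ; rw [h] at this; simp at this
    rw [hds _ (mul_ne_zero hr0 he)]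

end Sz
end Magnus
end

section
open Filter Topology ComplexConjugate MeasureTheory Set

namespace Magnus
namespace Sz

theorem unif_poly {f : ℂ → ℂ} {R : ℝ} (hR : 1 < R) (hd : DifferentiableOn ℂ f (Metric.closedBall 0 R)) {ε : ℝ} (hε : 0 < ε)
    (hf0 : f 0 = 1) (hc : ∀ z : ℂ, ‖z‖ ≤ 1 → f (conj z) = conj (f z)) :
    ∃ (N : ℕ) (c : ℕ → ℝ), 1 ≤ N ∧ c 0 = 1 ∧ ∀ z : ℂ, ‖z‖ ≤ 1 → ‖(∑ j ∈ Finset.range N, (c j : ℂ) * z ^ j) - f z‖ ≤ ε := by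
  lift R to NNReal using (by linarith)
  have hR0 : (0 : NNReal) < R := by rw [← NNReal.coe_pos]; linarith
  have h := hd.hasFPowerSeriesOnBall hR0
  obtain ⟨r', hr1, hr2⟩ := exists_between (show (1 : NNReal) < R by exact_mod_cast hR)
  have hu := h.tendstoUniformlyOn (r' := r') (by exact_mod_cast hr2)
  rw [Metric.tendstoUniformlyOn_iff] at hu
  have hu2 := ((hu ε hε).and (eventually_ge_atTop 1)).exists
  obtain ⟨N, hN, hN1⟩ := hu2
  set q := cauchyPowerSeries f 0 R with hq
  have hps : ∀ z, q.partialSum N z = ∑ j ∈ Finset.range N, q.coeff j * z ^ j := by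
    intro z
    unfold FormalMultilinearSeries.partialSum
    refine Finset.sum_congr rfl fun j _ => ?_
    rw [FormalMultilinearSeries.apply_eq_pow_smul_coeff, smul_eq_mul, mul_comm]
  have hS : ∀ z : ℂ, ‖z‖ ≤ 1 → ‖(∑ j ∈ Finset.range N, q.coeff j * z ^ j) - f z‖ ≤ ε := by
    intro z hz
    have := hN z (by
      rw [mem_ball_zero_iff]
      exact lt_of_le_of_lt hz (by exact_mod_cast hr1))
    rw [zero_add, hps, dist_eq_norm, norm_sub_rev] at this
    exact this.le
  refine ⟨N, fun j => (q.coeff j).re, hN1, ?_, ?_⟩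
  · have := h.coeff_zero (fun _ => 0)
    have e : q.coeff 0 = f 0 := by
      rw [← this]; unfold FormalMultilinearSeries.coeff
      congr 1
      ext i; exact i.elim0
    simp only [e, hf0, Complex.one_re]
  · intro z hz
    have a1 := hS z hz
    have a2 := hS (conj z) (by simpa using hz)
    rw [hc z hz, ← RCLike.norm_conj, map_sub, Complex.conj_conj, map_sum] at a2
    simp only [map_mul, map_pow, Complex.conj_conj] at a2
    have e : (∑ j ∈ Finset.range N, ((q.coeff j).re : ℂ) * z ^ j) - f z =
        (1 / 2) * (((∑ j ∈ Finset.range N, q.coeff j * z ^ j) - f z) + ((∑ j ∈ Finset.range N, conj (q.coeff j) * z ^ j) - f z)) := by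
      have : ∑ j ∈ Finset.range N, ((q.coeff j).re : ℂ) * z ^ j = (1 / 2) * ((∑ j ∈ Finset.range N, q.coeff j * z ^ j) +
          (∑ j ∈ Finset.range N, conj (q.coeff j) * z ^ j)) := by
        rw [← Finset.sum_add_distrib, Finset.mul_sum]
        refine Finset.sum_congr rfl fun j _ => ?_
        rw [← add_mul, Complex.add_conj]; push_cast; ring
      rw [this]; ring
    simp only
    rw [e, norm_mul]
    have h3 := norm_add_le ((∑ j ∈ Finset.range N, q.coeff j * z ^ j) - f z) ((∑ j ∈ Finset.range N, conj (q.coeff j) * z ^ j) - f z)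
    have h4 : ‖(1 / 2 : ℂ)‖ = 1 / 2 := by norm_num
    rw [h4]
    linarith

variable {c0 c1 l t : ℝ}

theorem D2 (ht : 0 < t) (ht2 : t < Real.pi) (h0 : -1 < 2 * c0) (h1 : -1 < 2 * c1)
    (h2 : -1 < 2 * l) {ε : ℝ} (hε : 0 < ε) :
    ∃ (N : ℕ) (c : ℕ → ℝ), 1 ≤ N ∧ c 0 = 1 ∧
      ∫ θ, ‖(∑ j ∈ Finset.range N, (c j : ℂ) * ee θ ^ j) * Df c0 c1 l t (ee θ) - 1‖ ^ 2 ∂mu ≤ ε := by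
  set G := Gd c0 c1 l t (CG c0 c1 l t) with hGdef
  have hG2 : Integrable (fun x => G x ^ 2) mu := Gd_sq_int _ ht ht2 h0 h1 h2
  have hG := int_of_sq (Gd_meas c0 c1 l t (CG c0 c1 l t)) hG2
  have hbig : Integrable (fun x => (G x + 1) ^ 2) mu := by
    have : Integrable (fun x => G x ^ 2 + (2 * G x + 1)) mu := hG2.add ((hG.const_mul 2).add (integrable_const _))
    refine this.congr (Eventually.of_forall fun x => ?_)
    simp only; ring
  have hDr : ∀ r : ℝ, 0 ≤ r → r < 1 → Continuous (fun θ : ℝ => Df c0 c1 l t (r * ee θ)) := by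
    intro r hr hr1
    refine (Df_diff c0 c1 l t).continuousOn.comp_continuous (by have := ee_cont; fun_prop) ?_
    intro θ
    simp only [Metric.mem_ball, dist_zero_right, norm_mul, ee_norm, mul_one, Complex.norm_real, Real.norm_eq_abs]
    rw [abs_of_nonneg hr]; exact hr1
  have hev : ∀ᶠ r : ℝ in 𝓝[<] 1, 1 / 2 ≤ r ∧ r < 1 := by
    filter_upwards [Ico_mem_nhdsLT (by norm_num : (1 / 2 : ℝ) < 1)] with r hr using hr
  have hlim : Tendsto (fun r : ℝ => ∫ θ, ‖Df c0 c1 l t (ee θ) / Df c0 c1 l t (r * ee θ) - 1‖ ^ 2 ∂mu) (𝓝[<] 1) (𝓝 0) := by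
    have := tendsto_integral_filter_of_dominated_convergence (μ := mu) (l := 𝓝[<] (1:ℝ))
      (F := fun r θ => ‖Df c0 c1 l t (ee θ) / Df c0 c1 l t (r * ee θ) - 1‖ ^ 2) (f := fun _ => (0:ℝ)) (fun x => (G x + 1) ^ 2) ?_ ?_ hbig ?_
    · simpa using this
    · filter_upwards [hev] with r hr
      have := Df_mble c0 c1 l t
      have h3 := (hDr r (by linarith [hr.1]) hr.2).measurable
      exact Measurable.aestronglyMeasurable (by fun_prop)
    · filter_upwards [hev] with r hr
      filter_upwards [ae_pt ht ht2] with θ h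
      have b := Df_ratio c0 c1 l h (by linarith [hr.1]) hr.2
      rw [Real.norm_of_nonneg (by positivity)]
      have : ‖Df c0 c1 l t (ee θ) / Df c0 c1 l t (r * ee θ) - 1‖ ≤ G θ + 1 := by
        refine (norm_sub_le _ _).trans ?_
        rw [norm_one]; linarith
      gcongr
    · filter_upwards [ae_pt ht ht2] with θ h
      have hne := Df_bne c0 c1 l h
      have h5 := ((tendsto_const_nhds (x := Df c0 c1 l t (ee θ))).div (Df_lim c0 c1 l h) hne).sub_const 1
      rw [div_self hne, sub_self] at h5
      have h6 := (h5.norm).pow 2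
      simpa using h6
  have hI0 : 0 ≤ ∫ x, G x ^ 2 ∂mu := integral_nonneg fun x => sq_nonneg _
  obtain ⟨r, ⟨hr, hr1⟩, hrε⟩ := (hev.and (hlim.eventually (gt_mem_nhds (show (0:ℝ) < ε / 4 by positivity)))).exists
  obtain ⟨δ, hδ0, hδ⟩ : ∃ δ : ℝ, 0 < δ ∧ 2 * (δ ^ 2 * ∫ x, G x ^ 2 ∂mu) ≤ ε / 2 := by
    refine ⟨Real.sqrt (ε / 4 / (1 + ∫ x, G x ^ 2 ∂mu)), Real.sqrt_pos.2 (by positivity), ?_⟩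
    rw [Real.sq_sqrt (by positivity), div_mul_eq_mul_div]
    have : ε / 4 * (∫ x, G x ^ 2 ∂mu) / (1 + ∫ x, G x ^ 2 ∂mu) ≤ ε / 4 := by
      rw [div_le_iff₀ (by positivity)]; nlinarith
    linarith
  have hr0 : 0 < r := by linarith
  obtain ⟨R, hR1, hR2⟩ : ∃ R : ℝ, 1 < R ∧ r * R < 1 := by
    refine ⟨(1 + r⁻¹) / 2, ?_, ?_⟩
    · have := one_lt_inv₀ hr0 |>.2 hr1
      linarith
    · rw [mul_div_assoc', mul_add, mul_inv_cancel₀ hr0.ne']; linarith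
  have hnr : ∀ z : ℂ, ‖z‖ ≤ R → ‖(r : ℂ) * z‖ < 1 := by
    intro z hz
    rw [norm_mul, Complex.norm_real, Real.norm_of_nonneg hr0.le]
    exact lt_of_le_of_lt (mul_le_mul_of_nonneg_left hz hr0.le) hR2
  obtain ⟨N, c, hN, hc0, hc⟩ := unif_poly (f := fun z => (Df c0 c1 l t (r * z))⁻¹) hR1 (by
      refine DifferentiableOn.inv ?_ ?_
      · refine (Df_diff c0 c1 l t).comp (by fun_prop) ?_
        intro z hz
        simpa using hnr z (by simpa using hz)
      · intro z hz
        exact Df_ne _ _ _ _ (hnr z (by simpa using hz))) hδ0 (by simp [Df_zero]) (by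
      intro z hz
      have := Df_conj c0 c1 l t (hnr z (by linarith))
      rw [map_mul, Complex.conj_ofReal] at this
      rw [this, map_inv₀])
  refine ⟨N, c, hN, hc0, ?_⟩
  have hmP : Continuous (fun θ : ℝ => (∑ j ∈ Finset.range N, (c j : ℂ) * ee θ ^ j)) := by
    have := ee_cont; fun_prop
  have hratio : Integrable (fun θ => ‖Df c0 c1 l t (ee θ) / Df c0 c1 l t (r * ee θ) - 1‖ ^ 2) mu := by
    refine hbig.mono' ?_ ?_
    · have := Df_mble c0 c1 l t
      have h3 := (hDr r (by linarith) hr1).measurable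
      exact Measurable.aestronglyMeasurable (by fun_prop)
    · filter_upwards [ae_pt ht ht2] with θ h
      have b := Df_ratio c0 c1 l h (by linarith) hr1
      rw [Real.norm_of_nonneg (by positivity)]
      have : ‖Df c0 c1 l t (ee θ) / Df c0 c1 l t (r * ee θ) - 1‖ ≤ G θ + 1 := by
        refine (norm_sub_le _ _).trans ?_
        rw [norm_one]; linarith
      gcongr
  calc ∫ θ, ‖(∑ j ∈ Finset.range N, (c j : ℂ) * ee θ ^ j) * Df c0 c1 l t (ee θ) - 1‖ ^ 2 ∂mu
      ≤ ∫ θ, (2 * (δ ^ 2 * G θ ^ 2) + 2 * ‖Df c0 c1 l t (ee θ) / Df c0 c1 l t (r * ee θ) - 1‖ ^ 2) ∂mu := by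
        refine integral_mono_of_nonneg (Eventually.of_forall fun θ => by simp only [Pi.zero_apply]; positivity)
          (((hG2.const_mul _).const_mul 2).add (hratio.const_mul 2)) ?_
        filter_upwards [ae_pt ht ht2] with θ h
        have b1 := hc (ee θ) (ee_norm θ).le
        have b2 := Df_bd c0 c1 l h zero_le_one le_rfl
        rw [Complex.ofReal_one, one_mul] at b2
        have e : (∑ j ∈ Finset.range N, (c j : ℂ) * ee θ ^ j) * Df c0 c1 l t (ee θ) - 1 =
          ((∑ j ∈ Finset.range N, (c j : ℂ) * ee θ ^ j) - (Df c0 c1 l t (r * ee θ))⁻¹) * Df c0 c1 l t (ee θ) +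
          (Df c0 c1 l t (ee θ) / Df c0 c1 l t (r * ee θ) - 1) := by
          rw [div_eq_mul_inv]; ring
        have b3 : ‖((∑ j ∈ Finset.range N, (c j : ℂ) * ee θ ^ j) - (Df c0 c1 l t (r * ee θ))⁻¹) * Df c0 c1 l t (ee θ)‖ ≤ δ * G θ := by
          rw [norm_mul]
          gcongr
        have b4 := norm_add_le (((∑ j ∈ Finset.range N, (c j : ℂ) * ee θ ^ j) - (Df c0 c1 l t (r * ee θ))⁻¹) * Df c0 c1 l t (ee θ))
          (Df c0 c1 l t (ee θ) / Df c0 c1 l t (r * ee θ) - 1)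
        rw [e]
        have b5 := b4.trans (add_le_add_left b3 _)
        have b6 := pow_le_pow_left₀ (norm_nonneg _) b5 2
        refine b6.trans ?_
        nlinarith [sq_nonneg (δ * G θ - ‖Df c0 c1 l t (ee θ) / Df c0 c1 l t (r * ee θ) - 1‖)]
    _ = 2 * (δ ^ 2 * ∫ θ, G θ ^ 2 ∂mu) + 2 * ∫ θ, ‖Df c0 c1 l t (ee θ) / Df c0 c1 l t (r * ee θ) - 1‖ ^ 2 ∂mu := by
        rw [integral_add ((hG2.const_mul _).const_mul 2) (hratio.const_mul 2), integral_const_mul, integral_const_mul, integral_const_mul]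
    _ ≤ ε := by linarith

end Sz
end Magnus
end

section
open Filter Topology ComplexConjugate MeasureTheory Set

namespace Magnus
namespace Sz

theorem int_cos_lin (a b m φ : ℝ) (hm : 0 < m) : |∫ x in a..b, Real.cos (m * x - φ)| ≤ 2 / m := by
  rw [intervalIntegral.integral_comp_mul_sub Real.cos hm.ne', integral_cos, smul_eq_mul, abs_mul, abs_of_pos (inv_pos.2 hm)]
  have h1 := Real.abs_sin_le_one (m * b - φ)
  have h2 := Real.abs_sin_le_one (m * a - φ)
  have h3 := abs_sub (Real.sin (m * b - φ)) (Real.sin (m * a - φ))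
  rw [div_eq_inv_mul]
  gcongr
  linarith

theorem gam_mble (c0 c1 l t : ℝ) : Measurable (gam c0 c1 l t) := by
  unfold gam
  refine Measurable.sub (by fun_prop) (Measurable.ite (measurableSet_lt (by fun_prop) (by fun_prop)) (by fun_prop) (by fun_prop))

variable {c0 c1 l t : ℝ}

theorem D3_bd (ht : 0 < t) (ht2 : t < Real.pi) (k : ℝ) (hk : 0 < k + (c0 + c1 + 2 * l)) :
    |∫ θ, Real.cos (k * θ + 2 * gam c0 c1 l t θ) ∂mu| ≤ 4 / (k + (c0 + c1 + 2 * l)) := by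
  have hpi := Real.pi_pos
  have hint : Integrable (fun θ => Real.cos (k * θ + 2 * gam c0 c1 l t θ)) mu := by
    refine (integrable_const (1:ℝ)).mono' ?_ (Eventually.of_forall fun θ => Real.abs_cos_le_one _)
    have := gam_mble c0 c1 l t
    exact Measurable.aestronglyMeasurable (by fun_prop)
  have hsplit : ∫ θ, Real.cos (k * θ + 2 * gam c0 c1 l t θ) ∂mu =
      (∫ θ in (0:ℝ)..t, Real.cos ((k + (c0 + c1 + 2 * l)) * θ - c0 * Real.pi)) +
      ∫ θ in t..Real.pi, Real.cos ((k + (c0 + c1 + 2 * l)) * θ - (c0 * Real.pi + 2 * l * Real.pi)) := by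
    have hii : IntegrableOn (fun θ => Real.cos (k * θ + 2 * gam c0 c1 l t θ)) (Ioc 0 Real.pi) := by
      rw [integrableOn_Ioc_iff_integrableOn_Ioo]; exact hint
    have e1 : IntervalIntegrable (fun θ => Real.cos (k * θ + 2 * gam c0 c1 l t θ)) volume 0 t := by
      rw [intervalIntegrable_iff_integrableOn_Ioc_of_le ht.le]; exact hii.mono_set (Ioc_subset_Ioc le_rfl ht2.le)
    have e2 : IntervalIntegrable (fun θ => Real.cos (k * θ + 2 * gam c0 c1 l t θ)) volume t Real.pi := by
      rw [intervalIntegrable_iff_integrableOn_Ioc_of_le ht2.le]; exact hii.mono_set (Ioc_subset_Ioc ht.le le_rfl)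
    rw [← integral_Ioc_eq_integral_Ioo, ← intervalIntegral.integral_of_le hpi.le,
      ← intervalIntegral.integral_add_adjacent_intervals e1 e2]
    congr 1
    · rw [intervalIntegral.integral_of_le ht.le, intervalIntegral.integral_of_le ht.le]
      refine setIntegral_congr_fun measurableSet_Ioc fun θ hθ => ?_
      simp only [gam]
      rw [if_neg (not_lt.2 hθ.2)]
      congr 1; ring
    · rw [intervalIntegral.integral_of_le ht2.le, intervalIntegral.integral_of_le ht2.le]
      refine setIntegral_congr_fun measurableSet_Ioc fun θ hθ => ?_
      simp only [gam]
      rw [if_pos hθ.1]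
      congr 1; ring
  rw [hsplit]
  have b1 := int_cos_lin 0 t _ (c0 * Real.pi) hk
  have b2 := int_cos_lin t Real.pi _ (c0 * Real.pi + 2 * l * Real.pi) hk
  refine (abs_add_le _ _).trans ((add_le_add b1 b2).trans (le_of_eq (by ring)))

theorem D3 (ht : 0 < t) (ht2 : t < Real.pi) :
    Ok 1 (fun n : ℕ => ∫ θ, Real.cos (2 * n * θ + 2 * gam c0 c1 l t θ) ∂mu) := by
  obtain ⟨M, hM⟩ := exists_nat_ge |c0 + c1 + 2 * l|
  refine ⟨4, by norm_num, M + 1, by omega, ?_⟩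
  intro n hn
  have hn' : (M : ℝ) + 1 ≤ n := by exact_mod_cast hn
  have hM0 : (0:ℝ) ≤ M := Nat.cast_nonneg _
  have h3 := neg_abs_le (c0 + c1 + 2 * l)
  rw [Real.norm_eq_abs, pow_one]
  refine (D3_bd ht ht2 (2 * n) (by linarith)).trans ?_
  gcongr
  · linarith
  · linarith

end Sz
end Magnus
end

section
open Polynomial Filter Topology MeasureTheory Set

namespace Magnus

/-- the generalized Jacobi weight -/
noncomputable def wt (A x₁ α β lam x : ℝ) : ℝ := A * (1 - x) ^ α * (1 + x) ^ β * |x - x₁| ^ (2 * lam)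

theorem cos_image : Real.cos '' Ioo 0 Real.pi = Ioo (-1) 1 := by
  ext y; constructor
  · rintro ⟨θ, hθ, rfl⟩
    constructor
    · have := Real.cos_lt_cos_of_nonneg_of_le_pi hθ.1.le le_rfl hθ.2
      rwa [Real.cos_pi] at this
    · have := Real.cos_lt_cos_of_nonneg_of_le_pi le_rfl hθ.2.le hθ.1
      rwa [Real.cos_zero] at this
  · intro hy
    refine ⟨Real.arccos y, ⟨Real.arccos_pos.2 hy.2, ?_⟩, Real.cos_arccos hy.1.le hy.2.le⟩
    exact lt_of_le_of_ne (Real.arccos_le_pi y) (by rw [Ne, Real.arccos_eq_pi]; linarith [hy.1])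

theorem abs_neg_sin {θ : ℝ} (h : θ ∈ Ioo 0 Real.pi) : |(-Real.sin θ)| = Real.sin θ := by
  rw [abs_neg, abs_of_pos (Real.sin_pos_of_pos_of_lt_pi h.1 h.2)]

theorem cov (f : ℝ → ℝ) : ∫ x in Ioo (-1 : ℝ) 1, f x = ∫ θ, f (Real.cos θ) * Real.sin θ ∂Sz.mu := by
  rw [← cos_image, integral_image_eq_integral_abs_deriv_smul measurableSet_Ioo
    (fun x _ => (Real.hasDerivAt_cos x).hasDerivWithinAt) (Real.injOn_cos.mono Ioo_subset_Icc_self)]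
  refine setIntegral_congr_fun measurableSet_Ioo fun θ hθ => ?_
  simp only [smul_eq_mul]
  rw [abs_neg_sin hθ, mul_comm]

theorem cov_int (f : ℝ → ℝ) : IntegrableOn f (Ioo (-1 : ℝ) 1) ↔ Integrable (fun θ => f (Real.cos θ) * Real.sin θ) Sz.mu := by
  rw [← cos_image, integrableOn_image_iff_integrableOn_abs_deriv_smul measurableSet_Ioo
    (fun x _ => (Real.hasDerivAt_cos x).hasDerivWithinAt) (Real.injOn_cos.mono Ioo_subset_Icc_self)]
  refine integrableOn_congr_fun (fun θ hθ => ?_) measurableSet_Ioo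
  simp only [smul_eq_mul]
  rw [abs_neg_sin hθ, mul_comm]

section
variable {A x₁ α β lam : ℝ}

theorem arc_pos (hx : -1 < x₁ ∧ x₁ < 1) : 0 < Real.arccos x₁ := Real.arccos_pos.2 hx.2
theorem arc_lt (hx : -1 < x₁ ∧ x₁ < 1) : Real.arccos x₁ < Real.pi :=
  lt_of_le_of_ne (Real.arccos_le_pi _) (by rw [Ne, Real.arccos_eq_pi]; linarith [hx.1])
theorem cos_arc (hx : -1 < x₁ ∧ x₁ < 1) : Real.cos (Real.arccos x₁) = x₁ := Real.cos_arccos hx.1.le hx.2.le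

theorem wt_mble (A x₁ α β lam : ℝ) : Measurable (wt A x₁ α β lam) := by
  unfold wt; fun_prop

theorem wt_W (hx : -1 < x₁ ∧ x₁ < 1) {θ : ℝ} (h : Sz.Pt (Real.arccos x₁) θ) :
    wt A x₁ α β lam (Real.cos θ) * Real.sin θ = A * (2 : ℝ) ^ (-(α + β + 2 * lam + 1)) *
      ‖Sz.Df (α + 1 / 2) (β + 1 / 2) lam (Real.arccos x₁) (Sz.ee θ)‖ ^ 2 := by
  have := Sz.W_eq A α β lam h
  rw [cos_arc hx] at this
  exact this

theorem wt_int (hA : 0 < A) (hx : -1 < x₁ ∧ x₁ < 1) (hα : -1 < α) (hβ : -1 < β) (hl : -1 < 2 * lam) :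
    IntegrableOn (wt A x₁ α β lam) (Ioo (-1 : ℝ) 1) := by
  rw [cov_int]
  have hG := (Sz.Gd_sq_int (c0 := α + 1 / 2) (c1 := β + 1 / 2) (l := lam) (t := Real.arccos x₁)
    (Sz.CG (α + 1 / 2) (β + 1 / 2) lam (Real.arccos x₁)) (arc_pos hx) (arc_lt hx)
    (by linarith) (by linarith) hl).const_mul (A * (2 : ℝ) ^ (-(α + β + 2 * lam + 1)))
  refine hG.mono' ?_ ?_
  · have := wt_mble A x₁ α β lam
    exact Measurable.aestronglyMeasurable (by fun_prop)
  · filter_upwards [Sz.ae_pt (arc_pos hx) (arc_lt hx)] with θ h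
    rw [wt_W hx h, Real.norm_of_nonneg (by positivity)]
    have := Sz.Df_bd (α + 1 / 2) (β + 1 / 2) lam h zero_le_one le_rfl
    rw [Complex.ofReal_one, one_mul] at this
    gcongr

theorem qwt_int {w : ℝ → ℝ} (hw : IntegrableOn w (Ioo (-1 : ℝ) 1)) (q : ℝ[X]) :
    IntegrableOn (fun x => q.eval x * w x) (Ioo (-1 : ℝ) 1) := by
  rw [← integrableOn_Icc_iff_integrableOn_Ioo] at hw ⊢
  exact hw.continuousOn_mul q.continuous.continuousOn isCompact_Icc

/-- the moment functional -/
noncomputable def Lw (w : ℝ → ℝ) (hw : IntegrableOn w (Ioo (-1 : ℝ) 1)) : ℝ[X] →ₗ[ℝ] ℝ where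
  toFun q := ∫ x in Ioo (-1 : ℝ) 1, q.eval x * w x
  map_add' q r := by
    simp only [eval_add, add_mul]
    exact integral_add (qwt_int hw q) (qwt_int hw r)
  map_smul' c q := by
    simp only [eval_smul, smul_eq_mul, mul_assoc, RingHom.id_apply]
    exact integral_const_mul _ _

theorem cont_uabs (hl : -1 < 2 * lam) : Continuous (fun u : ℝ => u * (u ^ 2) ^ lam) := by
  rw [continuous_iff_continuousAt]
  intro u
  by_cases hu : u = 0
  · subst hu
    have h1 : Tendsto (fun u : ℝ => |u| ^ (2 * lam + 1)) (𝓝 0) (𝓝 0) := by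
      have : Continuous (fun u : ℝ => |u| ^ (2 * lam + 1)) :=
        (Real.continuous_rpow_const (by linarith)).comp continuous_abs
      have h := this.tendsto 0
      rwa [abs_zero, Real.zero_rpow (by linarith)] at h
    unfold ContinuousAt
    simp only [zero_mul]
    refine squeeze_zero_norm (fun u => ?_) h1
    rw [norm_mul, Real.norm_eq_abs, Real.norm_of_nonneg (by positivity)]
    by_cases hu : u = 0
    · simp [hu]; positivity
    · rw [Real.rpow_add_one (abs_ne_zero.2 hu), ← sq_abs, ← Real.rpow_two, ← Real.rpow_mul (abs_nonneg _), mul_comm]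
  · exact ContinuousAt.mul continuousAt_id (ContinuousAt.rpow_const (by fun_prop) (Or.inl (by positivity)))

theorem abs_sq_rpow (u l : ℝ) : |u| ^ (2 * l) = (u ^ 2) ^ l := by
  rw [Real.rpow_mul (abs_nonneg _), Real.rpow_two, sq_abs]

theorem pearson_int (hA : 0 < A) (hx : -1 < x₁ ∧ x₁ < 1) (hα : -1 < α) (hβ : -1 < β) (hl : -1 < 2 * lam) (q : ℝ[X]) :
    ∫ x in Ioo (-1 : ℝ) 1, (PhiP x₁ * derivative q + (derivative (PhiP x₁) +
      NP (α + β + 2 * lam) (-α * (1 - x₁) + β * (1 + x₁)) (α * x₁ - β * x₁ + 2 * lam)) * q).eval x * wt A x₁ α β lam x = 0 := by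
  set f' : ℝ → ℝ := fun x => (PhiP x₁ * derivative q + (derivative (PhiP x₁) +
      NP (α + β + 2 * lam) (-α * (1 - x₁) + β * (1 + x₁)) (α * x₁ - β * x₁ + 2 * lam)) * q).eval x * wt A x₁ α β lam x with hf'
  set F : ℝ → ℝ := fun x => A * (q.eval x * ((1 - x) ^ (α + 1) * ((1 + x) ^ (β + 1) * ((x - x₁) * ((x - x₁) ^ 2) ^ lam)))) with hF
  have hi : IntegrableOn f' (Ioo (-1 : ℝ) 1) := qwt_int (wt_int hA hx hα hβ hl) _
  have := MeasureTheory.integral_eq_of_hasDerivAt_off_countable_of_le F f' (a := -1) (b := 1) (by norm_num)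
    (s := {x₁}) (countable_singleton _) ?_ ?_ ?_
  · rw [intervalIntegral.integral_of_le (by norm_num), integral_Ioc_eq_integral_Ioo] at this
    rw [this, hF]
    simp only
    rw [sub_self, Real.zero_rpow (by linarith), show (1 : ℝ) + -1 = 0 by ring, Real.zero_rpow (by linarith)]
    ring
  · refine Continuous.continuousOn ?_
    have h1 : Continuous (fun x : ℝ => (1 - x) ^ (α + 1)) := (Real.continuous_rpow_const (by linarith)).comp (by fun_prop)
    have h2 : Continuous (fun x : ℝ => (1 + x) ^ (β + 1)) := (Real.continuous_rpow_const (by linarith)).comp (by fun_prop)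
    have h3 : Continuous (fun x : ℝ => (x - x₁) * ((x - x₁) ^ 2) ^ lam) := (cont_uabs hl).comp (by fun_prop)
    have h4 : Continuous (fun x : ℝ => q.eval x) := q.continuous
    exact continuous_const.mul (h4.mul (h1.mul (h2.mul h3)))
  · rintro x ⟨⟨hx1, hx2⟩, hne⟩
    have hu : x - x₁ ≠ 0 := sub_ne_zero.2 hne
    have h1x : 0 < 1 - x := by linarith
    have h2x : 0 < 1 + x := by linarith
    have hu2 : 0 < (x - x₁) ^ 2 := by positivity
    have d1 : HasDerivAt (fun x : ℝ => (1 - x) ^ (α + 1)) (-(α + 1) * (1 - x) ^ α) x := by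
      have := ((hasDerivAt_id x).const_sub 1).rpow_const (p := α + 1) (Or.inl h1x.ne')
      exact this.congr_deriv (by simp)
    have d2 : HasDerivAt (fun x : ℝ => (1 + x) ^ (β + 1)) ((β + 1) * (1 + x) ^ β) x := by
      have := ((hasDerivAt_id x).const_add 1).rpow_const (p := β + 1) (Or.inl h2x.ne')
      exact this.congr_deriv (by simp)
    have d3 : HasDerivAt (fun x : ℝ => (x - x₁) * ((x - x₁) ^ 2) ^ lam) ((2 * lam + 1) * ((x - x₁) ^ 2) ^ lam) x := by
      have e1 := (hasDerivAt_id x).sub_const x₁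
      have e2 := (e1.pow 2).rpow_const (p := lam) (Or.inl hu2.ne')
      have e3 := e1.mul e2
      refine e3.congr_deriv ?_
      simp only [id, Pi.pow_apply]
      rw [Real.rpow_sub_one hu2.ne']
      field_simp
      ring
    have d := ((q.hasDerivAt x).mul (d1.mul (d2.mul d3))).const_mul A
    refine d.congr_deriv ?_
    simp only [hf', wt, abs_sq_rpow, Pi.mul_apply]
    rw [Real.rpow_add_one h1x.ne', Real.rpow_add_one h2x.ne']
    simp only [PhiP, NP, eval_add, eval_mul, eval_sub, eval_neg, eval_pow, eval_X, eval_C, derivative_add, derivative_sub,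
      derivative_neg, derivative_X_pow, derivative_C, derivative_C_mul_X_pow, derivative_X, eval_one, eval_zero, derivative_mul]
    push_cast
    ring
  · rw [intervalIntegrable_iff_integrableOn_Ioo_of_le (by norm_num)]; exact hi

end
end Magnus
end

section
open Polynomial Filter Topology MeasureTheory Set ComplexConjugate

namespace Magnus

structure SzD (c0 c1 l t K : ℝ) (L : ℝ[X] →ₗ[ℝ] ℝ) : Prop where
  t0 : 0 < t
  t1 : t < Real.pi
  h0 : -1 < 2 * c0
  h1 : -1 < 2 * c1
  h2 : -1 < 2 * l
  K0 : 0 < K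
  hL : ∀ q : ℝ[X], L q = ∫ θ, q.eval (Real.cos θ) * (K * ‖Sz.Df c0 c1 l t (Sz.ee θ)‖ ^ 2) ∂Sz.mu

/-- bounded factor -/
theorem pb_int {f : ℝ → ℝ} (hf : Integrable f Sz.mu) (q : ℝ[X]) : Integrable (fun θ => q.eval (Real.cos θ) * f θ) Sz.mu := by
  obtain ⟨C, hC⟩ := isCompact_Icc.exists_bound_of_continuousOn (s := Icc (-1 : ℝ) 1) (f := fun x => q.eval x) q.continuous.continuousOn
  refine hf.bdd_mul (c := C) ?_ (Eventually.of_forall fun θ => hC _ ⟨Real.neg_one_le_cos θ, Real.cos_le_one θ⟩)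
  have := q.continuous
  exact (this.comp Real.continuous_cos).aestronglyMeasurable

namespace SzD
variable {c0 c1 l t K : ℝ} {L : ℝ[X] →ₗ[ℝ] ℝ}

theorem nD_mble (c0 c1 l t : ℝ) : Measurable (fun θ => ‖Sz.Df c0 c1 l t (Sz.ee θ)‖) := (Sz.Df_mble c0 c1 l t).norm

theorem nD_sq_int (H : SzD c0 c1 l t K L) : Integrable (fun θ => ‖Sz.Df c0 c1 l t (Sz.ee θ)‖ ^ 2) Sz.mu := by
  refine (Sz.Gd_sq_int (Sz.CG c0 c1 l t) H.t0 H.t1 H.h0 H.h1 H.h2).mono' ((nD_mble c0 c1 l t).pow_const 2).aestronglyMeasurable ?_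
  filter_upwards [Sz.ae_pt H.t0 H.t1] with θ h
  have := Sz.Df_bd c0 c1 l h zero_le_one le_rfl
  rw [Complex.ofReal_one, one_mul] at this
  rw [Real.norm_of_nonneg (by positivity)]
  gcongr

theorem nD_int (H : SzD c0 c1 l t K L) : Integrable (fun θ => ‖Sz.Df c0 c1 l t (Sz.ee θ)‖) Sz.mu :=
  Sz.int_of_sq (nD_mble c0 c1 l t) H.nD_sq_int

/-- pairing functional -/
noncomputable def ell (c0 c1 l t : ℝ) (k : ℤ) (q : ℝ[X]) : ℝ :=
  ∫ θ, q.eval (Real.cos θ) * (Sz.ee (k * θ) * Sz.Df c0 c1 l t (Sz.ee θ)).re ∂Sz.mu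

theorem re_int (H : SzD c0 c1 l t K L) (k : ℤ) : Integrable (fun θ => (Sz.ee (k * θ) * Sz.Df c0 c1 l t (Sz.ee θ)).re) Sz.mu :=
  (Sz.ee_mul_int (Sz.Df_int H.t0 H.t1 H.h0 H.h1 H.h2) k).re

theorem ell_int (H : SzD c0 c1 l t K L) (k : ℤ) (q : ℝ[X]) :
    Integrable (fun θ => q.eval (Real.cos θ) * (Sz.ee (k * θ) * Sz.Df c0 c1 l t (Sz.ee θ)).re) Sz.mu := pb_int (H.re_int k) q

theorem ell_add (H : SzD c0 c1 l t K L) (k : ℤ) (q r : ℝ[X]) : ell c0 c1 l t k (q + r) = ell c0 c1 l t k q + ell c0 c1 l t k r := by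
  unfold ell
  simp only [eval_add, add_mul]
  exact integral_add (H.ell_int k q) (H.ell_int k r)

theorem ell_C (k : ℤ) (c : ℝ) (q : ℝ[X]) : ell c0 c1 l t k (C c * q) = c * ell c0 c1 l t k q := by
  unfold ell
  simp only [eval_mul, eval_C, mul_assoc]
  exact integral_const_mul _ _

theorem ell_X (H : SzD c0 c1 l t K L) (k : ℤ) (q : ℝ[X]) :
    ell c0 c1 l t k (X * q) = 1 / 2 * (ell c0 c1 l t (k + 1) q + ell c0 c1 l t (k - 1) q) := by
  unfold ell
  rw [← integral_add (H.ell_int _ q) (H.ell_int _ q), ← integral_const_mul]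
  refine integral_congr_ae (Eventually.of_forall fun θ => ?_)
  simp only [eval_mul, eval_X]
  have e1 : Sz.ee ((k + 1 : ℤ) * θ) = Sz.ee (k * θ) * Sz.ee θ := by rw [← Sz.ee_add]; push_cast; ring_nf
  have e2 : Sz.ee ((k - 1 : ℤ) * θ) = Sz.ee (k * θ) * Sz.ee (-θ) := by rw [← Sz.ee_add]; push_cast; ring_nf
  rw [e1, e2]
  simp only [Complex.mul_re, Complex.mul_im, Sz.ee_re, Sz.ee_im, Real.cos_neg, Real.sin_neg]
  ring

theorem ell_pos (H : SzD c0 c1 l t K L) (k : ℕ) (c : ℝ) : ell c0 c1 l t k (C c) = if k = 0 then c * Real.pi else 0 := by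
  unfold ell
  simp only [eval_C, Int.cast_natCast]
  rw [integral_const_mul, Sz.D1_nonneg H.t0 H.t1 H.h0 H.h1 H.h2]
  split_ifs <;> simp

theorem ell_neg (H : SzD c0 c1 l t K L) (c : ℝ) : ell c0 c1 l t (-1) (C c) = c * Real.pi * (c1 - c0 - 2 * l * Real.cos t) := by
  unfold ell
  simp only [eval_C]
  rw [integral_const_mul]
  have := Sz.D1_neg H.t0 H.t1 H.h0 H.h1 H.h2
  push_cast
  simp only [neg_mul, one_mul]
  rw [this]; ring

variable {x₁ σ N1 N0 : ℝ} {p : ℕ → ℝ[X]} {a b : ℕ → ℝ}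

theorem ell_rec (H : SzD c0 c1 l t K L) (S : OPSys x₁ σ N1 N0 L p a b) (k : ℤ) (m : ℕ) :
    a (m + 1) * ell c0 c1 l t k (p (m + 1)) = 1 / 2 * (ell c0 c1 l t (k + 1) (p m) + ell c0 c1 l t (k - 1) (p m))
      - b m * ell c0 c1 l t k (p m) - a m * ell c0 c1 l t k (p (m - 1)) := by
  have := congrArg (ell c0 c1 l t k) (S.recur m)
  rw [H.ell_X, H.ell_add, H.ell_add, ell_C, ell_C, ell_C] at this
  linarith

theorem p0 (S : OPSys x₁ σ N1 N0 L p a b) : p 0 = C ((p 0).coeff 0) := eq_C_of_natDegree_eq_zero (S.deg 0)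

theorem ell_big (H : SzD c0 c1 l t K L) (S : OPSys x₁ σ N1 N0 L p a b) (m : ℕ) : ∀ k : ℤ, (m : ℤ) < k → ell c0 c1 l t k (p m) = 0 := by
  induction m using Nat.strong_induction_on with
  | _ m ih =>
    intro k hk
    rcases m with _ | m
    · rw [p0 S]
      lift k to ℕ using (by omega)
      rw [H.ell_pos, if_neg (by push_cast at hk; omega)]
    · have h := H.ell_rec S k m
      have i1 := ih m (by omega) (k + 1) (by push_cast at hk; omega)
      have i2 := ih m (by omega) (k - 1) (by push_cast at hk; omega)
      have i3 := ih m (by omega) k (by push_cast at hk; omega)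
      have i4 := ih (m - 1) (by omega) k (by push_cast at hk; omega)
      rw [i1, i2, i3, i4] at h
      have := S.apos m
      have h2 : a (m + 1) * ell c0 c1 l t k (p (m + 1)) = 0 := by rw [h]; ring
      rcases mul_eq_zero.1 h2 with h3 | h3
      · linarith
      · exact h3

theorem ell_diag (H : SzD c0 c1 l t K L) (S : OPSys x₁ σ N1 N0 L p a b) (m : ℕ) :
    ell c0 c1 l t (m + 1 : ℕ) (p (m + 1)) * (2 * a (m + 1)) = ell c0 c1 l t m (p m) := by
  have h := H.ell_rec S (m + 1 : ℕ) m
  have e : (((m + 1 : ℕ) : ℤ) - 1) = m := by push_cast; ring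
  have i1 := H.ell_big S m (((m + 1 : ℕ) : ℤ) + 1) (by push_cast; omega)
  have i2 := H.ell_big S m ((m + 1 : ℕ) : ℤ) (by push_cast; omega)
  have i3 := H.ell_big S (m - 1) ((m + 1 : ℕ) : ℤ) (by push_cast; omega)
  rw [i1, e, i2, i3] at h
  linarith

theorem a0_ell (H : SzD c0 c1 l t K L) (S : OPSys x₁ σ N1 N0 L p a b) (m : ℕ) : a m * ell c0 c1 l t m (p (m - 1)) = 0 := by
  rcases m with _ | m
  · rw [S.a0, zero_mul]
  · rw [H.ell_big S _ _ (by push_cast; omega), mul_zero]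

theorem ell_off (H : SzD c0 c1 l t K L) (S : OPSys x₁ σ N1 N0 L p a b) (m : ℕ) :
    ell c0 c1 l t (m - 1 : ℤ) (p m) = ell c0 c1 l t m (p m) *
      ((c1 - c0 - 2 * l * Real.cos t) - 2 * ∑ k ∈ Finset.range m, b k) := by
  induction m with
  | zero =>
    rw [p0 S]
    have h1 := H.ell_pos 0 ((p 0).coeff 0)
    have h2 := H.ell_neg ((p 0).coeff 0)
    rw [if_pos rfl] at h1
    simp only [Nat.cast_zero, zero_sub, Finset.range_zero, Finset.sum_empty, mul_zero, sub_zero] at h1 ⊢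
    rw [h1, h2]
  | succ m ih =>
    have e : (((m + 1 : ℕ) : ℤ) - 1) = m := by push_cast; ring
    have h := H.ell_rec S m m
    rw [ih, H.a0_ell S, H.ell_big S m (m + 1) (by omega)] at h
    rw [e, Finset.sum_range_succ]
    have hd := H.ell_diag S m
    rw [← hd] at h
    have ha := S.apos m
    apply mul_left_cancel₀ ha.ne'
    rw [h]; ring

end SzD
end Magnus
end

section
open Polynomial Filter Topology MeasureTheory Set ComplexConjugate

namespace Magnus
namespace SzD
variable {c0 c1 l t K : ℝ} {L : ℝ[X] →ₗ[ℝ] ℝ}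

/-- the weighted polynomial on the half circle -/
noncomputable def ff (c0 c1 l t K : ℝ) (q : ℝ[X]) (θ : ℝ) : ℝ :=
  q.eval (Real.cos θ) * (Real.sqrt K * ‖Sz.Df c0 c1 l t (Sz.ee θ)‖)

/-- the comparison cosine -/
noncomputable def cc (c0 c1 l t : ℝ) (n : ℕ) (θ : ℝ) : ℝ :=
  Real.sqrt (2 / Real.pi) * Real.cos (n * θ + Sz.gam c0 c1 l t θ)

theorem ff_meas (c0 c1 l t K : ℝ) (q : ℝ[X]) : Measurable (ff c0 c1 l t K q) := by
  unfold ff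
  have h1 : Continuous (fun θ => q.eval (Real.cos θ)) := q.continuous.comp Real.continuous_cos
  exact h1.measurable.mul ((nD_mble c0 c1 l t).const_mul _)

theorem cc_meas (c0 c1 l t : ℝ) (n : ℕ) : Measurable (cc c0 c1 l t n) := by
  unfold cc
  exact (Real.measurable_cos.comp ((measurable_id.const_mul _).add (Sz.gam_mble c0 c1 l t))).const_mul _

theorem ff_sq (H : SzD c0 c1 l t K L) (q : ℝ[X]) (θ : ℝ) :
    ff c0 c1 l t K q θ ^ 2 = (q * q).eval (Real.cos θ) * (K * ‖Sz.Df c0 c1 l t (Sz.ee θ)‖ ^ 2) := by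
  unfold ff
  rw [mul_pow, mul_pow, Real.sq_sqrt H.K0.le, eval_mul]; ring

theorem ff_sq_int (H : SzD c0 c1 l t K L) (q : ℝ[X]) : Integrable (fun θ => ff c0 c1 l t K q θ ^ 2) Sz.mu := by
  simp only [H.ff_sq]
  exact pb_int (H.nD_sq_int.const_mul _) _

theorem ff_sq_val (H : SzD c0 c1 l t K L) (q : ℝ[X]) : ∫ θ, ff c0 c1 l t K q θ ^ 2 ∂Sz.mu = L (q * q) := by
  simp only [H.ff_sq]
  rw [H.hL]

theorem fc_eq (H : SzD c0 c1 l t K L) (n : ℕ) (q : ℝ[X]) : ∀ᵐ θ ∂Sz.mu, cc c0 c1 l t n θ * ff c0 c1 l t K q θ =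
    (Real.sqrt (2 / Real.pi) * Real.sqrt K) * (q.eval (Real.cos θ) * (Sz.ee ((n : ℤ) * θ) * Sz.Df c0 c1 l t (Sz.ee θ)).re) := by
  filter_upwards [Sz.ae_pt H.t0 H.t1] with θ h
  rw [Sz.Df_bdry c0 c1 l h]
  unfold cc ff
  have : (Sz.ee (((n:ℤ):ℝ) * θ) * (↑‖Sz.Df c0 c1 l t (Sz.ee θ)‖ * Sz.ee (Sz.gam c0 c1 l t θ))) =
    (‖Sz.Df c0 c1 l t (Sz.ee θ)‖ : ℂ) * Sz.ee (n * θ + Sz.gam c0 c1 l t θ) := by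
    rw [Sz.ee_add]; push_cast; ring
  rw [this, Complex.re_ofReal_mul, Sz.ee_re]
  ring

theorem fc_int (H : SzD c0 c1 l t K L) (n : ℕ) (q : ℝ[X]) : Integrable (fun θ => cc c0 c1 l t n θ * ff c0 c1 l t K q θ) Sz.mu :=
  ((H.ell_int n q).const_mul _).congr ((H.fc_eq n q).mono fun _ h => h.symm)

theorem fc_val (H : SzD c0 c1 l t K L) (n : ℕ) (q : ℝ[X]) : ∫ θ, cc c0 c1 l t n θ * ff c0 c1 l t K q θ ∂Sz.mu =
    (Real.sqrt (2 / Real.pi) * Real.sqrt K) * ell c0 c1 l t n q := by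
  rw [integral_congr_ae (H.fc_eq n q), integral_const_mul]; rfl

theorem cc_sq (c0 c1 l t : ℝ) (n : ℕ) (θ : ℝ) : cc c0 c1 l t n θ ^ 2 =
    1 / Real.pi + 1 / Real.pi * Real.cos (2 * n * θ + 2 * Sz.gam c0 c1 l t θ) := by
  unfold cc
  have hpi := Real.pi_pos
  rw [mul_pow, Real.sq_sqrt (by positivity), Real.cos_sq]
  have : 2 * (n * θ + Sz.gam c0 c1 l t θ) = 2 * n * θ + 2 * Sz.gam c0 c1 l t θ := by ring
  rw [this]; field_simp

theorem co_int (c0 c1 l t : ℝ) (n : ℕ) : Integrable (fun θ => Real.cos (2 * n * θ + 2 * Sz.gam c0 c1 l t θ)) Sz.mu := by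
  refine (integrable_const (1:ℝ)).mono' ?_ (Eventually.of_forall fun θ => Real.abs_cos_le_one _)
  exact (Real.measurable_cos.comp ((measurable_id.const_mul _).add ((Sz.gam_mble c0 c1 l t).const_mul _))).aestronglyMeasurable

theorem cc_sq_int (c0 c1 l t : ℝ) (n : ℕ) : Integrable (fun θ => cc c0 c1 l t n θ ^ 2) Sz.mu := by
  simp only [cc_sq]
  exact (integrable_const _).add ((co_int c0 c1 l t n).const_mul _)

theorem cc_sq_val (c0 c1 l t : ℝ) (n : ℕ) : ∫ θ, cc c0 c1 l t n θ ^ 2 ∂Sz.mu =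
    1 + 1 / Real.pi * ∫ θ, Real.cos (2 * n * θ + 2 * Sz.gam c0 c1 l t θ) ∂Sz.mu := by
  simp only [cc_sq]
  rw [integral_add (integrable_const _) ((co_int c0 c1 l t n).const_mul _), integral_const_mul]
  congr 1
  have hpi := Real.pi_pos
  simp [Measure.real, ENNReal.toReal_ofReal hpi.le]

theorem bes_int (H : SzD c0 c1 l t K L) (n : ℕ) (q : ℝ[X]) :
    Integrable (fun θ => (cc c0 c1 l t n θ - ff c0 c1 l t K q θ) ^ 2) Sz.mu := by
  have : (fun θ => (cc c0 c1 l t n θ - ff c0 c1 l t K q θ) ^ 2) = fun θ => cc c0 c1 l t n θ ^ 2 - 2 * (cc c0 c1 l t n θ * ff c0 c1 l t K q θ) + ff c0 c1 l t K q θ ^ 2 := by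
    funext θ; ring
  rw [this]
  exact ((cc_sq_int _ _ _ _ n).sub ((H.fc_int n q).const_mul 2)).add (H.ff_sq_int q)

theorem bes_val (H : SzD c0 c1 l t K L) (n : ℕ) (q : ℝ[X]) :
    ∫ θ, (cc c0 c1 l t n θ - ff c0 c1 l t K q θ) ^ 2 ∂Sz.mu =
      1 + 1 / Real.pi * (∫ θ, Real.cos (2 * n * θ + 2 * Sz.gam c0 c1 l t θ) ∂Sz.mu) -
      2 * ((Real.sqrt (2 / Real.pi) * Real.sqrt K) * ell c0 c1 l t n q) + L (q * q) := by
  have : (fun θ => (cc c0 c1 l t n θ - ff c0 c1 l t K q θ) ^ 2) = fun θ => cc c0 c1 l t n θ ^ 2 - 2 * (cc c0 c1 l t n θ * ff c0 c1 l t K q θ) + ff c0 c1 l t K q θ ^ 2 := by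
    funext θ; ring
  have hI : Integrable (fun θ => cc c0 c1 l t n θ ^ 2 - 2 * (cc c0 c1 l t n θ * ff c0 c1 l t K q θ)) Sz.mu :=
    (cc_sq_int _ _ _ _ n).sub ((H.fc_int n q).const_mul 2)
  rw [this, integral_add hI (H.ff_sq_int q), integral_sub (cc_sq_int _ _ _ _ n) ((H.fc_int n q).const_mul 2), cc_sq_val, integral_const_mul, H.fc_val, H.ff_sq_val]

variable {x₁ σ N1 N0 : ℝ} {p : ℕ → ℝ[X]} {a b : ℕ → ℝ}

/-- normalised diagonal pairing -/
noncomputable def uu (c0 c1 l t K : ℝ) (p : ℕ → ℝ[X]) (n : ℕ) : ℝ := (Real.sqrt (2 / Real.pi) * Real.sqrt K) * ell c0 c1 l t n (p n)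

theorem uu_rec (H : SzD c0 c1 l t K L) (S : OPSys x₁ σ N1 N0 L p a b) (n : ℕ) :
    uu c0 c1 l t K p (n + 1) * (2 * a (n + 1)) = uu c0 c1 l t K p n := by
  unfold uu
  rw [← H.ell_diag S n]; ring

theorem ell_gt (H : SzD c0 c1 l t K L) (S : OPSys x₁ σ N1 N0 L p a b) (hp0 : 0 < (p 0).coeff 0) (n : ℕ) :
    0 < ell c0 c1 l t n (p n) := by
  induction n with
  | zero =>
    rw [p0 S, H.ell_pos, if_pos rfl]
    have := Real.pi_pos
    positivity
  | succ n ih =>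
    have h := H.ell_diag S n
    have ha := S.apos n
    rw [← h] at ih
    exact pos_of_mul_pos_left ih (by positivity)

open Chebyshev in
theorem tau_rec (S : OPSys x₁ σ N1 N0 L p a b) (n : ℕ) (hn : 1 ≤ n) :
    L (T ℝ ((n + 1 : ℕ) : ℤ) * p (n + 1)) = 2 * a (n + 1) * L (T ℝ (n : ℤ) * p n) := by
  obtain ⟨m, rfl⟩ : ∃ m, n = m + 1 := ⟨n - 1, by omega⟩
  have h := T_add_two ℝ (m : ℤ)
  have e1 : ((m + 1 + 1 : ℕ) : ℤ) = (m : ℤ) + 2 := by push_cast; ring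
  have e2 : ((m + 1 : ℕ) : ℤ) = (m : ℤ) + 1 := by push_cast; ring
  have hd : ∀ k : ℕ, (T ℝ (k : ℤ)).natDegree = k := by
    intro k; rw [natDegree_T]; simp
  have o1 := S.orthdeg (T ℝ (m : ℤ)) (m + 1 + 1) (by rw [hd]; omega)
  have o2 := S.orthdeg (T ℝ ((m + 1 : ℕ) : ℤ)) (m + 1 + 1) (by rw [hd]; omega)
  have o3 := S.orthdeg (T ℝ ((m + 1 : ℕ) : ℤ)) (m + 1 + 1 + 1) (by rw [hd]; omega)
  have r := S.ruleX (T ℝ ((m + 1 : ℕ) : ℤ)) (m + 1 + 1)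
  rw [o2, o3, Nat.add_sub_cancel] at r
  rw [e1, h, ← e2]
  have : (2 * X * T ℝ ((m + 1 : ℕ) : ℤ) - T ℝ (m : ℤ)) * p (m + 1 + 1) =
    C 2 * (X * T ℝ ((m + 1 : ℕ) : ℤ) * p (m + 1 + 1)) - T ℝ (m : ℤ) * p (m + 1 + 1) := by
    have : (C (2:ℝ) : ℝ[X]) = 2 := rfl
    rw [this]; ring
  rw [this, map_sub, OPSys.LC, o1, r]; ring

open Chebyshev in
theorem tau_ell (H : SzD c0 c1 l t K L) (S : OPSys x₁ σ N1 N0 L p a b) (n : ℕ) :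
    L (T ℝ ((n + 1 : ℕ) : ℤ) * p (n + 1)) * ell c0 c1 l t (n + 1 : ℕ) (p (n + 1)) = Real.pi / 2 := by
  induction n with
  | zero =>
    have r := S.ruleX 1 1
    have o1 := S.orthdeg 1 1 (by simp)
    have o2 := S.orthdeg 1 2 (by simp)
    rw [o1] at r
    norm_num at r
    rw [one_mul] at o2
    rw [o2] at r
    have d := H.ell_diag S 0
    have n0 := S.orth 0 0
    rw [if_pos rfl] at n0
    have h1 : ell c0 c1 l t (0 : ℕ) (p 0) = (p 0).coeff 0 * Real.pi := by
      rw [p0 S, H.ell_pos, if_pos rfl]; simp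
    have h2 : (p 0).coeff 0 * L (p 0) = 1 := by
      rw [← OPSys.LC, ← p0 S]; exact n0
    have ha := S.apos 0
    rw [h1] at d
    simp only [zero_add, Nat.cast_one, T_one] at d r ⊢
    rw [r]
    linear_combination L (p 0) / 2 * d + Real.pi / 2 * h2
  | succ n ih =>
    rw [tau_rec S (n + 1) (by omega), ← ih, ← H.ell_diag S (n + 1)]; ring

end SzD
end Magnus
end

section
open Polynomial Filter Topology MeasureTheory Set ComplexConjugate

namespace Magnus
namespace SzD
variable {c0 c1 l t K : ℝ} {L : ℝ[X] →ₗ[ℝ] ℝ}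
variable {x₁ σ N1 N0 : ℝ} {p : ℕ → ℝ[X]} {a b : ℕ → ℝ}

theorem tau_lim (H : SzD c0 c1 l t K L) (S : OPSys x₁ σ N1 N0 L p a b) {δ : ℝ} (hδ : 0 < δ) :
    ∃ N : ℕ, ∀ n ≥ N, |L (Chebyshev.T ℝ (n : ℤ) * p n) - K * ell c0 c1 l t n (p n)| ≤ δ := by
  have hK := H.K0
  obtain ⟨N, c, hN, hc0, hc⟩ := Sz.D2 H.t0 H.t1 H.h0 H.h1 H.h2 (c0 := c0) (c1 := c1) (l := l) (ε := δ ^ 2 / K) (by positivity)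
  refine ⟨N, fun n hn => ?_⟩
  obtain ⟨P, hP⟩ : ∃ P : ℝ → ℂ, P = fun θ => ∑ j ∈ Finset.range N, (c j : ℂ) * Sz.ee θ ^ j := ⟨_, rfl⟩
  obtain ⟨D, hD⟩ : ∃ D : ℝ → ℂ, D = fun θ => Sz.Df c0 c1 l t (Sz.ee θ) := ⟨_, rfl⟩
  have hDm : Measurable D := by rw [hD]; exact Sz.Df_mble _ _ _ _
  have hPc : Continuous P := by
    rw [hP]
    have := Sz.ee_cont
    fun_prop
  obtain ⟨Q, hQ⟩ : ∃ Q : ℝ[X], Q = ∑ j ∈ Finset.range N, C (c j) * Chebyshev.T ℝ ((n - j : ℕ) : ℤ) := ⟨_, rfl⟩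
  have hQe : ∀ θ, Q.eval (Real.cos θ) = (Sz.ee (n * θ) * conj (P θ)).re := by
    intro θ
    rw [hQ, hP, eval_finset_sum]
    simp only [map_sum, Finset.mul_sum, Complex.re_sum]
    refine Finset.sum_congr rfl fun j hj => ?_
    have hj' := Finset.mem_range.1 hj
    rw [eval_mul, eval_C, Chebyshev.T_real_cos, map_mul, Complex.conj_ofReal, Sz.ee_pow, Sz.ee_conj]
    have : Sz.ee (n * θ) * (↑(c j) * Sz.ee (-(j * θ))) = (c j : ℂ) * Sz.ee (n * θ + -(j * θ)) := by rw [Sz.ee_add]; ring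
    rw [this, Complex.re_ofReal_mul, Sz.ee_re]
    congr 2
    rw [Int.cast_natCast, Nat.cast_sub (by omega)]; ring
  have hLQ : L (Chebyshev.T ℝ (n : ℤ) * p n) = L (Q * p n) := by
    rw [hQ, Finset.sum_mul, map_sum]
    rw [Finset.sum_eq_single_of_mem 0 (Finset.mem_range.2 (by omega))]
    · rw [hc0]; simp
    · intro j hj hj0
      have hj' := Finset.mem_range.1 hj
      rw [mul_assoc, OPSys.LC, S.orthdeg, mul_zero]
      rw [Chebyshev.natDegree_T]; simp; omega
  have hI1 : Integrable (fun θ => (Q * p n).eval (Real.cos θ) * (K * ‖D θ‖ ^ 2)) Sz.mu := by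
    rw [hD]; exact pb_int (H.nD_sq_int.const_mul _) _
  have hI2 : Integrable (fun θ => K * ((p n).eval (Real.cos θ) * (Sz.ee ((n : ℤ) * θ) * D θ).re)) Sz.mu := by
    rw [hD]; exact (H.ell_int n (p n)).const_mul K
  have hI3 : Integrable (fun θ => (p n * p n).eval (Real.cos θ) * (K * ‖D θ‖ ^ 2)) Sz.mu := by
    rw [hD]; exact pb_int (H.nD_sq_int.const_mul _) _
  have hI4 : Integrable (fun θ => ‖P θ * D θ - 1‖ ^ 2) Sz.mu := by
    have hb : Integrable (fun θ => 2 * ((∑ j ∈ Finset.range N, |c j|) ^ 2 * ‖D θ‖ ^ 2) + 2) Sz.mu := by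
      have := H.nD_sq_int
      rw [hD]
      exact ((this.const_mul _).const_mul _).add (integrable_const _)
    refine hb.mono' (((hPc.measurable.mul hDm).sub_const 1).norm.pow_const 2).aestronglyMeasurable (Eventually.of_forall fun θ => ?_)
    rw [Real.norm_of_nonneg (by positivity)]
    have h1 : ‖P θ‖ ≤ ∑ j ∈ Finset.range N, |c j| := by
      rw [hP]
      refine (norm_sum_le _ _).trans (Finset.sum_le_sum fun j _ => ?_)
      rw [norm_mul, norm_pow, Sz.ee_norm]; simp
    have h2 : ‖P θ * D θ - 1‖ ≤ (∑ j ∈ Finset.range N, |c j|) * ‖D θ‖ + 1 := by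
      refine (norm_sub_le _ _).trans ?_
      rw [norm_mul, norm_one]; gcongr
    calc ‖P θ * D θ - 1‖ ^ 2 ≤ ((∑ j ∈ Finset.range N, |c j|) * ‖D θ‖ + 1) ^ 2 := by gcongr
      _ ≤ _ := by nlinarith [sq_nonneg ((∑ j ∈ Finset.range N, |c j|) * ‖D θ‖ - 1)]
  have e3 : ∫ θ, (p n * p n).eval (Real.cos θ) * (K * ‖D θ‖ ^ 2) ∂Sz.mu = 1 := by
    have := H.hL (p n * p n)
    rw [S.orth, if_pos rfl] at this
    rw [hD]; exact this.symm
  have e4 : ∫ θ, ‖P θ * D θ - 1‖ ^ 2 ∂Sz.mu ≤ δ ^ 2 / K := by rw [hP, hD]; exact hc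
  have ediff : L (Chebyshev.T ℝ (n : ℤ) * p n) - K * ell c0 c1 l t n (p n) =
    ∫ θ, ((Q * p n).eval (Real.cos θ) * (K * ‖D θ‖ ^ 2) - K * ((p n).eval (Real.cos θ) * (Sz.ee ((n : ℤ) * θ) * D θ).re)) ∂Sz.mu := by
    rw [integral_sub hI1 hI2, hLQ, H.hL, integral_const_mul, hD]; rfl
  rw [ediff]
  have hb : Integrable (fun θ => δ / 2 * ((p n * p n).eval (Real.cos θ) * (K * ‖D θ‖ ^ 2)) + K / (2 * δ) * ‖P θ * D θ - 1‖ ^ 2) Sz.mu :=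
    (hI3.const_mul _).add (hI4.const_mul _)
  have hle : |∫ θ, ((Q * p n).eval (Real.cos θ) * (K * ‖D θ‖ ^ 2) - K * ((p n).eval (Real.cos θ) * (Sz.ee ((n : ℤ) * θ) * D θ).re)) ∂Sz.mu|
     ≤ ∫ θ, (δ / 2 * ((p n * p n).eval (Real.cos θ) * (K * ‖D θ‖ ^ 2)) + K / (2 * δ) * ‖P θ * D θ - 1‖ ^ 2) ∂Sz.mu := by
    rw [← Real.norm_eq_abs]
    refine MeasureTheory.norm_integral_le_of_norm_le hb (Eventually.of_forall fun θ => ?_)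
    have h1 : (Q * p n).eval (Real.cos θ) * (K * ‖D θ‖ ^ 2) - K * ((p n).eval (Real.cos θ) * (Sz.ee ((n : ℤ) * θ) * D θ).re)
      = K * (p n).eval (Real.cos θ) * (Sz.ee (n * θ) * D θ * conj (P θ * D θ - 1)).re := by
      rw [eval_mul, hQe]
      have : Sz.ee (n * θ) * D θ * conj (P θ * D θ - 1) = ((‖D θ‖ ^ 2 : ℝ) : ℂ) * (Sz.ee (n * θ) * conj (P θ)) - Sz.ee (n * θ) * D θ := by
        rw [← Complex.normSq_eq_norm_sq, ← Complex.mul_conj, map_sub, map_mul, map_one]; ring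
      rw [this, Complex.sub_re, Complex.re_ofReal_mul, Int.cast_natCast]; ring
    rw [h1, Real.norm_eq_abs, abs_mul, abs_mul, abs_of_pos hK, eval_mul]
    have h2 : |(Sz.ee (n * θ) * D θ * conj (P θ * D θ - 1)).re| ≤ ‖D θ‖ * ‖P θ * D θ - 1‖ := by
      refine (Complex.abs_re_le_norm _).trans ?_
      rw [norm_mul, norm_mul, Sz.ee_norm, one_mul, RCLike.norm_conj]
    obtain ⟨x, hx⟩ : ∃ x, x = |(p n).eval (Real.cos θ)| * ‖D θ‖ := ⟨_, rfl⟩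
    obtain ⟨y, hy⟩ : ∃ y, y = ‖P θ * D θ - 1‖ := ⟨_, rfl⟩
    have h3 : (p n).eval (Real.cos θ) * (p n).eval (Real.cos θ) * (K * ‖D θ‖ ^ 2) = K * x ^ 2 := by
      rw [hx, mul_pow, sq_abs]; ring
    rw [h3, ← hy]
    calc _ ≤ K * |(p n).eval (Real.cos θ)| * (‖D θ‖ * ‖P θ * D θ - 1‖) := by gcongr
      _ = K * (x * y) := by rw [hx, hy]; ring
      _ ≤ _ := by
        have : δ / 2 * (K * x ^ 2) + K / (2 * δ) * y ^ 2 - K * (x * y) = K / (2 * δ) * (δ * x - y) ^ 2 := by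
          field_simp; ring
        have : 0 ≤ K / (2 * δ) * (δ * x - y) ^ 2 := by positivity
        linarith
  refine hle.trans ?_
  rw [integral_add (hI3.const_mul _) (hI4.const_mul _), integral_const_mul, integral_const_mul, e3]
  have : K / (2 * δ) * ∫ θ, ‖P θ * D θ - 1‖ ^ 2 ∂Sz.mu ≤ K / (2 * δ) * (δ ^ 2 / K) := by gcongr
  have e : K / (2 * δ) * (δ ^ 2 / K) = δ / 2 := by field_simp
  linarith

theorem uu_pos (H : SzD c0 c1 l t K L) (S : OPSys x₁ σ N1 N0 L p a b) (hp0 : 0 < (p 0).coeff 0) (n : ℕ) :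
    0 < uu c0 c1 l t K p n := by
  have := H.ell_gt S hp0 n
  have := H.K0
  have := Real.pi_pos
  unfold uu; positivity

theorem uu_lim (H : SzD c0 c1 l t K L) (S : OPSys x₁ σ N1 N0 L p a b) (hp0 : 0 < (p 0).coeff 0) :
    Tendsto (uu c0 c1 l t K p) atTop (𝓝 1) := by
  rw [Metric.tendsto_atTop]
  intro ε hε
  have hK := H.K0
  have hpi := Real.pi_pos
  obtain ⟨r, hr⟩ : ∃ r, r = Real.sqrt (2 / Real.pi) * Real.sqrt K := ⟨_, rfl⟩
  have hr0 : 0 < r := by rw [hr]; positivity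
  have hr2 : r ^ 2 = 2 / Real.pi * K := by rw [hr, mul_pow, Real.sq_sqrt (by positivity), Real.sq_sqrt hK.le]
  obtain ⟨N, hN⟩ := H.tau_lim S (δ := ε / 2 * (Real.pi / 2 * r)) (by positivity)
  refine ⟨N + 1, fun n hn => ?_⟩
  have h1 := hN n (by omega)
  obtain ⟨m, rfl⟩ : ∃ m, n = m + 1 := ⟨n - 1, by omega⟩
  have h2 := H.tau_ell S m
  have hu := H.uu_pos S hp0 (m + 1)
  have hue : uu c0 c1 l t K p (m + 1) = r * ell c0 c1 l t (m + 1 : ℕ) (p (m + 1)) := by rw [hr]; rfl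
  obtain ⟨e, he⟩ : ∃ e, e = ell c0 c1 l t (m + 1 : ℕ) (p (m + 1)) := ⟨_, rfl⟩
  obtain ⟨τ, hτ⟩ : ∃ τ, τ = L (Chebyshev.T ℝ ((m + 1 : ℕ) : ℤ) * p (m + 1)) := ⟨_, rfl⟩
  obtain ⟨u, hu'⟩ : ∃ u, u = uu c0 c1 l t K p (m + 1) := ⟨_, rfl⟩
  rw [← hτ, ← he] at h1 h2
  rw [← hu'] at hu ⊢
  rw [← he, ← hu'] at hue
  have h3 : (u - 1) * (u + 1) = u * (-(τ - K * e) / (Real.pi / 2 * r)) := by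
    rw [hue]
    field_simp
    linear_combination 2 * h2 + Real.pi * e ^ 2 * hr2 + 2 * K * e^2 * (mul_inv_cancel₀ hpi.ne')
  have h4 : |u - 1| * (u + 1) ≤ u * (ε / 2) := by
    have := congrArg abs h3
    rw [abs_mul, abs_mul, abs_of_pos hu, abs_of_pos (by linarith : 0 < u + 1)] at this
    rw [this]
    gcongr
    rw [abs_div, abs_neg, abs_of_pos (by positivity : 0 < Real.pi / 2 * r), div_le_iff₀ (by positivity)]
    exact h1
  rw [Real.dist_eq]
  by_contra hcon
  push Not at hcon
  nlinarith

theorem a_lim (H : SzD c0 c1 l t K L) (S : OPSys x₁ σ N1 N0 L p a b) (hp0 : 0 < (p 0).coeff 0) :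
    Tendsto a atTop (𝓝 (1 / 2)) := by
  rw [← tendsto_add_atTop_iff_nat 1]
  have h := H.uu_lim S hp0
  have h1 := (tendsto_add_atTop_iff_nat 1).2 h
  have h2 := (h.div h1 one_ne_zero).div_const 2
  rw [div_one] at h2
  refine h2.congr fun n => ?_
  have := H.uu_rec S n
  have h3 := H.uu_pos S hp0 (n + 1)
  rw [Pi.div_apply, ← this]; field_simp

theorem b_lim (H : SzD c0 c1 l t K L) (S : OPSys x₁ σ N1 N0 L p a b) (hp0 : 0 < (p 0).coeff 0) :
    Tendsto (fun n => (c1 - c0 - 2 * l * Real.cos t) / 2 - ∑ k ∈ Finset.range n, b k) atTop (𝓝 0) := by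
  rw [← tendsto_add_atTop_iff_nat 1]
  have hu := H.uu_lim S hp0
  have hu1 := (tendsto_add_atTop_iff_nat 1).2 hu
  have hh := (Sz.D3 (c0 := c0) (c1 := c1) (l := l) H.t0 H.t1).tendsto le_rfl
  have hM : Tendsto (fun n => (uu c0 c1 l t K p (n + 1) * ((c1 - c0 - 2 * l * Real.cos t) - 2 * ∑ k ∈ Finset.range (n + 1), b k)) ^ 2) atTop (𝓝 0) := by
    have hup : Tendsto (fun n : ℕ => 1 + 1 / Real.pi * (∫ θ, Real.cos (2 * n * θ + 2 * Sz.gam c0 c1 l t θ) ∂Sz.mu) - uu c0 c1 l t K p n ^ 2) atTop (𝓝 0) := by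
      have := ((hh.const_mul (1 / Real.pi)).const_add 1).sub (hu.pow 2)
      norm_num at this ⊢
      exact this
    refine tendsto_of_tendsto_of_tendsto_of_le_of_le tendsto_const_nhds hup (fun n => sq_nonneg _) (fun n => ?_)
    obtain ⟨M, hMd⟩ : ∃ M, M = uu c0 c1 l t K p (n + 1) * ((c1 - c0 - 2 * l * Real.cos t) - 2 * ∑ k ∈ Finset.range (n + 1), b k) := ⟨_, rfl⟩
    obtain ⟨u, hud⟩ : ∃ u, u = uu c0 c1 l t K p n := ⟨_, rfl⟩
    have hoff := H.ell_off S (n + 1)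
    have e : (((n + 1 : ℕ) : ℤ) - 1) = n := by push_cast; ring
    rw [e] at hoff
    have hM2 : M = Real.sqrt (2 / Real.pi) * Real.sqrt K * ell c0 c1 l t n (p (n + 1)) := by
      rw [hoff, hMd]; unfold uu; ring
    have hv := H.bes_val n (C u * p n + C M * p (n + 1))
    have h0 : 0 ≤ ∫ θ, (cc c0 c1 l t n θ - ff c0 c1 l t K (C u * p n + C M * p (n + 1)) θ) ^ 2 ∂Sz.mu := integral_nonneg fun θ => sq_nonneg _
    have hq : L ((C u * p n + C M * p (n + 1)) * (C u * p n + C M * p (n + 1))) = u ^ 2 + M ^ 2 := by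
      have : (C u * p n + C M * p (n + 1)) * (C u * p n + C M * p (n + 1)) = C (u ^ 2) * (p n * p n) + C (2 * u * M) * (p n * p (n + 1)) + C (M ^ 2) * (p (n + 1) * p (n + 1)) := by
        have : (C (2:ℝ) : ℝ[X]) = 2 := rfl
        simp only [C_mul, C_pow, this]; ring
      rw [this, map_add, map_add, OPSys.LC, OPSys.LC, OPSys.LC, S.orth, S.orth, S.orth]
      simp
    have he : Real.sqrt (2 / Real.pi) * Real.sqrt K * ell c0 c1 l t n (C u * p n + C M * p (n + 1)) = u ^ 2 + M ^ 2 := by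
      rw [H.ell_add, ell_C, ell_C]
      have : u = Real.sqrt (2 / Real.pi) * Real.sqrt K * ell c0 c1 l t n (p n) := hud
      linear_combination -u * this - M * hM2
    rw [hq, he] at hv
    simp only [← hMd, ← hud]
    linarith
  have hM1 : Tendsto (fun n => uu c0 c1 l t K p (n + 1) * ((c1 - c0 - 2 * l * Real.cos t) - 2 * ∑ k ∈ Finset.range (n + 1), b k)) atTop (𝓝 0) := by
    have := hM.sqrt
    rw [Real.sqrt_zero] at this
    simp only [Real.sqrt_sq_eq_abs] at this
    exact (tendsto_zero_iff_abs_tendsto_zero _).2 this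
  have := (hM1.div hu1 one_ne_zero).div_const 2
  rw [zero_div, zero_div] at this
  refine this.congr fun n => ?_
  have h3 := H.uu_pos S hp0 (n + 1)
  rw [Pi.div_apply]; field_simp

/-- L2 distance -/
theorem bes_diag (H : SzD c0 c1 l t K L) (S : OPSys x₁ σ N1 N0 L p a b) (hu : Ok 1 (fun n => uu c0 c1 l t K p n - 1)) :
    Ok 1 (fun n => ∫ θ, (cc c0 c1 l t n θ - ff c0 c1 l t K (p n) θ) ^ 2 ∂Sz.mu) := by
  have hh := Sz.D3 (c0 := c0) (c1 := c1) (l := l) H.t0 H.t1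
  have := (hh.cmul (1 / Real.pi)).sub (hu.cmul 2)
  refine this.of_ev 0 fun n _ => ?_
  rw [H.bes_val, S.orth, if_pos rfl]
  have : uu c0 c1 l t K p n = Real.sqrt (2 / Real.pi) * Real.sqrt K * ell c0 c1 l t n (p n) := rfl
  rw [← this]; ring

end SzD
end Magnus
end

section
open Filter Topology Set

namespace Magnus

theorem energy {c T G S : ℝ} (hc : -1 < c) (hG : 0 ≤ G) {y1 y2 e1 e2 : ℝ → ℝ}
    (d1 : ∀ t, 0 < t → t ≤ T → HasDerivAt y1 (-y2 t + e1 t) t)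
    (d2 : ∀ t, 0 < t → t ≤ T → HasDerivAt y2 (y1 t - c / t * y2 t + e2 t) t)
    (b1 : ∀ t, 0 < t → t ≤ T → |e1 t| ≤ G) (b2 : ∀ t, 0 < t → t ≤ T → |e2 t| ≤ G)
    (s1 : ∀ t, 0 < t → t ≤ T → |y1 t| ≤ S * t) (s2 : ∀ t, 0 < t → t ≤ T → |y2 t| ≤ S * t)
    {t : ℝ} (ht : 0 < t) (htT : t ≤ T) : y1 t ^ 2 + y2 t ^ 2 ≤ 2 / (1 - max (-c) 0) ^ 2 * G ^ 2 * t ^ 2 := by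
  obtain ⟨k, hk⟩ : ∃ k, k = max (-c) 0 := ⟨_, rfl⟩
  have hk0 : 0 ≤ k := by rw [hk]; exact le_max_right _ _
  have hkc : -c ≤ k := by rw [hk]; exact le_max_left _ _
  have hk1 : k < 1 := by rw [hk]; exact max_lt (by linarith) one_pos
  rw [← hk]
  obtain ⟨δ, hδ⟩ : ∃ δ, δ = 1 - k := ⟨_, rfl⟩
  have hδ0 : 0 < δ := by linarith
  rw [← hδ]
  obtain ⟨Ψ, hΨ⟩ : ∃ Ψ : ℝ → ℝ, Ψ = fun t => t ^ (-(1 + k)) * (y1 t ^ 2 + y2 t ^ 2) - 2 * G ^ 2 / δ ^ 2 * t ^ δ := ⟨_, rfl⟩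
  have hd : ∀ t, 0 < t → t ≤ T → HasDerivAt Ψ (-(1 + k) * t ^ (-(1 + k) - 1) * (y1 t ^ 2 + y2 t ^ 2) +
      t ^ (-(1 + k)) * (2 * y1 t * (-y2 t + e1 t) + 2 * y2 t * (y1 t - c / t * y2 t + e2 t)) - 2 * G ^ 2 / δ ^ 2 * (δ * t ^ (δ - 1))) t := by
    intro t h0 h1
    have r1 := Real.hasDerivAt_rpow_const (x := t) (p := -(1 + k)) (Or.inl h0.ne')
    have r2 := Real.hasDerivAt_rpow_const (x := t) (p := δ) (Or.inl h0.ne')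
    have r3 := ((d1 t h0 h1).pow 2).add ((d2 t h0 h1).pow 2)
    rw [hΨ]
    refine ((r1.mul r3).sub (r2.const_mul (2 * G ^ 2 / δ ^ 2))).congr_deriv ?_
    simp only [Pi.add_apply, Pi.pow_apply]
    push_cast
    ring
  have hdn : ∀ t, 0 < t → t ≤ T → -(1 + k) * t ^ (-(1 + k) - 1) * (y1 t ^ 2 + y2 t ^ 2) +
      t ^ (-(1 + k)) * (2 * y1 t * (-y2 t + e1 t) + 2 * y2 t * (y1 t - c / t * y2 t + e2 t)) - 2 * G ^ 2 / δ ^ 2 * (δ * t ^ (δ - 1)) ≤ 0 := by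
    intro t h0 h1
    have p1 : t ^ (-(1 + k) - 1) = t ^ (-(1 + k)) / t := by rw [Real.rpow_sub h0, Real.rpow_one]
    have p2 : t ^ (δ - 1) = t ^ (-(1 + k)) * t := by
      have : δ - 1 = -(1 + k) + 1 := by linarith
      rw [this, Real.rpow_add h0, Real.rpow_one]
    rw [p1, p2]
    have hp : 0 < t ^ (-(1 + k)) := Real.rpow_pos_of_pos h0 _
    obtain ⟨q, hq⟩ : ∃ q, q = t ^ (-(1 + k)) := ⟨_, rfl⟩
    rw [← hq] at hp ⊢
    obtain ⟨Y1, hY1⟩ : ∃ Y, Y = y1 t := ⟨_, rfl⟩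
    obtain ⟨Y2, hY2⟩ : ∃ Y, Y = y2 t := ⟨_, rfl⟩
    obtain ⟨E1, hE1⟩ : ∃ Y, Y = e1 t := ⟨_, rfl⟩
    obtain ⟨E2, hE2⟩ : ∃ Y, Y = e2 t := ⟨_, rfl⟩
    have B1 := b1 t h0 h1
    have B2 := b2 t h0 h1
    rw [← hE1] at B1
    rw [← hE2] at B2
    rw [← hY1, ← hY2, ← hE1, ← hE2]
    have key : -(1 + k) / t * (Y1 ^ 2 + Y2 ^ 2) + (2 * Y1 * (-Y2 + E1) + 2 * Y2 * (Y1 - c / t * Y2 + E2)) - 2 * G ^ 2 / δ * t ≤ 0 := by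
      have am : ∀ Y E : ℝ, |E| ≤ G → 2 * Y * E ≤ δ / t * Y ^ 2 + t / δ * G ^ 2 := by
        intro Y E hE
        have h1 : δ / t * Y ^ 2 + t / δ * E ^ 2 - 2 * Y * E = (δ * Y - t * E) ^ 2 / (t * δ) := by
          field_simp; ring
        have h2 : 0 ≤ (δ * Y - t * E) ^ 2 / (t * δ) := by positivity
        have h3 : t / δ * E ^ 2 ≤ t / δ * G ^ 2 := by
          have : E ^ 2 ≤ G ^ 2 := by rw [← sq_abs E]; gcongr
          gcongr
        linarith
      have a1 := am Y1 E1 B1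
      have a2 := am Y2 E2 B2
      have h4 : -c / t * Y2 ^ 2 ≤ k / t * Y2 ^ 2 := by gcongr
      have h5 : 0 ≤ k / t * Y1 ^ 2 := by positivity
      have h6 : -(1 + k) / t * (Y1 ^ 2 + Y2 ^ 2) = -(2 * (k / t * Y1 ^ 2)) - 2 * (k / t * Y2 ^ 2) - (δ / t * Y1 ^ 2) - (δ / t * Y2 ^ 2) := by
        rw [hδ]; field_simp; ring
      have h7 : 2 * G ^ 2 / δ * t = 2 * (t / δ * G ^ 2) := by field_simp
      have h8 : -c / t * Y2 ^ 2 = -(c / t * Y2 ^ 2) := by ring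
      rw [h6, h7]
      linarith
    have e : -(1 + k) * (q / t) * (Y1 ^ 2 + Y2 ^ 2) + q * (2 * Y1 * (-Y2 + E1) + 2 * Y2 * (Y1 - c / t * Y2 + E2)) - 2 * G ^ 2 / δ ^ 2 * (δ * (q * t))
      = q * (-(1 + k) / t * (Y1 ^ 2 + Y2 ^ 2) + (2 * Y1 * (-Y2 + E1) + 2 * Y2 * (Y1 - c / t * Y2 + E2)) - 2 * G ^ 2 / δ * t) := by
      field_simp
    rw [e]
    exact mul_nonpos_of_nonneg_of_nonpos hp.le key
  have hanti : AntitoneOn Ψ (Ioc 0 T) := by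
    refine antitoneOn_of_deriv_nonpos (convex_Ioc 0 T) (fun t h => (hd t h.1 h.2).continuousAt.continuousWithinAt)
      (fun t h => ?_) (fun t h => ?_)
    · rw [interior_Ioc] at h
      exact (hd t h.1 h.2.le).differentiableAt.differentiableWithinAt
    · rw [interior_Ioc] at h
      rw [(hd t h.1 h.2.le).deriv]
      exact hdn t h.1 h.2.le
  have hup : ∀ ε, 0 < ε → ε ≤ t → Ψ t ≤ 2 * S ^ 2 * ε ^ δ := by
    intro ε h0 h1
    refine (hanti ⟨h0, h1.trans htT⟩ ⟨ht, htT⟩ h1).trans ?_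
    rw [hΨ]
    have hq : 0 < ε ^ δ := Real.rpow_pos_of_pos h0 _
    have e : ε ^ δ = ε ^ (-(1 + k)) * ε ^ 2 := by
      rw [← Real.rpow_natCast, ← Real.rpow_add h0, hδ]; congr 1; push_cast; ring
    have i1 : y1 ε ^ 2 ≤ (S * ε) ^ 2 := by rw [← sq_abs]; gcongr; exact s1 ε h0 (h1.trans htT)
    have i2 : y2 ε ^ 2 ≤ (S * ε) ^ 2 := by rw [← sq_abs]; gcongr; exact s2 ε h0 (h1.trans htT)
    have i3 : ε ^ (-(1 + k)) * (y1 ε ^ 2 + y2 ε ^ 2) ≤ ε ^ (-(1 + k)) * ((S * ε) ^ 2 + (S * ε) ^ 2) := by gcongr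
    have i4 : ε ^ (-(1 + k)) * ((S * ε) ^ 2 + (S * ε) ^ 2) = 2 * S ^ 2 * ε ^ δ := by rw [e]; ring
    have i5 : 0 ≤ 2 * G ^ 2 / δ ^ 2 * ε ^ δ := by positivity
    simp only
    linarith
  have hle : Ψ t ≤ 0 := by
    have hl : Tendsto (fun ε : ℝ => 2 * S ^ 2 * ε ^ δ) (𝓝[>] 0) (𝓝 0) := by
      have := ((Real.continuousAt_rpow_const 0 δ (Or.inr hδ0.le)).tendsto.const_mul (2 * S ^ 2)).mono_left (nhdsWithin_le_nhds (s := Ioi 0))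
      rwa [Real.zero_rpow hδ0.ne', mul_zero] at this
    refine ge_of_tendsto hl ?_
    filter_upwards [Ioc_mem_nhdsGT ht] with ε h
    exact hup ε h.1 h.2
  have hq : 0 < t ^ (-(1 + k)) := Real.rpow_pos_of_pos ht _
  have e : t ^ δ = t ^ (-(1 + k)) * t ^ 2 := by
    rw [← Real.rpow_natCast, ← Real.rpow_add ht, hδ]; congr 1; push_cast; ring
  rw [hΨ] at hle
  simp only at hle
  rw [e] at hle
  have : t ^ (-(1 + k)) * (y1 t ^ 2 + y2 t ^ 2) ≤ t ^ (-(1 + k)) * (2 / δ ^ 2 * G ^ 2 * t ^ 2) := by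
    have : t ^ (-(1 + k)) * (2 / δ ^ 2 * G ^ 2 * t ^ 2) = 2 * G ^ 2 / δ ^ 2 * (t ^ (-(1 + k)) * t ^ 2) := by ring
    linarith
  exact le_of_mul_le_mul_left this hq

/-- linear form of the energy estimate -/
theorem energy' {c : ℝ} (hc : -1 < c) : ∃ M : ℝ, 1 ≤ M ∧ ∀ (T G S : ℝ) (y1 y2 e1 e2 : ℝ → ℝ), 0 ≤ G →
    (∀ t, 0 < t → t ≤ T → HasDerivAt y1 (-y2 t + e1 t) t) →
    (∀ t, 0 < t → t ≤ T → HasDerivAt y2 (y1 t - c / t * y2 t + e2 t) t) →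
    (∀ t, 0 < t → t ≤ T → |e1 t| ≤ G) → (∀ t, 0 < t → t ≤ T → |e2 t| ≤ G) →
    (∀ t, 0 < t → t ≤ T → |y1 t| ≤ S * t) → (∀ t, 0 < t → t ≤ T → |y2 t| ≤ S * t) →
    ∀ t, 0 < t → t ≤ T → |y1 t| ≤ M * G * t ∧ |y2 t| ≤ M * G * t := by
  have hk1 : max (-c) 0 < 1 := max_lt (by linarith) one_pos
  have hk0 : 0 ≤ max (-c) 0 := le_max_right _ _
  obtain ⟨δ, hδ⟩ : ∃ δ, δ = 1 - max (-c) 0 := ⟨_, rfl⟩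
  have hδ0 : 0 < δ := by linarith
  have hδ1 : δ ≤ 1 := by linarith
  refine ⟨2 / δ, by rw [le_div_iff₀ hδ0]; linarith, ?_⟩
  intro T G S y1 y2 e1 e2 hG d1 d2 b1 b2 s1 s2 t ht htT
  have h := energy hc hG d1 d2 b1 b2 s1 s2 ht htT
  rw [← hδ] at h
  have h2 : 2 / δ ^ 2 * G ^ 2 * t ^ 2 ≤ (2 / δ * G * t) ^ 2 := by
    have : (2 / δ * G * t) ^ 2 = 2 * (2 / δ ^ 2 * G ^ 2 * t ^ 2) := by field_simp
    have : 0 ≤ 2 / δ ^ 2 * G ^ 2 * t ^ 2 := by positivity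
    linarith
  have h3 : 0 ≤ 2 / δ * G * t := by positivity
  constructor
  · exact abs_le_of_sq_le_sq (by nlinarith [sq_nonneg (y2 t)]) h3
  · exact abs_le_of_sq_le_sq (by nlinarith [sq_nonneg (y1 t)]) h3

/-- a singular system near its regular solution -/
structure Sing (c T ε R S : ℝ) (U V e1 e2 : ℝ → ℝ) : Prop where
  d1 : ∀ t, 0 < t → t ≤ T → HasDerivAt U (-V t + e1 t) t
  d2 : ∀ t, 0 < t → t ≤ T → HasDerivAt V (U t - c / t * V t + e2 t) t
  b1 : ∀ t, 0 < t → t ≤ T → |e1 t| ≤ ε * (|U t| + |V t| + |V t| / t)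
  b2 : ∀ t, 0 < t → t ≤ T → |e2 t| ≤ ε * (|U t| + |V t| + |V t| / t)
  s1 : ∀ t, 0 < t → t ≤ T → |U t - R| ≤ S * t
  s2 : ∀ t, 0 < t → t ≤ T → |V t| ≤ S * t

theorem Sing.err {c T ε R S S' : ℝ} {U V e1 e2 : ℝ → ℝ} (h : Sing c T ε R S U V e1 e2) (hε : 0 ≤ ε) (hR : 0 ≤ R)
    (s1 : ∀ t, 0 < t → t ≤ T → |U t - R| ≤ S' * t) (s2 : ∀ t, 0 < t → t ≤ T → |V t| ≤ S' * t)
    {t : ℝ} (ht : 0 < t) (htT : t ≤ T) :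
    |e1 t| ≤ ε * (R + S' * (2 * T + 1)) ∧ |e2 t| ≤ ε * (R + S' * (2 * T + 1)) := by
  have i1 := s1 t ht htT
  have i2 := s2 t ht htT
  have hS' : 0 ≤ S' := by
    have := (abs_nonneg _).trans i2
    exact nonneg_of_mul_nonneg_left this ht
  have i3 : |U t| ≤ R + S' * T := by
    have : |U t| ≤ |U t - R| + |R| := by
      have := abs_add_le (U t - R) R
      rwa [sub_add_cancel] at this
    rw [abs_of_nonneg hR] at this
    nlinarith
  have i4 : |V t| ≤ S' * T := i2.trans (by gcongr)
  have i5 : |V t| / t ≤ S' := by rwa [div_le_iff₀ ht]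
  have i6 : |U t| + |V t| + |V t| / t ≤ R + S' * (2 * T + 1) := by linarith
  exact ⟨(h.b1 t ht htT).trans (by gcongr), (h.b2 t ht htT).trans (by gcongr)⟩

theorem sing_bd {c : ℝ} (hc : -1 < c) : ∃ M : ℝ, 1 ≤ M ∧ ∀ (T ε R S : ℝ) (U V e1 e2 : ℝ → ℝ), 0 < T → 0 ≤ ε → ε ≤ 1 → 0 ≤ R →
    M * ε * (2 * T + 1) ≤ 1 / 2 → Sing c T ε R S U V e1 e2 →
    ∀ t, 0 < t → t ≤ T → |U t - R| ≤ 4 * M * R * t ∧ |V t| ≤ 4 * M * R * t := by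
  obtain ⟨M, hM, h⟩ := energy' hc
  refine ⟨M, hM, ?_⟩
  intro T ε R S U V e1 e2 hT hε hε1 hR hs H
  have hS : 0 ≤ S := nonneg_of_mul_nonneg_left ((abs_nonneg _).trans (H.s2 T hT le_rfl)) hT
  have step : ∀ k : ℕ, ∀ t, 0 < t → t ≤ T → |U t - R| ≤ (4 * M * R + S / 2 ^ k) * t ∧ |V t| ≤ (4 * M * R + S / 2 ^ k) * t := by
    intro k
    induction k with
    | zero =>
      intro t h0 h1
      have i1 := H.s1 t h0 h1
      have i2 := H.s2 t h0 h1
      have : 0 ≤ 4 * M * R * t := by positivity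
      constructor <;> · rw [pow_zero, div_one, add_mul]; linarith
    | succ k ih =>
      obtain ⟨S', hS'⟩ : ∃ S', S' = 4 * M * R + S / 2 ^ k := ⟨_, rfl⟩
      have hS0 : 0 ≤ S' := by rw [hS']; positivity
      rw [← hS'] at ih
      have hG : 0 ≤ R + ε * (R + S' * (2 * T + 1)) := by positivity
      have := h T (R + ε * (R + S' * (2 * T + 1))) S' (fun t => U t - R) V e1 (fun t => R + e2 t) hG
        (fun t h0 h1 => (H.d1 t h0 h1).sub_const R)
        (fun t h0 h1 => (H.d2 t h0 h1).congr_deriv (by ring))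
        (fun t h0 h1 => ((H.err hε hR (fun t a b => (ih t a b).1) (fun t a b => (ih t a b).2) h0 h1).1).trans (by linarith))
        (fun t h0 h1 => by
          have := (H.err hε hR (fun t a b => (ih t a b).1) (fun t a b => (ih t a b).2) h0 h1).2
          have h2 := abs_add_le R (e2 t)
          rw [abs_of_nonneg hR] at h2
          linarith)
        (fun t a b => (ih t a b).1) (fun t a b => (ih t a b).2)
      have hb : M * (R + ε * (R + S' * (2 * T + 1))) ≤ 4 * M * R + S / 2 ^ (k + 1) := by
        have e1 : M * (R + ε * (R + S' * (2 * T + 1))) = M * R + M * ε * R + (M * ε * (2 * T + 1)) * S' := by ring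
        have e2 : (M * ε * (2 * T + 1)) * S' ≤ 1 / 2 * S' := by gcongr
        have e3 : M * ε * R ≤ M * 1 * R := by gcongr
        have e4 : S / 2 ^ (k + 1) = 1 / 2 * (S / 2 ^ k) := by rw [pow_succ]; field_simp
        rw [e1, e4]
        have : 1 / 2 * S' = 2 * M * R + 1 / 2 * (S / 2 ^ k) := by rw [hS']; ring
        linarith
      intro t h0 h1
      have ⟨j1, j2⟩ := this t h0 h1
      exact ⟨j1.trans (by gcongr), j2.trans (by gcongr)⟩
  intro t h0 h1
  have hl : Tendsto (fun k : ℕ => (4 * M * R + S / 2 ^ k) * t) atTop (𝓝 (4 * M * R * t)) := by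
    have h2 : Tendsto (fun k : ℕ => S * (1 / 2 : ℝ) ^ k) atTop (𝓝 (S * 0)) := (tendsto_pow_atTop_nhds_zero_of_lt_one (by norm_num) (by norm_num)).const_mul S
    have h3 := (h2.const_add (4 * M * R)).mul_const t
    rw [mul_zero, add_zero] at h3
    refine h3.congr fun k => ?_
    rw [one_div, inv_pow, div_eq_mul_inv]
  exact ⟨ge_of_tendsto' hl fun k => (step k t h0 h1).1, ge_of_tendsto' hl fun k => (step k t h0 h1).2⟩

theorem sing_pair {c : ℝ} (hc : -1 < c) : ∃ M : ℝ, 1 ≤ M ∧ ∀ (T ε R S : ℝ) (U V e1 e2 U' V' e1' e2' : ℝ → ℝ), 0 < T → 0 ≤ ε → ε ≤ 1 → 0 ≤ R →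
    M * ε * (2 * T + 1) ≤ 1 / 2 → Sing c T ε R S U V e1 e2 → Sing c T ε R S U' V' e1' e2' →
    ∀ t, 0 < t → t ≤ T → (|U t| ≤ R * (1 + 4 * M * T) ∧ |V t| ≤ R * (4 * M * T)) ∧
      (|U t - U' t| ≤ M * (2 * (ε * (R + 4 * M * R * (2 * T + 1)))) * T ∧ |V t - V' t| ≤ M * (2 * (ε * (R + 4 * M * R * (2 * T + 1)))) * T) := by
  obtain ⟨M1, hM1, h1⟩ := energy' hc
  obtain ⟨M2, hM2, h2⟩ := sing_bd hc
  obtain ⟨M, hM⟩ : ∃ M, M = max M1 M2 := ⟨_, rfl⟩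
  have hMM1 : M1 ≤ M := by rw [hM]; exact le_max_left _ _
  have hMM2 : M2 ≤ M := by rw [hM]; exact le_max_right _ _
  refine ⟨M, hM1.trans hMM1, ?_⟩
  intro T ε R S U V e1 e2 U' V' e1' e2' hT hε hε1 hR hs H H'
  have hs2 : M2 * ε * (2 * T + 1) ≤ 1 / 2 := le_trans (by gcongr) hs
  have A := h2 T ε R S U V e1 e2 hT hε hε1 hR hs2 H
  have A' := h2 T ε R S U' V' e1' e2' hT hε hε1 hR hs2 H'
  have up : ∀ t, 0 < t → 4 * M2 * R * t ≤ 4 * M * R * t := fun t h => by gcongr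
  have er := fun t h0 h1 => H.err (t := t) hε hR (fun t a b => ((A t a b).1).trans (up t a)) (fun t a b => ((A t a b).2).trans (up t a)) h0 h1
  have er' := fun t h0 h1 => H'.err (t := t) hε hR (fun t a b => ((A' t a b).1).trans (up t a)) (fun t a b => ((A' t a b).2).trans (up t a)) h0 h1
  have hM0 : 0 ≤ M := by linarith
  have B := h1 T (2 * (ε * (R + 4 * M * R * (2 * T + 1)))) (2 * S) (fun t => U t - U' t) (fun t => V t - V' t) (fun t => e1 t - e1' t) (fun t => e2 t - e2' t)
    (by positivity)
    (fun t h0 h1 => ((H.d1 t h0 h1).sub (H'.d1 t h0 h1)).congr_deriv (by ring))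
    (fun t h0 h1 => ((H.d2 t h0 h1).sub (H'.d2 t h0 h1)).congr_deriv (by ring))
    (fun t h0 h1 => (abs_sub _ _).trans (by linarith [(er t h0 h1).1, (er' t h0 h1).1]))
    (fun t h0 h1 => (abs_sub _ _).trans (by linarith [(er t h0 h1).2, (er' t h0 h1).2]))
    (fun t h0 h1 => by
      have e : U t - U' t = (U t - R) - (U' t - R) := by ring
      rw [e]
      exact (abs_sub _ _).trans (by linarith [H.s1 t h0 h1, H'.s1 t h0 h1]))
    (fun t h0 h1 => (abs_sub _ _).trans (by linarith [H.s2 t h0 h1, H'.s2 t h0 h1]))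
  intro t h0 h1
  have j := B t h0 h1
  have k := A t h0 h1
  have e1 : 4 * M2 * R * t ≤ R * (4 * M * T) := by
    calc 4 * M2 * R * t ≤ 4 * M * R * T := by gcongr
      _ = _ := by ring
  refine ⟨⟨?_, k.2.trans e1⟩, j.1.trans (by gcongr), j.2.trans (by gcongr)⟩
  have h3 := abs_add_le (U t - R) R
  rw [sub_add_cancel, abs_of_nonneg hR] at h3
  have := k.1
  linarith

end Magnus
end

section
open Filter Topology Set Polynomial

namespace Magnus

theorem Ok.unif {k : ℕ} {T : ℝ} (hT : 0 ≤ T) {f : ℕ → ℝ → ℝ} (h : ∀ τ : ℕ → ℝ, (∀ m, |τ m| ≤ T) → Ok k (fun m => f m (τ m))) :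
    ∃ C : ℝ, 0 ≤ C ∧ ∃ N : ℕ, 1 ≤ N ∧ ∀ m : ℕ, N ≤ m → ∀ τ, |τ| ≤ T → |f m τ| ≤ C / (m : ℝ) ^ k := by
  have ch : ∀ m : ℕ, ∃ τ, |τ| ≤ T ∧ ((m : ℝ) ≤ |f m τ| * (m : ℝ) ^ k ∨ ∀ τ', |τ'| ≤ T → |f m τ'| * (m : ℝ) ^ k ≤ |f m τ| * (m : ℝ) ^ k + 1) := by
    intro m
    by_contra hcon
    push Not at hcon
    have key : ∀ j : ℕ, ∃ τ, |τ| ≤ T ∧ (j : ℝ) ≤ |f m τ| * (m : ℝ) ^ k := by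
      intro j
      induction j with
      | zero => exact ⟨0, by simpa using hT, by rw [Nat.cast_zero]; positivity⟩
      | succ j ih =>
        obtain ⟨τ, h1, h2⟩ := ih
        obtain ⟨_, τ', h3, h4⟩ := hcon τ h1
        exact ⟨τ', h3, by push_cast; linarith⟩
    obtain ⟨τ, h1, h2⟩ := key m
    have := (hcon τ h1).1
    linarith
  choose τ hτ hτ2 using ch
  obtain ⟨C, hC, N, hN, H⟩ := h τ hτ
  obtain ⟨M, hM⟩ := exists_nat_gt C
  refine ⟨C + 1, by positivity, max N (M + 1), le_max_of_le_left hN, fun m hm τ' hτ' => ?_⟩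
  have hm1 : N ≤ m := le_of_max_le_left hm
  have hm2 : M + 1 ≤ m := le_of_max_le_right hm
  have hm0 : (0 : ℝ) < m := by exact_mod_cast (by omega : 0 < m)
  have h1 := H m hm1
  rw [le_div_iff₀ (by positivity), Real.norm_eq_abs] at h1
  rw [le_div_iff₀ (by positivity)]
  rcases hτ2 m with h2 | h2
  · have : (M : ℝ) + 1 ≤ m := by exact_mod_cast hm2
    linarith
  · have := h2 τ' hτ'
    linarith

theorem Ok.inv_c {f : ℕ → ℝ} {c : ℝ} (hc : c ≠ 0) (h : Ok 1 (fun n => f n - c)) : Ok 0 (fun n => (f n)⁻¹) ∧ Ok 1 (fun n => (f n)⁻¹ - c⁻¹) := by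
  have ht : Tendsto f atTop (𝓝 c) := by
    have := (h.tendsto le_rfl).add_const c
    simpa using this
  have hi := ht.inv₀ hc
  have h0 := Ok.of_tendsto hi
  refine ⟨h0, ?_⟩
  obtain ⟨N, hN⟩ := eventually_atTop.1 (ht.eventually_ne hc)
  refine ((h.mul0 h0).cmul (-c⁻¹)).of_ev N fun n hn => ?_
  have := hN n hn
  field_simp; ring

end Magnus
end

section
open Filter Topology Set Polynomial

namespace Magnus
namespace Dyn
variable {x₁ α β lam : ℝ} {p : ℕ → ℝ[X]} {a b g ω ξ : ℕ → ℝ}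

/-- total size of all error coefficients -/
noncomputable def errc (x₁ α β lam s : ℝ) (a g ω ξ : ℕ → ℝ) (m : ℕ) (τ : ℝ) : ℝ :=
  |-(s * (m:ℝ)⁻¹ * (1 - (x₁ - s * τ * (m:ℝ)⁻¹) ^ 2)⁻¹ * (-((m:ℝ) + (α + β + 2 * lam) / 2) * (x₁ - s * τ * (m:ℝ)⁻¹) + g m
      - ((-α * (1 + (x₁ - s * τ * (m:ℝ)⁻¹)) + β * (1 - (x₁ - s * τ * (m:ℝ)⁻¹))) / 2 - lam * ((x₁ - s * τ * (m:ℝ)⁻¹) + x₁)))) - x₁ / s|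
  + |-(s * (m:ℝ)⁻¹ * (1 - (x₁ - s * τ * (m:ℝ)⁻¹) ^ 2)⁻¹ * (a m * (2 * m + 1 + (α + β + 2 * lam)))) + 1 / s|
  + |s * (m:ℝ)⁻¹ * (1 - (x₁ - s * τ * (m:ℝ)⁻¹) ^ 2)⁻¹ * (a m * (2 * m - 1 + (α + β + 2 * lam))) - 1 / s|
  + |-(s * (m:ℝ)⁻¹ * (1 - (x₁ - s * τ * (m:ℝ)⁻¹) ^ 2)⁻¹ * (((m:ℝ) + (α + β + 2 * lam) / 2) * (x₁ - s * τ * (m:ℝ)⁻¹) - g m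
      - ((-α * (1 + (x₁ - s * τ * (m:ℝ)⁻¹)) + β * (1 - (x₁ - s * τ * (m:ℝ)⁻¹))) / 2 - lam * ((x₁ - s * τ * (m:ℝ)⁻¹) + x₁)))) + x₁ / s|
  + |(-(a m * ξ m) * s - (a m * ξ (m - 1) - 2 * x₁ * ω m + x₁ ^ 2 * (a m * ξ m)) / s) * (1 - (x₁ - s * τ * (m:ℝ)⁻¹) ^ 2)⁻¹|
  + |2 * lam * s * (x₁ + (x₁ - s * τ * (m:ℝ)⁻¹)) * (m:ℝ)⁻¹ * (1 - (x₁ - s * τ * (m:ℝ)⁻¹) ^ 2)⁻¹|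
  + |1 - (x₁ - s * τ * (m:ℝ)⁻¹) ^ 2 - s ^ 2|

theorem errc_ok (D : Dyn x₁ α β lam p a b g ω ξ) (hx : -1 < x₁ ∧ x₁ < 1) {s : ℝ} (hs : 0 < s)
    (hs2 : s ^ 2 = 1 - x₁ ^ 2)
    (ha : Tendsto a atTop (𝓝 (1 / 2))) (hg : Tendsto g atTop (𝓝 0)) {T : ℝ} (hT : 0 ≤ T) :
    ∃ C : ℝ, 0 ≤ C ∧ ∃ N : ℕ, 1 ≤ N ∧ ∀ m : ℕ, N ≤ m → ∀ τ, |τ| ≤ T → |errc x₁ α β lam s a g ω ξ m τ| ≤ C / (m : ℝ) ^ 1 := by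
  obtain ⟨Og, Oa, Ob, -, -, -, Ox⟩ := D.asym1 hx ha hg
  obtain ⟨Oω, Oξ⟩ := D.bdd hx ha hg
  have Oa0 : Ok 0 a := Ok.of_tendsto ha
  have Og0 : Ok 0 g := Ok.of_tendsto hg
  refine Ok.unif hT fun τ hτ => ?_
  unfold errc
  have Oi : Ok 1 (fun m : ℕ => (m : ℝ)⁻¹) := Ok.inv_n
  have Oτ : Ok 0 τ := ⟨T, hT, 1, le_rfl, fun n _ => by rw [pow_zero, div_one]; exact hτ n⟩
  obtain ⟨y, hy⟩ : ∃ y : ℕ → ℝ, y = fun m => x₁ - s * τ m * (m : ℝ)⁻¹ := ⟨_, rfl⟩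
  have hy' : ∀ m, x₁ - s * τ m * (m : ℝ)⁻¹ = y m := fun m => by rw [hy]
  simp only [hy']
  have Oy : Ok 1 (fun m => y m - x₁) := ((Oi.mul0 Oτ).cmul (-s)).of_ev 0 fun m _ => by rw [hy]; ring
  have Oy0 : Ok 0 y := ((Oy.mono (Nat.zero_le 1)).add (Ok.const x₁)).of_ev 0 fun m _ => by ring
  have OS : Ok 1 (fun m => 1 - y m ^ 2 - s ^ 2) :=
    (Oy.mul0 (Oy0.add (Ok.const x₁))).neg.of_ev 0 fun m _ => by rw [hs2]; ring
  obtain ⟨OI0, OI⟩ := OS.inv_c (by positivity)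
  obtain ⟨I, hI⟩ : ∃ I : ℕ → ℝ, I = fun m => (1 - y m ^ 2)⁻¹ := ⟨_, rfl⟩
  have hI' : ∀ m, (1 - y m ^ 2)⁻¹ = I m := fun m => by rw [hI]
  simp only [hI'] at OI0 OI ⊢
  have OR : ∀ c0 c1 : ℝ, Ok 0 (fun m => c0 + c1 * y m) := fun c0 c1 => (Ok.const c0).add (Oy0.cmul c1)
  have mi : ∀ m : ℕ, 1 ≤ m → (m : ℝ)⁻¹ * m = 1 := fun m hm => inv_mul_cancel₀ (by positivity)
  refine ((((((Ok.add ?_ ?_).add ?_).add ?_).add ?_).add ?_).add OS.norm)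
  · refine Ok.norm (f := fun m : ℕ => _ - x₁ / s) ?_
    have h1 := ((OI.mul0 Oy0).cmul s).add (Oy.cmul (1 / s))
    have h2 := (((Oi.mul0 OI0).mul0 ((OR ((β - α) / 2 - lam * x₁) ((α + β + 2 * lam) / 2 + (-α - β) / 2 - lam)).sub Og0))).cmul s
    refine (h1.add h2).of_ev 1 fun m hm => ?_
    have := mi m hm
    have e : x₁ / s = s * ((s ^ 2)⁻¹ * x₁) := by field_simp
    have e2 : 1 / s = s * (s ^ 2)⁻¹ := by field_simp
    rw [e, e2]
    linear_combination (-s * I m * y m) * this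
  · refine Ok.norm (f := fun m : ℕ => _ + 1 / s) ?_
    have h1 := (((Oa.mul0 OI0).cmul 2).add OI).cmul (-s)
    have h2 := (((Oi.mul0 OI0).mul0 Oa0).cmul (-s * (1 + (α + β + 2 * lam))))
    refine (h1.add h2).of_ev 1 fun m hm => ?_
    have := mi m hm
    have e2 : 1 / s = s * (s ^ 2)⁻¹ := by field_simp
    rw [e2]
    linear_combination (2 * s * I m * a m) * this
  · refine Ok.norm (f := fun m : ℕ => _ - 1 / s) ?_
    have h1 := (((Oa.mul0 OI0).cmul 2).add OI).cmul s
    have h2 := (((Oi.mul0 OI0).mul0 Oa0).cmul (s * (-1 + (α + β + 2 * lam))))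
    refine (h1.add h2).of_ev 1 fun m hm => ?_
    have := mi m hm
    have e2 : 1 / s = s * (s ^ 2)⁻¹ := by field_simp
    rw [e2]
    linear_combination (-2 * s * I m * a m) * this
  · refine Ok.norm (f := fun m : ℕ => _ + x₁ / s) ?_
    have h1 := (((OI.mul0 Oy0).cmul s).add (Oy.cmul (1 / s))).neg
    have h2 := (((Oi.mul0 OI0).mul0 ((OR ((β - α) / 2 - lam * x₁) (-(α + β + 2 * lam) / 2 + (-α - β) / 2 - lam)).add Og0))).cmul s
    refine (h1.add h2).of_ev 1 fun m hm => ?_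
    have := mi m hm
    have e : x₁ / s = s * ((s ^ 2)⁻¹ * x₁) := by field_simp
    have e2 : 1 / s = s * (s ^ 2)⁻¹ := by field_simp
    rw [e, e2]
    linear_combination (s * I m * y m) * this
  · refine Ok.norm (f := fun m : ℕ => _ * I m) ?_
    have h3 : Ok 1 (fun m => a m * (ξ m + ξ (m - 1)) - 2 * x₁ * ω m) := by
      refine Ok.unshift ?_
      have k1 := Oa.shift.mul0 (Oξ.add Oξ.shift)
      refine (k1.add (Ox.cmul (1 / 2))).of_ev 0 fun m _ => ?_
      rw [Nat.add_sub_cancel]; ring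
    refine ((h3.mul0 OI0).cmul (-1 / s)).of_ev 0 fun m _ => ?_
    field_simp
    linear_combination a m * ξ m * I m * hs2
  · refine Ok.norm (f := fun m : ℕ => _ * I m) ?_
    refine (((Oi.mul0 OI0).mul0 (OR x₁ 1)).cmul (2 * lam * s)).of_ev 0 fun m _ => ?_
    ring

end Dyn
end Magnus
end

section
open Filter Topology Set Polynomial

namespace Magnus

theorem alg_bd {Err P Q U V cx cy s x₁ E1 E2 E3 E4 st I τ : ℝ} (hs : 0 < s) (hx : |x₁| ≤ 1) (hs1 : s ≤ 1)
    (hcx : |cx| ≤ 1) (hcy : |cy| ≤ 1)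
    (hP : P = U * cx - V * cy) (hQ : Q = x₁ * P + s * (U * cy + V * cx)) (e1 : |E1| ≤ Err) (e2 : |E2| ≤ Err)
    (e3 : |E3| ≤ Err) (e4 : |E4| ≤ Err) (e5 : |st * I| ≤ Err) :
    |(E1 * P + E2 * Q) * cx + (E3 * P + E4 * Q - x₁ * (E1 * P + E2 * Q)) / s * cy + st * V * I * τ⁻¹|
      ≤ (4 + 6 / s) * Err * (|U| + |V| + |V| / |τ|) := by
  have hE : 0 ≤ Err := (abs_nonneg _).trans e1
  have mm : ∀ a b c : ℝ, |b| ≤ 1 → |a| ≤ c → |a * b| ≤ c := fun a b c hb ha => by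
    rw [abs_mul]; exact (mul_le_of_le_one_right (abs_nonneg _) hb).trans ha
  have mU := mm U cx _ hcx le_rfl
  have mU' := mm U cy _ hcy le_rfl
  have mV := mm V cx _ hcx le_rfl
  have mV' := mm V cy _ hcy le_rfl
  have bP : |P| ≤ |U| + |V| := by rw [hP]; exact (abs_sub _ _).trans (add_le_add mU mV')
  have bQ : |Q| ≤ 2 * (|U| + |V|) := by
    rw [hQ]
    have h1 : |x₁ * P| ≤ |U| + |V| := by rw [mul_comm]; exact mm _ _ _ hx bP
    have h2 : |s * (U * cy + V * cx)| ≤ |U| + |V| := by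
      rw [mul_comm]
      exact mm _ _ _ (by rw [abs_of_pos hs]; exact hs1) ((abs_add_le _ _).trans (add_le_add mU' mV))
    linarith [abs_add_le (x₁ * P) (s * (U * cy + V * cx))]
  have c1 : ∀ E F : ℝ, |E| ≤ Err → |F| ≤ Err → |E * P + F * Q| ≤ 3 * Err * (|U| + |V|) := by
    intro E F hE' hF
    refine (abs_add_le _ _).trans ?_
    rw [abs_mul, abs_mul]
    have := mul_le_mul hE' bP (abs_nonneg _) hE
    have := mul_le_mul hF bQ (abs_nonneg _) hE
    linarith
  have k1 := c1 E1 E2 e1 e2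
  have k2 := c1 E3 E4 e3 e4
  have k3 : |(E1 * P + E2 * Q) * cx| ≤ 3 * Err * (|U| + |V|) := mm _ _ _ hcx k1
  have k4 : |(E3 * P + E4 * Q - x₁ * (E1 * P + E2 * Q)) / s * cy| ≤ 6 * Err * (|U| + |V|) / s := by
    refine mm _ _ _ hcy ?_
    rw [abs_div, abs_of_pos hs]
    gcongr
    refine (abs_sub _ _).trans ?_
    have : |x₁ * (E1 * P + E2 * Q)| ≤ 3 * Err * (|U| + |V|) := by rw [mul_comm]; exact mm _ _ _ hx k1
    linarith
  have k5 : |st * V * I * τ⁻¹| ≤ Err * (|V| / |τ|) := by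
    rw [show st * V * I * τ⁻¹ = (st * I) * (V * τ⁻¹) by ring, abs_mul, abs_mul V, abs_inv, ← div_eq_mul_inv]
    gcongr
  have n1 : 0 ≤ |V| / |τ| := by positivity
  have n2 := abs_nonneg U
  have n3 := abs_nonneg V
  refine (abs_add_le _ _).trans ((add_le_add (abs_add_le _ _) le_rfl).trans ((add_le_add (add_le_add k3 k4) k5).trans ?_))
  have : (4 + 6 / s) * Err * (|U| + |V| + |V| / |τ|) = 3 * Err * (|U| + |V|) + 6 * Err * (|U| + |V|) / s + Err * (|V| / |τ|)
     + (Err * (|U| + |V|) + 3 * (Err * (|V| / |τ|)) + 6 / s * (Err * (|V| / |τ|))) := by ring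
  rw [this]
  have : 0 ≤ Err * (|U| + |V|) + 3 * (Err * (|V| / |τ|)) + 6 / s * (Err * (|V| / |τ|)) := by positivity
  linarith

theorem alg_bd2 {Err P Q U V cx cy s x₁ E1 E2 E3 E4 k τ : ℝ} (hs : 0 < s) (hx : |x₁| ≤ 1) (hs1 : s ≤ 1)
    (hcx : |cx| ≤ 1) (hcy : |cy| ≤ 1)
    (hP : P = U * cx - V * cy) (hQ : Q = x₁ * P + s * (U * cy + V * cx)) (e1 : |E1| ≤ Err) (e2 : |E2| ≤ Err)
    (e3 : |E3| ≤ Err) (e4 : |E4| ≤ Err) (e5 : |k| ≤ Err) :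
    |-((E1 * P + E2 * Q) * cy) + (E3 * P + E4 * Q - x₁ * (E1 * P + E2 * Q)) / s * cx + k * V|
      ≤ (5 + 6 / s) * Err * (|U| + |V| + |V| / |τ|) := by
  have hE : 0 ≤ Err := (abs_nonneg _).trans e1
  have h' := alg_bd (τ := 0) (cx := -cy) (cy := cx) (U := V) (V := -U) (st := 0) (I := 0) (P := P) (Q := Q) hs hx hs1 (by rwa [abs_neg]) hcx
    (by rw [hP]; ring) (by rw [hQ]; ring) e1 e2 e3 e4 (by simpa using (abs_nonneg _).trans e1)
  rw [abs_neg, abs_zero, div_zero, add_zero] at h'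
  have k5 : |k * V| ≤ Err * |V| := by rw [abs_mul]; gcongr
  have n1 : 0 ≤ |V| / |τ| := by positivity
  have n2 := abs_nonneg U
  have n3 := abs_nonneg V
  refine (abs_add_le _ _).trans ?_
  have e : (E1 * P + E2 * Q) * -cy + (E3 * P + E4 * Q - x₁ * (E1 * P + E2 * Q)) / s * cx =
    -((E1 * P + E2 * Q) * cy) + (E3 * P + E4 * Q - x₁ * (E1 * P + E2 * Q)) / s * cx := by ring
  simp only [zero_mul, add_zero] at h'
  rw [e] at h'
  have : (5 + 6 / s) * Err * (|U| + |V| + |V| / |τ|) = (4 + 6 / s) * Err * (|V| + |U|) + Err * |V| + (Err * |U| +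
     (5 + 6 / s) * Err * (|V| / |τ|)) := by ring
  rw [this]
  have : 0 ≤ Err * |U| + (5 + 6 / s) * Err * (|V| / |τ|) := by positivity
  linarith

/-- residue identities -/
theorem alg_res {ωm aξ aξ' κ lam x₁ s cx cy P Q U V : ℝ} (hs : s ≠ 0) (hκ : κ = lam * s ^ 2) (hc : cx ^ 2 + cy ^ 2 = 1)
    (q1 : (ωm - κ) * cx = aξ * (x₁ * cx + s * cy)) (q2 : aξ' * cx = (ωm + κ) * (x₁ * cx + s * cy))
    (hP : P = U * cx - V * cy) (hQ : Q = x₁ * P + s * (U * cy + V * cx)) :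
    ((ωm - κ) * P - aξ * Q) * cx + ((aξ' * P - (ωm + κ) * Q) - x₁ * ((ωm - κ) * P - aξ * Q)) / s * cy
      = (-(aξ) * s - (aξ' - 2 * x₁ * ωm + x₁ ^ 2 * aξ) / s) * V ∧
    -(((ωm - κ) * P - aξ * Q) * cy) + ((aξ' * P - (ωm + κ) * Q) - x₁ * ((ωm - κ) * P - aξ * Q)) / s * cx
      = -2 * κ * V := by
  obtain ⟨i, hi⟩ : ∃ i, i = 1 / s := ⟨_, rfl⟩
  have his : i * s = 1 := by rw [hi]; field_simp
  have hd : ∀ y, y / s = y * i := fun y => by rw [hi]; ring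
  simp only [hd]
  obtain ⟨v, hv⟩ : ∃ v, v = U * cy + V * cx := ⟨_, rfl⟩
  obtain ⟨m11, h11⟩ : ∃ v, v = ωm - κ - aξ * x₁ := ⟨_, rfl⟩
  obtain ⟨m12, h12⟩ : ∃ v, v = -aξ * s := ⟨_, rfl⟩
  obtain ⟨m21, h21⟩ : ∃ v, v = (aξ' - 2 * x₁ * ωm + x₁ ^ 2 * aξ) * i := ⟨_, rfl⟩
  obtain ⟨m22, h22⟩ : ∃ v, v = -(ωm + κ) + x₁ * aξ := ⟨_, rfl⟩
  have r1 : (ωm - κ) * P - aξ * Q = m11 * P + m12 * v := by rw [hQ, ← hv, h11, h12]; ring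
  have r2 : ((aξ' * P - (ωm + κ) * Q) - x₁ * ((ωm - κ) * P - aξ * Q)) * i = m21 * P + m22 * v := by
    rw [hQ, ← hv, h21, h22]; linear_combination (-(ωm + κ) + x₁ * aξ) * v * his
  have p1 : m11 * cx + m12 * cy = 0 := by rw [h11, h12]; linear_combination q1
  have p2 : m21 * cx + m22 * cy = 0 := by
    rw [h21, h22]; linear_combination i * (q2 - x₁ * q1) - (-(ωm + κ) + x₁ * aξ) * cy * his
  rw [r2, r1, hP, hv, ← h21, ← h12, show -2 * κ = m11 + m22 by rw [h11, h22]; ring]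
  constructor
  · linear_combination (U * cx - V * cy) * p1 + (U * cy + V * cx) * p2 + (m12 - m21) * V * hc
  · linear_combination (-U * cy - V * cx) * p1 + (U * cx - V * cy) * p2 + (m11 + m22) * V * hc

namespace Dyn
variable {x₁ α β lam : ℝ} {p : ℕ → ℝ[X]} {a b g ω ξ : ℕ → ℝ}

theorem ode_alg {x₁ α β lam s τ m i x ρ I gm ωm am ξm P Q D : ℝ} (hi : i * m = 1) (hτ : τ ≠ 0)
    (hx : x = x₁ - s * τ * i) (hI : (1 - x ^ 2) * I = 1) (hρ : ρ = x - x₁) (hs2 : s ^ 2 = 1 - x₁ ^ 2)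
    (L1 : (1 - x ^ 2) * ρ * D =
      (ρ * (-(m + (α + β + 2 * lam) / 2) * x + gm) + ωm
      - (-α * (1 + x) * ρ + β * (1 - x) * ρ + 2 * lam * (1 - x ^ 2)) / 2) * P
      - am * (-(2 * m + 1 + (α + β + 2 * lam)) * ρ + ξm) * Q) :
    -(s * i) * D = -(s * i * I * (-(m + (α + β + 2 * lam) / 2) * x + gm
      - ((-α * (1 + x) + β * (1 - x)) / 2 - lam * (x + x₁)))) * P
      + -(s * i * I * (am * (2 * m + 1 + (α + β + 2 * lam)))) * Q
      + ((ωm - lam * s ^ 2) * P - am * ξm * Q) * I * τ⁻¹ := by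
  have hρ' : ρ = -(s * τ * i) := by rw [hρ, hx]; ring
  have hN : 2 * lam * (1 - x ^ 2) = 2 * lam * s ^ 2 - 2 * lam * ρ * (x + x₁) := by rw [hs2, hρ]; ring
  have ht : τ * τ⁻¹ = 1 := mul_inv_cancel₀ hτ
  rw [hN, hρ'] at L1
  linear_combination I * τ⁻¹ * L1 + (s * i * D) * ht * (1 - x ^ 2) * I + s * i * D * hI + (-(s * i * I) * ((-(m + (α + β + 2 * lam) / 2) * x + gm
      - ((-α * (1 + x) + β * (1 - x)) / 2 - lam * (x + x₁))) * P + (am * (2 * m + 1 + (α + β + 2 * lam))) * Q)) * ht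

theorem ode_alg2 {x₁ α β lam s τ m i x ρ I gm ωm am ξm P Q D : ℝ} (hi : i * m = 1) (hτ : τ ≠ 0)
    (hx : x = x₁ - s * τ * i) (hI : (1 - x ^ 2) * I = 1) (hρ : ρ = x - x₁) (hs2 : s ^ 2 = 1 - x₁ ^ 2)
    (L2 : (1 - x ^ 2) * ρ * D =
      am * (-(2 * m - 1 + (α + β + 2 * lam)) * ρ + ξm) * P -
      (ρ * (-(m + (α + β + 2 * lam) / 2) * x + gm) + ωm
      + (-α * (1 + x) * ρ + β * (1 - x) * ρ + 2 * lam * (1 - x ^ 2)) / 2) * Q) :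
    -(s * i) * D = (s * i * I * (am * (2 * m - 1 + (α + β + 2 * lam)))) * P
      + -(s * i * I * ((m + (α + β + 2 * lam) / 2) * x - gm
      - ((-α * (1 + x) + β * (1 - x)) / 2 - lam * (x + x₁)))) * Q
      + (am * ξm * P - (ωm + lam * s ^ 2) * Q) * I * τ⁻¹ := by
  have hρ' : ρ = -(s * τ * i) := by rw [hρ, hx]; ring
  have hN : 2 * lam * (1 - x ^ 2) = 2 * lam * s ^ 2 - 2 * lam * ρ * (x + x₁) := by rw [hs2, hρ]; ring
  have ht : τ * τ⁻¹ = 1 := mul_inv_cancel₀ hτ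
  rw [hN, hρ'] at L2
  linear_combination I * τ⁻¹ * L2 + (s * i * D) * ht * (1 - x ^ 2) * I + s * i * D * hI + (s * i * I) * ((am * (2 * m - 1 + (α + β + 2 * lam))) * P + (-(m + (α + β + 2 * lam) / 2) * x + gm
      + ((-α * (1 + x) + β * (1 - x)) / 2 - lam * (x + x₁))) * Q) * ht

end Dyn
end Magnus
end

section
open Filter Topology Set Polynomial

namespace Magnus
namespace Dyn
variable {x₁ α β lam : ℝ} {p : ℕ → ℝ[X]} {a b g ω ξ : ℕ → ℝ}

/-- rescaled polynomial value near the singular point -/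
noncomputable def zt (x₁ s : ℝ) (p : ℕ → ℝ[X]) (n : ℕ) (τ : ℝ) : ℂ :=
  ⟨(p (n + 1)).eval (x₁ - s * τ * ((n + 1 : ℕ) : ℝ)⁻¹),
    ((p n).eval (x₁ - s * τ * ((n + 1 : ℕ) : ℝ)⁻¹) - x₁ * (p (n + 1)).eval (x₁ - s * τ * ((n + 1 : ℕ) : ℝ)⁻¹)) / s⟩

theorem zt_zero (x₁ s : ℝ) (p : ℕ → ℝ[X]) (n : ℕ) : zt x₁ s p n 0 = Zc x₁ s p n := by
  simp [zt, Zc]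

noncomputable def Uf (x₁ s : ℝ) (p : ℕ → ℝ[X]) (n : ℕ) (cx cy τ : ℝ) : ℝ :=
  (zt x₁ s p n τ).re * cx + (zt x₁ s p n τ).im * cy

theorem Uf_lip (x₁ s : ℝ) (p : ℕ → ℝ[X]) (n : ℕ) (cx cy T : ℝ) :
    ∃ S, ∀ τ, |τ| ≤ T → |Uf x₁ s p n cx cy τ - Uf x₁ s p n cx cy 0| ≤ S * |τ| := by
  obtain ⟨Q, hQ⟩ : ∃ Q : ℝ[X], ∀ τ, Uf x₁ s p n cx cy τ = Q.eval τ := by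
    obtain ⟨l, hl⟩ : ∃ l : ℝ[X], l = C x₁ - C (s * ((n + 1 : ℕ) : ℝ)⁻¹) * X := ⟨_, rfl⟩
    have hl' : ∀ τ, l.eval τ = x₁ - s * τ * ((n + 1 : ℕ) : ℝ)⁻¹ := fun τ => by rw [hl]; simp; ring
    refine ⟨C cx * (p (n + 1)).comp l + C (cy / s) * ((p n).comp l - C x₁ * (p (n + 1)).comp l), fun τ => ?_⟩
    simp only [eval_add, eval_mul, eval_C, eval_sub, eval_comp, hl', Uf, zt]
    ring
  have : (X : ℝ[X]) ∣ Q - C (Q.eval 0) := by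
    rw [X_dvd_iff]; simp [coeff_zero_eq_eval_zero]
  obtain ⟨q, hq⟩ := this
  obtain ⟨S, hS⟩ := (isCompact_Icc (a := -T) (b := T)).exists_bound_of_continuousOn (f := fun t => q.eval t) q.continuous.continuousOn
  refine ⟨S, fun τ hτ => ?_⟩
  have h := congrArg (fun r : ℝ[X] => r.eval τ) hq
  simp only [eval_sub, eval_C, eval_mul, eval_X] at h
  rw [hQ, hQ, h, abs_mul, mul_comm]
  have := hS τ ⟨by linarith [neg_abs_le τ], (le_abs_self τ).trans hτ⟩
  rw [Real.norm_eq_abs] at this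
  gcongr

theorem Uf_deriv (x₁ s : ℝ) (p : ℕ → ℝ[X]) (n : ℕ) (cx cy τ : ℝ) :
    HasDerivAt (Uf x₁ s p n cx cy) (-(s * ((n + 1 : ℕ) : ℝ)⁻¹) * (derivative (p (n + 1))).eval (x₁ - s * τ * ((n + 1 : ℕ) : ℝ)⁻¹) * cx
      + (-(s * ((n + 1 : ℕ) : ℝ)⁻¹) * (derivative (p n)).eval (x₁ - s * τ * ((n + 1 : ℕ) : ℝ)⁻¹)
        - x₁ * (-(s * ((n + 1 : ℕ) : ℝ)⁻¹) * (derivative (p (n + 1))).eval (x₁ - s * τ * ((n + 1 : ℕ) : ℝ)⁻¹))) / s * cy) τ := by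
  have hy : HasDerivAt (fun τ : ℝ => x₁ - s * τ * ((n + 1 : ℕ) : ℝ)⁻¹) (-(s * ((n + 1 : ℕ) : ℝ)⁻¹)) τ := by
    have := ((((hasDerivAt_id τ).const_mul s).mul_const (((n + 1 : ℕ) : ℝ)⁻¹)).const_sub x₁)
    exact this.congr_deriv (by simp)
  have h1 := ((p (n + 1)).hasDerivAt (x₁ - s * τ * ((n + 1 : ℕ) : ℝ)⁻¹)).comp τ hy
  have h2 := ((p n).hasDerivAt (x₁ - s * τ * ((n + 1 : ℕ) : ℝ)⁻¹)).comp τ hy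
  refine ((h1.mul_const cx).add (((h2.sub (h1.const_mul x₁)).div_const s).mul_const cy)).congr_deriv ?_
  ring

set_option maxHeartbeats 1000000 in
theorem ode (D : Dyn x₁ α β lam p a b g ω ξ) (hx : -1 < x₁ ∧ x₁ < 1) {s : ℝ} (hs : 0 < s)
    (hs2 : s ^ 2 = 1 - x₁ ^ 2) (n : ℕ) {cx cy R τ : ℝ} (hR : R ≠ 0) (hc : cx ^ 2 + cy ^ 2 = 1)
    (hx1 : (p (n + 3)).eval x₁ = R * cx) (hx2 : (p (n + 2)).eval x₁ = R * (x₁ * cx + s * cy)) (hτ : τ ≠ 0)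
    (hS : 1 - (x₁ - s * τ * ((n + 3 : ℕ) : ℝ)⁻¹) ^ 2 ≠ 0) :
    ∃ e1 e2, HasDerivAt (Uf x₁ s p (n + 2) cx cy) (-Uf x₁ s p (n + 2) (-cy) cx τ + e1) τ ∧
      HasDerivAt (Uf x₁ s p (n + 2) (-cy) cx) (Uf x₁ s p (n + 2) cx cy τ - 2 * lam / τ * Uf x₁ s p (n + 2) (-cy) cx τ + e2) τ ∧
      |e1| ≤ (5 + 6 / s) * errc x₁ α β lam s a g ω ξ (n + 3) τ * (|Uf x₁ s p (n + 2) cx cy τ| +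
        |Uf x₁ s p (n + 2) (-cy) cx τ| + |Uf x₁ s p (n + 2) (-cy) cx τ| / |τ|) ∧
      |e2| ≤ (5 + 6 / s) * errc x₁ α β lam s a g ω ξ (n + 3) τ * (|Uf x₁ s p (n + 2) cx cy τ| +
        |Uf x₁ s p (n + 2) (-cy) cx τ| + |Uf x₁ s p (n + 2) (-cy) cx τ| / |τ|) := by
  have H1 := Uf_deriv x₁ s p (n + 2) cx cy τ
  have H2 := Uf_deriv x₁ s p (n + 2) (-cy) cx τ
  have P1 := D.Prel1 n
  have P2 := D.Prel2 n
  have hU : Uf x₁ s p (n + 2) cx cy τ = (p (n + 3)).eval (x₁ - s * τ * ((n + 3 : ℕ) : ℝ)⁻¹) * cx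
    + ((p (n + 2)).eval (x₁ - s * τ * ((n + 3 : ℕ) : ℝ)⁻¹) - x₁ * (p (n + 3)).eval (x₁ - s * τ * ((n + 3 : ℕ) : ℝ)⁻¹)) / s * cy := rfl
  have hV : Uf x₁ s p (n + 2) (-cy) cx τ = (p (n + 3)).eval (x₁ - s * τ * ((n + 3 : ℕ) : ℝ)⁻¹) * (-cy)
    + ((p (n + 2)).eval (x₁ - s * τ * ((n + 3 : ℕ) : ℝ)⁻¹) - x₁ * (p (n + 3)).eval (x₁ - s * τ * ((n + 3 : ℕ) : ℝ)⁻¹)) / s * cx := rfl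
  simp only [show n + 2 + 1 = n + 3 by omega] at H1 H2
  have L1 := D.L1 (n + 1) (x₁ - s * τ * ((n + 3 : ℕ) : ℝ)⁻¹)
  have L2 := D.L2 n (x₁ - s * τ * ((n + 3 : ℕ) : ℝ)⁻¹)
  simp only [show n + 1 + 2 = n + 3 by omega, show n + 1 + 1 = n + 2 by omega] at L1
  have hm : ((n + 1 : ℕ) : ℝ) + 2 = ((n + 3 : ℕ) : ℝ) := by push_cast; ring
  have hm2 : (n : ℝ) + 3 = ((n + 3 : ℕ) : ℝ) := by push_cast; ring
  have hm3 : 2 * ((n : ℝ) + 2) + 1 = 2 * ((n + 3 : ℕ) : ℝ) - 1 := by push_cast; ring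
  rw [hm] at L1
  rw [hm2, hm3] at L2
  have him : (((n + 3 : ℕ) : ℝ)⁻¹) * ((n + 3 : ℕ) : ℝ) = 1 := inv_mul_cancel₀ (by positivity)
  unfold errc
  simp only [show n + 3 - 1 = n + 2 by omega]
  obtain ⟨m, hmm⟩ : ∃ m : ℝ, m = ((n + 3 : ℕ) : ℝ) := ⟨_, rfl⟩
  rw [← hmm] at H1 H2 L1 L2 hU hV him hS ⊢
  obtain ⟨i, hi⟩ : ∃ i, i = m⁻¹ := ⟨_, rfl⟩
  rw [← hi] at H1 H2 L1 L2 hU hV him hS ⊢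
  obtain ⟨x, hxd⟩ : ∃ x, x = x₁ - s * τ * i := ⟨_, rfl⟩
  rw [← hxd] at H1 H2 L1 L2 hU hV hS ⊢
  obtain ⟨I, hId⟩ : ∃ I, I = (1 - x ^ 2)⁻¹ := ⟨_, rfl⟩
  have hI : (1 - x ^ 2) * I = 1 := by rw [hId]; exact mul_inv_cancel₀ hS
  rw [← hId]
  have q1 : (ω (n + 3) - lam * s ^ 2) * cx = a (n + 3) * ξ (n + 3) * (x₁ * cx + s * cy) := by
    apply mul_left_cancel₀ hR
    rw [hx1, hx2, ← hs2] at P1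
    linear_combination P1
  have q2 : a (n + 3) * ξ (n + 2) * cx = (ω (n + 3) + lam * s ^ 2) * (x₁ * cx + s * cy) := by
    apply mul_left_cancel₀ hR
    rw [hx1, hx2, ← hs2] at P2
    linear_combination -P2
  obtain ⟨U, hUd⟩ : ∃ U, U = Uf x₁ s p (n + 2) cx cy τ := ⟨_, rfl⟩
  obtain ⟨V, hVd⟩ : ∃ V, V = Uf x₁ s p (n + 2) (-cy) cx τ := ⟨_, rfl⟩
  rw [← hUd] at hU ⊢
  rw [← hVd] at hV ⊢
  clear hUd hVd hmm
  have A1 := ode_alg him hτ hxd hI rfl hs2 L1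
  have A2 := ode_alg2 him hτ hxd hI rfl hs2 L2
  obtain ⟨P, hPd⟩ : ∃ P, P = (p (n + 3)).eval x := ⟨_, rfl⟩
  obtain ⟨Q, hQd⟩ : ∃ Q, Q = (p (n + 2)).eval x := ⟨_, rfl⟩
  rw [← hPd, ← hQd] at A1 A2 hU hV
  have hsn := hs.ne'
  have hP : P = U * cx - V * cy := by
    rw [hU, hV]; linear_combination -P * hc
  have hQ : Q = x₁ * P + s * (U * cy + V * cx) := by
    rw [hU, hV]
    have e : s * ((Q - x₁ * P) / s) = Q - x₁ * P := by field_simp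
    linear_combination -(Q - x₁ * P) * hc - (cx ^ 2 + cy ^ 2) * e
  obtain ⟨ae, hae⟩ : ∃ y, y = a (n + 3) * ξ (n + 3) := ⟨_, rfl⟩
  obtain ⟨ae', hae'⟩ : ∃ y, y = a (n + 3) * ξ (n + 2) := ⟨_, rfl⟩
  rw [← hae] at A1 q1 ⊢
  rw [← hae'] at A2 q2 ⊢
  rw [A1, A2] at H1 H2
  obtain ⟨R1, R2⟩ := alg_res hsn rfl hc q1 q2 hP hQ
  obtain ⟨F1, hF1⟩ : ∃ F, F = -(s * i * I * (-(m + (α + β + 2 * lam) / 2) * x + g (n + 3)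
      - ((-α * (1 + x) + β * (1 - x)) / 2 - lam * (x + x₁)))) := ⟨_, rfl⟩
  obtain ⟨F2, hF2⟩ : ∃ F, F = -(s * i * I * (a (n + 3) * (2 * m + 1 + (α + β + 2 * lam)))) := ⟨_, rfl⟩
  obtain ⟨F3, hF3⟩ : ∃ F, F = s * i * I * (a (n + 3) * (2 * m - 1 + (α + β + 2 * lam))) := ⟨_, rfl⟩
  obtain ⟨F4, hF4⟩ : ∃ F, F = -(s * i * I * ((m + (α + β + 2 * lam) / 2) * x - g (n + 3)
      - ((-α * (1 + x) + β * (1 - x)) / 2 - lam * (x + x₁)))) := ⟨_, rfl⟩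
  obtain ⟨st, hst⟩ : ∃ F, F = (-ae * s - (ae' - 2 * x₁ * ω (n + 3) + x₁ ^ 2 * ae) / s) := ⟨_, rfl⟩
  obtain ⟨r1, hr1⟩ : ∃ F, F = (ω (n + 3) - lam * s ^ 2) * P - ae * Q := ⟨_, rfl⟩
  obtain ⟨r2, hr2⟩ : ∃ F, F = ae' * P - (ω (n + 3) + lam * s ^ 2) * Q := ⟨_, rfl⟩
  rw [← hF1, ← hF2, ← hF3, ← hF4] at H1 H2 ⊢
  rw [← hr1, ← hr2] at H1 H2 R1 R2
  rw [← hst] at R1 ⊢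
  obtain ⟨k, hk⟩ : ∃ k, k = 2 * lam * s * (x₁ + x) * i * I := ⟨_, rfl⟩
  rw [← hk]
  clear A1 A2 L1 L2 P1 P2 hF1 hF2 hF3 hF4 hst hr1 hr2 q1 q2 hm hm2 hm3
  obtain ⟨Err, hErr⟩ : ∃ E, E = |F1 - x₁ / s| + |F2 + 1 / s| + |F3 - 1 / s| + |F4 + x₁ / s| + |st * I| + |k| + |1 - x ^ 2 - s ^ 2| := ⟨_, rfl⟩
  rw [← hErr]
  have n1 := abs_nonneg (F1 - x₁ / s)
  have n2 := abs_nonneg (F2 + 1 / s)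
  have n3 := abs_nonneg (F3 - 1 / s)
  have n4 := abs_nonneg (F4 + x₁ / s)
  have n5 := abs_nonneg (st * I)
  have n6 := abs_nonneg k
  have n7 := abs_nonneg (1 - x ^ 2 - s ^ 2)
  have hx' : |x₁| ≤ 1 := abs_le.2 ⟨hx.1.le, hx.2.le⟩
  have hs1 : s ≤ 1 := by nlinarith
  have hcx : |cx| ≤ 1 := abs_le_one_iff_mul_self_le_one.2 (by nlinarith)
  have hcy : |cy| ≤ 1 := abs_le_one_iff_mul_self_le_one.2 (by nlinarith)
  have E1 : |F1 - x₁ / s| ≤ Err := by linarith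
  have E2 : |F2 + 1 / s| ≤ Err := by linarith
  have E3 : |F3 - 1 / s| ≤ Err := by linarith
  have E4 : |F4 + x₁ / s| ≤ Err := by linarith
  have E5 : |st * I| ≤ Err := by linarith
  have E6 : |k| ≤ Err := by linarith
  have B1 := alg_bd (τ := τ) hs hx' hs1 hcx hcy hP hQ E1 E2 E3 E4 E5
  have B2 := alg_bd2 (τ := τ) hs hx' hs1 hcx hcy hP hQ E1 E2 E3 E4 E6
  have hs3 : (1 - x₁ ^ 2) * s⁻¹ * s⁻¹ = 1 := by rw [← hs2]; field_simp
  have hk2 : -2 * (lam * s ^ 2) * V * (I * τ⁻¹) = -(2 * lam * τ⁻¹ * V) + k * V := by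
    have ht : τ * τ⁻¹ = 1 := mul_inv_cancel₀ hτ
    have e : (s ^ 2 + (s * τ * i) * (x₁ + x)) * I = 1 := by
      rw [← hI, hs2]; rw [show s * τ * i = x₁ - x by rw [hxd]; ring]; ring
    rw [hk]
    linear_combination (-2 * lam * V * τ⁻¹) * e + 2 * lam * V * s * i * (x₁ + x) * I * ht
  clear hk hErr hI hId hS hxd hQ hP
  refine ⟨_, _, H1.congr_deriv ?_, H2.congr_deriv ?_, B1.trans ?_, B2⟩
  · clear B1 B2 R2 H1 H2 hk2
    rw [hV]
    simp only [div_eq_mul_inv, one_mul] at R1 hV ⊢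
    linear_combination I * τ⁻¹ * R1 + P * cy * hs3 + I * τ⁻¹ * st * hV
  · clear B1 B2 R1 H1 H2
    rw [hU]
    simp only [div_eq_mul_inv, one_mul] at R2 ⊢
    linear_combination I * τ⁻¹ * R2 + P * cx * hs3 + hk2
  · have : 0 ≤ Err := (abs_nonneg _).trans E1
    gcongr; norm_num
end Dyn
end Magnus
end

section
open Filter Topology Set Polynomial

namespace Magnus
namespace Dyn
variable {x₁ α β lam : ℝ} {p : ℕ → ℝ[X]} {a b g ω ξ : ℕ → ℝ}

set_option maxHeartbeats 1000000 in
theorem symm (D : Dyn x₁ α β lam p a b g ω ξ) (hx : -1 < x₁ ∧ x₁ < 1) {s : ℝ} (hs : 0 < s)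
    (hs2 : s ^ 2 = 1 - x₁ ^ 2) (hlam : -1 < 2 * lam)
    (ha : Tendsto a atTop (𝓝 (1 / 2))) (hg : Tendsto g atTop (𝓝 0)) (w : ℕ → ℂ) (hw1 : ∀ n, ‖w n‖ = 1)
    (hwZ : ∀ n, Zc x₁ s p n = ‖Zc x₁ s p n‖ * w n) {T : ℝ} (hT : 0 < T) :
    ∃ C : ℝ, 0 ≤ C ∧ ∃ N : ℕ, ∀ n, N ≤ n → ∀ t, 0 < t → t ≤ T →
      ‖zt x₁ s p n t * star (w n)‖ ≤ C * ‖Zc x₁ s p n‖ ∧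
      ‖zt x₁ s p n (-t) * star (w n) - star (zt x₁ s p n t * star (w n))‖ ≤ C * ‖Zc x₁ s p n‖ * ((n + 1 : ℕ) : ℝ)⁻¹ := by
  obtain ⟨C0, hC0, N0, hN0, HE⟩ := D.errc_ok hx hs hs2 ha hg hT.le
  obtain ⟨M, hM, HP⟩ := sing_pair hlam
  obtain ⟨G, hG⟩ : ∃ G, G = (5 + 6 / s) * C0 := ⟨_, rfl⟩
  have hG0 : 0 ≤ G := by rw [hG]; positivity
  obtain ⟨N1, hN1⟩ := exists_nat_gt (C0 / s ^ 2 + G + 2 * (M * G * (2 * T + 1)))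
  have z1 : 0 ≤ C0 / s ^ 2 := by positivity
  have z2 : 0 ≤ M * G * (2 * T + 1) := by positivity
  obtain ⟨K, hK⟩ : ∃ K, K = M * (2 * (G * (1 + 4 * M * (2 * T + 1)))) * T := ⟨_, rfl⟩
  have hK0 : 0 ≤ K := by rw [hK]; positivity
  refine ⟨1 + 8 * M * T + 2 * K, by positivity, N0 + N1 + 2, fun n hn => ?_⟩
  obtain ⟨k, rfl⟩ : ∃ k, n = k + 2 := ⟨n - 2, by omega⟩
  have hmN0 : N0 ≤ k + 3 := by omega
  have hmN1 : (N1 : ℝ) ≤ ((k + 3 : ℕ) : ℝ) := by exact_mod_cast (by omega : N1 ≤ k + 3)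
  have HE' := HE (k + 3) hmN0
  have e3 : k + 2 + 1 = k + 3 := by omega
  rw [e3]
  have him : 0 < (((k + 3 : ℕ) : ℝ)) := by positivity
  obtain ⟨m, hm⟩ : ∃ m : ℝ, m = ((k + 3 : ℕ) : ℝ) := ⟨_, rfl⟩
  obtain ⟨cx, hcx⟩ : ∃ c, c = (w (k + 2)).re := ⟨_, rfl⟩
  obtain ⟨cy, hcy⟩ : ∃ c, c = (w (k + 2)).im := ⟨_, rfl⟩
  have hR : 0 < ‖Zc x₁ s p (k + 2)‖ := norm_pos_iff.2 (D.Zc_ne hs _)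
  have hre := congrArg Complex.re (hwZ (k + 2))
  have hig := congrArg Complex.im (hwZ (k + 2))
  rw [Complex.re_ofReal_mul, ← hcx] at hre
  rw [Complex.im_ofReal_mul, ← hcy] at hig
  have hU0 : Uf x₁ s p (k + 2) cx cy 0 = (Zc x₁ s p (k + 2)).re * cx + (Zc x₁ s p (k + 2)).im * cy := by
    unfold Uf; rw [zt_zero]
  have hV0 : Uf x₁ s p (k + 2) (-cy) cx 0 = (Zc x₁ s p (k + 2)).re * (-cy) + (Zc x₁ s p (k + 2)).im * cx := by
    unfold Uf; rw [zt_zero]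
  have hc : cx ^ 2 + cy ^ 2 = 1 := by
    have := hw1 (k + 2)
    rw [Complex.norm_eq_sqrt_sq_add_sq, Real.sqrt_eq_one, ← hcx, ← hcy] at this
    exact this
  obtain ⟨R, hRd⟩ : ∃ R, R = ‖Zc x₁ s p (k + 2)‖ := ⟨_, rfl⟩
  rw [← hRd] at hR hre hig ⊢
  rw [hre, hig] at hU0 hV0
  have hU0' : Uf x₁ s p (k + 2) cx cy 0 = R := by rw [hU0]; linear_combination R * hc
  have hV0' : Uf x₁ s p (k + 2) (-cy) cx 0 = 0 := by rw [hV0]; ring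
  have q1 : (p (k + 3)).eval x₁ = R * cx := hre
  have q2 : (p (k + 2)).eval x₁ = R * (x₁ * cx + s * cy) := by
    have : ((p (k + 2)).eval x₁ - x₁ * (p (k + 3)).eval x₁) / s = R * cy := hig
    rw [div_eq_iff hs.ne', q1] at this
    linear_combination this
  obtain ⟨ε, hε⟩ : ∃ ε, ε = G / m := ⟨_, rfl⟩
  rw [← hm] at him hmN1
  have hε0 : 0 ≤ ε := by rw [hε]; positivity
  have hε1 : ε ≤ 1 := by rw [hε, div_le_one him]; linarith
  have hε2 : M * ε * (2 * T + 1) ≤ 1 / 2 := by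
    rw [hε, show M * (G / m) * (2 * T + 1) = M * G * (2 * T + 1) / m by ring, div_le_iff₀ him]; linarith
  have hode : ∀ τ, τ ≠ 0 → |τ| ≤ T → ∃ e1 e2, HasDerivAt (Uf x₁ s p (k + 2) cx cy) (-Uf x₁ s p (k + 2) (-cy) cx τ + e1) τ ∧
      HasDerivAt (Uf x₁ s p (k + 2) (-cy) cx) (Uf x₁ s p (k + 2) cx cy τ - 2 * lam / τ * Uf x₁ s p (k + 2) (-cy) cx τ + e2) τ ∧
      |e1| ≤ ε * (|Uf x₁ s p (k + 2) cx cy τ| +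
        |Uf x₁ s p (k + 2) (-cy) cx τ| + |Uf x₁ s p (k + 2) (-cy) cx τ| / |τ|) ∧
      |e2| ≤ ε * (|Uf x₁ s p (k + 2) cx cy τ| +
        |Uf x₁ s p (k + 2) (-cy) cx τ| + |Uf x₁ s p (k + 2) (-cy) cx τ| / |τ|) := by
    intro τ hτ hτT
    have hb := (le_abs_self _).trans (HE' τ hτT)
    rw [← hm, pow_one] at hb
    have hS : 1 - (x₁ - s * τ * ((k + 3 : ℕ) : ℝ)⁻¹) ^ 2 ≠ 0 := by
      intro h0
      have h1 : |1 - (x₁ - s * τ * ((k + 3 : ℕ) : ℝ)⁻¹) ^ 2 - s ^ 2| ≤ errc x₁ α β lam s a g ω ξ (k + 3) τ := by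
        unfold errc
        exact le_add_of_nonneg_left (by positivity)
      rw [h0, zero_sub, abs_neg, abs_of_nonneg (by positivity)] at h1
      have h2 := h1.trans hb
      rw [le_div_iff₀ him, ← le_div_iff₀' (by positivity)] at h2
      linarith
    obtain ⟨e1, e2, h1, h2, h3, h4⟩ := D.ode hx hs hs2 k hR.ne' hc q1 q2 hτ hS
    have hcb : (5 + 6 / s) * errc x₁ α β lam s a g ω ξ (k + 3) τ ≤ ε := by
      rw [hε, hG, mul_div_assoc]; gcongr
    exact ⟨e1, e2, h1, h2, h3.trans (by gcongr), h4.trans (by gcongr)⟩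
  obtain ⟨S1, hS1⟩ := Uf_lip x₁ s p (k + 2) cx cy T
  obtain ⟨S2, hS2⟩ := Uf_lip x₁ s p (k + 2) (-cy) cx T
  rw [hU0'] at hS1
  rw [hV0'] at hS2
  obtain ⟨U, hU⟩ : ∃ U, U = Uf x₁ s p (k + 2) cx cy := ⟨_, rfl⟩
  obtain ⟨V, hV⟩ : ∃ V, V = Uf x₁ s p (k + 2) (-cy) cx := ⟨_, rfl⟩
  rw [← hU] at hode hS1
  rw [← hV] at hode hS2
  have hode' : ∀ τ, ∃ e : ℝ × ℝ, τ ≠ 0 → |τ| ≤ T → (HasDerivAt U (-V τ + e.1) τ ∧ HasDerivAt V (U τ - 2 * lam / τ * V τ + e.2) τ ∧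
      |e.1| ≤ ε * (|U τ| + |V τ| + |V τ| / |τ|) ∧ |e.2| ≤ ε * (|U τ| + |V τ| + |V τ| / |τ|)) := by
    intro τ
    by_cases h : τ ≠ 0 ∧ |τ| ≤ T
    · obtain ⟨e1, e2, H⟩ := hode τ h.1 h.2
      exact ⟨(e1, e2), fun _ _ => H⟩
    · exact ⟨0, fun h1 h2 => absurd ⟨h1, h2⟩ h⟩
  choose e he using hode'
  have Ha : Sing (2 * lam) T ε R (max S1 S2) U V (fun t => (e t).1) (fun t => (e t).2) := by
    have hab : ∀ t, 0 < t → t ≤ T → |t| ≤ T := fun t h1 h2 => by rwa [abs_of_pos h1]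
    have A := fun t h1 h2 => he t (ne_of_gt h1) (hab t h1 h2)
    refine ⟨fun t h1 h2 => (A t h1 h2).1, fun t h1 h2 => (A t h1 h2).2.1, fun t h1 h2 => ?_, fun t h1 h2 => ?_, fun t h1 h2 => ?_, fun t h1 h2 => ?_⟩
    · have := (A t h1 h2).2.2.1
      rwa [abs_of_pos h1] at this
    · have := (A t h1 h2).2.2.2
      rwa [abs_of_pos h1] at this
    · have := hS1 t (hab t h1 h2)
      rw [abs_of_pos h1] at this
      exact this.trans (by gcongr; exact le_max_left _ _)
    · have := hS2 t (hab t h1 h2)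
      rw [abs_of_pos h1, sub_zero] at this
      exact this.trans (by gcongr; exact le_max_right _ _)
  have Hb : Sing (2 * lam) T ε R (max S1 S2) (fun t => U (-t)) (fun t => -V (-t)) (fun t => -(e (-t)).1) (fun t => (e (-t)).2) := by
    have hab : ∀ t, 0 < t → t ≤ T → |-t| ≤ T := fun t h1 h2 => by rwa [abs_neg, abs_of_pos h1]
    have A := fun t h1 h2 => he (-t) (by linarith : -t < 0).ne (hab t h1 h2)
    refine ⟨fun t h1 h2 => ?_, fun t h1 h2 => ?_, fun t h1 h2 => ?_, fun t h1 h2 => ?_, fun t h1 h2 => ?_, fun t h1 h2 => ?_⟩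
    · have := HasDerivAt.comp t (A t h1 h2).1 (hasDerivAt_neg t)
      exact this.congr_deriv (by ring)
    · have := (HasDerivAt.comp t (A t h1 h2).2.1 (hasDerivAt_neg t)).neg
      refine this.congr_deriv ?_
      rw [div_neg]; ring
    · have := (A t h1 h2).2.2.1
      rw [abs_neg t, abs_of_pos h1] at this
      simpa only [abs_neg] using this
    · have := (A t h1 h2).2.2.2
      rw [abs_neg t, abs_of_pos h1] at this
      simpa only [abs_neg] using this
    · have := hS1 (-t) (hab t h1 h2)
      rw [abs_neg t, abs_of_pos h1] at this
      exact this.trans (by gcongr; exact le_max_left _ _)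
    · have := hS2 (-t) (hab t h1 h2)
      rw [abs_neg t, abs_of_pos h1, sub_zero] at this
      rw [abs_neg]
      exact this.trans (by gcongr; exact le_max_right _ _)
  have fin := HP T ε R (max S1 S2) _ _ _ _ _ _ _ _ hT hε0 hε1 hR.le hε2 Ha Hb
  have hz : ∀ t, zt x₁ s p (k + 2) t * star (w (k + 2)) = ⟨U t, V t⟩ := by
    intro t
    apply Complex.ext
    · simp [hU, Uf, hcx, hcy]
    · simp [hV, Uf, hcx, hcy]
  intro t h1 h2
  obtain ⟨⟨f1, f2⟩, f3, f4⟩ := fin t h1 h2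
  rw [hz, hz]
  have nb : ∀ z : ℂ, ‖z‖ ≤ |z.re| + |z.im| := Complex.norm_le_abs_re_add_abs_im
  constructor
  · refine (nb _).trans ((add_le_add f1 f2).trans ?_)
    have : 0 ≤ R * K := by positivity
    linarith
  · refine (nb _).trans ?_
    have g1 : (({ re := U (-t), im := V (-t) } : ℂ) - star { re := U t, im := V t }).re = U (-t) - U t := by simp
    have g2 : (({ re := U (-t), im := V (-t) } : ℂ) - star { re := U t, im := V t }).im = V t - -V (-t) := by simp; ring
    rw [g1, g2, abs_sub_comm]
    refine (add_le_add f3 f4).trans ?_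
    have e4 : M * (2 * (ε * (R + 4 * M * R * (2 * T + 1)))) * T = K * R * m⁻¹ := by rw [hε, hK]; ring
    rw [e4, ← hm]
    have : 0 ≤ (1 + 8 * M * T) * R * m⁻¹ := by positivity
    linarith
end Dyn
end Magnus
end

section
open Filter Topology Set MeasureTheory

namespace Magnus

theorem avg {g : ℝ → ℝ} (h0 : ∀ x, 0 ≤ g x) (hg : IntegrableOn g (Ioo (-1 : ℝ) 1)) {B x₁ δ K : ℝ}
    (hB : ∫ x in Ioo (-1 : ℝ) 1, g x ≤ B) (hδ : 0 < δ) (hK : 0 < K) (h1 : -1 < x₁ - δ * (2 * K)) (h2 : x₁ + δ * (2 * K) < 1) :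
    ∃ τ ∈ Ioc K (2 * K), g (x₁ - δ * τ) + g (x₁ + δ * τ) ≤ 2 * B / (δ * K) := by
  have hKK : K ≤ 2 * K := by linarith
  have key : ∀ c : ℝ, c ≠ 0 → |c| = δ →
    IntervalIntegrable (fun τ => g (x₁ + c * τ)) volume K (2 * K) ∧ ∫ τ in K..(2 * K), g (x₁ + c * τ) ≤ B / δ := by
    intro c hc hcδ
    have sub : uIoc (x₁ + c * K) (x₁ + c * (2 * K)) ⊆ Ioo (-1 : ℝ) 1 := by
      intro y hy
      have e1 : δ * K ≤ δ * (2 * K) := by gcongr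
      have e0 : 0 < δ * K := by positivity
      rcases abs_choice c with h | h
      · rw [h] at hcδ; rw [hcδ] at hy
        rw [uIoc_of_le (by linarith)] at hy
        constructor
        · linarith [hy.1]
        · linarith [hy.2]
      · rw [h] at hcδ; rw [show c = -δ by linarith] at hy
        rw [uIoc_of_ge (by linarith)] at hy
        constructor
        · linarith [hy.1]
        · linarith [hy.2]
    have hi : IntervalIntegrable g volume (x₁ + c * K) (x₁ + c * (2 * K)) := by
      rw [intervalIntegrable_iff]; exact hg.mono_set sub
    constructor
    · have := (hi.comp_add_left x₁).comp_mul_left (c := c)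
      have e : ∀ y, (x₁ + c * y - x₁) / c = y := fun y => by field_simp; ring
      rw [e, e] at this
      exact this
    · rw [intervalIntegral.integral_comp_add_mul _ hc, smul_eq_mul]
      have b1 : |∫ x in (x₁ + c * K)..(x₁ + c * (2 * K)), g x| ≤ B := by
        rw [intervalIntegral.abs_integral_eq_abs_integral_uIoc, abs_of_nonneg (integral_nonneg h0)]
        exact (setIntegral_mono_set hg (ae_of_all _ h0) sub.eventuallyLE).trans hB
      refine (le_abs_self _).trans ?_
      rw [abs_mul, abs_inv, hcδ, div_eq_inv_mul]
      gcongr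
  obtain ⟨i1, j1⟩ := key (-δ) (by linarith) (by rw [abs_neg, abs_of_pos hδ])
  obtain ⟨i2, j2⟩ := key δ hδ.ne' (abs_of_pos hδ)
  have e1 : ∀ τ, x₁ + -δ * τ = x₁ - δ * τ := fun τ => by ring
  simp only [e1] at i1 j1
  have isum := i1.add i2
  rw [intervalIntegrable_iff, uIoc_of_le hKK] at isum
  obtain ⟨τ, hτ, hle⟩ := exists_le_setAverage (μ := volume) (s := Ioc K (2 * K)) (by simp [hK]) (by simp) isum
  refine ⟨τ, hτ, hle.trans ?_⟩
  rw [setAverage_eq, ← intervalIntegral.integral_of_le hKK, smul_eq_mul]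
  have := intervalIntegral.integral_add i1 i2
  have hv : volume.real (Ioc K (2 * K)) = K := by simp [measureReal_def, Real.volume_Ioc]; rw [show 2 * K - K = K by ring, ENNReal.toReal_ofReal hK.le]
  rw [hv]
  have e : ∫ τ in K..(2 * K), (g (x₁ - δ * τ) + g (x₁ + δ * τ)) ≤ 2 * (B / δ) := by
    rw [this]; linarith
  calc _ ≤ K⁻¹ * (2 * (B / δ)) := mul_le_mul_of_nonneg_left e (by positivity)
    _ = _ := by field_simp

end Magnus
end

section
open Filter Topology Set Polynomial MeasureTheory

namespace Magnus
namespace Ph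

variable {x₁ s : ℝ}

noncomputable def xs (x₁ s : ℝ) (n : ℕ) (y : ℝ) : ℝ := x₁ - s * y * ((n + 1 : ℕ) : ℝ)⁻¹

theorem inv_lim : Tendsto (fun n : ℕ => ((n + 1 : ℕ) : ℝ)⁻¹) atTop (𝓝 0) :=
  tendsto_inv_atTop_zero.comp (tendsto_natCast_atTop_atTop.comp (tendsto_add_atTop_nat 1))

theorem bd_mul {u v : ℕ → ℝ} {B : ℝ} (hu : ∀ᶠ n in atTop, |u n| ≤ B) (hv : Tendsto v atTop (𝓝 0)) :
    Tendsto (fun n => u n * v n) atTop (𝓝 0) := by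
  have h1 : Tendsto (fun n => B * |v n|) atTop (𝓝 0) := by simpa using hv.abs.const_mul B
  refine squeeze_zero_norm' ?_ h1
  filter_upwards [hu] with n hn
  rw [Real.norm_eq_abs, abs_mul]; gcongr

theorem xs_lim (x₁ s : ℝ) {y : ℕ → ℝ} {B : ℝ} (hy : ∀ n, |y n| ≤ B) : Tendsto (fun n => xs x₁ s n (y n)) atTop (𝓝 x₁) := by
  have := (bd_mul (Eventually.of_forall hy) (inv_lim.const_mul s |>.trans (by simp))).const_sub x₁
  rw [sub_zero] at this
  refine this.congr fun n => ?_
  unfold xs; ring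

theorem sin_arc (hs : 0 < s) (hs2 : s ^ 2 = 1 - x₁ ^ 2) : Real.sin (Real.arccos x₁) = s := by
  rw [Real.sin_arccos, ← hs2, Real.sqrt_sq hs.le]

theorem arc_lim (hx : -1 < x₁ ∧ x₁ < 1) (hs : 0 < s) (hs2 : s ^ 2 = 1 - x₁ ^ 2) {y : ℕ → ℝ} {B : ℝ} (hy : ∀ n, |y n| ≤ B) :
    Tendsto (fun n : ℕ => ((n + 1 : ℕ) : ℝ) * (Real.arccos (xs x₁ s n (y n)) - Real.arccos x₁) - y n) atTop (𝓝 0) := by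
  have hd := Real.hasDerivAt_arccos hx.1.ne' hx.2.ne
  rw [← hs2, Real.sqrt_sq hs.le] at hd
  have ho := (hasDerivAt_iff_isLittleO.1 hd).comp_tendsto (xs_lim x₁ s hy)
  have hO : (fun n : ℕ => xs x₁ s n (y n) - x₁) =O[atTop] (fun n : ℕ => ((n + 1 : ℕ) : ℝ)⁻¹) := by
    refine Asymptotics.IsBigO.of_bound (s * B) (Eventually.of_forall fun n => ?_)
    unfold xs
    rw [show x₁ - s * y n * ((n + 1 : ℕ) : ℝ)⁻¹ - x₁ = -(s * y n * ((n + 1 : ℕ) : ℝ)⁻¹) by ring, norm_neg, norm_mul, norm_mul,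
      Real.norm_eq_abs, Real.norm_eq_abs, abs_of_pos hs]
    have := hy n
    gcongr
  have h1 := (ho.trans_isBigO hO).tendsto_div_nhds_zero
  refine h1.congr fun n => ?_
  have : ((n + 1 : ℕ) : ℝ) ≠ 0 := by positivity
  simp only [Function.comp, smul_eq_mul, div_inv_eq_mul]
  unfold xs
  field_simp
  ring

/-- side comparison -/
theorem E_lim (hx : -1 < x₁ ∧ x₁ < 1) (hs : 0 < s) (hs2 : s ^ 2 = 1 - x₁ ^ 2) {y : ℕ → ℝ} {B : ℝ} (hy : ∀ n, |y n| ≤ B)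
    {c0 c1 l t γ : ℝ}
    (hγ : Tendsto (fun n => Sz.gam c0 c1 l t (Real.arccos (xs x₁ s n (y n)))) atTop (𝓝 γ)) :
    Tendsto (fun n : ℕ => ‖(⟨SzD.cc c0 c1 l t (n + 1) (Real.arccos (xs x₁ s n (y n))),
      (SzD.cc c0 c1 l t n (Real.arccos (xs x₁ s n (y n))) - x₁ * SzD.cc c0 c1 l t (n + 1) (Real.arccos (xs x₁ s n (y n)))) / s⟩ : ℂ) -
      (Real.sqrt (2 / Real.pi) : ℂ) * Sz.ee (((n + 1 : ℕ) : ℝ) * Real.arccos x₁ + y n + γ)‖) atTop (𝓝 0) := by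
  have hA := arc_lim hx hs hs2 hy
  obtain ⟨θ, hθ⟩ : ∃ θ : ℕ → ℝ, θ = fun n => Real.arccos (xs x₁ s n (y n)) := ⟨_, rfl⟩
  have hθ' : ∀ n, Real.arccos (xs x₁ s n (y n)) = θ n := fun n => by rw [hθ]
  simp only [hθ'] at hA hγ ⊢
  have hθl : Tendsto θ atTop (𝓝 (Real.arccos x₁)) := by
    rw [hθ]; exact (Real.continuous_arccos.tendsto _).comp (xs_lim x₁ s hy)
  have hc : Tendsto (fun n => Real.cos (θ n)) atTop (𝓝 x₁) := by
    have := (Real.continuous_cos.tendsto _).comp hθl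
    rwa [cos_arc hx] at this
  have hsn : Tendsto (fun n => Real.sin (θ n)) atTop (𝓝 s) := by
    have := (Real.continuous_sin.tendsto _).comp hθl
    rwa [sin_arc hs hs2] at this
  obtain ⟨ψ, hψ⟩ : ∃ ψ : ℕ → ℝ, ψ = fun n : ℕ => ((n + 1 : ℕ) : ℝ) * θ n + Sz.gam c0 c1 l t (θ n) := ⟨_, rfl⟩
  obtain ⟨ψ0, hψ0⟩ : ∃ ψ : ℕ → ℝ, ψ = fun n : ℕ => ((n + 1 : ℕ) : ℝ) * Real.arccos x₁ + y n + γ := ⟨_, rfl⟩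
  have hdiff : Tendsto (fun n => ψ n - ψ0 n) atTop (𝓝 0) := by
    have := hA.add (hγ.sub_const γ)
    simp only [sub_self, add_zero] at this
    refine this.congr fun n => ?_
    rw [hψ, hψ0]; ring
  have hbd : Tendsto (fun n => Real.sqrt (2 / Real.pi) * (2 * |ψ n - ψ0 n| + (|Real.cos (θ n) - x₁| + |Real.sin (θ n) - s|) / s)) atTop (𝓝 0) := by
    have h1 := (hc.sub_const x₁).abs
    have h2 := (hsn.sub_const s).abs
    have := ((hdiff.abs.const_mul 2).add ((h1.add h2).div_const s)).const_mul (Real.sqrt (2 / Real.pi))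
    simpa using this
  refine squeeze_zero (fun _ => norm_nonneg _) (fun n => ?_) hbd
  have e1 : SzD.cc c0 c1 l t (n + 1) (θ n) = Real.sqrt (2 / Real.pi) * Real.cos (ψ n) := by
    unfold SzD.cc; rw [hψ]
  have e2 : SzD.cc c0 c1 l t n (θ n) = Real.sqrt (2 / Real.pi) * Real.cos (ψ n - θ n) := by
    unfold SzD.cc; rw [hψ]; congr 2; push_cast; ring
  have e3 : ((n + 1 : ℕ) : ℝ) * Real.arccos x₁ + y n + γ = ψ0 n := by rw [hψ0]
  rw [e1, e2, e3]
  have q0 : 0 ≤ Real.sqrt (2 / Real.pi) := Real.sqrt_nonneg _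
  obtain ⟨q, hq⟩ : ∃ q, q = Real.sqrt (2 / Real.pi) := ⟨_, rfl⟩
  rw [← hq] at q0 ⊢
  have c1 : |Real.cos (ψ n) - Real.cos (ψ0 n)| ≤ |ψ n - ψ0 n| := Real.abs_cos_sub_cos_le _ _
  have c2 : |Real.sin (ψ n) - Real.sin (ψ0 n)| ≤ |ψ n - ψ0 n| := Real.abs_sin_sub_sin_le _ _
  refine (Complex.norm_le_abs_re_add_abs_im _).trans ?_
  have r1 : (({ re := q * Real.cos (ψ n), im := (q * Real.cos (ψ n - θ n) - x₁ * (q * Real.cos (ψ n))) / s } : ℂ) - (q : ℂ) * Sz.ee (ψ0 n)).re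
      = q * (Real.cos (ψ n) - Real.cos (ψ0 n)) := by
    rw [Complex.sub_re, Complex.re_ofReal_mul, Sz.ee_re]; ring
  have r2 : (({ re := q * Real.cos (ψ n), im := (q * Real.cos (ψ n - θ n) - x₁ * (q * Real.cos (ψ n))) / s } : ℂ) - (q : ℂ) * Sz.ee (ψ0 n)).im
      = q * ((Real.cos (ψ n) * (Real.cos (θ n) - x₁) + Real.sin (ψ n) * (Real.sin (θ n) - s)) / s + (Real.sin (ψ n) - Real.sin (ψ0 n))) := by
    rw [Complex.sub_im, Complex.im_ofReal_mul, Sz.ee_im, Real.cos_sub]; field_simp; ring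
  rw [r1, r2, abs_mul, abs_mul q, abs_of_nonneg q0, ← mul_add]
  refine mul_le_mul_of_nonneg_left ?_ q0
  have c3 : |(Real.cos (ψ n) * (Real.cos (θ n) - x₁) + Real.sin (ψ n) * (Real.sin (θ n) - s)) / s| ≤ (|Real.cos (θ n) - x₁| + |Real.sin (θ n) - s|) / s := by
    rw [abs_div, abs_of_pos hs]
    gcongr
    refine (abs_add_le _ _).trans ?_
    rw [abs_mul, abs_mul]
    have := mul_le_of_le_one_left (abs_nonneg (Real.cos (θ n) - x₁)) (Real.abs_cos_le_one (ψ n))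
    have := mul_le_of_le_one_left (abs_nonneg (Real.sin (θ n) - s)) (Real.abs_sin_le_one (ψ n))
    linarith
  have c4 := abs_add_le ((Real.cos (ψ n) * (Real.cos (θ n) - x₁) + Real.sin (ψ n) * (Real.sin (θ n) - s)) / s) (Real.sin (ψ n) - Real.sin (ψ0 n))
  linarith

theorem F_bd (hs : 0 < s) (hx : |x₁| ≤ 1) (f1 f0 c1 c0 : ℝ) :
    ‖(⟨f1, (f0 - x₁ * f1) / s⟩ : ℂ) - ⟨c1, (c0 - x₁ * c1) / s⟩‖ ≤ (1 + 2 / s) * (|c1 - f1| + |c0 - f0|) := by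
  refine (Complex.norm_le_abs_re_add_abs_im _).trans ?_
  simp only [Complex.sub_re, Complex.sub_im]
  rw [show (f0 - x₁ * f1) / s - (c0 - x₁ * c1) / s = (x₁ * (c1 - f1) - (c0 - f0)) / s by ring, abs_div, abs_of_pos hs, abs_sub_comm f1]
  have h : |x₁ * (c1 - f1) - (c0 - f0)| ≤ |c1 - f1| + |c0 - f0| := by
    refine (abs_sub _ _).trans ?_
    rw [abs_mul]
    have := mul_le_of_le_one_left (abs_nonneg (c1 - f1)) hx
    linarith
  have h2 : |x₁ * (c1 - f1) - (c0 - f0)| / s ≤ (|c1 - f1| + |c0 - f0|) / s := by gcongr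
  have e : (1 + 2 / s) * (|c1 - f1| + |c0 - f0|) = (|c1 - f1| + |c0 - f0|) + (|c1 - f1| + |c0 - f0|) / s + (|c1 - f1| + |c0 - f0|) / s := by ring
  have : 0 ≤ (|c1 - f1| + |c0 - f0|) / s := by positivity
  rw [e]
  linarith [abs_nonneg (c0 - f0)]
end Ph
end Magnus
end

section
open Filter Topology Set Polynomial MeasureTheory

namespace Magnus
namespace Ph

variable {x₁ s : ℝ}

theorem xs_mem (hx : -1 < x₁ ∧ x₁ < 1) (s : ℝ) {y : ℕ → ℝ} {B : ℝ} (hy : ∀ n, |y n| ≤ B) :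
    ∀ᶠ n in atTop, xs x₁ s n (y n) ∈ Ioo (-1 : ℝ) 1 :=
  (xs_lim x₁ s hy).eventually (Ioo_mem_nhds hx.1 hx.2)

theorem gam_pos (hx : -1 < x₁ ∧ x₁ < 1) (hs : 0 < s) {y : ℕ → ℝ} {B : ℝ} (hy : ∀ n, |y n| ≤ B) (hp : ∀ n, 0 < y n) (c0 c1 l : ℝ) :
    Tendsto (fun n => Sz.gam c0 c1 l (Real.arccos x₁) (Real.arccos (xs x₁ s n (y n)))) atTop
      (𝓝 ((c0 + c1 + 2 * l) / 2 * Real.arccos x₁ - c0 * Real.pi / 2 - l * Real.pi)) := by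
  have h1 := (Real.continuous_arccos.tendsto _).comp (xs_lim x₁ s hy)
  have := ((h1.const_mul ((c0 + c1 + 2 * l) / 2)).sub_const (c0 * Real.pi / 2)).sub_const (l * Real.pi)
  refine this.congr' ?_
  filter_upwards [xs_mem hx s hy] with n hn
  have hlt : xs x₁ s n (y n) < x₁ := by
    unfold xs; have := hp n; have : 0 < s * y n * ((n + 1 : ℕ) : ℝ)⁻¹ := by positivity
    linarith
  unfold Sz.gam
  rw [if_pos (Real.arccos_lt_arccos hn.1.le hlt hx.2.le)]; rfl

theorem gam_neg (hx : -1 < x₁ ∧ x₁ < 1) (hs : 0 < s) {y : ℕ → ℝ} {B : ℝ} (hy : ∀ n, |y n| ≤ B) (hp : ∀ n, y n < 0) (c0 c1 l : ℝ) :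
    Tendsto (fun n => Sz.gam c0 c1 l (Real.arccos x₁) (Real.arccos (xs x₁ s n (y n)))) atTop
      (𝓝 ((c0 + c1 + 2 * l) / 2 * Real.arccos x₁ - c0 * Real.pi / 2)) := by
  have h1 := (Real.continuous_arccos.tendsto _).comp (xs_lim x₁ s hy)
  have := ((h1.const_mul ((c0 + c1 + 2 * l) / 2)).sub_const (c0 * Real.pi / 2))
  refine this.congr' ?_
  filter_upwards [xs_mem hx s hy] with n hn
  have hlt : x₁ < xs x₁ s n (y n) := by
    unfold xs; have := neg_pos.2 (hp n); have : 0 < s * -y n * ((n + 1 : ℕ) : ℝ)⁻¹ := by positivity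
    linarith
  unfold Sz.gam
  rw [if_neg (not_lt.2 (Real.arccos_lt_arccos hx.1.le hlt hn.2.le).le), sub_zero]; rfl

noncomputable def hf (c0 c1 l K x : ℝ) : ℝ := Real.sqrt K * Real.sqrt (2 ^ (c0 + c1 + 2 * l) * (1 - x) ^ c0 * (1 + x) ^ c1)

theorem q_eq (hx : -1 < x₁ ∧ x₁ < 1) {x : ℝ} (h : x ∈ Ioo (-1 : ℝ) 1) (hne : x ≠ x₁) (c0 c1 l K : ℝ) :
    Real.sqrt K * ‖Sz.Df c0 c1 l (Real.arccos x₁) (Sz.ee (Real.arccos x))‖ = hf c0 c1 l K x * |x - x₁| ^ l := by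
  have hP : Sz.Pt (Real.arccos x₁) (Real.arccos x) := ⟨arc_pos hx, arc_lt hx, arc_pos h, arc_lt h, fun e => hne (by
    rw [← cos_arc h, ← cos_arc hx, e])⟩
  have := Sz.Df_norm c0 c1 l hP
  rw [cos_arc hx, cos_arc h] at this
  unfold hf
  rw [mul_assoc]
  congr 1
  have u1 : 0 < 1 - x := by linarith [h.2]
  have u2 : 0 < 1 + x := by linarith [h.1]
  rw [← Real.sqrt_sq (norm_nonneg (Sz.Df _ _ _ _ _)), this, Real.sqrt_mul (by positivity)]
  congr 1
  rw [mul_comm 2 l, Real.rpow_mul (abs_nonneg _), Real.rpow_two, Real.sqrt_sq (by positivity)]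

theorem hf_cont (hx : -1 < x₁ ∧ x₁ < 1) (c0 c1 l K : ℝ) : ContinuousAt (hf c0 c1 l K) x₁ := by
  unfold hf
  have u1 : 1 - x₁ ≠ 0 := by linarith [hx.2]
  have u2 : 1 + x₁ ≠ 0 := by linarith [hx.1]
  have h1 : ContinuousAt (fun x : ℝ => (1 - x) ^ c0) x₁ := ContinuousAt.rpow_const (by fun_prop) (Or.inl u1)
  have h2 : ContinuousAt (fun x : ℝ => (1 + x) ^ c1) x₁ := ContinuousAt.rpow_const (by fun_prop) (Or.inl u2)
  exact continuousAt_const.mul (((continuousAt_const.mul h1).mul h2).sqrt)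

variable {c0 c1 l t K : ℝ} {L : ℝ[X] →ₗ[ℝ] ℝ} {σ N1 N0 : ℝ} {p : ℕ → ℝ[X]} {a b : ℕ → ℝ}

theorem pick (H : SzD c0 c1 l t K L) (hx : -1 < x₁ ∧ x₁ < 1) (hs : 0 < s)
    (hb : Ok 1 (fun n => ∫ θ, (SzD.cc c0 c1 l t n θ - SzD.ff c0 c1 l t K (p n) θ) ^ 2 ∂Sz.mu)) :
    ∃ C : ℝ, 0 ≤ C ∧ ∀ κ : ℝ, 0 < κ → ∃ τ : ℕ → ℝ, (∀ n, κ ≤ τ n ∧ τ n ≤ 2 * κ) ∧ ∀ᶠ n in atTop, ∀ y, (y = τ n ∨ y = -τ n) →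
      (SzD.cc c0 c1 l t (n + 1) (Real.arccos (xs x₁ s n y)) - SzD.ff c0 c1 l t K (p (n + 1)) (Real.arccos (xs x₁ s n y))) ^ 2 ≤ C / κ ∧
      (SzD.cc c0 c1 l t n (Real.arccos (xs x₁ s n y)) - SzD.ff c0 c1 l t K (p n) (Real.arccos (xs x₁ s n y))) ^ 2 ≤ C / κ := by
  obtain ⟨C0, hC0, N, hN, hb⟩ := hb
  refine ⟨6 * C0 / s, by positivity, fun κ hκ => ?_⟩
  have ex : ∀ᶠ n : ℕ in atTop, ∃ τ ∈ Ioc κ (2 * κ),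
     ∀ y, (y = τ ∨ y = -τ) →
      (SzD.cc c0 c1 l t (n + 1) (Real.arccos (xs x₁ s n y)) - SzD.ff c0 c1 l t K (p (n + 1)) (Real.arccos (xs x₁ s n y))) ^ 2 ≤ 6 * C0 / s / κ ∧
      (SzD.cc c0 c1 l t n (Real.arccos (xs x₁ s n y)) - SzD.ff c0 c1 l t K (p n) (Real.arccos (xs x₁ s n y))) ^ 2 ≤ 6 * C0 / s / κ := by
    have m1 := xs_mem hx s (y := fun _ => 2 * κ) (fun _ => le_rfl)
    have m2 := xs_mem hx s (y := fun _ => -(2 * κ)) (fun _ => le_rfl)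
    filter_upwards [m1, m2, eventually_ge_atTop N] with n h1 h2 hn
    obtain ⟨G, hG⟩ : ∃ G : ℝ → ℝ, G = fun θ => (SzD.cc c0 c1 l t (n + 1) θ - SzD.ff c0 c1 l t K (p (n + 1)) θ) ^ 2 +
      (SzD.cc c0 c1 l t n θ - SzD.ff c0 c1 l t K (p n) θ) ^ 2 := ⟨_, rfl⟩
    have G0 : ∀ θ, 0 ≤ G θ := fun θ => by rw [hG]; positivity
    have Gi : Integrable G Sz.mu := by rw [hG]; exact (H.bes_int _ _).add (H.bes_int _ _)
    have GB : ∫ θ, G θ ∂Sz.mu ≤ 3 * C0 / ((n + 1 : ℕ) : ℝ) := by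
      rw [hG, integral_add (H.bes_int _ _) (H.bes_int _ _)]
      have b1 := (Real.le_norm_self _).trans (hb (n + 1) (by omega))
      have b2 := (Real.le_norm_self _).trans (hb n hn)
      rw [pow_one] at b1 b2
      have hn0 : (1 : ℝ) ≤ n := by exact_mod_cast hN.trans hn
      have b3 : C0 / (n : ℝ) ≤ 2 * C0 / ((n + 1 : ℕ) : ℝ) := by
        rw [div_le_div_iff₀ (by linarith) (by positivity)]
        push_cast
        nlinarith
      have : 3 * C0 / ((n + 1 : ℕ) : ℝ) = C0 / ((n + 1 : ℕ) : ℝ) + 2 * C0 / ((n + 1 : ℕ) : ℝ) := by ring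
      linarith
    have ae1 : ∀ᵐ θ ∂Sz.mu, G (Real.arccos (Real.cos θ)) * Real.sin θ = Real.sin θ * G θ := by
      filter_upwards [Sz.ae_pt H.t0 H.t1] with θ h
      rw [Real.arccos_cos h.h0.le h.h1.le, mul_comm]
    have Gsi : Integrable (fun θ => Real.sin θ * G θ) Sz.mu :=
      Gi.bdd_mul (c := 1) Real.continuous_sin.aestronglyMeasurable (Eventually.of_forall fun θ => Real.abs_sin_le_one θ)
    have gi : IntegrableOn (fun x => G (Real.arccos x)) (Ioo (-1 : ℝ) 1) := by
      rw [cov_int]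
      exact Gsi.congr (ae1.mono fun _ h => h.symm)
    have gB : ∫ x in Ioo (-1 : ℝ) 1, G (Real.arccos x) ≤ 3 * C0 / ((n + 1 : ℕ) : ℝ) := by
      rw [cov (fun x => G (Real.arccos x)), integral_congr_ae ae1]
      refine le_trans (integral_mono Gsi Gi fun θ => ?_) GB
      exact mul_le_of_le_one_left (G0 θ) (Real.sin_le_one θ)
    have hn0 : 0 < ((n + 1 : ℕ) : ℝ) := by positivity
    obtain ⟨τ, hτ, hle⟩ := avg (x₁ := x₁) (δ := s * ((n + 1 : ℕ) : ℝ)⁻¹) (K := κ) (fun x => G0 _) gi gB (by positivity) hκ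
      (by have := h1.1; unfold xs at this; linarith) (by have := h2.2; unfold xs at this; linarith)
    refine ⟨τ, hτ, fun y hy => ?_⟩
    have e1 : x₁ - s * ((n + 1 : ℕ) : ℝ)⁻¹ * τ = xs x₁ s n τ := by unfold xs; ring
    have e2 : x₁ + s * ((n + 1 : ℕ) : ℝ)⁻¹ * τ = xs x₁ s n (-τ) := by unfold xs; ring
    have e3 : 2 * (3 * C0 / ((n + 1 : ℕ) : ℝ)) / (s * ((n + 1 : ℕ) : ℝ)⁻¹ * κ) = 6 * C0 / s / κ := by field_simp; ring
    rw [e1, e2, e3] at hle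
    have g1 := G0 (Real.arccos (xs x₁ s n τ))
    have g2 := G0 (Real.arccos (xs x₁ s n (-τ)))
    have hGy : G (Real.arccos (xs x₁ s n y)) ≤ 6 * C0 / s / κ := by
      rcases hy with rfl | rfl <;> linarith
    rw [hG] at hGy
    simp only at hGy
    have p1 := sq_nonneg (SzD.cc c0 c1 l t (n + 1) (Real.arccos (xs x₁ s n y)) - SzD.ff c0 c1 l t K (p (n + 1)) (Real.arccos (xs x₁ s n y)))
    have p2 := sq_nonneg (SzD.cc c0 c1 l t n (Real.arccos (xs x₁ s n y)) - SzD.ff c0 c1 l t K (p n) (Real.arccos (xs x₁ s n y)))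
    constructor <;> linarith
  obtain ⟨M, hM⟩ := eventually_atTop.1 ex
  have : ∀ n, ∃ τ : ℝ, (κ ≤ τ ∧ τ ≤ 2 * κ) ∧ (M ≤ n → ∀ y, (y = τ ∨ y = -τ) →
      (SzD.cc c0 c1 l t (n + 1) (Real.arccos (xs x₁ s n y)) - SzD.ff c0 c1 l t K (p (n + 1)) (Real.arccos (xs x₁ s n y))) ^ 2 ≤ 6 * C0 / s / κ ∧
      (SzD.cc c0 c1 l t n (Real.arccos (xs x₁ s n y)) - SzD.ff c0 c1 l t K (p n) (Real.arccos (xs x₁ s n y))) ^ 2 ≤ 6 * C0 / s / κ) := by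
    intro n
    by_cases h : M ≤ n
    · obtain ⟨τ, h1, h2⟩ := hM n h
      exact ⟨τ, ⟨h1.1.le, h1.2⟩, fun _ => h2⟩
    · exact ⟨κ, ⟨le_rfl, by linarith⟩, fun h' => absurd h' h⟩
  choose τ hτ hτ2 using this
  exact ⟨τ, hτ, eventually_atTop.2 ⟨M, fun n hn => hτ2 n hn⟩⟩
end Ph
end Magnus
end

section
open Filter Topology Set Polynomial MeasureTheory

namespace Magnus
namespace Ph

variable {x₁ s : ℝ}
variable {c0 c1 l t K : ℝ} {p : ℕ → ℝ[X]}

noncomputable def qq (x₁ s c0 c1 l K : ℝ) (n : ℕ) (y : ℝ) : ℝ :=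
  Real.sqrt K * ‖Sz.Df c0 c1 l (Real.arccos x₁) (Sz.ee (Real.arccos (xs x₁ s n y)))‖

theorem side (hx : -1 < x₁ ∧ x₁ < 1) (hs : 0 < s) (hs2 : s ^ 2 = 1 - x₁ ^ 2) {y : ℕ → ℝ} {B : ℝ} (hy : ∀ n, |y n| ≤ B) {γ C : ℝ}
    (hγ : Tendsto (fun n => Sz.gam c0 c1 l (Real.arccos x₁) (Real.arccos (xs x₁ s n (y n)))) atTop (𝓝 γ))
    (hC : ∀ᶠ n in atTop, (SzD.cc c0 c1 l (Real.arccos x₁) (n + 1) (Real.arccos (xs x₁ s n (y n))) -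
        SzD.ff c0 c1 l (Real.arccos x₁) K (p (n + 1)) (Real.arccos (xs x₁ s n (y n)))) ^ 2 ≤ C ∧
      (SzD.cc c0 c1 l (Real.arccos x₁) n (Real.arccos (xs x₁ s n (y n))) -
        SzD.ff c0 c1 l (Real.arccos x₁) K (p n) (Real.arccos (xs x₁ s n (y n)))) ^ 2 ≤ C) :
    ∃ ε : ℕ → ℝ, Tendsto ε atTop (𝓝 0) ∧ ∀ᶠ n in atTop,
      ‖(qq x₁ s c0 c1 l K n (y n) : ℂ) * Dyn.zt x₁ s p n (y n) -
        (Real.sqrt (2 / Real.pi) : ℂ) * Sz.ee (((n + 1 : ℕ) : ℝ) * Real.arccos x₁ + y n + γ)‖ ≤ (1 + 2 / s) * (2 * Real.sqrt C) + ε n := by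
  refine ⟨_, E_lim hx hs hs2 hy hγ, ?_⟩
  filter_upwards [hC, xs_mem hx s hy] with n hn hm
  refine (norm_sub_le_norm_sub_add_norm_sub _ _ _).trans (add_le_add ?_ le_rfl)
  have e : (qq x₁ s c0 c1 l K n (y n) : ℂ) * Dyn.zt x₁ s p n (y n) =
     ⟨SzD.ff c0 c1 l (Real.arccos x₁) K (p (n + 1)) (Real.arccos (xs x₁ s n (y n))),
      (SzD.ff c0 c1 l (Real.arccos x₁) K (p n) (Real.arccos (xs x₁ s n (y n))) -
       x₁ * SzD.ff c0 c1 l (Real.arccos x₁) K (p (n + 1)) (Real.arccos (xs x₁ s n (y n)))) / s⟩ := by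
    unfold SzD.ff
    rw [cos_arc hm]
    change _ * (⟨(p (n + 1)).eval (xs x₁ s n (y n)), ((p n).eval (xs x₁ s n (y n)) - x₁ * (p (n + 1)).eval (xs x₁ s n (y n))) / s⟩ : ℂ) = _
    apply Complex.ext
    · rw [Complex.re_ofReal_mul]; simp only; unfold qq; ring
    · rw [Complex.im_ofReal_mul]; simp only; unfold qq; ring
  rw [e]
  refine (F_bd hs (abs_le.2 ⟨hx.1.le, hx.2.le⟩) _ _ _ _).trans ?_
  have h1 := Real.abs_le_sqrt hn.1
  have h2 := Real.abs_le_sqrt hn.2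
  have : 0 < 1 + 2 / s := by positivity
  gcongr
  linarith

theorem rpow_bd {a b x l : ℝ} (ha : 0 < a) (h1 : a ≤ x) (h2 : x ≤ b) : x ^ l ≤ a ^ l + b ^ l := by
  have hx : 0 < x := by linarith
  have hb : 0 < b := by linarith
  have p1 : 0 < a ^ l := Real.rpow_pos_of_pos ha _
  have p2 : 0 < b ^ l := Real.rpow_pos_of_pos hb _
  rcases le_total 0 l with h | h
  · have := Real.rpow_le_rpow hx.le h2 h; linarith
  · have := Real.rpow_le_rpow_of_nonpos ha h1 h; linarith

theorem R_bd {R : ℕ → ℝ} {r κ : ℝ} (hR : Tendsto (fun n : ℕ => R n * (n : ℝ) ^ (-l)) atTop (𝓝 r)) (hR0 : ∀ n, 0 ≤ R n)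
    (hs : 0 < s) (hκ : 0 < κ) {τ : ℕ → ℝ} (hτ : ∀ n, κ ≤ τ n ∧ τ n ≤ 2 * κ) :
    ∃ B, ∀ᶠ n : ℕ in atTop, |R n * (s * τ n * ((n + 1 : ℕ) : ℝ)⁻¹) ^ l| ≤ B := by
  refine ⟨(r + 1) * ((s * κ / 2) ^ l + (2 * s * κ) ^ l), ?_⟩
  filter_upwards [hR.eventually (Iio_mem_nhds (show r < r + 1 by linarith)), eventually_ge_atTop 1] with n h1 h2
  have hn : (1 : ℝ) ≤ n := by exact_mod_cast h2
  obtain ⟨k1, k2⟩ := hτ n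
  have hτ0 : 0 < τ n := by linarith
  obtain ⟨x, hx⟩ : ∃ x, x = n * (s * τ n * ((n + 1 : ℕ) : ℝ)⁻¹) := ⟨_, rfl⟩
  have e : s * τ n * ((n + 1 : ℕ) : ℝ)⁻¹ = (n : ℝ)⁻¹ * x := by rw [hx]; field_simp
  have hx' : x = s * τ n * (n / (n + 1)) := by rw [hx]; push_cast; ring
  have x1 : s * κ / 2 ≤ x := by
    have : (1 : ℝ) / 2 ≤ n / (n + 1) := by rw [div_le_div_iff₀] <;> linarith
    rw [hx', show s * κ / 2 = s * κ * (1 / 2) by ring]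
    gcongr
  have x2 : x ≤ 2 * s * κ := by
    have : (n : ℝ) / (n + 1) ≤ 1 := by rw [div_le_one] <;> linarith
    rw [hx']
    calc s * τ n * (n / (n + 1)) ≤ s * τ n * 1 := by gcongr
      _ ≤ _ := by nlinarith
  have hx0 : 0 < x := lt_of_lt_of_le (by positivity) x1
  rw [e, Real.mul_rpow (by positivity) hx0.le, Real.inv_rpow (by positivity), ← Real.rpow_neg (by positivity), ← mul_assoc, abs_of_nonneg]
  · have := rpow_bd (l := l) (by positivity) x1 x2
    have h1 : R n * (n : ℝ) ^ (-l) < r + 1 := h1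
    have h0 : 0 ≤ R n * (n : ℝ) ^ (-l) := mul_nonneg (hR0 n) (by positivity)
    gcongr
    linarith
  · exact mul_nonneg (mul_nonneg (hR0 n) (by positivity)) (by positivity)

end Ph
end Magnus
end

section
open Filter Topology Set Polynomial MeasureTheory

namespace Magnus
namespace Ph

variable {x₁ s : ℝ}
variable {c0 c1 α β lam t K : ℝ} {L : ℝ[X] →ₗ[ℝ] ℝ} {p : ℕ → ℝ[X]} {a b g ω ξ : ℕ → ℝ}

theorem Dlim (D : Dyn x₁ α β lam p a b g ω ξ) (hx : -1 < x₁ ∧ x₁ < 1) (hs : 0 < s)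
    (hs2 : s ^ 2 = 1 - x₁ ^ 2) (hlam : -1 < 2 * lam)
    (ha : Tendsto a atTop (𝓝 (1 / 2))) (hg : Tendsto g atTop (𝓝 0)) (w : ℕ → ℂ) (hw1 : ∀ n, ‖w n‖ = 1)
    (hwZ : ∀ n, Dyn.Zc x₁ s p n = ‖Dyn.Zc x₁ s p n‖ * w n) {r κ : ℝ}
    (hR : Tendsto (fun n : ℕ => ‖Dyn.Zc x₁ s p n‖ * (n : ℝ) ^ (-lam)) atTop (𝓝 r)) (hκ : 0 < κ) {τ : ℕ → ℝ}
    (hτ : ∀ n, κ ≤ τ n ∧ τ n ≤ 2 * κ) :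
    Tendsto (fun n => ‖(qq x₁ s c0 c1 lam K n (-τ n) : ℂ) * Dyn.zt x₁ s p n (-τ n) * star (w n) -
      star ((qq x₁ s c0 c1 lam K n (τ n) : ℂ) * Dyn.zt x₁ s p n (τ n) * star (w n))‖) atTop (𝓝 0) := by
  obtain ⟨C, hC, N, HS⟩ := D.symm hx hs hs2 hlam ha hg w hw1 hwZ (T := 2 * κ) (by linarith)
  obtain ⟨B, HB⟩ := R_bd hR (fun n => norm_nonneg _) hs hκ hτ
  have hb1 : ∀ n, |τ n| ≤ 2 * κ := fun n => by rw [abs_of_nonneg (by linarith [(hτ n).1])]; exact (hτ n).2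
  have hb2 : ∀ n, |(-τ n)| ≤ 2 * κ := fun n => by rw [abs_neg]; exact hb1 n
  have f1 := (hf_cont hx c0 c1 lam K).tendsto.comp (xs_lim x₁ s hb1)
  have f2 := (hf_cont hx c0 c1 lam K).tendsto.comp (xs_lim x₁ s hb2)
  have lim : Tendsto (fun n : ℕ => (‖Dyn.Zc x₁ s p n‖ * (s * τ n * ((n + 1 : ℕ) : ℝ)⁻¹) ^ lam) *
      (C * (|hf c0 c1 lam K (xs x₁ s n (-τ n))| * ((n + 1 : ℕ) : ℝ)⁻¹ + |hf c0 c1 lam K (xs x₁ s n (-τ n)) - hf c0 c1 lam K (xs x₁ s n (τ n))|)))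
      atTop (𝓝 0) := by
    refine bd_mul HB ?_
    have := ((f2.abs.mul inv_lim).add (f2.sub f1).abs).const_mul C
    simpa using this
  refine squeeze_zero' (Eventually.of_forall fun _ => norm_nonneg _) ?_ lim
  filter_upwards [eventually_ge_atTop N, xs_mem hx s hb1, xs_mem hx s hb2] with n hn m1 m2
  have hτ0 : 0 < τ n := by linarith [(hτ n).1]
  obtain ⟨S1, S2⟩ := HS n hn (τ n) hτ0 (hτ n).2
  have hd : 0 < s * τ n * ((n + 1 : ℕ) : ℝ)⁻¹ := by positivity
  have q1 : qq x₁ s c0 c1 lam K n (τ n) = hf c0 c1 lam K (xs x₁ s n (τ n)) * (s * τ n * ((n + 1 : ℕ) : ℝ)⁻¹) ^ lam := by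
    unfold qq
    rw [q_eq hx m1 (by unfold xs; linarith)]
    congr 2
    unfold xs
    rw [show x₁ - s * τ n * ((n + 1 : ℕ) : ℝ)⁻¹ - x₁ = -(s * τ n * ((n + 1 : ℕ) : ℝ)⁻¹) by ring, abs_neg, abs_of_pos hd]
  have q2 : qq x₁ s c0 c1 lam K n (-τ n) = hf c0 c1 lam K (xs x₁ s n (-τ n)) * (s * τ n * ((n + 1 : ℕ) : ℝ)⁻¹) ^ lam := by
    unfold qq
    rw [q_eq hx m2 (by unfold xs; linarith)]
    congr 2
    unfold xs
    rw [show x₁ - s * -τ n * ((n + 1 : ℕ) : ℝ)⁻¹ - x₁ = (s * τ n * ((n + 1 : ℕ) : ℝ)⁻¹) by ring, abs_of_pos hd]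
  rw [q1, q2]
  obtain ⟨P, hP⟩ : ∃ P, P = (s * τ n * ((n + 1 : ℕ) : ℝ)⁻¹) ^ lam := ⟨_, rfl⟩
  have hP0 : 0 ≤ P := by rw [hP]; exact Real.rpow_nonneg hd.le _
  rw [← hP]
  obtain ⟨h1, hh1⟩ : ∃ h, h = hf c0 c1 lam K (xs x₁ s n (τ n)) := ⟨_, rfl⟩
  obtain ⟨h2, hh2⟩ : ∃ h, h = hf c0 c1 lam K (xs x₁ s n (-τ n)) := ⟨_, rfl⟩
  rw [← hh1, ← hh2]
  obtain ⟨z1, hz1⟩ : ∃ z, z = Dyn.zt x₁ s p n (τ n) * star (w n) := ⟨_, rfl⟩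
  obtain ⟨z2, hz2⟩ : ∃ z, z = Dyn.zt x₁ s p n (-τ n) * star (w n) := ⟨_, rfl⟩
  rw [mul_assoc, mul_assoc, ← hz1, ← hz2]
  rw [← hz1] at S1 S2
  rw [← hz2] at S2
  have e : ((h2 * P : ℝ) : ℂ) * z2 - star (((h1 * P : ℝ) : ℂ) * z1) = ((h2 * P : ℝ) : ℂ) * (z2 - star z1) + (((h2 - h1) * P : ℝ) : ℂ) * star z1 := by
    rw [star_mul, show star (((h1 * P : ℝ) : ℂ)) = ((h1 * P : ℝ) : ℂ) from Complex.conj_ofReal _]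
    push_cast; ring
  rw [e]
  refine (norm_add_le _ _).trans ?_
  rw [norm_mul, norm_mul, Complex.norm_real, Complex.norm_real, norm_star, Real.norm_eq_abs, Real.norm_eq_abs, abs_mul, abs_mul, abs_of_nonneg hP0]
  have k1 := mul_le_mul_of_nonneg_left S2 (mul_nonneg (abs_nonneg h2) hP0)
  have k2 := mul_le_mul_of_nonneg_left S1 (mul_nonneg (abs_nonneg (h2 - h1)) hP0)
  refine (add_le_add k1 k2).trans (le_of_eq ?_)
  ring

theorem phase (D : Dyn x₁ α β lam p a b g ω ξ) (hx : -1 < x₁ ∧ x₁ < 1) (hs : 0 < s)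
    (hs2 : s ^ 2 = 1 - x₁ ^ 2) (hlam : -1 < 2 * lam)
    (ha : Tendsto a atTop (𝓝 (1 / 2))) (hg : Tendsto g atTop (𝓝 0))
    (H : SzD c0 c1 lam (Real.arccos x₁) K L)
    (hb : Ok 1 (fun n => ∫ θ, (SzD.cc c0 c1 lam (Real.arccos x₁) n θ - SzD.ff c0 c1 lam (Real.arccos x₁) K (p n) θ) ^ 2 ∂Sz.mu))
    (w : ℕ → ℂ) (hw1 : ∀ n, ‖w n‖ = 1)
    (hwZ : ∀ n, Dyn.Zc x₁ s p n = ‖Dyn.Zc x₁ s p n‖ * w n) {r : ℝ} {v : ℂ}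
    (hR : Tendsto (fun n : ℕ => ‖Dyn.Zc x₁ s p n‖ * (n : ℝ) ^ (-lam)) atTop (𝓝 r))
    (hv : Tendsto (fun n => w n * (⟨x₁, -s⟩ : ℂ) ^ n) atTop (𝓝 v)) :
    (Sz.ee (Real.arccos x₁ + ((c0 + c1 + 2 * lam) / 2 * Real.arccos x₁ - c0 * Real.pi / 2 - lam * Real.pi / 2)) * star v).im = 0 := by
  obtain ⟨γ, hγ⟩ : ∃ γ, γ = (c0 + c1 + 2 * lam) / 2 * Real.arccos x₁ - c0 * Real.pi / 2 - lam * Real.pi / 2 := ⟨_, rfl⟩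
  rw [← hγ]
  obtain ⟨C, hC, HC⟩ := pick H hx hs hb
  obtain ⟨q, hq⟩ : ∃ q, q = Real.sqrt (2 / Real.pi) := ⟨_, rfl⟩
  have hq0 : 0 < q := by rw [hq]; have := Real.pi_pos; positivity
  obtain ⟨I, hI⟩ : ∃ I, I = (Sz.ee (Real.arccos x₁ + γ) * star v).im := ⟨_, rfl⟩
  rw [← hI]
  have ez : ∀ n : ℕ, Sz.ee (((n + 1 : ℕ) : ℝ) * Real.arccos x₁ + γ) * star (w n) = Sz.ee (Real.arccos x₁ + γ) * star (w n * (⟨x₁, -s⟩ : ℂ) ^ n) := by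
    intro n
    have e1 : (⟨x₁, -s⟩ : ℂ) = star (Sz.ee (Real.arccos x₁)) := by
      apply Complex.ext
      · rw [show star (Sz.ee (Real.arccos x₁)) = (starRingEnd ℂ) (Sz.ee (Real.arccos x₁)) from rfl, Complex.conj_re, Sz.ee_re, cos_arc hx]
      · rw [show star (Sz.ee (Real.arccos x₁)) = (starRingEnd ℂ) (Sz.ee (Real.arccos x₁)) from rfl, Complex.conj_im, Sz.ee_im, sin_arc hs hs2]
    rw [e1, star_mul, star_pow, star_star, Sz.ee_pow, ← mul_assoc, ← Sz.ee_add]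
    congr 2
    push_cast; ring
  have hz : Tendsto (fun n : ℕ => q * (2 * |(Sz.ee (((n + 1 : ℕ) : ℝ) * Real.arccos x₁ + γ) * star (w n)).im|)) atTop (𝓝 (q * (2 * |I|))) := by
    simp only [ez]
    rw [hI]
    refine (((Complex.continuous_im.tendsto _).comp (tendsto_const_nhds.mul hv.star)).abs.const_mul 2).const_mul q
  have key : ∀ κ : ℝ, 0 < κ → q * (2 * |I|) ≤ 2 * ((1 + 2 / s) * (2 * Real.sqrt (C / κ))) := by
    intro κ hκ
    obtain ⟨τ, hτ, hp⟩ := HC κ hκ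
    have hb1 : ∀ n, |τ n| ≤ 2 * κ := fun n => by rw [abs_of_nonneg (by linarith [(hτ n).1])]; exact (hτ n).2
    have hb2 : ∀ n, |(-τ n)| ≤ 2 * κ := fun n => by rw [abs_neg]; exact hb1 n
    have hτ0 : ∀ n, 0 < τ n := fun n => by linarith [(hτ n).1]
    obtain ⟨ε1, hε1, F1⟩ := side (p := p) (K := K) hx hs hs2 hb1 (gam_pos hx hs hb1 hτ0 c0 c1 lam) (hp.mono fun n h => h _ (Or.inl rfl))
    obtain ⟨ε2, hε2, F2⟩ := side (p := p) (K := K) hx hs hs2 hb2 (gam_neg hx hs hb2 (fun n => neg_lt_zero.2 (hτ0 n)) c0 c1 lam) (hp.mono fun n h => h _ (Or.inr rfl))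
    have DL := Dlim (c0 := c0) (c1 := c1) (K := K) D hx hs hs2 hlam ha hg w hw1 hwZ hR hκ hτ
    have lim2 := (DL.add (hε1.add hε2)).const_add (2 * ((1 + 2 / s) * (2 * Real.sqrt (C / κ))))
    simp only [add_zero] at lim2
    refine le_of_tendsto_of_tendsto hz lim2 ?_
    filter_upwards [F1, F2] with n f1 f2
    have g1 : (c0 + c1 + 2 * lam) / 2 * Real.arccos x₁ - c0 * Real.pi / 2 - lam * Real.pi = γ - lam * Real.pi / 2 := by rw [hγ]; ring
    have g2 : (c0 + c1 + 2 * lam) / 2 * Real.arccos x₁ - c0 * Real.pi / 2 = γ + lam * Real.pi / 2 := by rw [hγ]; ring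
    rw [g1, ← hq] at f1
    rw [g2, ← hq] at f2
    obtain ⟨G1, hG1⟩ : ∃ G, G = (qq x₁ s c0 c1 lam K n (τ n) : ℂ) * Dyn.zt x₁ s p n (τ n) := ⟨_, rfl⟩
    obtain ⟨G2, hG2⟩ : ∃ G, G = (qq x₁ s c0 c1 lam K n (-τ n) : ℂ) * Dyn.zt x₁ s p n (-τ n) := ⟨_, rfl⟩
    rw [← hG1] at f1 ⊢
    rw [← hG2] at f2 ⊢
    obtain ⟨E1, hE1⟩ : ∃ E, E = (q : ℂ) * Sz.ee (((n + 1 : ℕ) : ℝ) * Real.arccos x₁ + τ n + (γ - lam * Real.pi / 2)) := ⟨_, rfl⟩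
    obtain ⟨E2, hE2⟩ : ∃ E, E = (q : ℂ) * Sz.ee (((n + 1 : ℕ) : ℝ) * Real.arccos x₁ + -τ n + (γ + lam * Real.pi / 2)) := ⟨_, rfl⟩
    rw [← hE1] at f1
    rw [← hE2] at f2
    obtain ⟨z, hzz⟩ : ∃ z, z = Sz.ee (((n + 1 : ℕ) : ℝ) * Real.arccos x₁ + γ) * star (w n) := ⟨_, rfl⟩
    rw [← hzz]
    have m1 : E2 * star (w n) = (q : ℂ) * Sz.ee (-τ n + lam * Real.pi / 2) * z := by
      rw [hE2, hzz, show ((n + 1 : ℕ) : ℝ) * Real.arccos x₁ + -τ n + (γ + lam * Real.pi / 2) = (-τ n + lam * Real.pi / 2) + (((n + 1 : ℕ) : ℝ) * Real.arccos x₁ + γ) by ring, Sz.ee_add]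
      ring
    have m2 : star (E1 * star (w n)) = (q : ℂ) * Sz.ee (-τ n + lam * Real.pi / 2) * star z := by
      have : E1 * star (w n) = (q : ℂ) * (Sz.ee (-(-τ n + lam * Real.pi / 2)) * z) := by
        rw [hE1, hzz, show ((n + 1 : ℕ) : ℝ) * Real.arccos x₁ + τ n + (γ - lam * Real.pi / 2) = -(-τ n + lam * Real.pi / 2) + (((n + 1 : ℕ) : ℝ) * Real.arccos x₁ + γ) by ring, Sz.ee_add]
        ring
      rw [this, ← Sz.ee_conj, star_mul, star_mul, show star (q : ℂ) = (q : ℂ) from Complex.conj_ofReal _]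
      rw [show star ((starRingEnd ℂ) (Sz.ee (-τ n + lam * Real.pi / 2))) = Sz.ee (-τ n + lam * Real.pi / 2) from star_star _]
      ring
    have m3 : q * (2 * |z.im|) = ‖E2 * star (w n) - star (E1 * star (w n))‖ := by
      rw [m1, m2, ← mul_sub, norm_mul, norm_mul, Sz.ee_norm, mul_one, Complex.norm_real, Real.norm_eq_abs, abs_of_pos hq0,
        show z - star z = ((2 * z.im : ℝ) : ℂ) * Complex.I from Complex.sub_conj z, norm_mul, Complex.norm_I, mul_one, Complex.norm_real, Real.norm_eq_abs, abs_mul, abs_two]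
    rw [m3]
    have m4 : E2 * star (w n) - star (E1 * star (w n)) = (G2 * star (w n) - star (G1 * star (w n))) - (G2 - E2) * star (w n) + star ((G1 - E1) * star (w n)) := by
      rw [sub_mul, sub_mul, star_sub]; ring
    rw [m4]
    have n1 : ‖(G2 - E2) * star (w n)‖ = ‖G2 - E2‖ := by rw [norm_mul, norm_star, hw1, mul_one]
    have n2 : ‖star ((G1 - E1) * star (w n))‖ = ‖G1 - E1‖ := by rw [norm_star, norm_mul, norm_star, hw1, mul_one]
    have n3 := norm_add_le ((G2 * star (w n) - star (G1 * star (w n))) - (G2 - E2) * star (w n)) (star ((G1 - E1) * star (w n)))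
    have n4 := norm_sub_le (G2 * star (w n) - star (G1 * star (w n))) ((G2 - E2) * star (w n))
    linarith
  have lim0 : Tendsto (fun κ : ℝ => 2 * ((1 + 2 / s) * (2 * Real.sqrt (C / κ)))) atTop (𝓝 0) := by
    have h1 : Tendsto (fun κ : ℝ => C / κ) atTop (𝓝 0) := tendsto_const_nhds.div_atTop tendsto_id
    have := (((Real.continuous_sqrt.tendsto _).comp h1).const_mul 2).const_mul (1 + 2 / s) |>.const_mul 2
    simpa using this
  have fin := ge_of_tendsto lim0 ((eventually_gt_atTop 0).mono key)
  have : |I| ≤ 0 := by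
    by_contra h
    push Not at h
    have := mul_pos hq0 (mul_pos two_pos h)
    linarith
  exact abs_nonpos_iff.1 this

end Ph
end Magnus
end

section
open Filter Topology Set Polynomial MeasureTheory

namespace Magnus

theorem sq_of_im {z v : ℂ} (hz : ‖z‖ = 1) (hv : ‖v‖ = 1) (h : (z * star v).im = 0) : v ^ 2 = z ^ 2 := by
  obtain ⟨u, hu⟩ : ∃ u, u = z * star v := ⟨_, rfl⟩
  have hu1 : ‖u‖ = 1 := by rw [hu, norm_mul, norm_star, hz, hv, one_mul]
  have hvv : v * star v = 1 := by
    have := Complex.mul_conj v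
    rw [Complex.normSq_eq_norm_sq, hv] at this
    simpa using this
  rw [← hu] at h
  have e1 : star u = u := Complex.conj_eq_iff_im.2 h
  have e2 : u * u = 1 := by
    have := Complex.mul_conj u
    rw [Complex.normSq_eq_norm_sq, hu1, show (starRingEnd ℂ) u = u from e1] at this
    simpa using this
  have e3 : z = u * v := by
    rw [hu]; linear_combination (-z) * hvv
  rw [e3]; linear_combination (-v ^ 2) * e2

theorem Ok.toO {f : ℕ → ℝ} (h : Ok 2 f) : f =O[atTop] (fun n : ℕ => ((n : ℝ)⁻¹) ^ 2) := by
  obtain ⟨C, hC, N, hN, H⟩ := h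
  refine Asymptotics.IsBigO.of_bound C (eventually_atTop.2 ⟨N, fun n hn => (H n hn).trans (le_of_eq ?_)⟩)
  rw [norm_pow, norm_inv, Real.norm_natCast, inv_pow, div_eq_mul_inv]

theorem szd {A x₁ α β lam : ℝ} (hA : 0 < A) (hx : -1 < x₁ ∧ x₁ < 1) (hα : -1 < α) (hβ : -1 < β) (hl : -1 < 2 * lam) :
    SzD (α + 1 / 2) (β + 1 / 2) lam (Real.arccos x₁) (A * (2 : ℝ) ^ (-(α + β + 2 * lam + 1)))
      (Lw (wt A x₁ α β lam) (wt_int hA hx hα hβ hl)) where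
  t0 := arc_pos hx
  t1 := arc_lt hx
  h0 := by linarith
  h1 := by linarith
  h2 := hl
  K0 := by positivity
  hL q := by
    change ∫ x in Ioo (-1 : ℝ) 1, q.eval x * wt A x₁ α β lam x = _
    rw [cov]
    refine integral_congr_ae ?_
    filter_upwards [Sz.ae_pt (arc_pos hx) (arc_lt hx)] with θ h
    rw [mul_assoc, wt_W hx h]

theorem final {x₁ α β lam K s Φ : ℝ} {L : ℝ[X] →ₗ[ℝ] ℝ} {p : ℕ → ℝ[X]} {a b : ℕ → ℝ} (hx : -1 < x₁ ∧ x₁ < 1)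
    (hl : -1 < 2 * lam) (hs : 0 < s) (hs2 : s ^ 2 = 1 - x₁ ^ 2)
    (S : OPSys x₁ (α + β + 2 * lam) (-α * (1 - x₁) + β * (1 + x₁)) (α * x₁ - β * x₁ + 2 * lam) L p a b)
    (H : SzD (α + 1 / 2) (β + 1 / 2) lam (Real.arccos x₁) K L) (hp0 : 0 < (p 0).coeff 0)
    (hΦ : Φ = (α + lam) * Real.pi - (α + β + 2 * lam) * Real.arccos x₁) :
    Ok 2 (fun n : ℕ => a n - (1 / 2 - lam / (2 * (n : ℝ)) * s * Real.cos (2 * n * Real.arccos x₁ - Φ))) ∧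
    Ok 2 (fun n : ℕ => b n - (-(lam / (n : ℝ)) * s * Real.cos ((2 * n + 1) * Real.arccos x₁ - Φ))) := by
  obtain ⟨g, ω, ξ, D⟩ := S.toDyn
  have ha := H.a_lim S hp0
  have hg : Tendsto g atTop (𝓝 0) := by
    refine (H.b_lim S hp0).congr fun n => ?_
    rw [D.gdef, cos_arc hx]; ring
  have hu := D.Lrate hx hs hs2 ha hg _ (H.uu_rec S) (H.uu_lim S hp0)
  have hb := H.bes_diag S hu
  obtain ⟨_, _, _, A2, B2, _, _⟩ := D.asym1 hx ha hg
  obtain ⟨l, w, hl0, hw1, hwZ, OZ, Ow, Oω, Oξ⟩ := D.asym3 hx hs hs2 ha hg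
  obtain ⟨t, ht⟩ : ∃ t, t = Real.arccos x₁ := ⟨_, rfl⟩
  have e1 : (⟨x₁, -s⟩ : ℂ) = Sz.ee (-t) := by
    apply Complex.ext
    · rw [Sz.ee_re, Real.cos_neg, ht, cos_arc hx]
    · rw [Sz.ee_im, Real.sin_neg, ht, Ph.sin_arc hs hs2]
  have hR : Tendsto (fun n : ℕ => ‖Dyn.Zc x₁ s p n‖ * (n : ℝ) ^ (-lam)) atTop (𝓝 ‖l‖) := by
    have := ((OZ.tendsto le_rfl).add_const l).norm
    rw [zero_add] at this
    refine this.congr fun n => ?_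
    rw [sub_add_cancel, norm_mul, norm_mul, norm_pow, e1, Sz.ee_norm, one_pow, mul_one, Complex.norm_real, Real.norm_eq_abs,
      abs_of_nonneg (Real.rpow_nonneg (Nat.cast_nonneg n) _)]
  obtain ⟨v, hv⟩ : ∃ v : ℂ, v = l / ‖l‖ := ⟨_, rfl⟩
  have hv1 : ‖v‖ = 1 := by
    rw [hv, norm_div, Complex.norm_real, norm_norm, div_self (norm_ne_zero_iff.2 hl0)]
  rw [← hv] at Ow
  have hvl : Tendsto (fun n => w n * (⟨x₁, -s⟩ : ℂ) ^ n) atTop (𝓝 v) := by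
    have := (Ow.tendsto le_rfl).add_const v
    rw [zero_add] at this
    exact this.congr fun n => sub_add_cancel _ _
  have ph := Ph.phase D hx hs hs2 hl ha hg H hb w hw1 hwZ hR hvl
  have hv2 := sq_of_im (Sz.ee_norm _) hv1 ph
  rw [← ht] at hv2 hΦ ⊢
  rw [sq (Sz.ee _), ← Sz.ee_add, show t + ((α + 1 / 2 + (β + 1 / 2) + 2 * lam) / 2 * t - (α + 1 / 2) * Real.pi / 2 - lam * Real.pi / 2) +
      (t + ((α + 1 / 2 + (β + 1 / 2) + 2 * lam) / 2 * t - (α + 1 / 2) * Real.pi / 2 - lam * Real.pi / 2)) = 3 * t - Φ - Real.pi / 2 by rw [hΦ]; ring] at hv2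
  rw [e1] at Ow Oω hvl
  have Ow2 : Ok 1 (fun n => w n ^ 2 - Sz.ee ((2 * n + 3) * t - Φ - Real.pi / 2)) := by
    have b1 : Ok 0 (fun n => w n * Sz.ee (-t) ^ n + v) := Ok.of_tendsto (hvl.add_const v)
    have b2 : Ok 0 (fun n : ℕ => Sz.ee (2 * n * t)) := (Ok.const (1 : ℝ)).norm_le 0 fun n _ => by rw [Sz.ee_norm]; simp
    refine ((Ow.mul0 b1).mul0 b2).of_ev 0 fun n _ => ?_
    have k1 : (Sz.ee (-t) ^ n) ^ 2 * Sz.ee (2 * n * t) = 1 := by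
      rw [← pow_mul, Sz.ee_pow, ← Sz.ee_add, ← Sz.ee_zero]; congr 1; push_cast; ring
    have k2 : Sz.ee ((2 * n + 3) * t - Φ - Real.pi / 2) = v ^ 2 * Sz.ee (2 * n * t) := by
      rw [hv2, ← Sz.ee_add]; congr 1; ring
    rw [k2]
    linear_combination (w n ^ 2) * k1
  have Oω2 : Ok 1 (fun n => ω n - lam * s * Real.cos (2 * n * t - Φ)) := by
    apply Ok.unshift
    have b2 : Ok 0 (fun n : ℕ => Sz.ee (-t)) := Ok.const _
    refine (Oω.sub ((Ow2.mul0 b2).im.cmul (lam * s))).of_ev 0 fun n _ => ?_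
    have k : (Sz.ee ((2 * n + 3) * t - Φ - Real.pi / 2) * Sz.ee (-t)).im = - Real.cos (2 * ((n + 1 : ℕ) : ℝ) * t - Φ) := by
      rw [← Sz.ee_add, Sz.ee_im, ← Real.sin_sub_pi_div_two]; congr 1; push_cast; ring
    rw [sub_mul, Complex.sub_im, k]; ring
  have Oξ2 : Ok 1 (fun n => ξ n - 2 * lam * s * Real.cos ((2 * n + 1) * t - Φ)) := by
    apply Ok.unshift
    refine (Oξ.sub (Ow2.im.cmul (2 * lam * s))).of_ev 0 fun n _ => ?_
    have k : (Sz.ee ((2 * n + 3) * t - Φ - Real.pi / 2)).im = - Real.cos ((2 * ((n + 1 : ℕ) : ℝ) + 1) * t - Φ) := by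
      rw [Sz.ee_im, ← Real.sin_sub_pi_div_two]; congr 1; push_cast; ring
    rw [Complex.sub_im, k]; ring
  constructor
  · refine (A2.sub ((Oω2.mul Ok.inv_n).cmul (1 / 2))).of_ev 1 fun n hn => ?_
    have : (n : ℝ) ≠ 0 := by positivity
    field_simp; ring
  · refine (B2.sub ((Oξ2.mul Ok.inv_n).cmul (1 / 2))).of_ev 1 fun n hn => ?_
    have : (n : ℝ) ≠ 0 := by positivity
    field_simp; ring

end Magnus
end

open MeasureTheory Filter Asymptotics

/-- Magnus' conjecture in the case `A = B`: first-order asymptotics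
of the recurrence coefficients for the weight `A (1-x)^α (1+x)^β |x - x₁|^{2λ}`. -/
theorem magnus_conjecture_A_eq_B
    (A x₁ α β lam : ℝ)
    (hA : 0 < A) (hx₁ : -1 < x₁ ∧ x₁ < 1)
    (hα : -1 < α) (hβ : -1 < β)
    (hlam : -1 < 2 * lam) (hlam' : lam ≠ 0)
    (w : ℝ → ℝ)
    (hw : ∀ t ∈ Set.Ioo (-1 : ℝ) 1,
      w t = A * (1 - t) ^ α * (1 + t) ^ β * |t - x₁| ^ (2 * lam))
    (p : ℕ → Polynomial ℝ)
    (hdeg : ∀ n : ℕ, (p n).degree = n)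
    (hlead : ∀ n : ℕ, 0 < (p n).leadingCoeff)
    (horth : ∀ m n : ℕ,
      ∫ t in Set.Ioo (-1 : ℝ) 1, (p m).eval t * (p n).eval t * w t
        = if m = n then 1 else 0)
    (a b : ℕ → ℝ)
    (ha : ∀ n : ℕ, 1 ≤ n →
      a n = ∫ t in Set.Ioo (-1 : ℝ) 1, t * (p n).eval t * (p (n - 1)).eval t * w t)
    (hb : ∀ n : ℕ,
      b n = ∫ t in Set.Ioo (-1 : ℝ) 1, t * ((p n).eval t) ^ 2 * w t)
    (Φhat : ℝ)
    (hΦhat : Φhat = (α + lam) * Real.pi - (α + β + 2 * lam) * Real.arccos x₁) :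
    ((fun n : ℕ => a n -
        (1 / 2 - lam / (2 * (n : ℝ)) * Real.sqrt (1 - x₁ ^ 2) *
          Real.cos (2 * n * Real.arccos x₁ - Φhat)))
      =O[atTop] (fun n : ℕ => ((n : ℝ)⁻¹) ^ 2)) ∧
    ((fun n : ℕ => b n -
        (-(lam / (n : ℝ)) * Real.sqrt (1 - x₁ ^ 2) *
          Real.cos ((2 * n + 1) * Real.arccos x₁ - Φhat)))
      =O[atTop] (fun n : ℕ => ((n : ℝ)⁻¹) ^ 2)) := by
  have hpos : 0 < 1 - x₁ ^ 2 := by nlinarith [hx₁.1, hx₁.2]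
  have hs : 0 < Real.sqrt (1 - x₁ ^ 2) := Real.sqrt_pos.2 hpos
  have hs2 : Real.sqrt (1 - x₁ ^ 2) ^ 2 = 1 - x₁ ^ 2 := Real.sq_sqrt hpos.le
  have H := Magnus.szd hA hx₁ hα hβ hlam
  have hww : ∀ t ∈ Set.Ioo (-1 : ℝ) 1, w t = Magnus.wt A x₁ α β lam t := hw
  have S := Magnus.mkOPSys (L := Magnus.Lw (Magnus.wt A x₁ α β lam) (Magnus.wt_int hA hx₁ hα hβ hlam)) (p := p)
    x₁ (α + β + 2 * lam) (-α * (1 - x₁) + β * (1 + x₁)) (α * x₁ - β * x₁ + 2 * lam)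
    (a := fun n => if n = 0 then 0 else a n) (b := b) hdeg hlead
    (fun m n => by
      rw [← horth m n]
      refine setIntegral_congr_fun measurableSet_Ioo fun t ht => ?_
      simp only [hww t ht, Polynomial.eval_mul])
    (by simp)
    (fun n => by
      simp only [Nat.add_eq_zero_iff, one_ne_zero, and_false, if_false]
      rw [ha (n + 1) (by omega)]
      refine setIntegral_congr_fun measurableSet_Ioo fun t ht => ?_
      simp only [hww t ht, Polynomial.eval_mul, Polynomial.eval_X, Nat.add_sub_cancel])
    (fun n => by
      rw [hb n]
      refine setIntegral_congr_fun measurableSet_Ioo fun t ht => ?_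
      simp only [hww t ht, Polynomial.eval_mul, Polynomial.eval_X]
      ring)
    (fun q => Magnus.pearson_int hA hx₁ hα hβ hlam q)
  have hp0 : 0 < (p 0).coeff 0 := by
    have := hlead 0
    rwa [Polynomial.leadingCoeff, Polynomial.natDegree_eq_of_degree_eq_some (hdeg 0)] at this
  obtain ⟨h1, h2⟩ := Magnus.final hx₁ hlam hs hs2 S H hp0 hΦhat
  refine ⟨Magnus.Ok.toO (h1.of_ev 1 fun n hn => ?_), Magnus.Ok.toO h2⟩
  rw [if_neg (by omega)]
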